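/- Let k ∈ {7, 8, 10, 11, 12, 13}. Suppose D = {a, ka, u, v} is a D(4)-quadruple containing the positive integers a and b = ka. Let d denote the largest element of D and let x < y < z be the other three elements of D in increasing order. Then d = d₊(x,y,z) = x + y + z + (xyz + √((xy+4)(xz+4)(yz+4)))/2; that is, every D(4)-quadruple containing a and ka is regular. -/

import Mathlib

section

open PowerSeries in
/-- The kernel `∏_{l ≠ j} (X + α_j - α_l)^{-κ_l}` at the node `α_j`. -/
noncomputable def nodeKernel (α : Fin 3 → ℝ) (κ : Fin 3 → ℕ) (j : Fin 3) : PowerSeries ℝ :=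
  ∏ l ∈ Finset.univ.erase j, ((X + C (α j - α l))⁻¹ : PowerSeries ℝ) ^ κ l

/-- The divided difference functional with multiplicities `κ` at the nodes `α`,
applied to a family of jets: the sum of the residues of `F / ∏ (z - α_l)^{κ_l}`. -/
noncomputable def divDiff (α : Fin 3 → ℝ) (κ : Fin 3 → ℕ) (F : Fin 3 → PowerSeries ℝ) : ℝ :=
  ∑ j, PowerSeries.coeff (κ j) (PowerSeries.X * nodeKernel α κ j * F j)

namespace divDiff

open PowerSeries Finset

variable {α : Fin 3 → ℝ}

lemma add (κ : Fin 3 → ℕ) (F G : Fin 3 → PowerSeries ℝ) :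
    divDiff α κ (F + G) = divDiff α κ F + divDiff α κ G := by
  simp [divDiff, mul_add, Finset.sum_add_distrib]

lemma const_mul (κ : Fin 3 → ℕ) (c : ℝ) (F : Fin 3 → PowerSeries ℝ) :
    divDiff α κ (fun j => C c * F j) = c * divDiff α κ F := by
  simp only [divDiff, Finset.mul_sum]
  refine Finset.sum_congr rfl fun j _ => ?_
  rw [show X * nodeKernel α κ j * (C c * F j) = C c * (X * nodeKernel α κ j * F j) by ring,
    coeff_C_mul]

lemma kernel_add_single_ne (hα : Function.Injective α) (κ : Fin 3 → ℕ) {i j : Fin 3}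
    (h : j ≠ i) :
    nodeKernel α (κ + Pi.single i 1) j * (X + C (α j - α i)) = nodeKernel α κ j := by
  have hne : α j - α i ≠ 0 := sub_ne_zero.mpr (hα.ne h)
  have hi : i ∈ univ.erase j := by simp [h.symm]
  unfold nodeKernel
  rw [← Finset.mul_prod_erase _ _ hi, ← Finset.mul_prod_erase _ _ hi]
  have : ∏ x ∈ (univ.erase j).erase i,
      ((X + C (α j - α x))⁻¹ : PowerSeries ℝ) ^ (κ + Pi.single i 1 : Fin 3 → ℕ) x =
      ∏ x ∈ (univ.erase j).erase i, ((X + C (α j - α x))⁻¹ : PowerSeries ℝ) ^ κ x := by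
    refine Finset.prod_congr rfl fun x hx => ?_
    have : x ≠ i := (Finset.mem_erase.mp hx).1
    simp [Pi.single_eq_of_ne this]
  rw [this]
  simp only [Pi.add_apply, Pi.single_eq_same, pow_succ]
  have h1 : ((X + C (α j - α i))⁻¹ : PowerSeries ℝ) * (X + C (α j - α i)) = 1 :=
    PowerSeries.inv_mul_cancel _ (by simpa using hne)
  linear_combination ((X + C (α j - α i))⁻¹ : PowerSeries ℝ) ^ κ i *
    (∏ x ∈ (univ.erase j).erase i, ((X + C (α j - α x))⁻¹ : PowerSeries ℝ) ^ κ x) * h1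

lemma kernel_add_single_self (κ : Fin 3 → ℕ) (i : Fin 3) :
    nodeKernel α (κ + Pi.single i 1) i = nodeKernel α κ i := by
  unfold nodeKernel
  refine Finset.prod_congr rfl fun x hx => ?_
  have : x ≠ i := (Finset.mem_erase.mp hx).1
  simp [Pi.single_eq_of_ne this]

/-- Multiplying by `z - α_i` lowers the multiplicity of `α_i`. -/
lemma mul_node (hα : Function.Injective α) (κ : Fin 3 → ℕ) (i : Fin 3)
    (F : Fin 3 → PowerSeries ℝ) :
    divDiff α (κ + Pi.single i 1) (fun j => (X + C (α j - α i)) * F j) = divDiff α κ F := by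
  unfold divDiff
  refine Finset.sum_congr rfl fun j _ => ?_
  by_cases h : j = i
  · subst h
    rw [kernel_add_single_self]
    simp only [Pi.add_apply, Pi.single_eq_same, sub_self, map_zero, add_zero]
    rw [show X * nodeKernel α κ j * (X * F j) = X * (X * nodeKernel α κ j * F j) by ring,
      coeff_succ_X_mul]
  · rw [← kernel_add_single_ne hα κ h]
    simp only [Pi.add_apply, Pi.single_eq_of_ne h, add_zero]
    congr 1; ring

lemma exchange (hα : Function.Injective α) (κ : Fin 3 → ℕ) (i j : Fin 3)
    (F : Fin 3 → PowerSeries ℝ) :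
    (α i - α j) * divDiff α (κ + Pi.single i 1 + Pi.single j 1) F =
      divDiff α (κ + Pi.single i 1) F - divDiff α (κ + Pi.single j 1) F := by
  have h1 := mul_node hα (κ + Pi.single i 1) j F
  have h2 := mul_node hα (κ + Pi.single j 1) i F
  rw [add_right_comm] at h2
  rw [← h1, ← h2, ← const_mul]
  have : (fun l => (X + C (α l - α j)) * F l) =
      (fun l => C (α i - α j) * F l) + fun l => (X + C (α l - α i)) * F l := by
    funext l
    simp only [Pi.add_apply, map_sub]; ring
  rw [this, add]; ring

lemma mult_zero (F : Fin 3 → PowerSeries ℝ) : divDiff α 0 F = 0 := by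
  simp [divDiff]

lemma single_node (κ : Fin 3 → ℕ) (i : Fin 3) (h : ∀ j, j ≠ i → κ j = 0)
    (F : Fin 3 → PowerSeries ℝ) : divDiff α κ F = coeff (κ i) (X * F i) := by
  unfold divDiff
  rw [Finset.sum_eq_single i]
  · have : nodeKernel α κ i = 1 := by
      unfold nodeKernel
      refine Finset.prod_eq_one fun x hx => ?_
      rw [h x (Finset.mem_erase.mp hx).1, pow_zero]
    rw [this, mul_one]
  · intro j _ hj
    rw [h j hj, mul_assoc]; simp
  · simp

lemma eq_add_single {κ : Fin 3 → ℕ} {i : Fin 3} (h : 1 ≤ κ i) :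
    ∃ κ' : Fin 3 → ℕ, κ = κ' + Pi.single i 1 := by
  refine ⟨κ - Pi.single i 1, ?_⟩
  funext j
  by_cases hj : j = i
  · subst hj; simp; omega
  · simp [Pi.single_eq_of_ne hj]

lemma sum_add_single (κ : Fin 3 → ℕ) (i : Fin 3) :
    ∑ j, (κ + Pi.single i 1 : Fin 3 → ℕ) j = ∑ j, κ j + 1 := by
  simp [Finset.sum_add_distrib]

lemma one_apply (hα : Function.Injective α) :
    ∀ (K : ℕ) (κ : Fin 3 → ℕ), ∑ j, κ j = K + 1 →
      divDiff α κ (fun _ => 1) = if K = 0 then 1 else 0 := by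
  intro K
  induction K with
  | zero =>
    intro κ hκ
    obtain ⟨i, hi⟩ : ∃ i, 1 ≤ κ i := by
      by_contra hcon
      push Not at hcon
      have : ∑ j, κ j = 0 := Finset.sum_eq_zero fun j _ => by have := hcon j; omega
      omega
    obtain ⟨κ', rfl⟩ := eq_add_single hi
    rw [sum_add_single] at hκ
    have h0 : ∀ j, κ' j = 0 := fun j => by
      have : κ' j ≤ ∑ j, κ' j := Finset.single_le_sum (fun _ _ => Nat.zero_le _) (mem_univ j)
      omega
    rw [single_node _ i (fun j hj => by simp [h0, Pi.single_eq_of_ne hj])]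
    simp [h0]
  | succ K ih =>
    intro κ hκ
    rw [if_neg (Nat.succ_ne_zero K)]
    obtain ⟨i, hi⟩ : ∃ i, 1 ≤ κ i := by
      by_contra hcon
      push Not at hcon
      have : ∑ j, κ j = 0 := Finset.sum_eq_zero fun j _ => by have := hcon j; omega
      omega
    by_cases hex : ∃ j, j ≠ i ∧ 1 ≤ κ j
    · obtain ⟨j, hji, hj⟩ := hex
      obtain ⟨κ₁, rfl⟩ := eq_add_single hj
      have hi' : 1 ≤ κ₁ i := by simpa [Pi.single_eq_of_ne hji.symm] using hi
      obtain ⟨κ₂, rfl⟩ := eq_add_single hi'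
      have hex := exchange hα κ₂ i j (fun _ => 1)
      rw [sum_add_single, sum_add_single] at hκ
      rw [ih (κ₂ + Pi.single i 1) (by rw [sum_add_single]; omega),
        ih (κ₂ + Pi.single j 1) (by rw [sum_add_single]; omega), sub_self] at hex
      exact (mul_eq_zero.mp hex).resolve_left (sub_ne_zero.mpr (hα.ne hji.symm))
    · push Not at hex
      have h0 : ∀ j, j ≠ i → κ j = 0 := fun j hj => by have := hex j hj; omega
      have : κ i = K + 1 + 1 := by
        rw [← hκ, Finset.sum_eq_single i (fun j _ hj => h0 j hj) (by simp)]
      rw [single_node _ i h0, this, coeff_succ_X_mul]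
      simp [coeff_one]

/-- The recursion for the divided differences of powers. -/
lemma pow_succ_apply (hα : Function.Injective α) (κ : Fin 3 → ℕ) (i : Fin 3) (n : ℕ) :
    divDiff α (κ + Pi.single i 1) (fun j => (X + C (α j)) ^ (n + 1)) =
      divDiff α κ (fun j => (X + C (α j)) ^ n) +
        α i * divDiff α (κ + Pi.single i 1) (fun j => (X + C (α j)) ^ n) := by
  rw [← mul_node hα κ i, ← const_mul, ← add]
  congr 1
  funext j
  simp only [Pi.add_apply, map_sub]; ring

lemma pow_bounds (hα : Function.Injective α) (h0 : ∀ i, 0 ≤ α i) {M : ℝ}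
    (hM : ∀ i, α i ≤ M) : ∀ (n : ℕ) (κ : Fin 3 → ℕ) (K : ℕ), ∑ j, κ j = K + 1 →
      0 ≤ divDiff α κ (fun j => (X + C (α j)) ^ n) ∧
      divDiff α κ (fun j => (X + C (α j)) ^ n) ≤ (n.choose K : ℝ) * M ^ (n - K) := by
  have hM0 : 0 ≤ M := (h0 0).trans (hM 0)
  intro n
  induction n with
  | zero =>
    intro κ K hκ
    simp only [pow_zero]
    rw [one_apply hα K κ hκ]
    rcases K with _ | K <;> simp
  | succ n ih =>
    intro κ K hκ
    obtain ⟨i, hi⟩ : ∃ i, 1 ≤ κ i := by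
      by_contra hcon
      push Not at hcon
      have : ∑ j, κ j = 0 := Finset.sum_eq_zero fun j _ => by have := hcon j; omega
      omega
    obtain ⟨κ', rfl⟩ := eq_add_single hi
    rw [pow_succ_apply hα]
    obtain ⟨h1, h2⟩ := ih _ K hκ
    rw [sum_add_single] at hκ
    have h3 : α i * divDiff α (κ' + Pi.single i 1) (fun j => (X + C (α j)) ^ n) ≤
        M * ((n.choose K : ℝ) * M ^ (n - K)) :=
      mul_le_mul (hM i) h2 h1 hM0
    have h4 := mul_nonneg (h0 i) h1
    rcases K with _ | K
    · have hz : κ' = 0 := by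
        funext j
        have : κ' j ≤ ∑ j, κ' j := Finset.single_le_sum (fun _ _ => Nat.zero_le _) (mem_univ j)
        simp only [Pi.zero_apply]; omega
      subst hz
      simp only [mult_zero, zero_add] at *
      refine ⟨h4, h3.trans (le_of_eq ?_)⟩
      simp; ring
    · obtain ⟨h5, h6⟩ := ih κ' K (by omega)
      refine ⟨add_nonneg h5 h4, (add_le_add h6 h3).trans ?_⟩
      rw [Nat.choose_succ_succ, Nat.add_sub_add_right]
      push_cast
      rcases le_or_gt (K + 1) n with hle | hlt
      · obtain ⟨q, rfl⟩ := Nat.exists_eq_add_of_le hle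
        rw [show K + 1 + q - K = q + 1 by omega, show K + 1 + q - (K + 1) = q by omega]
        apply le_of_eq; ring
      · rw [Nat.choose_eq_zero_of_lt hlt]; simp

lemma hasSum (κ : Fin 3 → ℕ) {F : ℕ → Fin 3 → PowerSeries ℝ} {G : Fin 3 → PowerSeries ℝ}
    (h : ∀ j l, HasSum (fun n => coeff l (F n j)) (coeff l (G j))) :
    HasSum (fun n => divDiff α κ (F n)) (divDiff α κ G) := by
  unfold divDiff
  refine hasSum_sum fun j _ => ?_
  simp only [coeff_mul]
  exact hasSum_sum fun p _ => (h j p.2).mul_left _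

end divDiff

end

section

open PowerSeries

lemma Ring.choose_succ_mul (r : ℝ) (n : ℕ) :
    Ring.choose r (n + 1) * (n + 1) = Ring.choose r n * (r - n) := by
  have h := Ring.choose_add_smul_choose (r - n) 1 n
  rw [add_comm 1 n, sub_add_cancel] at h
  simpa [Nat.choose_succ_self_right, mul_comm] using h

lemma Ring.succ_mul_choose (r : ℝ) (n : ℕ) :
    Ring.choose (r + 1) (n + 1) * (n + 1) = (r + 1) * Ring.choose r n := by
  rw [Ring.choose_succ_succ, add_mul, Ring.choose_succ_mul]; ring

lemma four_pow_mul_choose_neg_half (n : ℕ) :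
    (4 : ℝ) ^ n * Ring.choose (-(1 / 2) : ℝ) n = (-1) ^ n * (n.centralBinom : ℝ) := by
  induction n with
  | zero => simp
  | succ n ih =>
    have h1 := Ring.choose_succ_mul (-(1 / 2) : ℝ) n
    have h2 : ((n : ℝ) + 1) * ((n + 1).centralBinom : ℝ) = 2 * (2 * n + 1) * n.centralBinom := by
      exact_mod_cast Nat.succ_mul_centralBinom_succ n
    have h3 : ((n : ℝ) + 1) ≠ 0 := by positivity
    apply mul_right_cancel₀ h3
    calc (4 : ℝ) ^ (n + 1) * Ring.choose (-(1 / 2) : ℝ) (n + 1) * (n + 1)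
        = 4 * 4 ^ n * (Ring.choose (-(1 / 2) : ℝ) (n + 1) * (n + 1)) := by ring
      _ = 4 * (4 ^ n * Ring.choose (-(1 / 2) : ℝ) n) * (-(1 / 2) - n) := by rw [h1]; ring
      _ = (-1) ^ (n + 1) * (2 * (2 * n + 1) * n.centralBinom) := by rw [ih]; ring
      _ = _ := by rw [← h2]; ring

lemma four_pow_mul_choose_half_int (m n : ℕ) :
    ∃ z : ℤ, (4 : ℝ) ^ n * Ring.choose ((m : ℝ) + 1 / 2) n = z := by
  have key : ∀ (m n : ℕ), ∃ z : ℤ, (4 : ℝ) ^ n * Ring.choose ((m : ℝ) - 1 / 2) n = z := by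
    intro m
    induction m with
    | zero =>
      intro n
      refine ⟨(-1) ^ n * n.centralBinom, ?_⟩
      have := four_pow_mul_choose_neg_half n
      push_cast
      rw [← this]; norm_num
    | succ m ih =>
      intro n
      rcases n with _ | n
      · exact ⟨1, by simp⟩
      · obtain ⟨u, hu⟩ := ih n
        obtain ⟨v, hv⟩ := ih (n + 1)
        refine ⟨4 * u + v, ?_⟩
        rw [show ((m + 1 : ℕ) : ℝ) - 1 / 2 = ((m : ℝ) - 1 / 2) + 1 by push_cast; ring,
          Ring.choose_succ_succ]
        push_cast
        rw [← hu, ← hv]; ring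
  obtain ⟨z, hz⟩ := key (m + 1) n
  refine ⟨z, ?_⟩
  rw [← hz]; congr 2; push_cast; ring

lemma choose_half_bounds (m : ℕ) : ∀ n ≤ m + 1, 0 ≤ Ring.choose ((m : ℝ) + 1 / 2) n ∧
    Ring.choose ((m : ℝ) + 1 / 2) n ≤ ((m + 1).choose n : ℝ) := by
  intro n
  induction n with
  | zero => intro _; simp
  | succ n ih =>
    intro hn
    obtain ⟨h0, h1⟩ := ih (by omega)
    have h2 := Ring.choose_succ_mul ((m : ℝ) + 1 / 2) n
    have h3 : (((m + 1).choose (n + 1) : ℝ)) * (n + 1) = (m + 1).choose n * (m + 1 - n) := by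
      have := Nat.choose_succ_right_eq (m + 1) n
      have h4 : ((m + 1 - n : ℕ) : ℝ) = (m : ℝ) + 1 - n := by
        rw [Nat.cast_sub (by omega)]; push_cast; ring
      rw [← h4]; exact_mod_cast this
    have hnm : (n : ℝ) ≤ m := by exact_mod_cast (by omega : n ≤ m)
    have hpos : (0 : ℝ) < n + 1 := by positivity
    constructor
    · refine nonneg_of_mul_nonneg_left ?_ hpos
      rw [h2]; exact mul_nonneg h0 (by linarith)
    · refine le_of_mul_le_mul_right ?_ hpos
      rw [h2, h3]
      exact mul_le_mul h1 (by linarith) (by linarith) (by positivity)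

lemma abs_choose_half_three_mul (m : ℕ) :
    |Ring.choose ((m : ℝ) + 1 / 2) (3 * m)| ≤ (4 / 27 : ℝ) ^ m := by
  induction m with
  | zero => simp
  | succ m ih =>
    have e1 := Ring.succ_mul_choose ((m : ℝ) + 1 / 2) (3 * m + 2)
    have e2 := Ring.choose_succ_mul ((m : ℝ) + 1 / 2) (3 * m + 1)
    have e3 := Ring.choose_succ_mul ((m : ℝ) + 1 / 2) (3 * m)
    push_cast at e1 e2 e3
    have hm : (0 : ℝ) ≤ m := by positivity
    have hcast : (((m + 1 : ℕ) : ℝ) + 1 / 2) = (m : ℝ) + 1 / 2 + 1 := by push_cast; ring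
    have hidx : 3 * (m + 1) = 3 * m + 2 + 1 := by ring
    rw [hcast, hidx]
    set A := Ring.choose ((m : ℝ) + 1 / 2) (3 * m)
    set B := Ring.choose ((m : ℝ) + 1 / 2) (3 * m + 1)
    set D := Ring.choose ((m : ℝ) + 1 / 2) (3 * m + 2)
    set E := Ring.choose ((m : ℝ) + 1 / 2 + 1) (3 * m + 2 + 1)
    have hprod : E * ((3 * m + 3) * (3 * m + 2) * (3 * m + 1)) =
        A * ((m + 3 / 2) * (4 * (m : ℝ) ^ 2 - 1 / 4)) := by
      have : D * (3 * m + 2) * (3 * m + 1) = A * (1 / 2 - 2 * m) * (-1 / 2 - 2 * m) := by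
        have e2' : D * (3 * m + 2) = B * (-1 / 2 - 2 * m) := by linear_combination e2
        have e3' : B * (3 * m + 1) = A * (1 / 2 - 2 * m) := by linear_combination e3
        linear_combination (3 * (m : ℝ) + 1) * e2' + (-1 / 2 - 2 * (m : ℝ)) * e3'
      linear_combination (3 * (m : ℝ) + 2) * (3 * m + 1) * e1 + ((m : ℝ) + 3 / 2) * this
    have hden : (0 : ℝ) < (3 * m + 3) * (3 * m + 2) * (3 * m + 1) := by positivity
    refine le_of_mul_le_mul_right ?_ hden
    rw [← abs_of_pos hden, ← abs_mul, hprod, abs_mul, abs_of_pos hden, pow_succ (4 / 27 : ℝ) m,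
      mul_assoc ((4 / 27 : ℝ) ^ m)]
    refine mul_le_mul ih ?_ (abs_nonneg _) (by positivity)
    rw [abs_le]
    constructor <;> nlinarith [mul_nonneg hm hm, mul_nonneg (mul_nonneg hm hm) hm]

lemma hasSum_choose_mul_pow (β : ℝ) {y : ℝ} (hy : |y| < 1) :
    HasSum (fun n : ℕ => Ring.choose β n * y ^ n) ((1 + y) ^ β) := by
  have h := (Real.one_add_rpow_hasFPowerSeriesOnBall_zero (a := β)).hasSum
    (y := y) (by simpa [enorm_eq_nnnorm] using! hy)
  simpa [_root_.binomialSeries, FormalMultilinearSeries.coeff_ofScalars, mul_comm] using h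

lemma hasSum_of_eq {f g : ℕ → ℝ} {s : ℝ} (h : HasSum g s) (hfg : ∀ n, f n = g n) :
    HasSum f s := by
  rwa [funext hfg]

lemma hasSum_of_shift {f : ℕ → ℝ} {s : ℝ} (l : ℕ) (hz : ∀ n < l, f n = 0)
    (h : HasSum (fun n => f (n + l)) s) : HasSum f s := by
  have h2 := (hasSum_nat_add_iff (f := f) l).mp h
  rwa [Finset.sum_eq_zero (fun n hn => hz n (Finset.mem_range.mp hn)), add_zero] at h2

lemma coeff_X_add_C_pow (a : ℝ) (n l : ℕ) :
    coeff l ((X + C a : PowerSeries ℝ) ^ n) = a ^ (n - l) * (n.choose l : ℝ) := by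
  have : (X + C a : PowerSeries ℝ) ^ n =
      (((Polynomial.X + Polynomial.C a) ^ n : Polynomial ℝ) : PowerSeries ℝ) := by simp
  rw [this, Polynomial.coeff_coe, Polynomial.coeff_X_add_C_pow]

lemma choose_mul_nat_choose (β : ℝ) (n l : ℕ) :
    Ring.choose β (n + l) * ((n + l).choose l : ℝ) =
      Ring.choose β l * Ring.choose (β - l) n := by
  have h := Ring.choose_add_smul_choose (β - l) n l
  rw [sub_add_cancel] at h
  rw [← h]; simp [mul_comm]

lemma hasSum_binomial_jet (β : ℝ) {a x : ℝ} (hax : |a * x| < 1) (l : ℕ) :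
    HasSum (fun n : ℕ => coeff l (C (Ring.choose β n * x ^ n) * (X + C a : PowerSeries ℝ) ^ n))
      (Ring.choose β l * x ^ l * (1 + a * x) ^ (β - l)) := by
  simp only [coeff_C_mul, coeff_X_add_C_pow]
  have h := (hasSum_choose_mul_pow (β - l) hax).mul_left (Ring.choose β l * x ^ l)
  refine hasSum_of_shift l (fun n hn => by rw [Nat.choose_eq_zero_of_lt hn]; simp) ?_
  refine hasSum_of_eq h fun n => ?_
  rw [Nat.add_sub_cancel, mul_pow, pow_add]
  linear_combination x ^ n * x ^ l * a ^ n * choose_mul_nat_choose β n l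

lemma hasSum_abs_choose_neg {γ y : ℝ} (hγ : 0 ≤ γ) (hy0 : 0 ≤ y) (hy : y < 1) :
    HasSum (fun n : ℕ => |Ring.choose (-γ) n| * y ^ n) ((1 - y) ^ (-γ)) := by
  have h := hasSum_choose_mul_pow (-γ) (y := -y) (by rw [abs_neg, abs_of_nonneg hy0]; exact hy)
  rw [← sub_eq_add_neg] at h
  refine hasSum_of_eq h fun n => ?_
  have habs : |Ring.choose (-γ) n| = (-1) ^ n * Ring.choose (-γ) n := by
    have : 0 ≤ (-1) ^ n * Ring.choose (-γ) n := by
      induction n with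
      | zero => simp
      | succ n ih =>
        have h1 := Ring.choose_succ_mul (-γ) n
        have hpos : (0 : ℝ) < n + 1 := by positivity
        refine nonneg_of_mul_nonneg_left ?_ hpos
        have : (-1) ^ (n + 1) * Ring.choose (-γ) (n + 1) * ((n : ℝ) + 1) =
            ((-1) ^ n * Ring.choose (-γ) n) * (γ + n) := by
          rw [mul_assoc, h1]; ring
        rw [this]
        exact mul_nonneg ih (by positivity)
    rw [← abs_of_nonneg this, abs_mul, abs_pow]; simp
  rw [habs, neg_pow y]; ring

namespace divDiff

/-- The remainder estimate for the divided difference of `(1 + z x)^{m + 1/2}`. -/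
lemma abs_binomial_le {α : Fin 3 → ℝ} (hα : Function.Injective α) (h0 : ∀ i, 0 ≤ α i) {M x : ℝ}
    (hM : ∀ i, α i ≤ M) (hx0 : 0 < x) (hx : M * x < 1) {m : ℕ} (hm : 1 ≤ m)
    {κ : Fin 3 → ℕ} (hκ : ∑ j, κ j = 3 * m + 1) {G : Fin 3 → PowerSeries ℝ}
    (hG : ∀ j l, coeff l (G j) = Ring.choose ((m : ℝ) + 1 / 2) l * x ^ l *
      (1 + α j * x) ^ ((m : ℝ) + 1 / 2 - l)) :
    |divDiff α κ G| ≤ (4 / 27) ^ m * x ^ (3 * m) * ((1 - M * x) ^ (2 * m))⁻¹ := by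
  have hM0 : 0 ≤ M := (h0 0).trans (hM 0)
  set β : ℝ := (m : ℝ) + 1 / 2 with hβ
  have hsum : HasSum (fun n => divDiff α κ
      (fun j => C (Ring.choose β n * x ^ n) * (X + C (α j)) ^ n)) (divDiff α κ G) := by
    refine hasSum κ fun j l => ?_
    rw [hG j l]
    refine hasSum_binomial_jet β ?_ l
    rw [abs_of_nonneg (mul_nonneg (h0 j) hx0.le)]
    exact (mul_le_mul_of_nonneg_right (hM j) hx0.le).trans_lt hx
  simp only [const_mul] at hsum
  set γ : ℝ := 2 * m - 1 / 2 with hγ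
  have hm' : (1 : ℝ) ≤ m := by exact_mod_cast hm
  have hγ0 : 0 ≤ γ := by rw [hγ]; linarith
  have hmaj := (hasSum_abs_choose_neg hγ0 (mul_nonneg hM0 hx0.le) hx).mul_left
    (|Ring.choose β (3 * m)| * x ^ (3 * m))
  have hmaj2 : HasSum (fun n : ℕ => |Ring.choose β n * x ^ n| *
      ((n.choose (3 * m) : ℝ) * M ^ (n - 3 * m)))
      (|Ring.choose β (3 * m)| * x ^ (3 * m) * (1 - M * x) ^ (-γ)) := by
    refine hasSum_of_shift (3 * m) (fun n hn => by rw [Nat.choose_eq_zero_of_lt hn]; simp) ?_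
    refine hasSum_of_eq hmaj fun n => ?_
    have h1 := congrArg abs (choose_mul_nat_choose β n (3 * m))
    rw [abs_mul, abs_mul, Nat.abs_cast,
      show β - ((3 * m : ℕ) : ℝ) = -γ by rw [hβ, hγ]; push_cast; ring] at h1
    rw [Nat.add_sub_cancel, abs_mul, abs_of_pos (pow_pos hx0 _), mul_pow, pow_add]
    linear_combination x ^ n * x ^ (3 * m) * M ^ n * h1
  have hle : |divDiff α κ G| ≤ |Ring.choose β (3 * m)| * x ^ (3 * m) * (1 - M * x) ^ (-γ) := by
    have := hsum.norm_le_of_bounded hmaj2 fun n => by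
      obtain ⟨h1, h2⟩ := pow_bounds hα h0 hM n κ (3 * m) hκ
      rw [norm_mul, Real.norm_eq_abs, Real.norm_eq_abs, abs_of_nonneg h1]
      exact mul_le_mul_of_nonneg_left h2 (abs_nonneg _)
    simpa using this
  refine hle.trans ?_
  have hy0 : 0 < 1 - M * x := by linarith
  have hy1 : 1 - M * x ≤ 1 := by have := mul_nonneg hM0 hx0.le; linarith
  have hpow : (1 - M * x) ^ (-γ) ≤ ((1 - M * x) ^ (2 * m))⁻¹ := by
    rw [← Real.rpow_natCast, ← Real.rpow_neg hy0.le]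
    apply Real.rpow_le_rpow_of_exponent_ge hy0 hy1
    rw [hγ]; push_cast; linarith
  exact mul_le_mul (mul_le_mul_of_nonneg_right (abs_choose_half_three_mul m) (by positivity)) hpow
    (Real.rpow_nonneg hy0.le _) (by positivity)

end divDiff

end

section

open PowerSeries

namespace divDiff

/-- The jet of a polynomial at `a`. -/
noncomputable def jet (a : ℝ) : Polynomial ℝ →ₐ[ℝ] PowerSeries ℝ := Polynomial.aeval (X + C a)

lemma jet_X (a : ℝ) : jet a Polynomial.X = X + C a := by simp [jet]

lemma jet_C (a r : ℝ) : jet a (Polynomial.C r) = C r := by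
  simp [jet]

lemma derivative_jet (a : ℝ) (q : Polynomial ℝ) :
    d⁄dX ℝ (jet a q) = jet a (Polynomial.derivative q) := by
  have := Derivation.map_aeval (d⁄dX ℝ) q (X + C a)
  rw [jet, this]
  simp

lemma derivative_mul' (f g : PowerSeries ℝ) :
    d⁄dX ℝ (f * g) = d⁄dX ℝ f * g + f * d⁄dX ℝ g := by
  rw [Derivation.leibniz]; simp only [smul_eq_mul]; ring

lemma node_residue {i₁ i₂ P₁ P₂ G q q' Z : PowerSeries ℝ} {x β : ℝ} (m : ℕ)
    (h₁ : i₁ * P₁ = 1) (h₂ : i₂ * P₂ = 1) (hP₁ : d⁄dX ℝ P₁ = 1) (hP₂ : d⁄dX ℝ P₂ = 1)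
    (hq : d⁄dX ℝ q = q') (hZ : d⁄dX ℝ Z = C x) (hG : Z * d⁄dX ℝ G = C (β * x) * G) :
    (i₁ * i₂) ^ (m + 1) * (q' * Z * (X * P₁ * P₂) + C ((β + 1) * x) * q * (X * P₁ * P₂) -
      C (m : ℝ) * q * Z * (P₁ * P₂ + X * P₂ + X * P₁)) * G =
    X * d⁄dX ℝ ((i₁ * i₂) ^ m * q * Z * G) - C (m : ℝ) * ((i₁ * i₂) ^ m * q * Z * G) := by
  have hd : ∀ {i P : PowerSeries ℝ}, i * P = 1 → d⁄dX ℝ P = 1 → d⁄dX ℝ i = -(i * i) := by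
    intro i P h hP
    have h3 := congrArg (d⁄dX ℝ) h
    rw [derivative_mul', hP, derivative_one, mul_one] at h3
    linear_combination i * h3 - d⁄dX ℝ i * h
  have hpow : d⁄dX ℝ ((i₁ * i₂) ^ m) = -(C (m : ℝ) * (i₁ * i₂) ^ m * (i₁ + i₂)) := by
    rcases m with _ | m
    · simp
    · rw [PowerSeries.derivative_pow, derivative_mul', hd h₁ hP₁, hd h₂ hP₂]
      simp only [Nat.cast_add, Nat.cast_one, map_add, map_natCast, map_one, Nat.add_sub_cancel]
      ring
  rw [derivative_mul', derivative_mul', derivative_mul', hpow, hq, hZ]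
  have hu : (i₁ * i₂) ^ (m + 1) * (P₁ * P₂) = (i₁ * i₂) ^ m := by
    rw [pow_succ]
    linear_combination (i₁ * i₂) ^ m * (i₂ * P₂ * h₁ + h₂)
  have hu₁ : (i₁ * i₂) ^ (m + 1) * P₂ = (i₁ * i₂) ^ m * i₁ := by
    rw [pow_succ]
    linear_combination (i₁ * i₂) ^ m * i₁ * h₂
  have hu₂ : (i₁ * i₂) ^ (m + 1) * P₁ = (i₁ * i₂) ^ m * i₂ := by
    rw [pow_succ]
    linear_combination (i₁ * i₂) ^ m * i₂ * h₁
  have hC : (C ((β + 1) * x) : PowerSeries ℝ) = C (β * x) + C x := by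
    rw [← map_add]; congr 1; ring
  rw [hC]
  linear_combination (X * q' * Z * G + X * (C (β * x) + C x) * q * G - C (m : ℝ) * q * Z * G) * hu
    - C (m : ℝ) * q * Z * X * G * hu₁ - C (m : ℝ) * q * Z * X * G * hu₂
    - X * (i₁ * i₂) ^ m * q * hG

lemma coeff_X_mul_derivative_sub (m : ℕ) (F : PowerSeries ℝ) :
    coeff (m + 1) (X * (X * d⁄dX ℝ F - C (m : ℝ) * F)) = 0 := by
  rw [coeff_succ_X_mul, map_sub, coeff_C_mul]
  rcases m with _ | m
  · simp
  · rw [coeff_succ_X_mul, coeff_derivative]; push_cast; ring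

/-- The node polynomial `∏ (z - α_l)`. -/
noncomputable def nodePoly (α : Fin 3 → ℝ) : Polynomial ℝ :=
  ∏ l, (Polynomial.X - Polynomial.C (α l))

lemma total_residue {α : Fin 3 → ℝ} (hα : Function.Injective α) {x β : ℝ} (m : ℕ)
    {G : Fin 3 → PowerSeries ℝ}
    (hG : ∀ j, (1 + C x * (X + C (α j))) * d⁄dX ℝ (G j) = C (β * x) * G j)
    (q : Polynomial ℝ) :
    divDiff α (fun _ => m + 1) (fun j => jet (α j)
      (Polynomial.derivative q * (1 + Polynomial.C x * Polynomial.X) * nodePoly α +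
        Polynomial.C ((β + 1) * x) * q * nodePoly α -
        Polynomial.C (m : ℝ) * q * (1 + Polynomial.C x * Polynomial.X) *
          Polynomial.derivative (nodePoly α)) * G j) = 0 := by
  unfold divDiff
  refine Finset.sum_eq_zero fun j _ => ?_
  obtain ⟨l₁, l₂, hl₁, hl₂, hset, hprod⟩ : ∃ l₁ l₂ : Fin 3, l₁ ≠ j ∧ l₂ ≠ j ∧
      (∀ f : Fin 3 → PowerSeries ℝ, ∏ l ∈ Finset.univ.erase j, f l = f l₁ * f l₂) ∧
      (nodePoly α = (Polynomial.X - Polynomial.C (α j)) * (Polynomial.X - Polynomial.C (α l₁)) *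
        (Polynomial.X - Polynomial.C (α l₂))) := by
    fin_cases j
    · refine ⟨1, 2, by decide, by decide, fun f => ?_, ?_⟩
      · rw [show Finset.univ.erase ((fun i => i) ⟨0, by decide⟩ : Fin 3) = {1, 2} by decide]; simp
      · simp [nodePoly, Fin.prod_univ_three]
    · refine ⟨0, 2, by decide, by decide, fun f => ?_, ?_⟩
      · rw [show Finset.univ.erase ((fun i => i) ⟨1, by decide⟩ : Fin 3) = {0, 2} by decide]; simp
      · rw [nodePoly, Fin.prod_univ_three]
        simp only [Fin.mk_one]; ring
    · refine ⟨0, 1, by decide, by decide, fun f => ?_, ?_⟩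
      · rw [show Finset.univ.erase ((fun i => i) ⟨2, by decide⟩ : Fin 3) = {0, 1} by decide]; simp
      · rw [nodePoly, Fin.prod_univ_three]
        simp only [Fin.reduceFinMk]; ring
  have hinv : ∀ l, l ≠ j → ((X + C (α j - α l))⁻¹ : PowerSeries ℝ) * (X + C (α j - α l)) = 1 :=
    fun l hl => PowerSeries.inv_mul_cancel _ (by
      simpa using sub_ne_zero.mpr (hα.ne hl.symm))
  have hder : ∀ l, d⁄dX ℝ (X + C (α j - α l) : PowerSeries ℝ) = 1 := fun l => by
    rw [map_add, derivative_C, derivative_X, add_zero]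
  have key := node_residue (x := x) (β := β) m (hinv l₁ hl₁) (hinv l₂ hl₂) (hder l₁) (hder l₂)
    (derivative_jet (α j) q) (Z := 1 + C x * (X + C (α j)))
    (by rw [map_add, derivative_mul', map_add, derivative_C, derivative_C, derivative_one,
          derivative_X]; simp) (hG j)
  have hK : nodeKernel α (fun _ => m + 1) j =
      ((X + C (α j - α l₁))⁻¹ * (X + C (α j - α l₂))⁻¹ : PowerSeries ℝ) ^ (m + 1) := by
    unfold nodeKernel; rw [hset, mul_pow]
  have hjet : ∀ l, jet (α j) (Polynomial.X - Polynomial.C (α l)) = X + C (α j - α l) := by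
    intro l; rw [map_sub, jet_X, jet_C, map_sub]; ring
  rw [← coeff_X_mul_derivative_sub m, ← key, hK, hprod]
  congr 1
  simp only [map_add, map_sub, map_mul, jet_C, jet_X, map_one, Polynomial.derivative_mul,
    Polynomial.derivative_X, Polynomial.derivative_C, sub_zero]
  ring

lemma forall_jet_of_add {α : Fin 3 → ℝ} (hα : Function.Injective α) {G : Fin 3 → PowerSeries ℝ}
    (κ : Fin 3 → ℕ) : ∀ (n : ℕ) (κ' : Fin 3 → ℕ), ∑ j, κ' j = n →
      (∀ Q, divDiff α (κ + κ') (fun j => jet (α j) Q * G j) = 0) →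
      ∀ Q, divDiff α κ (fun j => jet (α j) Q * G j) = 0 := by
  intro n
  induction n with
  | zero =>
    intro κ' hκ' h
    have : κ' = 0 := funext fun j => by
      have : κ' j ≤ ∑ j, κ' j :=
        Finset.single_le_sum (fun _ _ => Nat.zero_le _) (Finset.mem_univ j)
      simp only [Pi.zero_apply]; omega
    simpa [this] using h
  | succ n ih =>
    intro κ' hκ' h
    obtain ⟨i, hi⟩ : ∃ i, 1 ≤ κ' i := by
      by_contra hcon
      push Not at hcon
      have : ∑ j, κ' j = 0 := Finset.sum_eq_zero fun j _ => by have := hcon j; omega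
      omega
    obtain ⟨κ'', rfl⟩ := eq_add_single hi
    rw [sum_add_single] at hκ'
    refine ih κ'' (by omega) fun Q => ?_
    have h1 := h ((Polynomial.X - Polynomial.C (α i)) * Q)
    rw [← add_assoc] at h1
    rw [← mul_node hα _ i, ← h1]
    congr 1
    funext j
    simp only [map_mul, map_sub, jet_X, jet_C]; ring

/-- If the divided differences of a solution of `(1 + x z) G' = β x G`, with `2 β` odd, vanish for
the three multiplicity vectors `(m, m, m) + e_i`, then `G` vanishes at all nodes. -/
lemma constantCoeff_eq_zero {α : Fin 3 → ℝ} (hα : Function.Injective α) {x : ℝ} (hx : x ≠ 0)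
    (m : ℕ) {G : Fin 3 → PowerSeries ℝ}
    (hG : ∀ j, (1 + C x * (X + C (α j))) * d⁄dX ℝ (G j) = C (((m : ℝ) + 1 / 2) * x) * G j)
    (h : ∀ i, divDiff α ((fun _ => m) + Pi.single i 1) G = 0) (j : Fin 3) :
    coeff 0 (G j) = 0 := by
  set β : ℝ := (m : ℝ) + 1 / 2 with hβ
  let M : Polynomial ℝ →ₗ[ℝ] ℝ :=
    { toFun := fun Q => divDiff α (fun _ => m + 1) (fun j => jet (α j) Q * G j)
      map_add' := fun Q R => by
        rw [← add]; congr 1; funext j; simp only [Pi.add_apply, map_add]; ring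
      map_smul' := fun r Q => by
        rw [RingHom.id_apply, smul_eq_mul, ← const_mul]; congr 1; funext j
        rw [map_smul, PowerSeries.smul_eq_C_mul]; ring }
  have hMapp : ∀ Q, M Q = divDiff α (fun _ => m + 1) (fun j => jet (α j) Q * G j) := fun Q => rfl
  have hκ : (fun _ => m + 1 : Fin 3 → ℕ) =
      (fun _ => m) + Pi.single 0 1 + Pi.single 1 1 + Pi.single 2 1 := by
    funext l; fin_cases l <;> simp
  have h2 : M ((Polynomial.X - Polynomial.C (α 1)) * (Polynomial.X - Polynomial.C (α 2))) = 0 := by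
    rw [hMapp, hκ, ← h 0, ← mul_node hα ((fun _ => m) + Pi.single 0 1) 1 G,
      ← mul_node hα ((fun _ => m) + Pi.single 0 1 + Pi.single 1 1) 2]
    congr 1; funext l
    simp only [map_mul, map_sub, jet_X, jet_C]; ring
  have hex : ∀ i j : Fin 3, i ≠ j →
      divDiff α ((fun _ => m) + Pi.single i 1 + Pi.single j 1) G = 0 := by
    intro i j hij
    have := exchange hα (fun _ => m) i j G
    rw [h i, h j, sub_zero] at this
    exact (mul_eq_zero.mp this).resolve_left (sub_ne_zero.mpr (hα.ne hij))
  have h1 : M (Polynomial.X - Polynomial.C (α 2)) = 0 := by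
    rw [hMapp, hκ, ← hex 0 1 (by decide),
      ← mul_node hα ((fun _ => m) + Pi.single 0 1 + Pi.single 1 1) 2 G]
    congr 1; funext l
    simp only [map_sub, jet_X, jet_C]; ring
  have h0 : M 1 = 0 := by
    have := exchange hα ((fun _ => m) + Pi.single 0 1) 1 2 G
    rw [hex 0 1 (by decide), hex 0 2 (by decide), sub_zero] at this
    rw [hMapp, hκ]
    simpa using (mul_eq_zero.mp this).resolve_left (sub_ne_zero.mpr (hα.ne (by decide)))
  have hT := fun q => total_residue hα m hG q
  simp only [← hMapp] at hT
  let T : ℕ → Polynomial ℝ := fun n => match n with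
    | 0 => 1
    | 1 => Polynomial.X - Polynomial.C (α 2)
    | 2 => (Polynomial.X - Polynomial.C (α 1)) * (Polynomial.X - Polynomial.C (α 2))
    | (e + 3) => Polynomial.derivative (Polynomial.X ^ e) *
        (1 + Polynomial.C x * Polynomial.X) * nodePoly α +
        Polynomial.C ((β + 1) * x) * Polynomial.X ^ e * nodePoly α -
        Polynomial.C (m : ℝ) * Polynomial.X ^ e * (1 + Polynomial.C x * Polynomial.X) *
          Polynomial.derivative (nodePoly α)
  have hMT : ∀ n, M (T n) = 0
    | 0 => h0
    | 1 => h1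
    | 2 => h2
    | (e + 3) => hT (Polynomial.X ^ e)
  obtain ⟨s₁, s₂, s₃, hNP⟩ : ∃ s₁ s₂ s₃ : ℝ, nodePoly α = Polynomial.X ^ 3 +
      Polynomial.C s₁ * Polynomial.X ^ 2 + Polynomial.C s₂ * Polynomial.X + Polynomial.C s₃ := by
    refine ⟨-(α 0 + α 1 + α 2), α 0 * α 1 + α 0 * α 2 + α 1 * α 2, -(α 0 * α 1 * α 2), ?_⟩
    simp only [nodePoly, Fin.prod_univ_three, map_add, map_mul, map_neg]; ring
  have hTdeg : ∀ n, (T n).degree = n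
    | 0 => by simp [T]
    | 1 => by simp [T]
    | 2 => by
      simp only [T, Polynomial.degree_mul, Polynomial.degree_X_sub_C]; rfl
    | (e + 3) => by
      have hlead : ((e : ℝ) + β + 1 - 3 * m) * x ≠ 0 := by
        refine mul_ne_zero (fun h0 => ?_) hx
        have h3 : (((2 * e + 3 : ℕ) : ℤ) : ℝ) = ((4 * m : ℕ) : ℤ) := by
          rw [hβ] at h0; push_cast; linarith
        have h4 : (2 * e + 3 : ℕ) = 4 * m := by exact_mod_cast h3
        omega
      have hsplit : T (e + 3) = Polynomial.C (((e : ℝ) + β + 1 - 3 * m) * x) *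
          Polynomial.X ^ (e + 3) + (T (e + 3) - Polynomial.C (((e : ℝ) + β + 1 - 3 * m) * x) *
          Polynomial.X ^ (e + 3)) := by ring
      have hsmall : (T (e + 3) - Polynomial.C (((e : ℝ) + β + 1 - 3 * m) * x) *
          Polynomial.X ^ (e + 3)).degree < ((e + 3 : ℕ) : WithBot ℕ) := by
        refine lt_of_le_of_lt (b := ((e + 2 : ℕ) : WithBot ℕ)) ?_ (by exact_mod_cast (by omega))
        rcases e with _ | e
        · have : T 3 - Polynomial.C (((0 : ℕ) : ℝ) + β + 1 - 3 * m) * Polynomial.C x *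
              Polynomial.X ^ 3 =
              Polynomial.C ((β + 1) * x * s₁ - m * (3 + 2 * x * s₁)) * Polynomial.X ^ 2 +
              Polynomial.C ((β + 1) * x * s₂ - m * (2 * s₁ + x * s₂)) * Polynomial.X +
              Polynomial.C ((β + 1) * x * s₃ - m * s₂) := by
            simp only [T, hNP]
            simp only [map_add, map_mul, map_sub, Polynomial.derivative_mul,
              Polynomial.derivative_X_pow, Polynomial.derivative_C, Polynomial.derivative_X,
              Polynomial.C_1, pow_zero, Polynomial.derivative_one, map_natCast, map_ofNat]
            push_cast
            ring
          rw [map_mul]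
          rw [this]
          refine Polynomial.degree_le_of_natDegree_le ?_
          compute_degree
        · have : T (e + 1 + 3) - Polynomial.C (((e + 1 : ℕ) : ℝ) + β + 1 - 3 * m) *
              Polynomial.C x * Polynomial.X ^ (e + 1 + 3) =
              Polynomial.C ((e + 1) * (1 + x * s₁) + (β + 1) * x * s₁ - m * (3 + 2 * x * s₁)) *
                Polynomial.X ^ (e + 3) +
              Polynomial.C ((e + 1) * (s₁ + x * s₂) + (β + 1) * x * s₂ - m * (2 * s₁ + x * s₂)) *
                Polynomial.X ^ (e + 2) +
              Polynomial.C ((e + 1) * (s₂ + x * s₃) + (β + 1) * x * s₃ - m * s₂) *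
                Polynomial.X ^ (e + 1) +
              Polynomial.C ((e + 1) * s₃) * Polynomial.X ^ e := by
            simp only [T, hNP]
            simp only [map_add, map_mul, map_sub, Polynomial.derivative_mul,
              Polynomial.derivative_X_pow, Polynomial.derivative_C, Polynomial.derivative_X,
              Polynomial.C_1, map_natCast, map_ofNat]
            push_cast
            ring
          rw [map_mul]
          rw [this]
          refine Polynomial.degree_le_of_natDegree_le ?_
          compute_degree
      rw [hsplit, Polynomial.degree_add_eq_left_of_degree_lt]
      · exact Polynomial.degree_C_mul_X_pow _ hlead
      · rw [Polynomial.degree_C_mul_X_pow _ hlead]; exact hsmall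
  let S : Polynomial.Sequence ℝ := ⟨T, hTdeg⟩
  have hspan := S.span fun i => (Polynomial.leadingCoeff_ne_zero.mpr (S.ne_zero i)).isUnit
  have hM0 : M = 0 := LinearMap.ext_on_range hspan fun n => by
    rw [LinearMap.zero_apply]; exact hMT n
  have hall : ∀ Q, divDiff α (Pi.single j 1 + fun l => (m + 1) - (Pi.single j 1 : Fin 3 → ℕ) l)
      (fun j => jet (α j) Q * G j) = 0 := by
    intro Q
    have : (Pi.single j 1 + fun l => (m + 1) - (Pi.single j 1 : Fin 3 → ℕ) l) =
        fun _ => m + 1 := by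
      funext l
      by_cases hl : l = j
      · subst hl; simp; omega
      · simp [Pi.single_eq_of_ne hl]
    rw [this, ← hMapp, hM0]; rfl
  have hfin := forall_jet_of_add hα _ _ _ rfl hall 1
  rw [single_node _ j fun l hl => Pi.single_eq_of_ne hl _] at hfin
  simpa using hfin

end divDiff

end

section

open PowerSeries Finset

/-- `F` has denominators dividing `e^(K+n) f^(L+n)` in degree `n`. -/
def HasDenom (e f : ℤ) (K L : ℕ) (F : PowerSeries ℝ) : Prop :=
  ∀ n, ∃ z : ℤ, (e : ℝ) ^ (K + n) * (f : ℝ) ^ (L + n) * coeff n F = z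

lemma exists_int_sum {ι : Type*} (s : Finset ι) (f : ι → ℝ) (h : ∀ i ∈ s, ∃ z : ℤ, f i = z) :
    ∃ z : ℤ, ∑ i ∈ s, f i = z := by
  choose! g hg using h
  exact ⟨∑ i ∈ s, g i, by rw [Int.cast_sum]; exact Finset.sum_congr rfl hg⟩

namespace HasDenom

variable {e f : ℤ} {K L K' L' : ℕ} {F G : PowerSeries ℝ}

protected lemma exists_int {n : ℕ} (h : HasDenom e f K L F) (hK : K + n ≤ K') (hL : L + n ≤ L') :
    ∃ z : ℤ, (e : ℝ) ^ K' * (f : ℝ) ^ L' * coeff n F = z := by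
  obtain ⟨z, hz⟩ := h n
  obtain ⟨u, rfl⟩ := Nat.exists_eq_add_of_le hK
  obtain ⟨v, rfl⟩ := Nat.exists_eq_add_of_le hL
  refine ⟨e ^ u * f ^ v * z, ?_⟩
  push_cast
  rw [← hz]; ring

lemma mul (hF : HasDenom e f K L F) (hG : HasDenom e f K' L' G) :
    HasDenom e f (K + K') (L + L') (F * G) := by
  intro n
  rw [coeff_mul, Finset.mul_sum]
  refine exists_int_sum _ _ fun p hp => ?_
  obtain ⟨z, hz⟩ := hF p.1
  obtain ⟨w, hw⟩ := hG p.2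
  exact ⟨z * w, by push_cast; rw [← hz, ← hw, ← mem_antidiagonal.mp hp]; ring⟩

lemma pow (hF : HasDenom e f K L F) (n : ℕ) : HasDenom e f (n * K) (n * L) (F ^ n) := by
  induction n with
  | zero =>
    intro n
    rw [pow_zero, coeff_one]
    split_ifs with h
    · subst h; exact ⟨1, by simp⟩
    · exact ⟨0, by simp⟩
  | succ n ih =>
    rw [pow_succ, add_mul, add_mul, one_mul, one_mul]
    exact ih.mul hF

end HasDenom

lemma coeff_X_add_C_inv {e : ℝ} (he : e ≠ 0) (n : ℕ) :
    coeff n ((X + C e)⁻¹ : PowerSeries ℝ) = (-1) ^ n * (e ^ (n + 1))⁻¹ := by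
  have : (X + C e : PowerSeries ℝ)⁻¹ = PowerSeries.mk fun n => (-1) ^ n * (e ^ (n + 1))⁻¹ := by
    rw [PowerSeries.inv_eq_iff_mul_eq_one (by simpa using he)]
    ext n
    rw [mul_add, map_add, mul_comm _ (C e), coeff_C_mul, coeff_mk]
    rcases n with _ | n
    · simp [he]
    · rw [coeff_succ_mul_X, coeff_mk, coeff_one, if_neg (Nat.succ_ne_zero n)]
      field_simp; ring
  rw [this, coeff_mk]

lemma hasDenom_inv_one {e f u : ℤ} (hu : u = 1 ∨ u = -1) :
    HasDenom e f 0 0 ((X + C (u : ℝ))⁻¹ : PowerSeries ℝ) := by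
  intro n
  have hne : (u : ℝ) ≠ 0 := by rcases hu with rfl | rfl <;> norm_num
  rw [coeff_X_add_C_inv hne]
  refine ⟨e ^ n * f ^ n * ((-1) ^ n * u ^ (n + 1)), ?_⟩
  have : ((u : ℝ) ^ (n + 1))⁻¹ = (u : ℝ) ^ (n + 1) := by
    have h2 : (u : ℝ)⁻¹ = u := by rcases hu with rfl | rfl <;> norm_num
    rw [← inv_pow, h2]
  rw [this]; push_cast; simp

lemma hasDenom_inv_left {e f u : ℤ} (he : e ≠ 0) (hu : u = e ∨ u = -e) :
    HasDenom e f 1 0 ((X + C (u : ℝ))⁻¹ : PowerSeries ℝ) := by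
  intro n
  have hne : (e : ℝ) ≠ 0 := by exact_mod_cast he
  have hnu : (u : ℝ) ≠ 0 := by rcases hu with rfl | rfl <;> simpa
  rw [coeff_X_add_C_inv hnu]
  rcases hu with rfl | rfl
  · refine ⟨f ^ n * (-1) ^ n, ?_⟩
    push_cast; rw [add_comm 1 n, zero_add]; field_simp
  · refine ⟨- f ^ n, ?_⟩
    push_cast
    rw [add_comm 1 n, zero_add, neg_pow (e : ℝ), pow_succ (-1 : ℝ)]
    rcases neg_one_pow_eq_or ℝ n with h | h <;> rw [h] <;> field_simp

lemma HasDenom.swap {e f : ℤ} {K L : ℕ} {F : PowerSeries ℝ} (h : HasDenom e f K L F) :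
    HasDenom f e L K F := fun n => by
  obtain ⟨z, hz⟩ := h n
  exact ⟨z, by rw [← hz]; ring⟩

/-- The absolute coefficients of `F` up to degree `n`, weighted by `w`, sum to at most `B`. -/
def MajorizedTo (n : ℕ) (w : ℝ) (F : PowerSeries ℝ) (B : ℝ) : Prop :=
  ∑ i ∈ range (n + 1), |coeff i F| * w ^ i ≤ B

namespace MajorizedTo

variable {n : ℕ} {w B B' : ℝ} {F G : PowerSeries ℝ}

lemma mul (hw : 0 ≤ w) (hF : MajorizedTo n w F B) (hG : MajorizedTo n w G B') :
    MajorizedTo n w (F * G) (B * B') := by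
  unfold MajorizedTo at *
  have hB : 0 ≤ B := (Finset.sum_nonneg fun _ _ => by positivity).trans hF
  refine le_trans ?_ (mul_le_mul hF hG (Finset.sum_nonneg fun _ _ => by positivity) hB)
  rw [Finset.sum_mul_sum, ← Finset.sum_product']
  calc ∑ i ∈ range (n + 1), |coeff i (F * G)| * w ^ i
      ≤ ∑ i ∈ range (n + 1), ∑ p ∈ antidiagonal i,
          |coeff p.1 F| * w ^ p.1 * (|coeff p.2 G| * w ^ p.2) := by
        refine Finset.sum_le_sum fun i _ => ?_
        rw [coeff_mul]
        refine (mul_le_mul_of_nonneg_right (Finset.abs_sum_le_sum_abs _ _)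
          (by positivity)).trans (le_of_eq ?_)
        rw [Finset.sum_mul]
        refine Finset.sum_congr rfl fun p hp => ?_
        rw [abs_mul, ← mem_antidiagonal.mp hp, pow_add]; ring
    _ = ∑ q ∈ (range (n + 1)).sigma fun i => antidiagonal i,
          |coeff q.2.1 F| * w ^ q.2.1 * (|coeff q.2.2 G| * w ^ q.2.2) := by
        rw [Finset.sum_sigma]
    _ = ∑ p ∈ ((range (n + 1)).sigma fun i => antidiagonal i).image (fun q => q.2),
          |coeff p.1 F| * w ^ p.1 * (|coeff p.2 G| * w ^ p.2) := by
        rw [Finset.sum_image]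
        rintro ⟨i, p⟩ h1 ⟨i', p'⟩ h2 (h : p = p')
        subst h
        simp only [coe_sigma, Set.mem_sigma_iff, mem_coe, HasAntidiagonal.mem_antidiagonal] at h1 h2
        have : i = i' := by rw [← h1.2, ← h2.2]
        subst this; rfl
    _ ≤ _ := by
        refine Finset.sum_le_sum_of_subset_of_nonneg ?_ fun _ _ _ => by positivity
        intro p hp
        simp only [mem_image, mem_sigma, mem_range, HasAntidiagonal.mem_antidiagonal,
          Sigma.exists] at hp
        obtain ⟨i, p', ⟨h1, h2⟩, rfl⟩ := hp
        simp only [mem_product, mem_range]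
        omega

lemma pow (hw : 0 ≤ w) (hF : MajorizedTo n w F B) (l : ℕ) :
    MajorizedTo n w (F ^ l) (B ^ l) := by
  induction l with
  | zero =>
    unfold MajorizedTo
    rw [Finset.sum_eq_single 0 (fun i _ hi => by simp [coeff_one, hi]) (by simp)]
    simp
  | succ l ih => rw [pow_succ, pow_succ]; exact ih.mul hw hF

lemma abs_coeff_le (hw : 0 ≤ w) (hF : MajorizedTo n w F B) : |coeff n F| * w ^ n ≤ B :=
  (Finset.single_le_sum (f := fun i => |coeff i F| * w ^ i) (fun _ _ => by positivity)
    (self_mem_range_succ n)).trans hF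

lemma inv {e : ℝ} (n : ℕ) (hw : 0 ≤ w) (he : w < |e|) :
    MajorizedTo n w ((X + C e)⁻¹ : PowerSeries ℝ) (1 / (|e| - w)) := by
  have hpos : 0 < |e| := hw.trans_lt he
  have hne : e ≠ 0 := abs_pos.mp hpos
  unfold MajorizedTo
  have : ∀ i ∈ range (n + 1), |coeff i ((X + C e)⁻¹ : PowerSeries ℝ)| * w ^ i =
      |e|⁻¹ * (w / |e|) ^ i := by
    intro i _
    rw [coeff_X_add_C_inv hne, abs_mul, abs_pow, abs_neg, abs_one, one_pow, one_mul, abs_inv,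
      abs_pow, div_pow, pow_succ]
    field_simp
  rw [Finset.sum_congr rfl this, ← Finset.mul_sum]
  have hq : w / |e| < 1 := (div_lt_one hpos).mpr he
  have hg : ∑ i ∈ range (n + 1), (w / |e|) ^ i ≤ (1 - w / |e|)⁻¹ := by
    rw [← tsum_geometric_of_lt_one (by positivity) hq]
    exact (summable_geometric_of_lt_one (by positivity) hq).sum_le_tsum _
      fun _ _ => by positivity
  refine (mul_le_mul_of_nonneg_left hg (by positivity)).trans (le_of_eq ?_)
  have : |e| - w ≠ 0 := by linarith
  field_simp

end MajorizedTo

end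

section

open PowerSeries Finset

/-- The jet of `(1 + z x)^{m + 1/2} / (1 + a x)^{1/2}` at `z = a`. -/
noncomputable def halfJet (m : ℕ) (x a : ℝ) : PowerSeries ℝ :=
  PowerSeries.mk fun h => Ring.choose ((m : ℝ) + 1 / 2) h * (x / (1 + a * x)) ^ h * (1 + a * x) ^ m

lemma coeff_halfJet (m : ℕ) (x a : ℝ) (h : ℕ) : coeff h (halfJet m x a) =
    Ring.choose ((m : ℝ) + 1 / 2) h * (x / (1 + a * x)) ^ h * (1 + a * x) ^ m :=
  coeff_mk _ _

lemma halfJet_ode (m : ℕ) {x a : ℝ} (hu : 1 + a * x ≠ 0) :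
    (1 + C x * (X + C a)) * d⁄dX ℝ (halfJet m x a) =
      C (((m : ℝ) + 1 / 2) * x) * halfJet m x a := by
  ext h
  have e1 : (1 + C x * (X + C a) : PowerSeries ℝ) = C (1 + a * x) + C x * X := by
    rw [map_add, map_mul, map_one]; ring
  rw [e1, add_mul, map_add, mul_assoc, coeff_C_mul, coeff_C_mul, coeff_C_mul, coeff_derivative,
    coeff_halfJet, coeff_halfJet]
  have e2 := Ring.choose_succ_mul ((m : ℝ) + 1 / 2) h
  have e3 : coeff h (X * d⁄dX ℝ (halfJet m x a)) = h * coeff h (halfJet m x a) := by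
    rcases h with _ | h
    · simp
    · rw [coeff_succ_X_mul, coeff_derivative]; push_cast; ring
  have e4 : (1 + a * x) * (x / (1 + a * x)) = x := by field_simp
  rw [e3, coeff_halfJet, pow_succ]
  linear_combination (x / (1 + a * x)) ^ h * (1 + a * x) ^ m *
    ((h + 1) * Ring.choose ((m : ℝ) + 1 / 2) (h + 1) * e4 + x * e2)

lemma MajorizedTo.halfJet {m n : ℕ} {x a w : ℝ} (hx : 0 ≤ x) (ha : 0 ≤ a) (hw : 0 ≤ w)
    (hn : n ≤ m) :
    MajorizedTo n w (halfJet m x a) ((1 + a * x) ^ m * (1 + x * w) ^ (m + 1)) := by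
  unfold MajorizedTo
  have hu : 1 ≤ 1 + a * x := by have := mul_nonneg ha hx; linarith
  have hxu : x / (1 + a * x) ≤ x := div_le_self hx hu
  calc ∑ i ∈ range (n + 1), |coeff i (_root_.halfJet m x a)| * w ^ i
      ≤ ∑ i ∈ range (n + 1), (1 + a * x) ^ m * ((x * w) ^ i * ((m + 1).choose i : ℝ)) := by
        refine Finset.sum_le_sum fun i hi => ?_
        have hi' : i ≤ m + 1 := by have := mem_range.mp hi; omega
        obtain ⟨h0, h1⟩ := choose_half_bounds m i hi'
        rw [coeff_halfJet, abs_of_nonneg (by positivity)]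
        have : (x / (1 + a * x)) ^ i ≤ x ^ i := by gcongr
        calc Ring.choose ((m : ℝ) + 1 / 2) i * (x / (1 + a * x)) ^ i * (1 + a * x) ^ m * w ^ i
            ≤ ((m + 1).choose i : ℝ) * x ^ i * (1 + a * x) ^ m * w ^ i := by gcongr
          _ = _ := by rw [mul_pow]; ring
    _ = (1 + a * x) ^ m * ∑ i ∈ range (n + 1), (x * w) ^ i * ((m + 1).choose i : ℝ) := by
        rw [Finset.mul_sum]
    _ ≤ (1 + a * x) ^ m * ∑ i ∈ range (m + 1 + 1), (x * w) ^ i * ((m + 1).choose i : ℝ) := by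
        refine mul_le_mul_of_nonneg_left ?_ (by positivity)
        refine Finset.sum_le_sum_of_subset_of_nonneg ?_ fun _ _ _ => by positivity
        exact range_subset_range.mpr (by omega)
    _ = _ := by
        rw [add_comm 1 (x * w), add_pow (x * w) 1 (m + 1)]; simp

/-- The nodes `0, 1, k`. -/
def rickertNode (k : ℕ) : Fin 3 → ℝ := ![0, 1, k]

lemma rickertNode_injective {k : ℕ} (hk : 2 ≤ k) : Function.Injective (rickertNode k) := by
  have h : (2 : ℝ) ≤ k := by exact_mod_cast hk
  intro i j hij
  fin_cases i <;> fin_cases j <;> simp [rickertNode] at hij ⊢ <;> linarith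

lemma nodeKernel_zero (α : Fin 3 → ℝ) (κ : Fin 3 → ℕ) : nodeKernel α κ 0 =
    ((X + C (α 0 - α 1))⁻¹ : PowerSeries ℝ) ^ κ 1 * ((X + C (α 0 - α 2))⁻¹) ^ κ 2 := by
  unfold nodeKernel
  rw [show Finset.univ.erase (0 : Fin 3) = {1, 2} by decide]; simp

lemma nodeKernel_one (α : Fin 3 → ℝ) (κ : Fin 3 → ℕ) : nodeKernel α κ 1 =
    ((X + C (α 1 - α 0))⁻¹ : PowerSeries ℝ) ^ κ 0 * ((X + C (α 1 - α 2))⁻¹) ^ κ 2 := by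
  unfold nodeKernel
  rw [show Finset.univ.erase (1 : Fin 3) = {0, 2} by decide]; simp

lemma nodeKernel_two (α : Fin 3 → ℝ) (κ : Fin 3 → ℕ) : nodeKernel α κ 2 =
    ((X + C (α 2 - α 0))⁻¹ : PowerSeries ℝ) ^ κ 0 * ((X + C (α 2 - α 1))⁻¹) ^ κ 1 := by
  unfold nodeKernel
  rw [show Finset.univ.erase (2 : Fin 3) = {0, 1} by decide]; simp

/-- The coefficient of the `j`-th square root in the approximation form. -/
noncomputable def formCoeff (k m : ℕ) (x : ℝ) (κ : Fin 3 → ℕ) (j : Fin 3) : ℝ :=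
  coeff (κ j) (X * nodeKernel (rickertNode k) κ j * halfJet m x (rickertNode k j))

lemma divDiff_eq_sum_formCoeff (k m : ℕ) (x : ℝ) (κ : Fin 3 → ℕ) (w : Fin 3 → ℝ) :
    divDiff (rickertNode k) κ (fun j => C (w j) * halfJet m x (rickertNode k j)) =
      ∑ j, w j * formCoeff k m x κ j := by
  unfold divDiff formCoeff
  refine Finset.sum_congr rfl fun j _ => ?_
  rw [← coeff_C_mul]; congr 1; ring

lemma pow_mul_coeff_halfJet {m h : ℕ} (hh : h ≤ m) {N a : ℝ} (hN : 0 < N) (ha : 0 ≤ a) :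
    N ^ m * coeff h (halfJet m (4 / N) a) =
      (4 ^ h * Ring.choose ((m : ℝ) + 1 / 2) h) * (N + 4 * a) ^ (m - h) := by
  rw [coeff_halfJet]
  obtain ⟨l, rfl⟩ := Nat.exists_eq_add_of_le hh
  have h1 : 1 + a * (4 / N) = (N + 4 * a) / N := by field_simp
  have h2 : 0 < N + 4 * a := by positivity
  rw [h1, Nat.add_sub_cancel_left, pow_add, pow_add, div_pow, div_pow, div_pow, div_pow]
  field_simp

lemma formCoeff_int {k m n : ℕ} (hk : 2 ≤ k) (hn : 0 < n) {κ : Fin 3 → ℕ}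
    (hκ : ∀ j l, j ≠ l → κ j + κ l ≤ 2 * m + 1) (hκm : ∀ j, κ j ≤ m + 1) (j : Fin 3) :
    ∃ z : ℤ, (k : ℝ) ^ m * ((k : ℝ) - 1) ^ (2 * m) * ((k : ℝ) * n) ^ m *
      formCoeff k m (4 / ((k : ℝ) * n)) κ j = z := by
  have hk' : (2 : ℝ) ≤ k := by exact_mod_cast hk
  have hN : (0 : ℝ) < (k : ℝ) * n := by
    have : (0 : ℝ) < n := by exact_mod_cast hn
    positivity
  have hf0 : ((k : ℤ) - 1) ≠ 0 := by omega
  have he0 : ((k : ℤ)) ≠ 0 := by omega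
  have hα0 : 0 ≤ rickertNode k j := by fin_cases j <;> simp [rickertNode]
  unfold formCoeff
  rcases hs : κ j with _ | s
  · exact ⟨0, by rw [mul_assoc X]; simp⟩
  rw [mul_assoc X, coeff_succ_X_mul, coeff_mul, Finset.mul_sum]
  refine exists_int_sum _ _ fun p hp => ?_
  have hp' := mem_antidiagonal.mp hp
  have hh : p.2 ≤ m := by have := hκm j; omega
  obtain ⟨c, hc⟩ := four_pow_mul_choose_half_int m p.2
  have hJ := pow_mul_coeff_halfJet hh hN hα0
  rw [hc] at hJ
  suffices hsuff : ∃ z : ℤ, (k : ℝ) ^ m * ((k : ℝ) - 1) ^ (2 * m) *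
      ((k : ℝ) * n + 4 * rickertNode k j) ^ (m - p.2) *
      coeff p.1 (nodeKernel (rickertNode k) κ j) = z by
    obtain ⟨z, hz⟩ := hsuff
    refine ⟨c * z, ?_⟩
    push_cast
    rw [← hz]
    linear_combination (k : ℝ) ^ m * ((k : ℝ) - 1) ^ (2 * m) *
      coeff p.1 (nodeKernel (rickertNode k) κ j) * hJ
  have h01 := hκ 0 1 (by decide)
  have h02 := hκ 0 2 (by decide)
  have h12 := hκ 1 2 (by decide)
  have h1m := hκm 1
  fin_cases j
  · have hs : κ 0 = s + 1 := hs
    have hden : HasDenom k ((k : ℤ) - 1) (κ 1 * 0 + κ 2 * 1) (κ 1 * 0 + κ 2 * 0)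
        (nodeKernel (rickertNode k) κ 0) := by
      rw [nodeKernel_zero]
      have h := ((hasDenom_inv_one (e := k) (f := k - 1) (u := -1) (Or.inr rfl)).pow (κ 1)).mul
        ((hasDenom_inv_left (u := -k) he0 (Or.inr rfl)).pow (κ 2))
      simpa [rickertNode] using h
    obtain ⟨z, hz⟩ := hden.exists_int (n := p.1) (K' := m + (m - p.2)) (L' := 2 * m)
      (by omega) (by omega)
    refine ⟨n ^ (m - p.2) * z, ?_⟩
    push_cast at hz ⊢
    rw [← hz]
    simp only [rickertNode, Matrix.cons_val_zero]
    rw [mul_zero, add_zero, mul_pow, pow_add]; ring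
  · have hs : κ 1 = s + 1 := hs
    have hden : HasDenom k ((k : ℤ) - 1) (κ 0 * 0 + κ 2 * 0) (κ 0 * 0 + κ 2 * 1)
        (nodeKernel (rickertNode k) κ 1) := by
      rw [nodeKernel_one]
      have h := ((hasDenom_inv_one (e := k) (f := k - 1) (u := 1) (Or.inl rfl)).pow (κ 0)).mul
        ((hasDenom_inv_left (u := -((k : ℤ) - 1)) hf0 (Or.inr rfl)).swap.pow (κ 2))
      simpa [rickertNode] using h
    obtain ⟨z, hz⟩ := hden.exists_int (n := p.1) (K' := m) (L' := 2 * m)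
      (by omega) (by omega)
    refine ⟨(k * n + 4) ^ (m - p.2) * z, ?_⟩
    push_cast at hz ⊢
    rw [← hz]
    simp only [rickertNode, Matrix.cons_val_one, Matrix.cons_val_zero]
    rw [mul_one]; ring
  · have hs : κ 2 = s + 1 := hs
    have hden : HasDenom k ((k : ℤ) - 1) (κ 0 * 1 + κ 1 * 0) (κ 0 * 0 + κ 1 * 1)
        (nodeKernel (rickertNode k) κ 2) := by
      rw [nodeKernel_two]
      have h := ((hasDenom_inv_left (f := k - 1) (u := k) he0 (Or.inl rfl)).pow (κ 0)).mul
        ((hasDenom_inv_left (u := (k : ℤ) - 1) hf0 (Or.inl rfl)).swap.pow (κ 1))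
      simpa [rickertNode] using h
    obtain ⟨z, hz⟩ := hden.exists_int (n := p.1) (K' := m + (m - p.2)) (L' := 2 * m)
      (by omega) (by omega)
    refine ⟨(n + 4) ^ (m - p.2) * z, ?_⟩
    push_cast at hz ⊢
    rw [← hz]
    simp only [rickertNode, Matrix.cons_val]
    rw [show (k : ℝ) * n + 4 * k = k * (n + 4) by ring, mul_pow, pow_add]; ring

lemma formCoeff_zero_le {k m : ℕ} (hk : 2 ≤ k) {N : ℝ} (hN : 0 < N) {κ : Fin 3 → ℕ}
    (hκ : ∀ j l, j ≠ l → κ j + κ l ≤ 2 * m + 1) (hκm : ∀ j, κ j ≤ m + 1) (hmκ : ∀ j, m ≤ κ j) :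
    (k : ℝ) ^ m * ((k : ℝ) - 1) ^ (2 * m) * N ^ m * |formCoeff k m (4 / N) κ 0| ≤
      (1 + 4 / N) * (8 * k * (k - 1) ^ 2 * (N + 2) / (2 * k - 1)) ^ m := by
  have hk' : (2 : ℝ) ≤ k := by exact_mod_cast hk
  have hk1 : (0 : ℝ) ≤ (k : ℝ) - 1 := by linarith
  have hx : 0 < 4 / N := by positivity
  have h2k : (0 : ℝ) < 2 * k - 1 := by linarith
  unfold formCoeff
  rcases hs : κ 0 with _ | s
  · rw [mul_assoc X]
    simp only [coeff_zero_X_mul, abs_zero, mul_zero]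
    positivity
  rw [mul_assoc X, coeff_succ_X_mul]
  have hsm : s ≤ m := by have := hκm 0; omega
  have hK : MajorizedTo s (1 / 2) (nodeKernel (rickertNode k) κ 0)
      ((2 : ℝ) ^ κ 1 * (2 / (2 * k - 1)) ^ κ 2) := by
    rw [nodeKernel_zero]
    have e1 : (1 : ℝ) / (|rickertNode k 0 - rickertNode k 1| - 1 / 2) = 2 := by
      simp [rickertNode]; norm_num
    have e2 : (1 : ℝ) / (|rickertNode k 0 - rickertNode k 2| - 1 / 2) = 2 / (2 * k - 1) := by
      simp only [rickertNode, Matrix.cons_val, zero_sub, abs_neg, Nat.abs_cast]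
      have : (k : ℝ) - 1 / 2 ≠ 0 := by linarith
      field_simp
    have h1 : (1 / 2 : ℝ) < |rickertNode k 0 - rickertNode k 1| := by
      simp [rickertNode]; norm_num
    have h2 : (1 / 2 : ℝ) < |rickertNode k 0 - rickertNode k 2| := by
      simp only [rickertNode, Matrix.cons_val, zero_sub, abs_neg, Nat.abs_cast]; linarith
    have h := MajorizedTo.mul (by norm_num) (MajorizedTo.pow (by norm_num)
      (MajorizedTo.inv s (by norm_num) h1) (κ 1)) (MajorizedTo.pow (by norm_num)
      (MajorizedTo.inv s (by norm_num) h2) (κ 2))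
    rwa [e1, e2] at h
  have hJ := MajorizedTo.halfJet (m := m) (x := 4 / N) (a := 0) (w := 1 / 2) hx.le le_rfl
    (by norm_num) hsm
  have hc := (hK.mul (by norm_num) hJ).abs_coeff_le (by norm_num)
  rw [show rickertNode k 0 = 0 from rfl]
  set c := |coeff s (nodeKernel (rickertNode k) κ 0 * halfJet m (4 / N) 0)|
  have hc2 : c ≤ 2 ^ s * ((2 : ℝ) ^ κ 1 * (2 / (2 * k - 1)) ^ κ 2 *
      (1 + 4 / N * (1 / 2)) ^ (m + 1)) := by
    rw [zero_mul, add_zero, one_pow, one_mul] at hc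
    calc c = 2 ^ s * (c * (1 / 2) ^ s) := by
            rw [one_div, inv_pow]; field_simp
      _ ≤ _ := mul_le_mul_of_nonneg_left hc (by positivity)
  have hp1 : (2 : ℝ) ^ s * 2 ^ κ 1 ≤ 4 ^ m := by
    rw [← pow_add, show (4 : ℝ) = 2 ^ 2 by norm_num, ← pow_mul]
    exact pow_le_pow_right₀ (by norm_num) (by have := hκ 0 1 (by decide); omega)
  have hp2 : (2 / (2 * k - 1) : ℝ) ^ κ 2 ≤ (2 / (2 * k - 1)) ^ m :=
    pow_le_pow_of_le_one (by positivity) (by rw [div_le_one h2k]; linarith) (hmκ 2)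
  have hc3 : c ≤ 4 ^ m * (2 / (2 * k - 1)) ^ m * ((1 + 4 / N * (1 / 2)) ^ m * (1 + 4 / N)) := by
    refine hc2.trans ?_
    rw [← mul_assoc, ← mul_assoc]
    refine mul_le_mul (mul_le_mul hp1 hp2 (by positivity) (by positivity)) ?_ (by positivity)
      (by positivity)
    rw [pow_succ]
    refine mul_le_mul_of_nonneg_left ?_ (by positivity)
    linarith
  calc (k : ℝ) ^ m * ((k : ℝ) - 1) ^ (2 * m) * N ^ m * c
      ≤ (k : ℝ) ^ m * ((k : ℝ) - 1) ^ (2 * m) * N ^ m *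
        (4 ^ m * (2 / (2 * k - 1)) ^ m * ((1 + 4 / N * (1 / 2)) ^ m * (1 + 4 / N))) := by
        gcongr
    _ = (1 + 4 / N) * (k * (k - 1) ^ 2 * N * 4 * (2 / (2 * k - 1)) * (1 + 4 / N * (1 / 2))) ^ m := by
        rw [pow_mul]; simp only [mul_pow]; ring
    _ = _ := by
        congr 2; field_simp; ring

lemma formCoeff_two_le {k m : ℕ} (hk : 4 ≤ k) {N : ℝ} (hN : 0 < N) (hkN : 8 * k ≤ N)
    {κ : Fin 3 → ℕ} (hκm : ∀ j, κ j ≤ m + 1) (hmκ : ∀ j, m ≤ κ j) :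
    (k : ℝ) ^ m * ((k : ℝ) - 1) ^ (2 * m) * N ^ m * |formCoeff k m (4 / N) κ 2| ≤
      (1 + 4 / N) * (8 * k * (k - 1) ^ 2 * (N + 2) / (2 * k - 1)) ^ m := by
  have hk' : (4 : ℝ) ≤ k := by exact_mod_cast hk
  have hk1 : (0 : ℝ) < (k : ℝ) - 1 := by linarith
  have hk2 : (0 : ℝ) < (k : ℝ) - 2 := by linarith
  have hx : 0 < 4 / N := by positivity
  have h2k : (0 : ℝ) < 2 * k - 1 := by linarith
  unfold formCoeff
  rcases hs : κ 2 with _ | s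
  · rw [mul_assoc X]
    simp only [coeff_zero_X_mul, abs_zero, mul_zero]
    positivity
  rw [mul_assoc X, coeff_succ_X_mul]
  have hsm : s ≤ m := by have := hκm 2; omega
  have hK : MajorizedTo s 1 (nodeKernel (rickertNode k) κ 2)
      ((1 / ((k : ℝ) - 1)) ^ κ 0 * (1 / ((k : ℝ) - 2)) ^ κ 1) := by
    rw [nodeKernel_two]
    have a1 : |rickertNode k 2 - rickertNode k 0| = k := by
      simp [rickertNode]
    have a2 : |rickertNode k 2 - rickertNode k 1| = k - 1 := by
      simp only [rickertNode, Matrix.cons_val]; exact abs_of_pos hk1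
    have e2 : (1 : ℝ) / ((k : ℝ) - 2) = 1 / (|rickertNode k 2 - rickertNode k 1| - 1) := by
      rw [a2]; congr 1; ring
    rw [e2]
    nth_rewrite 1 [← a1]
    refine MajorizedTo.mul (by norm_num) (MajorizedTo.pow (by norm_num)
      (MajorizedTo.inv _ (by norm_num) ?_) _) (MajorizedTo.pow (by norm_num)
      (MajorizedTo.inv _ (by norm_num) ?_) _)
    · rw [a1]; linarith
    · rw [a2]; linarith
  have hJ := MajorizedTo.halfJet (m := m) (x := 4 / N) (a := k) (w := 1) hx.le (by positivity)
    (by norm_num) hsm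
  have hc := (hK.mul (by norm_num) hJ).abs_coeff_le (by norm_num)
  rw [show rickertNode k 2 = k from rfl]
  rw [one_pow, mul_one] at hc
  set c := |coeff s (nodeKernel (rickertNode k) κ 2 * halfJet m (4 / N) k)|
  have hp1 : (1 / ((k : ℝ) - 1)) ^ κ 0 ≤ (1 / ((k : ℝ) - 1)) ^ m :=
    pow_le_pow_of_le_one (by positivity) (by rw [div_le_one hk1]; linarith) (hmκ 0)
  have hp2 : (1 / ((k : ℝ) - 2)) ^ κ 1 ≤ (1 / ((k : ℝ) - 2)) ^ m :=
    pow_le_pow_of_le_one (by positivity) (by rw [div_le_one hk2]; linarith) (hmκ 1)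
  calc (k : ℝ) ^ m * ((k : ℝ) - 1) ^ (2 * m) * N ^ m * c
      ≤ (k : ℝ) ^ m * ((k : ℝ) - 1) ^ (2 * m) * N ^ m *
        ((1 / ((k : ℝ) - 1)) ^ m * (1 / ((k : ℝ) - 2)) ^ m *
          ((1 + k * (4 / N)) ^ m * (1 + 4 / N * 1) ^ (m + 1))) := by
        refine mul_le_mul_of_nonneg_left (hc.trans ?_) (by positivity)
        gcongr
    _ = (1 + 4 / N) * (k * (k - 1) ^ 2 * N * (1 / (k - 1)) * (1 / (k - 2)) * (1 + k * (4 / N)) *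
          (1 + 4 / N)) ^ m := by
        rw [pow_mul, pow_succ]; simp only [mul_pow]; ring
    _ ≤ _ := by
        refine mul_le_mul_of_nonneg_left (pow_le_pow_left₀ (by positivity) ?_ m) (by positivity)
        have h3 : 1 + k * (4 / N) ≤ 3 / 2 := by
          have : k * (4 / N) = 4 * k / N := by ring
          rw [this]
          have : 4 * k / N ≤ 1 / 2 := by rw [div_le_iff₀ hN]; linarith
          linarith
        have h4 : 1 + 4 / N ≤ 5 / 4 := by
          have : 4 / N ≤ 1 / 4 := by rw [div_le_iff₀ hN]; linarith
          linarith
        calc (k : ℝ) * (k - 1) ^ 2 * N * (1 / (k - 1)) * (1 / (k - 2)) * (1 + k * (4 / N)) *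
              (1 + 4 / N) ≤ (k : ℝ) * (k - 1) ^ 2 * N * (1 / (k - 1)) * (1 / (k - 2)) * (3 / 2) *
              (5 / 4) := by gcongr
          _ = (15 / 8) * k * (k - 1) * N / (k - 2) := by field_simp; ring
          _ ≤ 8 * k * (k - 1) ^ 2 * N / (2 * k - 1) := by
              rw [div_le_div_iff₀ hk2 h2k]
              have : (15 / 8 : ℝ) * (2 * k - 1) ≤ 8 * (k - 1) * (k - 2) := by nlinarith
              have hpos : 0 ≤ k * ((k : ℝ) - 1) * N := by positivity
              nlinarith [mul_le_mul_of_nonneg_left this hpos]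
          _ ≤ _ := by gcongr; linarith

end

section

open PowerSeries Finset

lemma sum_unit_mult (m : ℕ) (i : Fin 3) :
    ∑ j, ((fun _ => m) + Pi.single i 1 : Fin 3 → ℕ) j = 3 * m + 1 := by
  rw [divDiff.sum_add_single]; simp

/-- Simultaneous approximation: for integers `p` whose ratios are close to those of
`1, √(1 + 4/N), √(1 + 4k/N)`. -/
theorem rickert_inequality {k m n : ℕ} (hk : 4 ≤ k) (hn : 8 ≤ n) (hm : 1 ≤ m) {p : Fin 3 → ℤ}
    (hp : p 0 ≠ 0) {l N : ℝ} (hN : N = (k : ℝ) * n) (hl : 0 ≤ l)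
    (hp1 : (p 1 : ℝ) = l * √(1 + 4 / N)) :
    1 ≤ (1 + 4 / N) * (8 * k * (k - 1) ^ 2 * (N + 2) / (2 * k - 1)) ^ m *
        (|(p 0 : ℝ) - l| + |(p 2 : ℝ) - l * √(1 + k * (4 / N))|) +
      l / (27 * (N - 4 * k) ^ 2 / (256 * k * (k - 1) ^ 2)) ^ m := by
  have hk' : (4 : ℝ) ≤ k := by exact_mod_cast hk
  have hn' : (8 : ℝ) ≤ n := by exact_mod_cast hn
  have hN0 : 0 < N := by rw [hN]; positivity
  have hkN : 8 * k ≤ N := by rw [hN]; nlinarith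
  set x : ℝ := 4 / N with hx
  have hx0 : 0 < x := by positivity
  have hkx : (k : ℝ) * x < 1 := by
    rw [hx, mul_div_assoc', div_lt_one hN0]; linarith
  set α := rickertNode k with hα
  have hinj : Function.Injective α := rickertNode_injective (by omega)
  have hα0 : ∀ i, 0 ≤ α i := fun i => by fin_cases i <;> simp [hα, rickertNode]
  have hαk : ∀ i, α i ≤ k := fun i => by
    fin_cases i <;> simp [hα, rickertNode]; omega
  have hu : ∀ i, 0 < 1 + α i * x := fun i => by have := mul_nonneg (hα0 i) hx0.le; linarith
  obtain ⟨i, hi⟩ : ∃ i, divDiff α ((fun _ => m) + Pi.single i 1)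
      (fun j => C (p j : ℝ) * halfJet m x (α j)) ≠ 0 := by
    by_contra hcon
    push Not at hcon
    have h0 := divDiff.constantCoeff_eq_zero hinj hx0.ne' m
      (G := fun j => C (p j : ℝ) * halfJet m x (α j)) (fun j => by
        rw [divDiff.derivative_mul', derivative_C, zero_mul, zero_add]
        have := halfJet_ode m (hu j).ne'
        linear_combination C (p j : ℝ) * this) hcon 0
    rw [coeff_C_mul, coeff_halfJet, hα] at h0
    simp [rickertNode, hp] at h0
  set κ : Fin 3 → ℕ := (fun _ => m) + Pi.single i 1 with hκdef
  have hκ2 : ∀ j l, j ≠ l → κ j + κ l ≤ 2 * m + 1 := by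
    intro j l hjl
    simp only [hκdef, Pi.add_apply, Pi.single_apply]
    by_cases h1 : j = i
    · by_cases h2 : l = i
      · exact absurd (h1.trans h2.symm) hjl
      · simp [h1, h2]; omega
    · by_cases h2 : l = i <;> simp [h1, h2] <;> omega
  have hκm : ∀ j, κ j ≤ m + 1 := by
    intro j; simp only [hκdef, Pi.add_apply, Pi.single_apply]; split_ifs <;> omega
  have hmκ : ∀ j, m ≤ κ j := by
    intro j; simp only [hκdef, Pi.add_apply]; omega
  rw [hα, divDiff_eq_sum_formCoeff] at hi
  set q : ℝ := (k : ℝ) ^ m * ((k : ℝ) - 1) ^ (2 * m) * N ^ m with hq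
  have hk1 : (0 : ℝ) < k - 1 := by linarith
  have hq0 : 0 < q := by positivity
  have hint : ∃ z : ℤ, q * ∑ j, (p j : ℝ) * formCoeff k m x κ j = z := by
    rw [Finset.mul_sum]
    refine exists_int_sum _ _ fun j _ => ?_
    obtain ⟨z, hz⟩ := formCoeff_int (k := k) (m := m) (n := n) (by omega) (by omega) hκ2 hκm j
    refine ⟨p j * z, ?_⟩
    push_cast
    rw [← hz, hq, hx, hN]; ring
  have h1 : 1 ≤ |q * ∑ j, (p j : ℝ) * formCoeff k m x κ j| := by
    obtain ⟨z, hz⟩ := hint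
    have hz0 : z ≠ 0 := by
      rintro rfl
      rw [Int.cast_zero] at hz
      exact hi ((mul_eq_zero.mp hz).resolve_left hq0.ne')
    rw [hz]
    exact_mod_cast Int.one_le_abs hz0
  -- the remainder
  have hrem : |divDiff α κ (fun j => C (√(1 + α j * x)) * halfJet m x (α j))| ≤
      (4 / 27) ^ m * x ^ (3 * m) * ((1 - k * x) ^ (2 * m))⁻¹ := by
    refine divDiff.abs_binomial_le hinj hα0 hαk hx0 hkx hm (sum_unit_mult m i) fun j l => ?_
    rw [coeff_C_mul, coeff_halfJet, Real.rpow_sub (hu j), Real.rpow_add (hu j),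
      Real.rpow_natCast, Real.rpow_natCast, ← Real.sqrt_eq_rpow, div_pow]
    have := (hu j).ne'
    field_simp
  rw [hα, divDiff_eq_sum_formCoeff] at hrem
  have hf0 := formCoeff_zero_le (k := k) (m := m) (by omega) hN0 hκ2 hκm hmκ
  have hf2 := formCoeff_two_le (k := k) (m := m) hk hN0 hkN hκm hmκ
  rw [← hx, ← hq] at hf0 hf2
  simp only [Fin.sum_univ_three] at h1 hrem
  rw [show rickertNode k 0 = 0 from rfl, show rickertNode k 1 = 1 from rfl,
    show rickertNode k 2 = k from rfl, zero_mul, add_zero, Real.sqrt_one, one_mul, one_mul] at hrem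
  set P0 := formCoeff k m x κ 0
  set P1 := formCoeff k m x κ 1
  set P2 := formCoeff k m x κ 2
  set R := P0 + √(1 + x) * P1 + √(1 + k * x) * P2
  have hdecomp : q * ((p 0 : ℝ) * P0 + p 1 * P1 + p 2 * P2) =
      q * P0 * (p 0 - l) + q * P2 * (p 2 - l * √(1 + k * x)) + q * l * R := by
    rw [hp1]; ring
  rw [hdecomp] at h1
  have htri : |q * P0 * (p 0 - l) + q * P2 * (p 2 - l * √(1 + k * x)) + q * l * R| ≤
      q * |P0| * |(p 0 : ℝ) - l| + q * |P2| * |(p 2 : ℝ) - l * √(1 + k * x)| + q * l * |R| := by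
    refine (abs_add_three _ _ _).trans (le_of_eq ?_)
    simp only [abs_mul, abs_of_pos hq0, abs_of_nonneg hl]
  have hR : q * l * |R| ≤ l / (27 * (N - 4 * k) ^ 2 / (256 * k * (k - 1) ^ 2)) ^ m := by
    have hN4 : 0 < N - 4 * k := by linarith
    calc q * l * |R| ≤ q * l * ((4 / 27) ^ m * x ^ (3 * m) * ((1 - k * x) ^ (2 * m))⁻¹) := by
          gcongr
      _ = l * (k * (k - 1) ^ 2 * N * (4 / 27) * x ^ 3 * ((1 - k * x) ^ 2)⁻¹) ^ m := by
          rw [hq, pow_mul, pow_mul, pow_mul]; simp only [mul_pow, inv_pow]; ring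
      _ = _ := by
          have : 1 - k * x = (N - 4 * k) / N := by rw [hx]; field_simp
          have hbase : k * ((k : ℝ) - 1) ^ 2 * N * (4 / 27) * x ^ 3 * ((1 - k * x) ^ 2)⁻¹ =
              (27 * (N - 4 * k) ^ 2 / (256 * k * (k - 1) ^ 2))⁻¹ := by
            rw [this, hx, inv_div]
            field_simp
            norm_num
          rw [hbase, inv_pow]; rfl
  refine h1.trans (htri.trans ?_)
  rw [mul_add]
  gcongr

lemma first_difference {b c d Z l W : ℝ} (hb0 : 0 < b) (hc : 0 < c) (hbc : b ≤ 3 * c)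
    (hl0 : 0 ≤ l) (hZ0 : 0 ≤ Z) (hZ : Z ^ 2 = c * d + 4) (hl2 : l ^ 2 = (b * d + 4) * (b * c))
    (hW0 : 0 < W) (hW2 : W ^ 2 * c = d) : |b * Z - l| ≤ 4 / W := by
  have hbZ : (b * Z) ^ 2 = b ^ 2 * (c * d) + 4 * b ^ 2 := by rw [mul_pow, hZ]; ring
  have hcd : (c * W) ^ 2 = c * d := by rw [mul_pow, ← hW2]; ring
  have hge1 : b * (c * W) ≤ b * Z := by
    refine le_of_sq_le_sq ?_ (by positivity)
    rw [hbZ, mul_pow, hcd]; nlinarith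
  have hge2 : b * (c * W) ≤ l := by
    refine le_of_sq_le_sq ?_ hl0
    rw [hl2, mul_pow, hcd]
    have : 0 ≤ 4 * b * c := by positivity
    linarith
  have hpos : 0 < b * (c * W) := by positivity
  have hsum : 0 < b * Z + l := by linarith
  have hprod : |b * Z - l| * (b * Z + l) = 4 * b * |b - c| := by
    have e : (b * Z - l) * (b * Z + l) = 4 * b * (b - c) := by linear_combination hbZ - hl2
    have e2 := congrArg abs e
    rwa [abs_mul, abs_mul, abs_of_pos hsum, abs_of_pos (by positivity : 0 < 4 * b)] at e2
  have hbcabs : |b - c| ≤ 2 * c := by rw [abs_le]; constructor <;> linarith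
  have h5 : |b * Z - l| * (2 * (b * (c * W))) ≤ 4 * b * (2 * c) :=
    calc |b * Z - l| * (2 * (b * (c * W))) ≤ |b * Z - l| * (b * Z + l) :=
          mul_le_mul_of_nonneg_left (by linarith) (abs_nonneg _)
      _ = 4 * b * |b - c| := hprod
      _ ≤ _ := mul_le_mul_of_nonneg_left hbcabs (by positivity)
  rw [le_div_iff₀ hW0]
  have h6 : 0 < 2 * b * c := by positivity
  refine le_of_mul_le_mul_left ?_ h6
  linarith

lemma second_difference {k a c d s X Y W : ℝ} (hk : 7 ≤ k) (hk13 : k ≤ 13)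
    (hc : 0 < c) (hd : 0 < d) (hac : 200 ≤ a * c) (hs0 : 0 < s) (hX0 : 0 ≤ X)
    (hY0 : 0 ≤ Y) (hs : s ^ 2 = a * c + 4) (hX : X ^ 2 = a * d + 4) (hY : Y ^ 2 = k * a * d + 4)
    (hW0 : 0 < W) (hW2 : W ^ 2 * c = d) : |k * s * X - s * Y * √k| ≤ 24.5 / W := by
  have hkk : √k ^ 2 = k := Real.sq_sqrt (by linarith)
  set g := √k
  have hg0 : 0 < g := Real.sqrt_pos.mpr (by linarith)
  have hacd := mul_le_mul_of_nonneg_left hac hd.le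
  have e1 : (W * s * g) ^ 2 * c = k * (d * (a * c + 4)) := by
    rw [mul_pow, mul_pow, hkk, hs, ← hW2]; ring
  have h4 : d * (a * c + 4) ≤ 1.0201 ^ 2 * ((a * d) * c) := by linarith
  have h4' := mul_le_mul_of_nonneg_left h4 (by linarith : 0 ≤ k)
  have hgX : W * s * g ≤ 1.0201 * (g * X) := by
    refine le_of_sq_le_sq ?_ (by positivity)
    have e2 : (1.0201 * (g * X)) ^ 2 * c = 1.0201 ^ 2 * (k * (a * d * c) + 4 * (k * c)) := by
      rw [mul_pow, mul_pow, hkk, hX]; ring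
    refine le_of_mul_le_mul_right ?_ hc
    rw [e1, e2]
    have : 0 ≤ k * c := by positivity
    linarith
  have hgY : W * s * g ≤ 1.0201 * Y := by
    refine le_of_sq_le_sq ?_ (by positivity)
    have e2 : (1.0201 * Y) ^ 2 * c = 1.0201 ^ 2 * (k * (a * d * c) + 4 * c) := by
      rw [mul_pow, hY]; ring
    refine le_of_mul_le_mul_right ?_ hc
    rw [e1, e2]
    linarith
  have hfac : k * s * X - s * Y * g = g * s * (g * X - Y) := by
    linear_combination -s * X * hkk
  have hdiff : (g * X - Y) * (g * X + Y) = 4 * (k - 1) := by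
    have : (g * X) ^ 2 = k * (a * d + 4) := by rw [mul_pow, hkk, hX]
    linear_combination this - hY
  have hsum : 0 < g * X + Y := by
    have : 0 < W * s * g := by positivity
    linarith
  have hnn : 0 ≤ g * X - Y := by
    have : 0 ≤ (g * X - Y) * (g * X + Y) := by rw [hdiff]; linarith
    exact nonneg_of_mul_nonneg_left this hsum
  rw [hfac, abs_of_nonneg (by positivity), le_div_iff₀ hW0]
  have h7 : (g * X - Y) * (2 * (W * s * g)) ≤ 1.0201 * (4 * (k - 1)) := by
    calc (g * X - Y) * (2 * (W * s * g)) ≤ (g * X - Y) * (1.0201 * (g * X + Y)) :=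
          mul_le_mul_of_nonneg_left (by linarith) hnn
      _ = _ := by linear_combination 1.0201 * hdiff
  linarith

set_option maxHeartbeats 600000 in
/-- In a `D(4)`-quadruple `{a, ka, c, d}`, the element `d` satisfies the gap inequality coming from
simultaneous approximation. -/
theorem D4_gap_inequality {k a c d s t X Y Z m : ℕ} (hk : 7 ≤ k) (hk13 : k ≤ 13)
    (hac : 200 ≤ a * c) (hbc : k * a ≤ 3 * c) (hd : 200 ≤ a * d) (hm : 1 ≤ m)
    (hs : s ^ 2 = a * c + 4) (ht : t ^ 2 = k * a * c + 4) (hX : X ^ 2 = a * d + 4)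
    (hY : Y ^ 2 = k * a * d + 4) (hZ : Z ^ 2 = c * d + 4) {N W E Q : ℝ}
    (hN : N = (k * a * c : ℕ)) (hW : W = √(d / c)) (hE0 : 0 < E)
    (hE : 256 * k * (k - 1) ^ 2 * E ≤ 27 * (N - 4 * k) ^ 2)
    (hQ : 8 * k * (k - 1) ^ 2 * (N + 2) ≤ (2 * k - 1) * Q) :
    1 ≤ 30 * Q ^ m / W + 1.01 * N * W / E ^ m := by
  have hk' : (7 : ℝ) ≤ k := by exact_mod_cast hk
  have hk13' : (k : ℝ) ≤ 13 := by exact_mod_cast hk13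
  have ha : (0 : ℝ) < a := by
    rcases Nat.eq_zero_or_pos a with h | h
    · subst h; omega
    · exact_mod_cast h
  have hc : (0 : ℝ) < c := by
    rcases Nat.eq_zero_or_pos c with h | h
    · subst h; omega
    · exact_mod_cast h
  have hdp : (0 : ℝ) < d := by
    rcases Nat.eq_zero_or_pos d with h | h
    · subst h; omega
    · exact_mod_cast h
  have hac' : (200 : ℝ) ≤ a * c := by exact_mod_cast hac
  have had' : (200 : ℝ) ≤ a * d := by exact_mod_cast hd
  have hbc' : (k : ℝ) * a ≤ 3 * c := by exact_mod_cast hbc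
  have hs' : (s : ℝ) ^ 2 = a * c + 4 := by exact_mod_cast hs
  have ht' : (t : ℝ) ^ 2 = k * a * c + 4 := by exact_mod_cast ht
  have hX' : (X : ℝ) ^ 2 = a * d + 4 := by exact_mod_cast hX
  have hY' : (Y : ℝ) ^ 2 = k * a * d + 4 := by exact_mod_cast hY
  have hZ' : (Z : ℝ) ^ 2 = c * d + 4 := by exact_mod_cast hZ
  have hN' : N = k * (a * c) := by rw [hN]; push_cast; ring
  have hN0 : 0 < N := by rw [hN']; positivity
  have hN1400 : 1400 ≤ N := by rw [hN']; nlinarith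
  have hW0 : 0 < W := by rw [hW]; positivity
  have hW2 : W ^ 2 * c = d := by rw [hW, Real.sq_sqrt (by positivity)]; field_simp
  set l : ℝ := Y * √N with hldef
  have hl0 : 0 ≤ l := by positivity
  have hl2 : l ^ 2 = (k * a * d + 4) * (k * a * c) := by
    rw [hldef, mul_pow, Real.sq_sqrt hN0.le, hY', hN']; ring
  have hp1 : ((t * Y : ℤ) : ℝ) = l * √(1 + 4 / N) := by
    rw [hldef, mul_assoc, ← Real.sqrt_mul hN0.le]
    have : N * (1 + 4 / N) = (t : ℝ) ^ 2 := by rw [ht', hN']; field_simp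
    rw [this, Real.sqrt_sq (by positivity)]; push_cast; ring
  have hZpos : 0 < Z := by
    rcases Nat.eq_zero_or_pos Z with h | h
    · subst h; simp at hZ
    · exact h
  have hapos : 0 < a := by exact_mod_cast ha
  have main := rickert_inequality (k := k) (m := m) (n := a * c) (by omega) (by omega) hm
    (p := ![(k * a * Z : ℤ), (t * Y : ℤ), (k * s * X : ℤ)]) (l := l) (N := N)
    (by simp; omega) (by rw [hN']; push_cast; ring) hl0 hp1
  simp only [Matrix.cons_val_zero, Matrix.cons_val] at main
  push_cast at main
  set b : ℝ := k * a with hb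
  have hb0 : 0 < b := by positivity
  have hd1 : |b * Z - l| ≤ 4 / W :=
    first_difference hb0 hc hbc' hl0 (by positivity) hZ' hl2 hW0 hW2
  have hsk : l * √(1 + k * (4 / N)) = s * Y * √k := by
    rw [hldef, mul_assoc, ← Real.sqrt_mul hN0.le]
    have : N * (1 + k * (4 / N)) = (s : ℝ) ^ 2 * k := by rw [hs', hN']; field_simp
    rw [this, Real.sqrt_mul (by positivity), Real.sqrt_sq (by positivity)]; ring
  have hs0 : (0 : ℝ) < s := by
    rcases Nat.eq_zero_or_pos s with h | h
    · subst h; simp at hs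
    · exact_mod_cast h
  have hd2 : |k * s * X - l * √(1 + k * (4 / N))| ≤ 24.5 / W := by
    rw [hsk]
    exact second_difference hk' hk13' hc hdp hac' hs0 (by positivity) (by positivity) hs' hX' hY'
      hW0 hW2
  have hlW : l ≤ 1.01 * N * W := by
    refine le_of_sq_le_sq ?_ (by positivity)
    rw [hl2]
    have : (1.01 * N * W) ^ 2 = 1.01 ^ 2 * b ^ 2 * (c * d) := by
      rw [mul_pow, mul_pow, ← hW2, hN']; ring
    rw [this]
    have h1 : 7 * 200 ≤ k * (a * d : ℝ) := mul_le_mul hk' had' (by norm_num) (by positivity)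
    have h2 : 1400 * (b * c) ≤ b * d * (b * c) := by
      refine mul_le_mul_of_nonneg_right ?_ (by positivity)
      rw [hb]; linarith
    have h3 : 0 < b * d * (b * c) := by positivity
    have h4 : b ^ 2 * (c * d) = b * d * (b * c) := by ring
    rw [mul_assoc (1.01 ^ 2 : ℝ), h4]
    linarith
  refine main.trans ?_
  have h2k : (0 : ℝ) < 2 * k - 1 := by linarith
  have hk1 : (0 : ℝ) < k - 1 := by linarith
  have hQ' : 8 * k * (k - 1) ^ 2 * (N + 2) / (2 * k - 1) ≤ Q := by
    rw [div_le_iff₀ h2k]; linarith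
  have hQ0 : 0 ≤ 8 * k * (k - 1) ^ 2 * (N + 2) / (2 * (k : ℝ) - 1) := by positivity
  have hE' : E ≤ 27 * (N - 4 * k) ^ 2 / (256 * k * (k - 1) ^ 2) := by
    rw [le_div_iff₀ (by positivity)]; linarith
  have h4N : 4 / N ≤ 4 / 1400 := by gcongr
  have hQnn : 0 ≤ Q := hQ0.trans hQ'
  refine add_le_add ?_ ?_
  · calc _ ≤ (1 + 4 / 1400) * Q ^ m * (4 / W + 24.5 / W) := by gcongr
      _ = (1 + 4 / 1400) * 28.5 * Q ^ m / W := by field_simp; ring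
      _ ≤ _ := by
        gcongr; norm_num
  · gcongr

/-- An upper bound for the largest element of a `D(4)`-quadruple `{a, ka, c, d}`. -/
theorem D4_upper_bound {k a c d s t X Y Z m₀ : ℕ} (hk : 7 ≤ k) (hk13 : k ≤ 13)
    (hac : 200 ≤ a * c) (hbc : k * a ≤ 3 * c) (hd : 200 ≤ a * d) (hm : 1 ≤ m₀)
    (hs : s ^ 2 = a * c + 4) (ht : t ^ 2 = k * a * c + 4) (hX : X ^ 2 = a * d + 4)
    (hY : Y ^ 2 = k * a * d + 4) (hZ : Z ^ 2 = c * d + 4) {N E Q : ℝ}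
    (hN : N = (k * a * c : ℕ)) (hE0 : 0 < E)
    (hE : 256 * k * (k - 1) ^ 2 * E ≤ 27 * (N - 4 * k) ^ 2)
    (hQ : 8 * k * (k - 1) ^ 2 * (N + 2) ≤ (2 * k - 1) * Q)
    (hEQ : 122 * N * Q * Q ^ m₀ < E ^ m₀) :
    (d : ℝ) < 3600 * c * Q ^ (2 * m₀) := by
  by_contra! hcon
  have hk' : (7 : ℝ) ≤ k := by exact_mod_cast hk
  have hac' : (200 : ℝ) ≤ a * c := by exact_mod_cast hac
  have hc : (0 : ℝ) < c := by
    rcases Nat.eq_zero_or_pos c with h | h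
    · subst h; omega
    · exact_mod_cast h
  have hN1400 : 1400 ≤ N := by rw [hN]; push_cast; rw [mul_assoc]; nlinarith
  have hQ1 : 1400 ≤ Q := by
    have h1 : (2 * (k : ℝ) - 1) * N ≤ 8 * k * (k - 1) ^ 2 * (N + 2) := by
      have : (2 * (k : ℝ) - 1) ≤ 8 * k * (k - 1) ^ 2 := by nlinarith
      have h2 : 0 ≤ 8 * (k : ℝ) * (k - 1) ^ 2 := by positivity
      nlinarith
    have h2 : N ≤ Q := le_of_mul_le_mul_left (h1.trans hQ) (by linarith)
    linarith
  have hEQ' : Q ≤ E := by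
    by_contra! hlt
    have : E ^ m₀ ≤ Q ^ m₀ := by gcongr
    have h3 : 0 < Q ^ m₀ := by positivity
    nlinarith [mul_le_mul_of_nonneg_right (by nlinarith : (1 : ℝ) ≤ 122 * N * Q) h3.le]
  set W : ℝ := √(d / c) with hW
  have hWge : 60 * Q ^ m₀ ≤ W := by
    rw [hW]
    refine Real.le_sqrt_of_sq_le ?_
    rw [le_div_iff₀ hc]
    calc (60 * Q ^ m₀) ^ 2 * c = 3600 * c * Q ^ (2 * m₀) := by ring
      _ ≤ d := hcon
  obtain ⟨m, hm1, hm2⟩ : ∃ m, 60 * Q ^ m ≤ W ∧ W < 60 * Q ^ (m + 1) := by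
    have hex : ∃ j, W < 60 * Q ^ j := by
      obtain ⟨j, hj⟩ := pow_unbounded_of_one_lt W (by linarith : 1 < Q)
      exact ⟨j, by have : 0 < Q ^ j := by positivity
                   linarith⟩
    classical
    have hf := Nat.find_spec hex
    rcases hj : Nat.find hex with _ | j
    · rw [hj] at hf
      have : 60 * Q ^ 0 ≤ 60 * Q ^ m₀ := by
        gcongr
        · linarith
        · omega
      linarith
    · refine ⟨j, ?_, by rw [hj] at hf; exact hf⟩
      exact not_lt.mp (Nat.find_min hex (by omega))
  have hmm : m₀ ≤ m := by
    by_contra! hlt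
    have : 60 * Q ^ (m + 1) ≤ 60 * Q ^ m₀ := by
      gcongr
      · linarith
      · omega
    linarith
  have key := D4_gap_inequality hk hk13 hac hbc hd (hm.trans hmm) hs ht hX hY hZ hN hW hE0 hE hQ
  have hQm : 0 < Q ^ m := by positivity
  have hW0 : 0 < W := by linarith [mul_pos (by norm_num : (0 : ℝ) < 60) hQm]
  have h1 : 30 * Q ^ m / W ≤ 1 / 2 := by rw [div_le_iff₀ hW0]; linarith
  have hEm : 0 < E ^ m := by positivity
  have h2 : 1 / 2 * E ^ m ≤ 1.01 * N * W := by
    rw [← le_div_iff₀ hEm]; linarith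
  have h3 : E ^ m ≤ 122 * N * Q * Q ^ m := by
    have : 1.01 * N * W ≤ 1.01 * N * (60 * Q ^ (m + 1)) := by gcongr
    rw [pow_succ] at this
    have h4 : 0 < N * Q * Q ^ m := by positivity
    nlinarith
  obtain ⟨j, rfl⟩ := Nat.exists_eq_add_of_le hmm
  have h4 : Q ^ j ≤ E ^ j := by gcongr
  have h5 : 122 * N * Q * Q ^ m₀ * Q ^ j < E ^ m₀ * E ^ j :=
    mul_lt_mul hEQ h4 (by positivity) (by positivity)
  rw [pow_add, pow_add] at h3
  linarith

end

/-- The binary recurrence `x_{n+2} = r x_{n+1} - x_n`. -/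
def lin (r x₀ x₁ : ℤ) : ℕ → ℤ
  | 0 => x₀
  | 1 => x₁
  | (n + 2) => r * lin r x₀ x₁ (n + 1) - lin r x₀ x₁ n

lemma lin_shift (r x₀ x₁ : ℤ) : ∀ n, lin r x₀ x₁ (n + 1) = lin r x₁ (r * x₁ - x₀) n
  | 0 => rfl
  | 1 => rfl
  | (n + 2) => by
    rw [lin, lin_shift r x₀ x₁ (n + 1), lin_shift r x₀ x₁ n, lin]

/-- `d` extends the pair `{A, B}`, with square roots `U` and `V`. -/
structure IsExt (A B d U V : ℤ) : Prop where
  left : U ^ 2 = A * d + 4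
  right : V ^ 2 = B * d + 4

lemma even_cross {A B r d U V : ℤ} (hr : r ^ 2 = A * B + 4) (h : IsExt A B d U V) :
    Even (r * U - A * V) ∧ Even (r * V - B * U) ∧ Even (A * B * d - r * U * V) := by
  have h1 : Even r ↔ Even (A * B) := by
    rw [← Int.even_pow' (n := 2) two_ne_zero, hr]; simp [Int.even_add, show Even (4 : ℤ) by decide]
  have h2 : Even U ↔ Even (A * d) := by
    rw [← Int.even_pow' (n := 2) two_ne_zero, h.left]
    simp [Int.even_add, show Even (4 : ℤ) by decide]
  have h3 : Even V ↔ Even (B * d) := by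
    rw [← Int.even_pow' (n := 2) two_ne_zero, h.right]
    simp [Int.even_add, show Even (4 : ℤ) by decide]
  simp only [Int.even_sub, Int.even_mul] at *
  tauto

/-- The downward step on extensions. -/
lemma IsExt.down {A B r d U V : ℤ} (hr : r ^ 2 = A * B + 4) (h : IsExt A B d U V) :
    ∃ d' U' V', IsExt A B d' U' V' ∧ 2 * U' = r * U - A * V ∧ 2 * V' = r * V - B * U ∧
      2 * d' = 2 * (A + B + d) + A * B * d - r * U * V := by
  obtain ⟨⟨u, hu⟩, ⟨v, hv⟩, ⟨w, hw⟩⟩ := even_cross hr h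
  refine ⟨A + B + d + w, u, v, ⟨?_, ?_⟩, by linarith, by linarith, by linarith⟩
  · have : 4 * u ^ 2 = 4 * (A * (A + B + d + w) + 4) := by
      have e1 : 4 * u ^ 2 = (r * U - A * V) ^ 2 := by rw [hu]; ring
      rw [e1]
      linear_combination (2 * A) * hw + U ^ 2 * hr + A ^ 2 * h.right + (A * B + 4) * h.left
    linarith
  · have : 4 * v ^ 2 = 4 * (B * (A + B + d + w) + 4) := by
      have e1 : 4 * v ^ 2 = (r * V - B * U) ^ 2 := by rw [hv]; ring
      rw [e1]
      linear_combination (2 * B) * hw + V ^ 2 * hr + B ^ 2 * h.left + (A * B + 4) * h.right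
    linarith

lemma lin_cross {A B r U₀ V₀ U₁ V₁ : ℤ} (hr : r ^ 2 = A * B + 4) (hU : 2 * U₁ = r * U₀ + A * V₀)
    (hV : 2 * V₁ = r * V₀ + B * U₀) : ∀ n,
    2 * lin r U₀ U₁ (n + 1) = r * lin r U₀ U₁ n + A * lin r V₀ V₁ n ∧
    2 * lin r V₀ V₁ (n + 1) = r * lin r V₀ V₁ n + B * lin r U₀ U₁ n := by
  intro n
  induction n with
  | zero => exact ⟨hU, hV⟩
  | succ n ih =>
    obtain ⟨h1, h2⟩ := ih
    constructor
    · have : 2 * (2 * lin r U₀ U₁ (n + 2)) =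
          2 * (r * lin r U₀ U₁ (n + 1) + A * lin r V₀ V₁ (n + 1)) := by
        rw [lin]
        linear_combination r * h1 - A * h2 + lin r U₀ U₁ n * hr
      linarith
    · have : 2 * (2 * lin r V₀ V₁ (n + 2)) =
          2 * (r * lin r V₀ V₁ (n + 1) + B * lin r U₀ U₁ (n + 1)) := by
        rw [lin]
        linear_combination r * h2 - B * h1 + lin r V₀ V₁ n * hr
      linarith

/-- Every extension arises by upward steps from a bounded one. -/
lemma IsExt.exists_base {A B r : ℤ} (hA : 0 < A) (hAB : A < B) (hr0 : 0 < r)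
    (hr : r ^ 2 = A * B + 4) : ∀ (N : ℕ) {d U V : ℤ}, V.toNat ≤ N → 0 < U → 0 < V →
      IsExt A B d U V →
    ∃ (n : ℕ) (d₀ U₀ V₀ U₁ V₁ : ℤ), IsExt A B d₀ U₀ V₀ ∧ 0 < U₀ ∧ V₀ ≤ 0 ∧
      V₀ ^ 2 < B * (B - A) ∧ 2 * U₁ = r * U₀ + A * V₀ ∧ 2 * V₁ = r * V₀ + B * U₀ ∧
      U = lin r U₀ U₁ (n + 1) ∧ V = lin r V₀ V₁ (n + 1) := by
  have hr2 : 2 ≤ r := by nlinarith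
  intro N
  induction N with
  | zero => intro d U V h1 _ h2 _; omega
  | succ N ih =>
    intro d U V hVN hU hV h
    obtain ⟨d', U', V', h', hU', hV', -⟩ := h.down hr
    have hpell : B * U ^ 2 = A * V ^ 2 + 4 * (B - A) := by
      linear_combination B * h.left - A * h.right
    have hU'0 : 0 < U' := by
      have h1 : (A * V) ^ 2 < (r * U) ^ 2 := by
        have : (r * U) ^ 2 - (A * V) ^ 2 = 4 * U ^ 2 + 4 * A * (B - A) := by
          linear_combination U ^ 2 * hr + A * hpell
        nlinarith [mul_pos hA (sub_pos.mpr hAB)]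
      have := lt_of_pow_lt_pow_left₀ 2 (by positivity) h1
      linarith
    have hVlt : V' < V := by
      have h1 : ((r - 2) * V) ^ 2 < (B * U) ^ 2 := by
        have : (B * U) ^ 2 - ((r - 2) * V) ^ 2 = 4 * B * (B - A) + (4 * r - 8) * V ^ 2 := by
          linear_combination B * hpell - V ^ 2 * hr
        nlinarith [mul_pos (hA.trans hAB) (sub_pos.mpr hAB), mul_nonneg
          (by linarith : 0 ≤ 4 * r - 8) (sq_nonneg V)]
      have := lt_of_pow_lt_pow_left₀ 2 (by nlinarith) h1
      linarith
    -- the up step undoes the down step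
    have hback : r * U' + A * V' = 2 * U := by
      have : 2 * (r * U' + A * V') = 2 * (2 * U) := by
        linear_combination r * hU' + A * hV' + U * hr
      linarith
    have hback2 : r * V' + B * U' = 2 * V := by
      have : 2 * (r * V' + B * U') = 2 * (2 * V) := by
        linear_combination r * hV' + B * hU' + V * hr
      linarith
    rcases le_or_gt V' 0 with hle | hgt
    · refine ⟨0, d', U', V', U, V, h', hU'0, hle, ?_, hback.symm, hback2.symm, rfl, rfl⟩
      have hpell' : B * U' ^ 2 = A * V' ^ 2 + 4 * (B - A) := by
        linear_combination B * h'.left - A * h'.right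
      have h1 : (-(r * V')) ^ 2 < (B * U') ^ 2 :=
        pow_lt_pow_left₀ (by linarith) (by nlinarith) two_ne_zero
      have : (B * U') ^ 2 - (-(r * V')) ^ 2 = 4 * B * (B - A) - 4 * V' ^ 2 := by
        linear_combination B * hpell' - V' ^ 2 * hr
      linarith
    · obtain ⟨n, d₀, U₀, V₀, U₁, V₁, h0, hU0, hV0, hb, hU1, hV1, hUn, hVn⟩ :=
        ih (by omega) hU'0 hgt h'
      refine ⟨n + 1, d₀, U₀, V₀, U₁, V₁, h0, hU0, hV0, hb, hU1, hV1, ?_, ?_⟩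
      · have := (lin_cross hr hU1 hV1 (n + 1)).1
        rw [← hUn, ← hVn] at this
        linarith
      · have := (lin_cross hr hU1 hV1 (n + 1)).2
        rw [← hUn, ← hVn] at this
        linarith

/-- A bounded extension `d₀` of `{A, B}` is `0`, or `A + B - 2r`, or it comes with another bounded
extension `e` such that `{d₀, e}` is a pair and `d₀ + e = A + B - r √(d₀ e + 4)`. -/
lemma IsExt.base_cases {A B r d₀ U₀ V₀ : ℤ} (hA : 0 < A) (hAB : A < B) (hB : 4 < B) (hr0 : 0 < r)
    (hr : r ^ 2 = A * B + 4) (h : IsExt A B d₀ U₀ V₀) (hU : 0 < U₀) (hV : V₀ ≤ 0)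
    (hb : V₀ ^ 2 < B * (B - A)) :
    (U₀ = 2 ∧ V₀ = -2) ∨ (U₀ = r - A ∧ V₀ = r - B) ∨
      ∃ e W : ℤ, 0 < d₀ ∧ 0 < e ∧ 3 ≤ W ∧ d₀ * e = W ^ 2 - 4 ∧ d₀ + e = A + B - r * W ∧
        ∀ U₁ V₁, 2 * U₁ = r * U₀ + A * V₀ → 2 * V₁ = r * V₀ + B * U₀ → IsExt A B e U₁ V₁ := by
  have hB0 : 0 < B := by linarith
  have hd0 : 0 ≤ d₀ := by
    have := h.right
    by_contra! hneg
    nlinarith [sq_nonneg V₀]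
  obtain ⟨e, U', V', h', hU', hV', he⟩ := IsExt.down hr (V := -V₀) (⟨h.left, by
    rw [neg_sq]; exact h.right⟩ : IsExt A B d₀ U₀ (-V₀))
  have hpell : B * U₀ ^ 2 = A * V₀ ^ 2 + 4 * (B - A) := by
    linear_combination B * h.left - A * h.right
  have hV'neg : V' < 0 := by
    have h1 : (-(r * V₀)) ^ 2 < (B * U₀) ^ 2 := by
      have : (B * U₀) ^ 2 - (-(r * V₀)) ^ 2 = 4 * (B * (B - A) - V₀ ^ 2) := by
        linear_combination B * hpell - V₀ ^ 2 * hr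
      linarith
    have := lt_of_pow_lt_pow_left₀ 2 (by positivity) h1
    linarith
  have he0 : 0 ≤ e := by
    have := h'.right
    by_contra! hneg
    nlinarith [sq_nonneg V']
  rcases hd0.eq_or_lt with hz | hd0
  · left
    have h1 := h.left
    have h2 := h.right
    rw [← hz] at h1 h2
    constructor <;> nlinarith
  rcases he0.eq_or_lt with hz | he0
  · right; left
    have h1 := h'.left
    have h2 := h'.right
    rw [← hz] at h1 h2
    have hV2 : V' = -2 := by nlinarith
    have hU1 : 0 < U' := by
      have h3 : (A * V₀) ^ 2 < (r * U₀) ^ 2 := by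
        have : (r * U₀) ^ 2 - (A * V₀) ^ 2 = 4 * U₀ ^ 2 + 4 * A * (B - A) := by
          linear_combination U₀ ^ 2 * hr + A * hpell
        nlinarith [mul_pos hA (sub_pos.mpr hAB)]
      have := abs_lt_of_sq_lt_sq h3 (by positivity)
      rw [abs_lt] at this
      linarith
    have hU2 : U' = 2 := by nlinarith
    subst hV2 hU2
    constructor
    · have : 4 * (U₀ - (r - A)) = 0 := by
        linear_combination (-U₀) * hr - r * hU' - A * hV'
      linarith
    · have : 4 * (V₀ - (r - B)) = 0 := by
        linear_combination (-V₀) * hr + r * hV' + B * hU'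
      linarith
  · right; right
    have hdB : d₀ < B := by
      have := h.right
      by_contra! hge
      nlinarith
    obtain ⟨w, hw⟩ : Even (-(U₀ * V₀) - d₀ * r) := by
      obtain ⟨h1, h2, h3⟩ := even_cross (r := U₀) (A := A) (B := d₀) (d := B) (U := r) (V := V₀)
        (by linarith [h.left]) ⟨by linarith, by linarith [h.right]⟩
      have : -(U₀ * V₀) - d₀ * r = (U₀ * V₀ - d₀ * r) + 2 * (-(U₀ * V₀)) := by ring
      rw [this]
      exact h2.add (even_two_mul _)
    have hWsum : d₀ + e = A + B - r * w := by
      have : 2 * (d₀ + e) = 2 * (A + B - r * w) := by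
        linear_combination he - r * hw - d₀ * hr
      linarith
    have hwpos : 0 < w := by
      have h1 : (d₀ * r) ^ 2 < (-(U₀ * V₀)) ^ 2 := by
        have : (-(U₀ * V₀)) ^ 2 - (d₀ * r) ^ 2 = 4 * d₀ * (A + B - d₀) + 16 := by
          linear_combination V₀ ^ 2 * h.left + (A * d₀ + 4) * h.right - d₀ ^ 2 * hr
        nlinarith [mul_pos hd0 (by linarith : 0 < A + B - d₀)]
      have hUV := mul_nonneg hU.le (neg_nonneg.mpr hV)
      have := lt_of_pow_lt_pow_left₀ 2 (by linarith) h1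
      linarith
    have hWprod : d₀ * e = w ^ 2 - 4 := by
      have e1 : 4 * w ^ 2 = (-(U₀ * V₀) - d₀ * r) ^ 2 := by rw [hw]; ring
      have : 4 * (d₀ * e) = 4 * (w ^ 2 - 4) := by
        have e2 : 4 * (w ^ 2 - 4) = (-(U₀ * V₀) - d₀ * r) ^ 2 - 16 := by linarith
        rw [e2]
        linear_combination 2 * d₀ * he - V₀ ^ 2 * h.left - (A * d₀ + 4) * h.right - d₀ ^ 2 * hr
      linarith
    refine ⟨e, w, hd0, he0, ?_, hWprod, hWsum, fun U₁ V₁ hU₁ hV₁ => ?_⟩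
    swap
    · have e1 : U₁ = U' := by linarith
      have e2 : V₁ = -V' := by linarith
      rw [e1, e2]
      exact ⟨h'.left, by rw [neg_sq]; exact h'.right⟩
    have hpos := mul_pos hd0 he0
    rw [hWprod] at hpos
    by_contra! hlt
    interval_cases w <;> norm_num at hpos

/-- The possible ratios `b / a` and the classification of the extensions of `{a, ka}`. -/
lemma ext_classification {k a r d U V : ℤ} (hk : k = 7 ∨ k = 8 ∨ k = 10 ∨ k = 11 ∨ k = 12 ∨ k = 13)
    (ha : 0 < a) (hr0 : 0 < r) (hr : r ^ 2 = a * (k * a) + 4) (hU : 0 < U) (hV : 0 < V)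
    (h : IsExt a (k * a) d U V) :
    (∃ n, U = lin r 2 (r - a) n) ∨ (∃ n, U = lin r 2 (r + a) n) ∨
    (k = 8 ∧ a = 12 ∧ ((∃ n, U = lin 34 4 8 n) ∨ ∃ n, U = lin 34 8 4 n)) ∨
    (k = 7 ∧ a = 96 ∧ ((∃ n, U = lin 254 10 22 n) ∨ ∃ n, U = lin 254 22 10 n)) := by
  have hk7 : 7 ≤ k := by omega
  have hk13 : k ≤ 13 := by omega
  obtain ⟨n, d₀, U₀, V₀, U₁, V₁, h0, hU0, hV0, hb, hU1, -, hUn, -⟩ :=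
    IsExt.exists_base ha (by nlinarith) hr0 hr V.toNat le_rfl hU hV h
  rcases h0.base_cases ha (by nlinarith) (by nlinarith) hr0 hr hU0 hV0 hb with
    ⟨rfl, rfl⟩ | ⟨rfl, rfl⟩ | ⟨e, W, hd0, he0, hW, hprod, hsum, -⟩
  · left
    exact ⟨n + 1, by rw [hUn]; congr 1; linarith⟩
  · right; left
    refine ⟨n, ?_⟩
    have : U₁ = 2 := by nlinarith
    rw [hUn, lin_shift, this]; congr 1; ring
  · right; right
    have hW4 : W < 4 := by
      by_contra! hge
      have h1 : r * 4 < (k + 1) * a := by nlinarith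
      have h2 : (r * 4) ^ 2 < ((k + 1) * a) ^ 2 := pow_lt_pow_left₀ h1 (by positivity) two_ne_zero
      have h3 : (k + 1) ^ 2 ≤ 16 * k := by nlinarith
      nlinarith [mul_le_mul_of_nonneg_right h3 (sq_nonneg a)]
    have hW3 : W = 3 := by omega
    subst hW3
    have hde : d₀ = 1 ∧ e = 5 ∨ d₀ = 5 ∧ e = 1 := by
      have h5 : d₀ * e = 5 := by linarith
      have hle : d₀ ≤ 5 := by nlinarith
      interval_cases d₀ <;> omega
    have hs6 : d₀ + e = 6 := by rcases hde with ⟨rfl, rfl⟩ | ⟨rfl, rfl⟩ <;> norm_num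
    have hr3 : r * 3 = (k + 1) * a - 6 := by linarith
    have hlin : ((k + 1) ^ 2 - 9 * k) * a = 12 * (k + 1) := by
      have : a * (((k + 1) ^ 2 - 9 * k) * a - 12 * (k + 1)) = 0 := by
        linear_combination 9 * hr - (r * 3 + ((k + 1) * a - 6)) * hr3
      rcases mul_eq_zero.mp this with h | h <;> linarith
    rcases hk with rfl | rfl | rfl | rfl | rfl | rfl
    · right
      have ha96 : a = 96 := by omega
      subst ha96
      have hr254 : r = 254 := by omega
      subst hr254
      refine ⟨rfl, rfl, ?_⟩
      have hl := h0.left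
      have hrr := h0.right
      rcases hde with ⟨rfl, rfl⟩ | ⟨rfl, rfl⟩
      · have : U₀ = 10 := by nlinarith
        have : V₀ = -26 := by nlinarith
        subst U₀ V₀
        left; exact ⟨n + 1, by rw [hUn]; congr 1; omega⟩
      · have : U₀ = 22 := by nlinarith
        have : V₀ = -58 := by nlinarith
        subst U₀ V₀
        right; exact ⟨n + 1, by rw [hUn]; congr 1; omega⟩
    · left
      have ha12 : a = 12 := by omega
      subst ha12
      have hr34 : r = 34 := by omega
      subst hr34
      refine ⟨rfl, rfl, ?_⟩
      have hl := h0.left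
      have hrr := h0.right
      rcases hde with ⟨rfl, rfl⟩ | ⟨rfl, rfl⟩
      · have : U₀ = 4 := by nlinarith
        have : V₀ = -10 := by nlinarith
        subst U₀ V₀
        left; exact ⟨n + 1, by rw [hUn]; congr 1; omega⟩
      · have : U₀ = 8 := by nlinarith
        have : V₀ = -22 := by nlinarith
        subst U₀ V₀
        right; exact ⟨n + 1, by rw [hUn]; congr 1; omega⟩
    all_goals omega

lemma lin_two_mul (r x₀ x₁ : ℤ) : ∀ i,
    lin r x₀ x₁ (2 * i) = lin (r ^ 2 - 2) x₀ (r * x₁ - x₀) i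
  | 0 => rfl
  | 1 => rfl
  | (i + 2) => by
    rw [lin, ← lin_two_mul r x₀ x₁ i, ← lin_two_mul r x₀ x₁ (i + 1)]
    rw [show 2 * (i + 2) = 2 * i + 2 + 2 by ring, show 2 * (i + 1) = 2 * i + 2 by ring]
    rw [lin, show 2 * i + 2 + 1 = 2 * i + 1 + 2 by ring, lin, lin]; ring

/-- Growth of a binary recurrence. -/
lemma lin_growth {R x₀ x₁ : ℤ} (hR : 3 ≤ R) (h : |x₀| ≤ x₁) (hx : 0 < x₁) : ∀ n,
    |lin R x₀ x₁ n| ≤ lin R x₀ x₁ (n + 1) ∧ 0 < lin R x₀ x₁ (n + 1) ∧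
    (R - 1) ^ n * x₁ ≤ lin R x₀ x₁ (n + 1) ∧ lin R x₀ x₁ (n + 1) ≤ (R + 1) ^ n * x₁ := by
  intro n
  induction n with
  | zero => exact ⟨h, hx, by simp [lin], by simp [lin]⟩
  | succ n ih =>
    obtain ⟨h1, h2, h3, h4⟩ := ih
    have e : lin R x₀ x₁ (n + 1 + 1) = R * lin R x₀ x₁ (n + 1) - lin R x₀ x₁ n := rfl
    rw [e]
    obtain ⟨h5, h6⟩ := abs_le.mp h1
    rw [abs_of_pos h2]
    set y := lin R x₀ x₁ (n + 1)
    set z := lin R x₀ x₁ n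
    have h7 : (R - 1) * y ≤ R * y - z := by linarith
    have h8 : R * y - z ≤ (R + 1) * y := by linarith
    have h9 : 2 * y ≤ (R - 1) * y := by nlinarith
    refine ⟨by linarith, by linarith, ?_, ?_⟩
    · calc (R - 1) ^ (n + 1) * x₁ = (R - 1) * ((R - 1) ^ n * x₁) := by ring
        _ ≤ (R - 1) * y := by gcongr; linarith
        _ ≤ _ := h7
    · calc R * y - z ≤ (R + 1) * y := h8
        _ ≤ (R + 1) * ((R + 1) ^ n * x₁) := by gcongr
        _ = _ := by ring

/-- The representation of an extension of `{A, B}` in double steps from a root `ζ` of absolute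
value below `B / 2`, or equal to `±(B - r)`. -/
lemma IsExt.double_rep {A B r d U V : ℤ} (hA : 0 < A) (hAB : 100 * A ≤ B) (hB : 100 ≤ B)
    (hr0 : 0 < r) (hr : r ^ 2 = A * B + 4) (hU : 0 < U) (hV : 0 < V) (h : IsExt A B d U V) :
    ∃ (i : ℕ) (e u ζ Z : ℤ), IsExt A B e u ζ ∧ 0 < u ∧ 2 * Z = 2 * ζ + B * (r * u + A * ζ) ∧
      V = lin (A * B + 2) ζ Z i ∧ |ζ| ≤ Z ∧ 0 < Z ∧
      (2 * |ζ| < B ∨ u = r - A ∧ (ζ = B - r ∨ ζ = -(B - r))) := by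
  have hr3 : 3 ≤ r := by nlinarith
  obtain ⟨n, d₀, U₀, V₀, U₁, V₁, h0, hU0, hV0, hb, hU1, hV1, hUn, hVn⟩ :=
    IsExt.exists_base hA (by linarith) hr0 hr V.toNat le_rfl hU hV h
  have hB0 : 0 < B := by linarith
  have hpell : B * U₀ ^ 2 = A * V₀ ^ 2 + 4 * (B - A) := by
    linear_combination B * h0.left - A * h0.right
  have hV1pos : 0 < V₁ := by
    have h1 : (-(r * V₀)) ^ 2 < (B * U₀) ^ 2 := by
      have : (B * U₀) ^ 2 - (-(r * V₀)) ^ 2 = 4 * (B * (B - A) - V₀ ^ 2) := by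
        linear_combination B * hpell - V₀ ^ 2 * hr
      linarith
    have := lt_of_pow_lt_pow_left₀ 2 (by positivity) h1
    linarith
  have hU1pos : 0 < U₁ := by
    have h3 : (A * V₀) ^ 2 < (r * U₀) ^ 2 := by
      have : (r * U₀) ^ 2 - (A * V₀) ^ 2 = 4 * U₀ ^ 2 + 4 * A * (B - A) := by
        linear_combination U₀ ^ 2 * hr + A * hpell
      have h4 := mul_pos hA (by linarith : 0 < B - A)
      have h5 := pow_pos hU0 2
      linarith
    have := abs_lt_of_sq_lt_sq h3 (by positivity)
    rw [abs_lt] at this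
    linarith
  set V₂ := r * V₁ - V₀ with hV2
  have hV2ge : V₁ ≤ V₂ := by nlinarith
  have hV2ge' : |V₀| ≤ V₂ := by rw [abs_of_nonpos hV0]; nlinarith
  set V₃ := r * V₂ - V₁ with hV3
  have hV3ge : V₁ ≤ V₃ := by nlinarith
  have hZ0 : 2 * V₂ = 2 * V₀ + B * (r * U₀ + A * V₀) := by
    linear_combination 2 * hV2 + r * hV1 + V₀ * hr
  have hZ1 : 2 * V₃ = 2 * V₁ + B * (r * U₁ + A * V₁) := by
    have e1 : 2 * V₂ = r * V₁ + B * U₁ := by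
      have : 2 * (2 * V₂) = 2 * (r * V₁ + B * U₁) := by
        linear_combination 4 * hV2 + r * hV1 - B * hU1 + V₀ * hr
      linarith
    linear_combination 2 * hV3 + r * e1 + V₁ * hr
  have hext1 : ∃ e, IsExt A B e U₁ V₁ := by
    obtain ⟨e, U', V', h', hU', hV', -⟩ := IsExt.down hr (V := -V₀) (⟨h0.left, by
      rw [neg_sq]; exact h0.right⟩ : IsExt A B d₀ U₀ (-V₀))
    have e1 : U₁ = U' := by linarith
    have e2 : V₁ = -V' := by linarith
    exact ⟨e, by rw [e1, e2]; exact ⟨h'.left, by rw [neg_sq]; exact h'.right⟩⟩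
  obtain ⟨e₁, he₁⟩ := hext1
  have hrB : 2 * 2 < B := by linarith
  -- small roots in the third case
  have hsmall : ∀ {x y u ζ W : ℤ}, 0 < x → 0 < y → x * y = W ^ 2 - 4 → 0 < W →
      x + y = A + B - r * W → IsExt A B x u ζ → (∃ w, w ^ 2 = A * y + 4) → 2 * |ζ| < B := by
    intro x y u ζ W hx hy hxy hW hsum hxe hye
    obtain ⟨w, hw⟩ := hye
    have hAy : 5 ≤ A * y := by
      have h1 : 0 < A * y := mul_pos hA hy
      have h2 : 3 ≤ |w| := by
        by_contra! hlt
        have : w ^ 2 ≤ 2 ^ 2 := by rw [← sq_abs]; gcongr; omega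
        linarith
      have : 3 ^ 2 ≤ |w| ^ 2 := by gcongr
      rw [sq_abs] at this
      linarith
    have hrW : (r * W) ^ 2 ≤ (A + B) ^ 2 := by
      apply pow_le_pow_left₀ (by positivity); linarith
    have h1 : A * B * (x * y) ≤ (A + B) ^ 2 := by
      have : (r * W) ^ 2 = A * B * (x * y) + 4 * (A * B) + 4 * W ^ 2 := by
        linear_combination W ^ 2 * hr - A * B * hxy
      nlinarith [mul_pos hA hB0, sq_nonneg W]
    have h2 : 5 * (B * x) ≤ (A + B) ^ 2 := by
      calc 5 * (B * x) ≤ (A * y) * (B * x) := by gcongr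
        _ = A * B * (x * y) := by ring
        _ ≤ _ := h1
    have h3 : (100 * (A + B)) ^ 2 ≤ (101 * B) ^ 2 := by
      apply pow_le_pow_left₀ (by positivity); linarith
    have h4 : (2 * |ζ|) ^ 2 < B ^ 2 := by
      rw [mul_pow, sq_abs, hxe.right]; nlinarith
    exact lt_of_pow_lt_pow_left₀ 2 hB0.le h4
  have hcases := h0.base_cases hA (by linarith) (by linarith) hr0 hr hU0 hV0 hb
  rcases Nat.even_or_odd' (n + 1) with ⟨i, hi | hi⟩
  · refine ⟨i, d₀, U₀, V₀, V₂, h0, hU0, hZ0, ?_, hV2ge', by linarith, ?_⟩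
    · rw [hVn, hi, lin_two_mul, hr]; congr 1; ring
    · rcases hcases with ⟨h1, h2⟩ | ⟨h1, h2⟩ | ⟨e, W, hd0, he0, hW, hprod, hsum, hx⟩
      · left; rw [h2]; simpa using hrB
      · right; exact ⟨h1, Or.inr (by rw [h2]; ring)⟩
      · left
        exact hsmall hd0 he0 hprod (by linarith) hsum h0 ⟨U₁, (hx U₁ V₁ hU1 hV1).left⟩
  · refine ⟨i, e₁, U₁, V₁, V₃, he₁, hU1pos, hZ1, ?_, ?_, by linarith, ?_⟩
    · rw [hVn, hi, lin_shift, lin_two_mul, hr]; congr 1; ring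
    · rw [abs_of_pos hV1pos]; exact hV3ge
    · rcases hcases with ⟨h1, h2⟩ | ⟨h1, h2⟩ | ⟨e, W, hd0, he0, hW, hprod, hsum, hx⟩
      · right
        subst h1 h2
        exact ⟨by linarith, Or.inl (by linarith)⟩
      · left
        have : V₁ = 2 := by
          subst h1 h2
          have : 2 * V₁ = 2 * 2 := by linear_combination hV1 + hr
          linarith
        rw [this]; simpa using hrB
      · left
        exact hsmall he0 hd0 (by linarith) (by linarith) (by linarith) (hx U₁ V₁ hU1 hV1)
          ⟨U₀, h0.left⟩

lemma dvd_lin_sub {c R x₀ x₁ : ℤ} (hR : c ∣ R - 2) (h : c ∣ x₁ - x₀) : ∀ n,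
    c ∣ lin R x₀ x₁ n - x₀ ∧ c ∣ lin R x₀ x₁ (n + 1) - x₀ := by
  intro n
  induction n with
  | zero => exact ⟨by simp [lin], h⟩
  | succ n ih =>
    refine ⟨ih.2, ?_⟩
    have e : lin R x₀ x₁ (n + 1 + 1) - x₀ = (R - 2) * lin R x₀ x₁ (n + 1) +
        2 * (lin R x₀ x₁ (n + 1) - x₀) - (lin R x₀ x₁ n - x₀) := by rw [lin]; ring
    rw [e]
    exact dvd_sub (dvd_add (hR.mul_right _) (ih.2.mul_left _)) ih.1

/-- Size comparison of two recurrences with multipliers `p + 2` and `k p + 2`. -/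
lemma lin_compare_of_le {k p ζ A ζ' B : ℤ} {i j : ℕ} (hk : 7 ≤ k) (hk' : k ≤ 13) (hp : 1 ≤ p)
    (hζ : |ζ| ≤ A) (hA : 0 < A) (hζ' : |ζ'| ≤ B) (hB : 0 < B) (hj : j ≤ 3)
    (h : lin (p + 2) ζ A (i + 1) = lin (k * p + 2) ζ' B (j + 1))
    (h1 : A ≤ B) (h2 : 2744 * B < A * (p + 1)) : A = B ∧ lin (p + 2) ζ A (i + 1) = A := by
  have hkp : 7 * p ≤ k * p := by gcongr
  have hkp' : k * p ≤ 13 * p := by gcongr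
  obtain ⟨-, -, gA, gA'⟩ := lin_growth (by linarith : 3 ≤ p + 2) hζ hA i
  obtain ⟨-, -, gB, gB'⟩ := lin_growth (by linarith : 3 ≤ k * p + 2) hζ' hB j
  rw [← h] at gB gB'
  rcases le_or_gt i j with hij | hij
  · rcases Nat.eq_zero_or_pos j with hj0 | hj0
    · obtain rfl : i = 0 := by omega
      subst hj0
      simp [lin] at h ⊢
      exact h
    · exfalso
      have h3 : (p + 2 + 1) ^ i ≤ (p + 2 + 1) ^ j := pow_le_pow_right₀ (by linarith) hij
      have h4 : (p + 2 + 1) ^ j < (k * p + 2 - 1) ^ j :=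
        pow_lt_pow_left₀ (by linarith) (by linarith) (by omega)
      have h5 : (k * p + 2 - 1) ^ j * B ≤ (p + 2 + 1) ^ j * B := by
        calc _ ≤ _ := gB
          _ ≤ _ := gA'
          _ ≤ (p + 2 + 1) ^ j * B := by gcongr
      exact absurd (lt_of_mul_lt_mul_right (h5.trans_lt (mul_lt_mul_of_pos_right h4 hB)) hB.le)
        (lt_irrefl _)
  · exfalso
    have h3 : (p + 2 - 1) ^ (j + 1) ≤ (p + 2 - 1) ^ i := pow_le_pow_right₀ (by linarith) hij
    have h4 : (k * p + 2 + 1) ^ j ≤ 2744 * (p + 2 - 1) ^ j := by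
      calc (k * p + 2 + 1) ^ j ≤ (14 * (p + 2 - 1)) ^ j := by
            apply pow_le_pow_left₀ <;> linarith
        _ = 14 ^ j * (p + 2 - 1) ^ j := mul_pow _ _ _
        _ ≤ 14 ^ 3 * (p + 2 - 1) ^ j := by
            have : (0 : ℤ) ≤ (p + 2 - 1) ^ j := pow_nonneg (by linarith) _
            gcongr; norm_num
        _ = _ := by norm_num
    have hpos : 0 < (p + 2 - 1) ^ j := pow_pos (by linarith) _
    have h5 : (p + 2 - 1) ^ j * (A * (p + 1)) ≤ (p + 2 - 1) ^ j * (2744 * B) := by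
      calc (p + 2 - 1) ^ j * (A * (p + 1)) = (p + 2 - 1) ^ (j + 1) * A := by ring
        _ ≤ (p + 2 - 1) ^ i * A := by gcongr
        _ ≤ _ := gA
        _ ≤ _ := gB'
        _ ≤ 2744 * (p + 2 - 1) ^ j * B := by gcongr
        _ = _ := by ring
    exact absurd (le_of_mul_le_mul_left h5 hpos) (not_le.mpr h2)

lemma lin_compare_of_lt {k p ζ A ζ' B : ℤ} {i j : ℕ} (hk : 7 ≤ k) (hk' : k ≤ 13) (hp : 1 ≤ p)
    (hζ : |ζ| ≤ A) (hA : 0 < A) (hζ' : |ζ'| ≤ B) (hB : 0 < B) (hj : j ≤ 3)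
    (h : lin (p + 2) ζ A (i + 1) = lin (k * p + 2) ζ' B (j + 1))
    (h1 : 2744 * B < A) (h2 : A < B * (k * p + 1)) : False := by
  have hkp : 7 * p ≤ k * p := by gcongr
  have hkp' : k * p ≤ 13 * p := by gcongr
  obtain ⟨-, -, gA, gA'⟩ := lin_growth (by linarith : 3 ≤ p + 2) hζ hA i
  obtain ⟨-, -, gB, gB'⟩ := lin_growth (by linarith : 3 ≤ k * p + 2) hζ' hB j
  rw [← h] at gB gB'
  rcases le_or_gt j i with hij | hij
  · have h3 : (p + 2 - 1) ^ j ≤ (p + 2 - 1) ^ i := pow_le_pow_right₀ (by linarith) hij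
    have h4 : (k * p + 2 + 1) ^ j ≤ 2744 * (p + 2 - 1) ^ j := by
      calc (k * p + 2 + 1) ^ j ≤ (14 * (p + 2 - 1)) ^ j := by
            apply pow_le_pow_left₀ <;> linarith
        _ = 14 ^ j * (p + 2 - 1) ^ j := mul_pow _ _ _
        _ ≤ 14 ^ 3 * (p + 2 - 1) ^ j := by
            have : (0 : ℤ) ≤ (p + 2 - 1) ^ j := pow_nonneg (by linarith) _
            gcongr; norm_num
        _ = _ := by norm_num
    have hpos : 0 < (p + 2 - 1) ^ j := pow_pos (by linarith) _
    have h5 : (p + 2 - 1) ^ j * A ≤ (p + 2 - 1) ^ j * (2744 * B) := by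
      calc (p + 2 - 1) ^ j * A ≤ (p + 2 - 1) ^ i * A := by gcongr
        _ ≤ _ := gA
        _ ≤ _ := gB'
        _ ≤ 2744 * (p + 2 - 1) ^ j * B := by gcongr
        _ = _ := by ring
    exact absurd (le_of_mul_le_mul_left h5 hpos) (not_le.mpr h1)
  · have hpos : 0 < (p + 2 + 1) ^ i := pow_pos (by linarith) _
    have h3 : (k * p + 2 - 1) ^ (i + 1) ≤ (k * p + 2 - 1) ^ j :=
      pow_le_pow_right₀ (by linarith) hij
    have h4 : (p + 2 + 1) ^ i ≤ (k * p + 2 - 1) ^ i := pow_le_pow_left₀ (by linarith) (by linarith) _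
    have h5 : (p + 2 + 1) ^ i * (B * (k * p + 1)) ≤ (p + 2 + 1) ^ i * A := by
      have : 0 < B * (k * p + 1) := by apply mul_pos hB; linarith
      calc (p + 2 + 1) ^ i * (B * (k * p + 1)) ≤ (k * p + 2 - 1) ^ i * (B * (k * p + 1)) := by
            gcongr
        _ = (k * p + 2 - 1) ^ (i + 1) * B := by ring
        _ ≤ (k * p + 2 - 1) ^ j * B := by gcongr
        _ ≤ _ := gB
        _ ≤ _ := gA'
    exact absurd (le_of_mul_le_mul_left h5 hpos) (not_le.mpr h2)


/-- The quadruple `{a, b, c, d}` is regular. -/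
def Reg (a b c d : ℤ) : Prop := (a + b - c - d) ^ 2 = (a * b + 4) * (c * d + 4)

lemma eq_of_sq {x y : ℤ} (hx : 0 ≤ x) (hy : 0 ≤ y) (h : x ^ 2 = y ^ 2) : x = y :=
  (pow_left_inj₀ hx hy two_ne_zero).mp h

lemma le_of_sq_le {x y : ℤ} (hy : 0 ≤ y) (h : x ^ 2 ≤ y ^ 2) : x ≤ y := by
  by_contra! hlt
  exact absurd h (not_le.mpr (pow_lt_pow_left₀ hlt hy two_ne_zero))

/-- Bounds for the cofactor `tr - bs`. -/
lemma cross_bounds {a b c r s t : ℤ} (ha : 0 < a) (hb : 0 < b) (hab : 7 ≤ a * b)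
    (hr0 : 0 < r) (hs0 : 0 < s) (ht0 : 0 < t)
    (hr : r ^ 2 = a * b + 4) (hs : s ^ 2 = a * c + 4) (ht : t ^ 2 = b * c + 4)
    (hc : 4 * a + 16 ≤ c) (hc' : 4 * b ≤ c) :
    c ≤ (t * r - b * s) * s ∧ (t * r - b * s) * s ≤ 3 * c ∧ 0 < t * r - b * s ∧
      t * r - b * s ≤ b * s := by
  set D := t * r - b * s with hD
  have key : D * (t * r + b * s) = 4 * (b * c) + 4 * (a * b) + 16 - 4 * b ^ 2 := by
    rw [hD]; linear_combination r ^ 2 * ht - b ^ 2 * hs + (b * c + 4) * hr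
  have hbs : 0 < b * s := by positivity
  have hrhs : 0 < 4 * (b * c) + 4 * (a * b) + 16 - 4 * b ^ 2 := by nlinarith
  have hD0 : 0 < D := by
    by_contra! hle
    have : 0 < t * r + b * s := by positivity
    nlinarith
  have hup : D * s ≤ 3 * c := by
    have h1 : D * (2 * (b * s)) ≤ D * (t * r + b * s) := by
      apply mul_le_mul_of_nonneg_left _ hD0.le; linarith
    have h2 : b * (2 * (D * s)) ≤ b * (6 * c) := by
      have : 4 * (a * b) + 16 ≤ 2 * (b * c) := by nlinarith
      nlinarith
    have := le_of_mul_le_mul_left h2 hb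
    linarith
  have hDle : D ≤ b * s := by
    have h1 : 7 * c ≤ a * b * c := by
      apply mul_le_mul_of_nonneg_right hab; linarith
    have h2 : b * s * s = a * b * c + 4 * b := by linear_combination b * hs
    have h3 : D * s ≤ b * s * s := by linarith
    exact le_of_mul_le_mul_right h3 hs0
  refine ⟨?_, hup, hD0, hDle⟩
  have h1 : D * (t * r + b * s) ≤ D * (3 * (b * s)) := by
    apply mul_le_mul_of_nonneg_left _ hD0.le; linarith
  have h2 : b * (3 * c) ≤ b * (3 * (D * s)) := by nlinarith
  have := le_of_mul_le_mul_left h2 hb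
  linarith

set_option maxHeartbeats 4000000 in
/-- If `c` is much larger than `a` and `ka`, an extension `d > c` of `{a, ka, c}` is regular or
very large. -/
theorem reg_or_large {k a c r s t d X Y Z : ℤ} (hk : 7 ≤ k) (hk' : k ≤ 13) (ha : 0 < a)
    (hc : 10 ^ 13 * a ≤ c) (hr0 : 0 < r) (hs0 : 0 < s) (ht0 : 0 < t)
    (hr : r ^ 2 = a * (k * a) + 4) (hs : s ^ 2 = a * c + 4) (ht : t ^ 2 = k * a * c + 4)
    (hX0 : 0 < X) (hY0 : 0 < Y) (hZ0 : 0 < Z) (hX : X ^ 2 = a * d + 4)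
    (hY : Y ^ 2 = k * a * d + 4) (hZ : Z ^ 2 = c * d + 4) (hcd : c < d)
    (ih : ∀ e u y z : ℤ, 0 < e → e < c → u ^ 2 = a * e + 4 → y ^ 2 = k * a * e + 4 →
      z ^ 2 = c * e + 4 → Reg a (k * a) e c) :
    Reg a (k * a) c d ∨ c * (k * a * c + 1) ^ 4 ≤ 2 * Z := by
  obtain ⟨b, hb⟩ : ∃ b, b = k * a := ⟨_, rfl⟩
  have hb7 : 7 * a ≤ b := by rw [hb]; gcongr
  have hb13 : b ≤ 13 * a := by rw [hb]; gcongr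
  have hb0 : 0 < b := by linarith
  rw [← hb] at hr ht hY ih ⊢
  have hc0 : 10 ^ 13 ≤ c := by linarith
  have hp0 : 10 ^ 13 ≤ a * c := by clear * - ha hc0; nlinarith
  have hab : 7 ≤ a * b := by clear * - ha hb7; nlinarith
  have hbc : b * c = k * (a * c) := by rw [hb]; ring
  have hbc7 : 7 * (a * c) ≤ b * c := by rw [hbc]; gcongr
  have hbc13 : b * c ≤ 13 * (a * c) := by rw [hbc]; gcongr
  have hac : 10 ^ 13 * (a * c) ≤ c * c := by
    calc 10 ^ 13 * (a * c) = 10 ^ 13 * a * c := by ring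
      _ ≤ c * c := by gcongr
  have haa : 10 ^ 13 * (a * a) ≤ a * c := by
    calc 10 ^ 13 * (a * a) = a * (10 ^ 13 * a) := by ring
      _ ≤ a * c := by gcongr
  have hbb : 4 * (b * b) ≤ b * c := by
    calc 4 * (b * b) = b * (4 * b) := by ring
      _ ≤ b * c := by gcongr; linarith
  have hcc : 10 ^ 13 * 10 ^ 13 ≤ c * c := by gcongr
  have hs' : s * 10 ^ 6 ≤ c := by
    apply le_of_sq_le (by linarith)
    rw [mul_pow, hs, sq c]; linarith
  have ht' : t * (5 * 10 ^ 5) ≤ c := by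
    apply le_of_sq_le (by linarith)
    rw [mul_pow, ht, sq c]; linarith
  have hsbig : 10 ^ 6 ≤ s := by
    apply le_of_sq_le hs0.le; rw [hs]; linarith
  have htbig : 10 ^ 6 ≤ t := by
    apply le_of_sq_le ht0.le; rw [ht]; linarith
  have hts : t ≤ 4 * s := by
    apply le_of_sq_le (by linarith); rw [mul_pow, hs, ht]; linarith
  have hst : s < t := by
    apply lt_of_pow_lt_pow_left₀ 2 ht0.le; rw [hs, ht]; linarith
  have hsa : 2 * a ≤ s := by
    apply le_of_sq_le hs0.le; rw [hs, mul_pow, sq a]; linarith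
  have htb : 2 * b ≤ t := by
    apply le_of_sq_le ht0.le; rw [ht, mul_pow, sq b]; linarith
  obtain ⟨i, e₁, u, ζ, A, hE₁, hu0, hA2, hZi, hζA, hA0, hζ⟩ := IsExt.double_rep ha
    (by linarith) (by linarith) hs0 hs hX0 hZ0 ⟨hX, hZ⟩
  obtain ⟨j, e₂, y, ξ, B, hE₂, hy0, hB2, hZj, hξB, hB0, hξ⟩ := IsExt.double_rep hb0
    (by linarith) (by linarith) ht0 ht hY0 hZ0 ⟨hY, hZ⟩
  have hZc : c < Z := by
    apply lt_of_pow_lt_pow_left₀ 2 hZ0.le; rw [hZ]; clear * - hcd hc0; nlinarith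
  have hsmallζ : |ζ| < c := by
    rcases hζ with h | ⟨-, rfl | rfl⟩
    · have := abs_nonneg ζ; linarith
    · rw [abs_lt]; constructor <;> linarith
    · rw [abs_lt]; constructor <;> linarith
  have hsmallξ : |ξ| < c := by
    rcases hξ with h | ⟨-, rfl | rfl⟩
    · have := abs_nonneg ξ; linarith
    · rw [abs_lt]; constructor <;> linarith
    · rw [abs_lt]; constructor <;> linarith
  obtain ⟨i, rfl⟩ : ∃ i', i = i' + 1 := by
    refine ⟨i - 1, ?_⟩
    rcases Nat.eq_zero_or_pos i with h0 | h0
    · subst h0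
      have : Z = ζ := hZi
      have := le_abs_self ζ
      linarith
    · omega
  obtain ⟨j, rfl⟩ : ∃ j', j = j' + 1 := by
    refine ⟨j - 1, ?_⟩
    rcases Nat.eq_zero_or_pos j with h0 | h0
    · subst h0
      have : Z = ξ := hZj
      have := le_abs_self ξ
      linarith
    · omega
  obtain ⟨α, hα⟩ : Even (s * u + a * ζ) := by
    have := (even_cross hs hE₁).1
    have e : s * u + a * ζ = s * u - a * ζ + 2 * (a * ζ) := by ring
    rw [e]; exact this.add (even_two_mul _)
  obtain ⟨β, hβ⟩ : Even (t * y + b * ξ) := by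
    have := (even_cross ht hE₂).1
    have e : t * y + b * ξ = t * y - b * ξ + 2 * (b * ξ) := by ring
    rw [e]; exact this.add (even_two_mul _)
  have hAα : A = ζ + c * α := by
    have : 2 * A = 2 * (ζ + c * α) := by linear_combination hA2 + c * hα
    linarith
  have hBβ : B = ξ + c * β := by
    have : 2 * B = 2 * (ξ + c * β) := by linear_combination hB2 + c * hβ
    linarith
  have hcong : c ∣ ζ - ξ := by
    have h1 := (dvd_lin_sub (c := c) (R := a * c + 2) (x₀ := ζ) (x₁ := A)
      ⟨a, by ring⟩ ⟨α, by linarith⟩ (i + 1)).1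
    have h2 := (dvd_lin_sub (c := c) (R := b * c + 2) (x₀ := ξ) (x₁ := B)
      ⟨b, by ring⟩ ⟨β, by linarith⟩ (j + 1)).1
    rw [← hZi] at h1
    rw [← hZj] at h2
    have := dvd_sub h2 h1
    have e : Z - ξ - (Z - ζ) = ζ - ξ := by ring
    rwa [e] at this
  have heq : lin (a * c + 2) ζ A (i + 1) = lin (k * (a * c) + 2) ξ B (j + 1) := by
    rw [← hZi, ← hbc]; exact hZj
  rcases le_or_gt 4 j with hj | hj
  · right
    obtain ⟨-, -, g, -⟩ := lin_growth (by linarith : 3 ≤ b * c + 2) hξB hB0 j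
    rw [← hZj] at g
    have hβ1 : 1 ≤ β := by
      by_contra! hlt
      have : β ≤ 0 := by linarith
      have h3 : (0:ℤ) < t * y + b * ξ := by
        have h4 : (b * ξ) ^ 2 < (t * y) ^ 2 := by
          have h5 : (t * y) ^ 2 - (b * ξ) ^ 2 = 4 * (y ^ 2) + 4 * b * (c - b) := by
            linear_combination y ^ 2 * ht - b ^ 2 * hE₂.right + b * c * hE₂.left
          have h6 : 0 < b * (c - b) := mul_pos hb0 (by linarith)
          linarith [sq_nonneg y]
        have := abs_lt_of_sq_lt_sq h4 (by positivity)
        rw [abs_lt] at this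
        linarith
      linarith
    have hBc : c ≤ 2 * B := by
      have h2 : c * 1 ≤ c * β := by gcongr
      rcases hξ with h | ⟨-, h | h⟩
      · have := neg_abs_le ξ; linarith
      · rw [hBβ, h]; linarith
      · have h7 : (ξ : ℤ) + c ≤ B := by linarith
        have h8 : |ξ| = c - t := by rw [h, abs_neg, abs_of_pos (by linarith)]
        linarith
    have h2 : (b * c + 2 - 1) ^ 4 ≤ (b * c + 2 - 1) ^ j := pow_le_pow_right₀ (by linarith) hj
    calc c * (b * c + 1) ^ 4 ≤ 2 * B * (b * c + 1) ^ 4 := by gcongr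
      _ = 2 * ((b * c + 2 - 1) ^ 4 * B) := by ring
      _ ≤ 2 * ((b * c + 2 - 1) ^ j * B) := by gcongr
      _ ≤ 2 * Z := by gcongr
  left
  have hj3 : j ≤ 3 := by omega
  have hle := lin_compare_of_le (i := i) (j := j) hk hk' (by linarith : 1 ≤ a * c) hζA hA0 hξB hB0
    hj3 heq
  have hlt := lin_compare_of_lt (i := i) (j := j) hk hk' (by linarith : 1 ≤ a * c) hζA hA0 hξB hB0
    hj3 heq
  have hratio : B ≤ 13 * A → 2744 * B < A * (a * c + 1) := by
    clear * - hA0 hp0; intro h; nlinarith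
  have hdvd0 : ∀ {x : ℤ}, c ∣ x → |x| < c → x = 0 := fun h1 h2 =>
    Int.eq_zero_of_abs_lt_dvd h1 h2
  rcases hζ with hζ | ⟨hu, hζ⟩
  · rcases hξ with hξ | ⟨hy, hξ⟩
    · have hζξ : ζ = ξ := by
        have := hdvd0 hcong (by
          have := abs_sub ζ ξ; linarith)
        linarith
      subst hζξ
      have hee : e₁ = e₂ := by
        have h1 := hE₁.right
        have h2 := hE₂.right
        have : c * e₁ = c * e₂ := by linarith
        exact mul_left_cancel₀ (by linarith) this
      subst hee
      have hl1 := hE₁.left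
      have hl2 := hE₂.left
      have hζ2 := hE₁.right
      have hζc : 4 * ζ ^ 2 < c ^ 2 := by
        have : (2 * |ζ|) ^ 2 < c ^ 2 := pow_lt_pow_left₀ hζ (by positivity) two_ne_zero
        rw [mul_pow, sq_abs] at this; linarith
      have hec : 4 * e₁ < c := by
        have : c * (4 * e₁) < c * c := by rw [← sq c]; linarith
        exact lt_of_mul_lt_mul_left this (by linarith)
      have he0 : 0 ≤ e₁ := by
        by_contra! hneg
        have h1 := sq_nonneg ζ
        clear * - h1 hneg hζ2 hc0
        nlinarith
      rcases he0.eq_or_lt with he | he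
      · subst he
        have hu2 : u = 2 := eq_of_sq hu0.le (by norm_num) (by linarith)
        have hy2 : y = 2 := eq_of_sq hy0.le (by norm_num) (by linarith)
        subst hu2 hy2
        have hζ4 : (ζ - 2) * (ζ + 2) = 0 := by linarith
        exfalso
        rcases mul_eq_zero.mp hζ4 with h | h
        · have hζv : ζ = 2 := by linarith
          subst hζv
          have hα' : α = s + a := by linarith
          have hβ' : β = t + b := by linarith
          have hAB : A < B := by
            rw [hAα, hBβ]
            have : c * α < c * β := by gcongr; linarith
            linarith
          have hBA : B ≤ 13 * A := by
            rw [hAα, hBβ]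
            have : c * β ≤ c * (13 * α) := by gcongr; linarith
            linarith
          have := (hle hAB.le (hratio hBA)).1
          linarith
        · have hζv : ζ = -2 := by linarith
          subst hζv
          have hα' : α = s - a := by linarith
          have hβ' : β = t - b := by linarith
          have hαβ : α < β := by
            have h1 : (t - s) * (t + s) = (b - a) * c := by linear_combination ht - hs
            have h2 : (b - a) * (t + s) < (t - s) * (t + s) := by
              rw [h1]; apply mul_lt_mul_of_pos_left <;> linarith
            have := lt_of_mul_lt_mul_right h2 (by linarith)
            linarith
          have hβα : β ≤ 8 * α := by linarith
          have hα1 : 10 ≤ α := by linarith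
          have hAB : A < B := by
            rw [hAα, hBβ]
            have : c * α < c * β := by gcongr
            linarith
          have hBA : B ≤ 13 * A := by
            rw [hAα, hBβ]
            have h1 : c * β ≤ c * (8 * α) := by gcongr
            have h2 : c * 10 ≤ c * α := by gcongr
            linarith
          have := (hle hAB.le (hratio hBA)).1
          linarith
      · have hreg := ih e₁ u y ζ he (by linarith) hl1 hl2 hζ2
        unfold Reg at hreg
        set w := |ζ| with hw
        have hw2 : w ^ 2 = c * e₁ + 4 := by rw [hw, sq_abs]; exact hζ2
        have hw0 : 0 ≤ w := abs_nonneg _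
        have hrw : r * w = c + e₁ - a - b := by
          apply eq_of_sq (by positivity) (by linarith)
          rw [mul_pow, hw2, hr]; linear_combination -hreg
        have hsu : s * u = 2 * r + a * w := by
          apply eq_of_sq (by positivity) (by positivity)
          linear_combination u ^ 2 * hs + (a * c + 4) * hl1 - 4 * hr - 4 * a * hrw - a ^ 2 * hw2
        have hty : t * y = 2 * r + b * w := by
          apply eq_of_sq (by positivity) (by positivity)
          linear_combination y ^ 2 * ht + (b * c + 4) * hl2 - 4 * hr - 4 * b * hrw - b ^ 2 * hw2
        have hwpos : 0 < w := by
          rw [hw, abs_pos]; rintro rfl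
          clear * - hζ2 he hc0; nlinarith
        rcases abs_choice ζ with h | h
        · exfalso
          have hζw : ζ = w := by rw [hw]; exact h.symm
          have hα' : α = r + a * w := by rw [hζw] at hα; linarith
          have hβ' : β = r + b * w := by rw [hζw] at hβ; linarith
          have hαβ : α < β := by
            rw [hα', hβ']
            have : a * w < b * w := by gcongr; linarith
            linarith
          have hβα : β ≤ 13 * α := by
            rw [hα', hβ']
            have : b * w ≤ 13 * a * w := by gcongr
            linarith
          have hAB : A < B := by
            rw [hAα, hBβ]
            have : c * α < c * β := by gcongr
            linarith
          have hBA : B ≤ 13 * A := by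
            rw [hAα, hBβ]
            have h1 : c * β ≤ c * (13 * α) := by gcongr
            linarith
          have := (hle hAB.le (hratio hBA)).1
          linarith
        · have hζw : ζ = -w := by rw [hw, h]; ring
          have hα' : α = r := by rw [hζw] at hα; linarith
          have hβ' : β = r := by rw [hζw] at hβ; linarith
          have hAB : A = B := by rw [hAα, hBβ, hα', hβ']
          have hfin := (hle hAB.le (hratio (by linarith))).2
          rw [← hZi] at hfin
          have hZv : Z = c * r - w := by rw [hfin, hAα, hα', hζw]; ring
          have hd : d = c * r ^ 2 - 2 * (c + e₁ - a - b) + e₁ := by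
            have : c * d = c * (c * r ^ 2 - 2 * (c + e₁ - a - b) + e₁) := by
              rw [hZv] at hZ
              linear_combination (-1) * hZ - 2 * c * hrw + hw2
            exact mul_left_cancel₀ (by linarith) this
          unfold Reg
          have e : a + b - c - d = -(r * Z) := by
            rw [hd, hZv]; linear_combination -hrw
          rw [e, ← hr, ← hZ]; ring
    · exfalso
      have hty : ∀ σ : ℤ, ζ = σ * t → σ ^ 2 = 1 → u = r := by
        intro σ h1 h2
        have h3 := hE₁.right
        have h4 : e₁ = b := by
          have : c * e₁ = c * b := by rw [h1, mul_pow, h2, ht] at h3; linarith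
          exact mul_left_cancel₀ (by linarith) this
        apply eq_of_sq hu0.le hr0.le
        rw [hr, hE₁.left, h4]
      obtain ⟨g1, g2, g3, g4⟩ := cross_bounds hb0 ha (by linarith) hr0 ht0 hs0 (by linarith) ht hs
        (by linarith) (by linarith)
      have hζ1 := abs_lt.mp (by linarith [abs_nonneg ζ] : |ζ| < c)
      obtain ⟨hζ2, hζ3⟩ := abs_le.mp (show |ζ| ≤ |ζ| from le_rfl)
      rcases hξ with hξ | hξ
      · have hζt : ζ = (-1) * t := by
          have h1 : c ∣ ζ + t := by
            have := dvd_add hcong (dvd_refl c)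
            rw [hξ] at this
            have e : ζ - (c - t) + c = ζ + t := by ring
            rwa [e] at this
          have := hdvd0 h1 (by rw [abs_lt]; constructor <;> linarith)
          linarith
        have hur := hty _ hζt (by norm_num)
        have hα' : 2 * α = s * r - a * t := by rw [hur, hζt] at hα; linarith
        have hβ' : β = b * c + 2 - b * t := by
          rw [hy, hξ] at hβ
          have : 2 * β = 2 * (b * c + 2 - b * t) := by linear_combination -hβ + ht
          linarith
        set D := s * r - a * t
        have hD1 : D ≤ a * t := g4
        have hbt : b * t * 4 ≤ b * c := by
          rw [mul_assoc]; gcongr; linarith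
        have hbc1 : c ≤ b * c := by clear * - hb0 hc0; nlinarith
        have hA4 : c * c ≤ A * t * 4 := by
          have h1 : 4 * t * t ≤ c * c := by clear * - ht' ht0; nlinarith
          have h2 : c * c ≤ c * (D * t) := by gcongr
          have h3 : A * t * 4 = 2 * c * (D * t) - 4 * t * t := by
            rw [hAα, hζt]; linear_combination 2 * c * t * hα'
          linarith
        have hBup : B ≤ 2 * (b * c * c) := by
          rw [hBβ, hξ, hβ']; clear * - hbt hbc1 ht' ht0 hc0; nlinarith
        have hBlo : b * c * c ≤ 2 * B := by
          rw [hBβ, hξ, hβ']; clear * - hbt hbc1 ht' ht0 hc0; nlinarith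
        have hAup : A ≤ a * t * c := by
          have : c * D ≤ c * (a * t) := by gcongr
          rw [hAα, hζt]
          have h1 : c * (2 * α) = c * D := by rw [hα']
          have h2 : 0 ≤ c * (a * t) := by positivity
          linarith
        have hABlt : A < B := by
          have : 4 * (a * t * c) ≤ b * c * c := by
            have : 4 * (a * t) ≤ b * c := by
              have : a * t ≤ b * t := by gcongr; linarith
              linarith
            have h1 : 4 * (a * t) * c ≤ b * c * c := by gcongr
            linarith
          have h0 : 0 < b * c * c := by positivity
          linarith
        have hfin : 2744 * B < A * (a * c + 1) := by
          have h1 : 2744 * B * (4 * t) < A * (a * c + 1) * (4 * t) := by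
            have h2 : c * c * (a * c) ≤ A * t * 4 * (a * c) := by gcongr
            have h3 : 2744 * B * (4 * t) ≤ 2744 * (2 * (13 * a * c * c)) * (4 * t) := by
              have : B ≤ 2 * (13 * a * c * c) := hBup.trans (by gcongr)
              gcongr
            have h4 : a * c * c * (2744 * 26 * 4 * t) ≤ a * c * c * c := by
              gcongr; linarith
            have h5 : 0 < A * t := by positivity
            linarith
          exact lt_of_mul_lt_mul_right h1 (by linarith)
        have := (hle hABlt.le hfin).1
        linarith
      · have hζt : ζ = 1 * t := by
          have h1 : c ∣ ζ - t := by
            have := dvd_sub hcong (dvd_refl c)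
            rw [hξ] at this
            have e : ζ - -(c - t) - c = ζ - t := by ring
            rwa [e] at this
          have := hdvd0 h1 (by rw [abs_lt]; constructor <;> linarith)
          linarith
        have hur := hty _ hζt (by norm_num)
        have hα' : 2 * α = s * r + a * t := by rw [hur, hζt] at hα; linarith
        have hβ' : β = 2 := by
          rw [hy, hξ] at hβ
          have : 2 * β = 2 * 2 := by linear_combination -hβ + ht
          linarith
        have hBv : B = c + t := by rw [hBβ, hβ', hξ]; ring
        have hα1 : a * t ≤ α := by linarith
        have hα2 : 2 * α ≤ 3 * (a * t) := by linarith
        have ht1 : t ≤ a * t := by clear * - ha ht0; nlinarith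
        apply hlt
        · rw [hBv, hAα, hζt]
          have h1 : c * 10 ^ 6 ≤ c * α := by gcongr; linarith
          linarith
        · rw [hBv, hAα, hζt, ← hbc]
          have h1 : c * (2 * α) ≤ c * (3 * (a * t)) := by gcongr
          have h2 : c * (3 * (a * t)) ≤ c * (b * c) := by
            apply mul_le_mul_of_nonneg_left _ (by linarith)
            have : a * (t * 4) ≤ a * c := by gcongr; linarith
            linarith
          have h3 : 0 ≤ t * (b * c) := by positivity
          have h4 : 0 ≤ c * (b * c) := by positivity
          linarith
  · exfalso
    rcases hξ with hξ | ⟨hy, hξ⟩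
    · have hsr : ∀ σ : ℤ, ξ = σ * s → σ ^ 2 = 1 → y = r := by
        intro σ h1 h2
        have h3 := hE₂.right
        have h4 : e₂ = a := by
          have : c * e₂ = c * a := by rw [h1, mul_pow, h2, hs] at h3; linarith
          exact mul_left_cancel₀ (by linarith) this
        apply eq_of_sq hy0.le hr0.le
        rw [hr, hE₂.left, h4]; ring
      obtain ⟨g1, g2, g3, g4⟩ := cross_bounds ha hb0 (by linarith) hr0 hs0 ht0 hr hs ht
        (by linarith) (by linarith)
      obtain ⟨hξ2, hξ3⟩ := abs_le.mp (show |ξ| ≤ |ξ| from le_rfl)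
      rcases hζ with hζ | hζ
      · have hξs : ξ = (-1) * s := by
          have h1 : c ∣ ξ + s := by
            have := dvd_sub (dvd_refl c) hcong
            rw [hζ] at this
            have e : c - (c - s - ξ) = ξ + s := by ring
            rwa [e] at this
          have := hdvd0 h1 (by rw [abs_lt]; constructor <;> linarith)
          linarith
        have hyr := hsr _ hξs (by norm_num)
        have hβ' : 2 * β = t * r - b * s := by rw [hyr, hξs] at hβ; linarith
        have hα' : α = a * c + 2 - a * s := by
          rw [hu, hζ] at hα
          have : 2 * α = 2 * (a * c + 2 - a * s) := by linear_combination -hα + hs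
          linarith
        set D := t * r - b * s
        have has : a * s * 4 ≤ a * c := by
          rw [mul_assoc]; gcongr; linarith
        have hac1 : c ≤ a * c := by clear * - ha hc0; nlinarith
        have hB4 : c * c ≤ B * s * 4 := by
          have h1 : 4 * s * s ≤ c * c := by clear * - hs' hs0; nlinarith
          have h2 : c * c ≤ c * (D * s) := by gcongr
          have h3 : B * s * 4 = 2 * c * (D * s) - 4 * s * s := by
            rw [hBβ, hξs]; linear_combination 2 * c * s * hβ'
          linarith
        have hBs : B * s ≤ 2 * (c * c) := by
          have h2 : c * (D * s) ≤ c * (3 * c) := by gcongr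
          have h3 : 2 * (B * s) = c * (D * s) - 2 * (s * s) := by
            rw [hBβ, hξs]; linear_combination c * s * hβ'
          have h4 : 0 ≤ s * s := by positivity
          linarith
        have hAup : A ≤ 2 * (a * c * c) := by
          rw [hAα, hζ, hα']; clear * - has hac1 hs' hs0 hc0 ha; nlinarith
        have hAlo : a * c * c ≤ 2 * A := by
          rw [hAα, hζ, hα']; clear * - has hac1 hs' hs0 hc0 ha; nlinarith
        apply hlt
        · have h1 : 2744 * B * (2 * s) < A * (2 * s) := by
            have h2 : c * c * s ≤ a * c * c * s := by
              have : c * c ≤ a * c * c := by gcongr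
              gcongr
            have h3 : c * c * 10 ^ 6 ≤ c * c * s := by gcongr
            have h4 : a * c * c * s ≤ 2 * A * s := by gcongr
            have h5 : 0 < c * c := by positivity
            linarith
          exact lt_of_mul_lt_mul_right h1 (by linarith)
        · rw [← hbc]
          have h1 : A * (4 * s) < B * (b * c + 1) * (4 * s) := by
            have h2 : c * c * (b * c) ≤ B * s * 4 * (b * c) := by gcongr
            have h3 : A * (4 * s) ≤ 2 * (a * c * c) * (4 * s) := by gcongr
            have h4 : a * c * c * (8 * s) ≤ a * c * c * c := by gcongr; linarith
            have h5 : a * c * c * c ≤ c * c * (b * c) := by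
              have : c * c * (a * c) ≤ c * c * (b * c) := by gcongr; linarith
              linarith
            have h6 : 0 < B * s := by positivity
            linarith
          exact lt_of_mul_lt_mul_right h1 (by linarith)
      · have hξs : ξ = 1 * s := by
          have h1 : c ∣ ξ - s := by
            have := dvd_add (dvd_refl c) hcong
            rw [hζ] at this
            have e : c + (-(c - s) - ξ) = -(ξ - s) := by ring
            rw [e] at this
            exact (dvd_neg).mp this
          have := hdvd0 h1 (by rw [abs_lt]; constructor <;> linarith)
          linarith
        have hyr := hsr _ hξs (by norm_num)
        have hβ' : 2 * β = t * r + b * s := by rw [hyr, hξs] at hβ; linarith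
        have hα' : α = 2 := by
          rw [hu, hζ] at hα
          have : 2 * α = 2 * 2 := by linear_combination -hα + hs
          linarith
        have hAv : A = c + s := by rw [hAα, hα', hζ]; ring
        have hβ1 : b * s ≤ β := by linarith
        have hβ2 : 2 * β ≤ 3 * (b * s) := by linarith
        have hs1 : s ≤ b * s := by clear * - hb0 hs0; nlinarith
        have hABlt : A < B := by
          rw [hBβ, hAv, hξs]
          have : c * 2 ≤ c * β := by gcongr; linarith
          linarith
        have hfin : 2744 * B < A * (a * c + 1) := by
          have h1 : c * (2 * β) ≤ c * (3 * (13 * a * s)) := by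
            have : 3 * (b * s) ≤ 3 * (13 * a * s) := by gcongr
            apply mul_le_mul_of_nonneg_left _ (by linarith)
            linarith
          have h2 : c * a * (s * 10 ^ 6) ≤ c * a * c := by gcongr
          have h3 : 1 * s ≤ c * a * s := by gcongr; linarith
          rw [hBβ, hAv, hξs]
          have h4 : 0 < s * (a * c + 1) := by positivity
          linarith
        have := (hle hABlt.le hfin).1
        linarith
    · rcases hζ with hζ | hζ <;> rcases hξ with hξ | hξ <;> rw [hζ, hξ] at hcong
      · have := hdvd0 hcong (by rw [abs_lt]; constructor <;> linarith)
        linarith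
      · have h1 := dvd_sub (dvd_sub hcong (dvd_refl c)) (dvd_refl c)
        have := hdvd0 h1 (by rw [abs_lt]; constructor <;> linarith)
        linarith
      · have h1 := dvd_add (dvd_add hcong (dvd_refl c)) (dvd_refl c)
        have := hdvd0 h1 (by rw [abs_lt]; constructor <;> linarith)
        linarith
      · have := hdvd0 hcong (by rw [abs_lt]; constructor <;> linarith)
        linarith

/-- Two recurrences with different multipliers separate. -/
lemma lin_ratio {R ρ P₀ P₁ p₀ p₁ : ℤ} (hρ : 3 ≤ ρ) (hR : ρ < R) (hp : 0 < p₀) (h0 : p₀ ≤ P₀)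
    (hP1 : P₀ ≤ P₁) (hp1 : p₀ ≤ p₁) (h : P₀ * p₁ < P₁ * p₀) : ∀ n,
    lin R P₀ P₁ n * lin ρ p₀ p₁ (n + 1) < lin R P₀ P₁ (n + 1) * lin ρ p₀ p₁ n ∧
    0 < lin ρ p₀ p₁ n ∧ 0 < lin ρ p₀ p₁ (n + 1) ∧ 0 < lin R P₀ P₁ (n + 1) ∧
    lin ρ p₀ p₁ n ≤ lin R P₀ P₁ n ∧ lin ρ p₀ p₁ (n + 1) < lin R P₀ P₁ (n + 1) := by
  have hPpos := fun n => (lin_growth (by linarith : 3 ≤ R) (x₀ := P₀) (x₁ := P₁)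
    (by rw [abs_of_pos (by linarith)]; exact hP1) (by linarith) n).2.1
  have hppos := fun n => (lin_growth hρ (x₀ := p₀) (x₁ := p₁)
    (by rw [abs_of_pos hp]; exact hp1) (by linarith) n).2.1
  have step : ∀ {x y X Y : ℤ}, 0 < x → 0 < y → x ≤ X → X * y < Y * x → y < Y := by
    intro x y X Y hx hy hxX hlt
    by_contra! hle
    nlinarith
  intro n
  induction n with
  | zero => exact ⟨h, hp, hppos 0, hPpos 0, h0, step hp (hppos 0) h0 h⟩
  | succ n ih =>
    obtain ⟨h1, h2, h3, h4, h5, h6⟩ := ih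
    have h7 : lin R P₀ P₁ (n + 1) * lin ρ p₀ p₁ (n + 1 + 1) <
        lin R P₀ P₁ (n + 1 + 1) * lin ρ p₀ p₁ (n + 1) := by
      have e1 : lin R P₀ P₁ (n + 1 + 1) = R * lin R P₀ P₁ (n + 1) - lin R P₀ P₁ n := rfl
      have e2 : lin ρ p₀ p₁ (n + 1 + 1) = ρ * lin ρ p₀ p₁ (n + 1) - lin ρ p₀ p₁ n := rfl
      rw [e1, e2]
      have h8 : 0 < (R - ρ) * (lin R P₀ P₁ (n + 1) * lin ρ p₀ p₁ (n + 1)) :=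
        mul_pos (by linarith) (mul_pos h4 h3)
      linarith
    exact ⟨h7, h3, hppos _, hPpos _, h6.le, step h3 (hppos _) h6.le h7⟩

/-- Coincidences of the recurrences attached to the pairs `{a, b}` and `{a, a + b ± 2r}`. -/
lemma adjacent_coincidence {a ρ P₁ p₁ : ℤ} {m n : ℕ} (ha : 10 ^ 8 ≤ a) (hρ : 8 * a ≤ 5 * ρ)
    (hP : P₁ = ρ + 2 * a ∨ P₁ = ρ) (hp : p₁ = ρ + a ∨ p₁ = ρ - a)
    (h : lin (ρ + a) 2 P₁ m = lin ρ 2 p₁ n) :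
    lin ρ 2 p₁ n = 2 ∨ lin ρ 2 p₁ n = ρ ^ 2 + a * ρ - 2 ∨ a ^ 20 ≤ lin ρ 2 p₁ n := by
  have hP1 : ρ ≤ P₁ ∧ P₁ ≤ ρ + 2 * a := by rcases hP with rfl | rfl <;> constructor <;> linarith
  have hp1 : ρ - a ≤ p₁ ∧ p₁ ≤ ρ + a := by rcases hp with rfl | rfl <;> constructor <;> linarith
  have gP := lin_growth (by linarith : 3 ≤ ρ + a) (x₀ := 2) (x₁ := P₁)
    (by rw [abs_of_pos (by norm_num)]; linarith) (by linarith)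
  have gp := lin_growth (by linarith : 3 ≤ ρ) (x₀ := 2) (x₁ := p₁)
    (by rw [abs_of_pos (by norm_num)]; linarith) (by linarith)
  rcases Nat.eq_zero_or_pos n with hn | hn
  · subst hn; left; rfl
  obtain ⟨n, rfl⟩ : ∃ n', n = n' + 1 := ⟨n - 1, by omega⟩
  rcases Nat.eq_zero_or_pos m with hm | hm
  · subst hm; left; rw [← h]; rfl
  obtain ⟨m, rfl⟩ : ∃ m', m = m' + 1 := ⟨m - 1, by omega⟩
  rcases lt_trichotomy m n with hmn | hmn | hmn
  · right; right
    rw [← h]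
    obtain ⟨-, -, g1, g2⟩ := gP m
    obtain ⟨-, -, g3, -⟩ := gp n
    rw [← h] at g3
    rcases le_or_gt 19 m with hm | hm
    · have h1 : a ^ m ≤ (ρ + a - 1) ^ m := pow_le_pow_left₀ (by linarith) (by linarith) _
      calc a ^ 20 = a ^ 19 * a := by ring
        _ ≤ a ^ m * a := by
          gcongr
          · linarith
        _ ≤ (ρ + a - 1) ^ m * P₁ := by
          apply mul_le_mul h1 (by linarith) (by linarith) (pow_nonneg (by linarith) _)
        _ ≤ _ := g1
    · exfalso
      have h1 : (ρ - 1) ^ (m + 1) ≤ (ρ - 1) ^ n := pow_le_pow_right₀ (by linarith) hmn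
      have h2 : (ρ + a + 1) ^ m ≤ 2 ^ 18 * (ρ - 1) ^ m := by
        calc (ρ + a + 1) ^ m ≤ (2 * (ρ - 1)) ^ m := by
              apply pow_le_pow_left₀ <;> linarith
          _ = 2 ^ m * (ρ - 1) ^ m := mul_pow _ _ _
          _ ≤ 2 ^ 18 * (ρ - 1) ^ m := by
              have : (0 : ℤ) ≤ (ρ - 1) ^ m := pow_nonneg (by linarith) _
              gcongr
              · norm_num
              · omega
      have hpos : 0 < (ρ - 1) ^ m := pow_pos (by linarith) _
      have h3 : (ρ - 1) ^ m * ((ρ - 1) * p₁) ≤ (ρ - 1) ^ m * (2 ^ 18 * P₁) := by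
        calc (ρ - 1) ^ m * ((ρ - 1) * p₁) = (ρ - 1) ^ (m + 1) * p₁ := by ring
          _ ≤ (ρ - 1) ^ n * p₁ := by gcongr; linarith
          _ ≤ _ := g3
          _ ≤ _ := g2
          _ ≤ 2 ^ 18 * (ρ - 1) ^ m * P₁ := by gcongr; linarith
          _ = _ := by ring
      have h4 := le_of_mul_le_mul_left h3 hpos
      have h5 : (ρ - 1) * 10 ^ 7 ≤ (ρ - 1) * p₁ := by gcongr <;> linarith
      linarith
  · subst hmn
    have case1 : P₁ ≤ p₁ := by
      by_contra! hlt
      have := (lin_ratio (P₀ := 2) (p₀ := 2) (by linarith : 3 ≤ ρ) (by linarith : ρ < ρ + a)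
        (by norm_num) le_rfl (by linarith : 2 ≤ P₁) (by linarith : 2 ≤ p₁) (by linarith) m).2.2.2.2.2
      linarith
    have hP' : P₁ = ρ := by rcases hP with h | h <;> rcases hp with h' | h' <;> linarith
    have hp' : p₁ = ρ + a := by rcases hp with h' | h' <;> linarith
    subst hP' hp'
    rcases m with _ | _ | m
    · simp [lin] at h; omega
    · right; left
      simp [lin]; ring
    · exfalso
      rw [lin_shift _ _ _ (m + 1 + 1), lin_shift _ _ _ (m + 1), lin_shift P₁ _ _ (m + 1 + 1),
        lin_shift P₁ _ _ (m + 1)] at h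
      have e1 : (P₁ + a) * P₁ - 2 = P₁ * (P₁ + a) - 2 := by ring
      have hbig : P₁ + a ≤ P₁ * (P₁ + a) - 2 := by nlinarith
      have h2 := (lin_ratio (R := P₁ + a) (ρ := P₁) (P₀ := (P₁ + a) * P₁ - 2)
        (P₁ := (P₁ + a) * ((P₁ + a) * P₁ - 2) - P₁)
        (p₀ := P₁ * (P₁ + a) - 2) (p₁ := P₁ * (P₁ * (P₁ + a) - 2) - (P₁ + a))
        (by linarith) (by linarith) (by linarith)
        (by linarith) (by nlinarith) (by nlinarith) (by
          rw [e1, mul_comm]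
          apply mul_lt_mul_of_pos_right _ (by linarith)
          nlinarith) m).2.2.2.2.2
      linarith
  · exfalso
    obtain ⟨-, -, g1, -⟩ := gP m
    obtain ⟨-, -, -, g4⟩ := gp n
    rw [← h] at g4
    have h1 : (ρ + a - 1) ^ (n + 1) ≤ (ρ + a - 1) ^ m := pow_le_pow_right₀ (by linarith) hmn
    have h2 : (ρ + 1) ^ n ≤ (ρ + a - 1) ^ n := pow_le_pow_left₀ (by linarith) (by linarith) _
    have hpos : 0 < (ρ + a - 1) ^ n := pow_pos (by linarith) _
    have h3 : (ρ + a - 1) ^ n * ((ρ + a - 1) * P₁) ≤ (ρ + a - 1) ^ n * p₁ := by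
      calc (ρ + a - 1) ^ n * ((ρ + a - 1) * P₁) = (ρ + a - 1) ^ (n + 1) * P₁ := by ring
        _ ≤ (ρ + a - 1) ^ m * P₁ := by gcongr; linarith
        _ ≤ _ := g1
        _ ≤ _ := g4
        _ ≤ _ := by gcongr; linarith
    have h4 := le_of_mul_le_mul_left h3 hpos
    have h5 : 2 * P₁ ≤ (ρ + a - 1) * P₁ := by gcongr <;> linarith
    linarith

set_option maxHeartbeats 1000000 in
/-- Extensions of `{a, ka, a + ka ± 2r}` are regular or very large. -/
theorem reg_or_large_of_adjacent {k a c r s ε d X Y Z : ℤ}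
    (hk : k = 7 ∨ k = 8 ∨ k = 10 ∨ k = 11 ∨ k = 12 ∨ k = 13) (ha : 10 ^ 8 ≤ a)
    (hε : ε = 1 ∨ ε = -1)
    (hr0 : 0 < r) (hs0 : 0 < s) (hr : r ^ 2 = a * (k * a) + 4) (hc : c = a + k * a + 2 * ε * r)
    (hs : s = r + ε * a) (hd : 0 < d)
    (hX0 : 0 < X) (hY0 : 0 < Y) (hZ0 : 0 < Z) (hX : X ^ 2 = a * d + 4)
    (hY : Y ^ 2 = k * a * d + 4) (hZ : Z ^ 2 = c * d + 4) :
    Reg a (k * a) c d ∨ a ^ 20 ≤ X := by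
  have hk7 : 7 ≤ k := by omega
  have hk13 : k ≤ 13 := by omega
  have haa : 0 ≤ a * a := by positivity
  have hka7 : 7 * (a * a) ≤ r ^ 2 := by
    rw [hr]; nlinarith
  have hka13 : r ^ 2 ≤ 13 * (a * a) + 4 := by
    rw [hr]; nlinarith
  have hr26 : 13 * a ≤ 5 * r := by
    apply le_of_sq_le (by linarith); nlinarith
  have hr4 : r ≤ 4 * a := by
    apply le_of_sq_le (by linarith); nlinarith
  have hε2 : ε ^ 2 = 1 := by rcases hε with rfl | rfl <;> norm_num
  have hs2 : s ^ 2 = a * c + 4 := by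
    rw [hs, hc]; linear_combination hr + a ^ 2 * hε2
  have hac : a < c := by
    have : 7 * a ≤ k * a := by gcongr
    rcases hε with rfl | rfl
    · linarith
    · have : (2 * r) ^ 2 < (k * a) ^ 2 := by
        have h1 : 7 * (k * (a * a)) ≤ k * (k * (a * a)) := by
          have : 0 ≤ k * (a * a) := by positivity
          gcongr
        have h2 : 7 * (a * a) ≤ k * (a * a) := by gcongr
        nlinarith
      have := lt_of_pow_lt_pow_left₀ 2 (by positivity) this
      linarith
  have hclass1 := ext_classification hk (by linarith) hr0 hr hX0 hY0 ⟨hX, hY⟩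
  have h1 : ∃ n, ∃ x₁, X = lin r 2 x₁ n ∧ (x₁ = r + a ∨ x₁ = r - a) := by
    rcases hclass1 with ⟨n, h⟩ | ⟨n, h⟩ | ⟨-, h, -⟩ | ⟨-, h, -⟩
    · exact ⟨n, _, h, Or.inr rfl⟩
    · exact ⟨n, _, h, Or.inl rfl⟩
    · omega
    · omega
  have h2 : ∃ n, ∃ x₁, X = lin s 2 x₁ n ∧ (x₁ = s + a ∨ x₁ = s - a) := by
    obtain ⟨n, d₀, U₀, V₀, U₁, V₁, h0, hU0, hV0, hb, hU1, -, hUn, -⟩ :=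
      IsExt.exists_base (by linarith) hac hs0 hs2 Z.toNat le_rfl hX0 hZ0 ⟨hX, hZ⟩
    rcases h0.base_cases (by linarith) hac (by linarith) hs0 hs2 hU0 hV0 hb with
      ⟨rfl, rfl⟩ | ⟨rfl, rfl⟩ | ⟨e, W, hd0, he0, hW, hprod, hsum, -⟩
    · exact ⟨n + 1, U₁, hUn, Or.inr (by linarith)⟩
    · refine ⟨n, s + a, ?_, Or.inl rfl⟩
      have : U₁ = 2 := by
        have : 2 * U₁ = 2 * 2 := by linear_combination hU1 + hs2
        linarith
      rw [hUn, lin_shift, this]; congr 1; ring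
    · exfalso
      have hle : d₀ + e ≤ W ^ 2 - 3 := by clear * - hd0 he0 hprod; nlinarith
      have hpos : 0 < d₀ + e := by linarith
      rw [hsum, hc, hs] at hle hpos
      clear hsum hprod hd0 he0 hUn hU1 hb hV0 hU0 h0 h1 hclass1
      rcases hε with rfl | rfl
      · have hW5 : W < 5 := by
          by_contra! hge
          have h3 : (r + a) * 5 ≤ (r + 1 * a) * W := by
            rw [one_mul]; gcongr
          have h4 : 3 * r < (k - 3) * a := by linarith
          have h5 : (3 * r) ^ 2 < ((k - 3) * a) ^ 2 :=
            pow_lt_pow_left₀ h4 (by linarith) two_ne_zero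
          have h6 : (k - 3) ^ 2 ≤ 9 * k := by clear * - hk7 hk13; nlinarith
          have h7 : (k - 3) ^ 2 * (a * a) ≤ 9 * k * (a * a) := by gcongr
          linarith
        have hW34 : W = 3 ∨ W = 4 := by omega
        rcases hW34 with rfl | rfl
        · have : 7 * a ≤ k * a := by gcongr
          linarith
        · rcases hk with rfl | rfl | rfl | rfl | rfl | rfl
          · have : 5 * a ≤ 2 * r := by
              apply le_of_sq_le (by linarith); clear * - hr; nlinarith
            linarith
          · have : 2 * r < 6 * a - 13 := by
              apply lt_of_pow_lt_pow_left₀ 2 (by linarith); clear * - ha hr; nlinarith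
            linarith
          · have : 2 * r < 8 * a - 13 := by
              apply lt_of_pow_lt_pow_left₀ 2 (by linarith); clear * - ha hr; nlinarith
            linarith
          all_goals linarith
      · have h3 : (r - a) * 3 ≤ (r + -1 * a) * W := by
          have : r + -1 * a = r - a := by ring
          rw [this]; gcongr; linarith
        have h4 : 5 * r < (k + 5) * a := by linarith
        have h5 : (5 * r) ^ 2 < ((k + 5) * a) ^ 2 :=
          pow_lt_pow_left₀ h4 (by linarith) two_ne_zero
        have h6 : (k + 5) ^ 2 ≤ 25 * k := by clear * - hk7 hk13; nlinarith
        have h7 : (k + 5) ^ 2 * (a * a) ≤ 25 * k * (a * a) := by gcongr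
        linarith
  obtain ⟨n, x₁, hx, hx1⟩ := h1
  obtain ⟨m, y₁, hy, hy1⟩ := h2
  have hfin : X = 2 ∨ X = r ^ 2 + ε * r * a - 2 ∨ a ^ 20 ≤ X := by
    rcases hε with rfl | rfl
    · have := adjacent_coincidence (m := m) (n := n) (P₁ := y₁) (p₁ := x₁) ha
        (by linarith : 8 * a ≤ 5 * r) (by rcases hy1 with h | h; left; linarith; right; linarith)
        hx1 (by rw [← hx]; rw [hy, hs, one_mul])
      rw [← hx] at this
      rcases this with h | h | h
      · exact Or.inl h
      · exact Or.inr (Or.inl (by linarith))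
      · exact Or.inr (Or.inr h)
    · have hsr : s = r - a := by linarith
      have := adjacent_coincidence (m := n) (n := m) (P₁ := x₁) (p₁ := y₁) (ρ := s) ha
        (by linarith) (by rcases hx1 with h | h; left; linarith; right; linarith)
        hy1 (by rw [← hy, hsr, sub_add_cancel, hx])
      rw [← hy, hsr] at this
      rcases this with h | h | h
      · exact Or.inl h
      · exact Or.inr (Or.inl (by linarith))
      · exact Or.inr (Or.inr h)
  rcases hfin with h | h | h
  · exfalso
    rw [h] at hX
    have := mul_pos (by linarith : 0 < a) hd
    linarith
  · left
    have hdv : d = (k * a + ε * r) * (r * (r + ε * a)) := by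
      have : a * d = a * ((k * a + ε * r) * (r * (r + ε * a))) := by
        rw [h] at hX
        linear_combination (-1) * hX + r * (r + ε * a) * hr
      exact mul_left_cancel₀ (by linarith) this
    have hQ : (k * a + ε * r) * (r + ε * a) = c * r - 4 * ε := by
      rw [hc]; linear_combination -ε * hr + r * a * hε2
    have e1 : a + k * a - c - d = -(r * (c * r - 2 * ε)) := by
      rw [hdv, hc]; rw [hc] at hQ; linear_combination -r * hQ
    have e2 : c * d + 4 = (c * r - 2 * ε) ^ 2 := by
      rw [hdv]; linear_combination c * r * hQ - 4 * hε2
    unfold Reg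
    rw [e1, e2, ← hr]; ring
  · exact Or.inr h

/-! ### Evaluation in the kernel -/

/-- `force f n` is `f n`; the kernel evaluates `n` to a literal before substituting it. -/
def force {α : Type} (f : ℕ → α) (n : ℕ) : α :=
  Nat.rec (motive := fun _ => α) (f 0) (fun m _ => f (Nat.succ m)) n

@[simp] lemma force_eq {α : Type} (f : ℕ → α) (n : ℕ) : force f n = f n := by
  cases n <;> rfl

/-- The `2 ^ n`-fold iterate of `f`. -/
def iterPow (f : ℕ → ℕ) (n : ℕ) : ℕ → ℕ :=
  Nat.rec (motive := fun _ => ℕ → ℕ) f (fun _ ih y => force ih (ih y)) n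

lemma iterPow_eq (f : ℕ → ℕ) (n : ℕ) : iterPow f n = f^[2 ^ n] := by
  induction n with
  | zero => rfl
  | succ n ih =>
    have : iterPow f (n + 1) = fun y => force (iterPow f n) (iterPow f n y) := rfl
    rw [this, ih, pow_succ, mul_two, Function.iterate_add]
    funext y
    simp

/-- The `N % 2 ^ l`-fold iterate of `f`. -/
def iterFast (f : ℕ → ℕ) (N l : ℕ) : ℕ → ℕ :=
  Nat.rec (motive := fun _ => ℕ → ℕ) (fun x => x)
    (fun i ih x => cond (Nat.beq (Nat.mod (Nat.shiftRight N i) 2) 0) (ih x)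
      (force ih (iterPow f i x))) l

lemma iterFast_eq (f : ℕ → ℕ) (N l : ℕ) : iterFast f N l = f^[N % 2 ^ l] := by
  induction l with
  | zero => simp [iterFast, Nat.mod_one]; rfl
  | succ l ih =>
    have h : iterFast f N (l + 1) = fun x => cond (Nat.beq ((N >>> l) % 2) 0) (iterFast f N l x)
      (force (iterFast f N l) (iterPow f l x)) := rfl
    rw [h, ih, iterPow_eq, Nat.mod_pow_succ, Nat.shiftRight_eq_div_pow]
    funext x
    rcases Nat.mod_two_eq_zero_or_one (N / 2 ^ l) with h0 | h0
    · simp [h0]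
    · have : Nat.beq 1 0 = false := rfl
      simp [h0, Function.iterate_add_apply, this]

/-- The `N`-fold iterate of `f`, evaluated by binary splitting. -/
def iter (f : ℕ → ℕ) (N : ℕ) : ℕ → ℕ := iterFast f N (Nat.succ (Nat.log2 N))

lemma iter_eq (f : ℕ → ℕ) (N : ℕ) : iter f N = f^[N] := by
  rw [iter, iterFast_eq, Nat.mod_eq_of_lt Nat.lt_log2_self]

/-- One step of the recurrence with multiplier `V` modulo `M`, on the state `x + M * y`;
a state that fails the test `t` leads to the absorbing state `D`. -/
def recStep (M D V : ℕ) (t : ℕ → Bool) (s : ℕ) : ℕ :=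
  Bool.rec (motive := fun _ => ℕ)
    (Bool.rec (motive := fun _ => ℕ) D
      (Nat.add (Nat.div s M) (Nat.mul M (Nat.mod (Nat.add (Nat.mul V (Nat.div s M))
        (Nat.sub M (Nat.mod s M))) M))) (t (Nat.mod s M)))
    s (Nat.ble D s)

/-- The state of two consecutive terms. -/
def enc (M : ℕ) (x y : ℤ) : ℕ := (x % M).toNat + M * (y % M).toNat

lemma enc_lt {M : ℕ} (hM : 0 < M) (x y : ℤ) : enc M x y < M * M := by
  have hM' : (0 : ℤ) < M := by exact_mod_cast hM
  have h1 := Int.emod_lt_of_pos x hM'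
  have h2 := Int.emod_lt_of_pos y hM'
  have h3 : (x % M).toNat < M := by omega
  have h4 : (y % M).toNat + 1 ≤ M := by omega
  unfold enc
  nlinarith

lemma recStep_enc {M : ℕ} (hM : 0 < M) (V : ℕ) (t : ℕ → Bool) (x y : ℤ) :
    recStep M (M * M) V t (enc M x y) =
      if t (x % M).toNat then enc M y (V * y - x) else M * M := by
  have hM' : (0 : ℤ) < M := by exact_mod_cast hM
  have h1 := Int.emod_lt_of_pos x hM'
  have h1' := Int.emod_nonneg x hM'.ne'
  have h2' := Int.emod_nonneg y hM'.ne'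
  have h3 : (x % M).toNat < M := by omega
  have hlt := enc_lt hM x y
  have hb : Nat.ble (M * M) (enc M x y) = false := by
    rw [Bool.eq_false_iff, ne_eq, Nat.ble_eq]; omega
  have hmod : enc M x y % M = (x % M).toNat := by
    rw [enc, Nat.add_mul_mod_self_left, Nat.mod_eq_of_lt h3]
  have hdiv : enc M x y / M = (y % M).toNat := by
    rw [enc, Nat.add_mul_div_left _ _ hM, Nat.div_eq_of_lt h3, zero_add]
  have h : recStep M (M * M) V t (enc M x y) = Bool.rec (motive := fun _ => ℕ)
    (Bool.rec (motive := fun _ => ℕ) (M * M) (enc M x y / M + M * ((V * (enc M x y / M) +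
      (M - enc M x y % M)) % M)) (t (enc M x y % M))) (enc M x y) (Nat.ble (M * M) (enc M x y)) :=
    rfl
  rw [h, hb, hmod, hdiv]
  rcases ht : t (x % M).toNat
  · simp
  · simp only [if_true]
    unfold enc
    congr 2
    zify [h3.le]
    rw [Int.toNat_of_nonneg h1', Int.toNat_of_nonneg h2',
      Int.toNat_of_nonneg (Int.emod_nonneg _ hM'.ne')]
    apply Int.emod_emod_of_dvd _ (dvd_refl _) |>.symm.trans
    rw [Int.emod_emod_of_dvd _ (dvd_refl _)]
    apply Int.ModEq.symm
    have e1 : (x % M) ≡ x [ZMOD M] := Int.mod_modEq _ _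
    have e2 : (y % M) ≡ y [ZMOD M] := Int.mod_modEq _ _
    have e3 : (M : ℤ) ≡ 0 [ZMOD M] := by simp [Int.ModEq]
    have := (e2.mul_left (V : ℤ)).add (e3.sub e1)
    exact (this.trans (by rw [zero_sub, ← sub_eq_add_neg])).symm

lemma recStep_dead (M V : ℕ) (t : ℕ → Bool) : recStep M (M * M) V t (M * M) = M * M := by
  have h : Nat.ble (M * M) (M * M) = true := by rw [Nat.ble_eq]
  have h' : recStep M (M * M) V t (M * M) = Bool.rec (motive := fun _ => ℕ)
    (Bool.rec (motive := fun _ => ℕ) (M * M) (M * M / M + M * ((V * (M * M / M) +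
      (M - M * M % M)) % M)) (t (M * M % M))) (M * M) (Nat.ble (M * M) (M * M)) := rfl
  rw [h', h]

/-- If the iteration of `recStep` along a recurrence survives, all terms passed the test. -/
lemma recStep_iterate {M V : ℕ} (hM : 0 < M) (t : ℕ → Bool) {x : ℕ → ℤ}
    (hx : ∀ i, (M : ℤ) ∣ x (i + 2) - (V * x (i + 1) - x i)) : ∀ n : ℕ,
    (recStep M (M * M) V t)^[n] (enc M (x 0) (x 1)) = M * M ∨
      ((recStep M (M * M) V t)^[n] (enc M (x 0) (x 1)) = enc M (x n) (x (n + 1)) ∧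
        ∀ i < n, t (x i % M).toNat = true) := by
  intro n
  induction n with
  | zero => right; exact ⟨rfl, fun i hi => by omega⟩
  | succ n ih =>
    rw [Function.iterate_succ_apply']
    rcases ih with h | ⟨h, h'⟩
    · left; rw [h, recStep_dead]
    · rw [h, recStep_enc hM]
      rcases ht : t (x n % M).toNat
      · left; simp
      · right
        have e : x (n + 1 + 1) % M = (V * x (n + 1) - x n) % M :=
          (Int.emod_emod_of_dvd _ (dvd_refl _)).symm.trans (by
            rw [Int.emod_emod_of_dvd _ (dvd_refl _)]
            exact (Int.emod_emod_of_dvd _ (dvd_refl _)).symm.trans (by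
              rw [Int.emod_emod_of_dvd _ (dvd_refl _)]
              exact Int.emod_eq_emod_iff_emod_sub_eq_zero.mpr (Int.emod_eq_zero_of_dvd (hx n))))
        refine ⟨by simp [enc, e], fun i hi => ?_⟩
        rcases Nat.lt_succ_iff_lt_or_eq.mp hi with h1 | rfl
        · exact h' i h1
        · exact ht

/-! ### The sieve by small moduli -/

/-- Moduli `q`, each with the set of squares modulo `q` as a bit mask. -/
def squareMasks : List (ℕ × ℕ) :=
  [(nat_lit 151, nat_lit 425021430996567349671854096638566139059703607),
    (nat_lit 149, nat_lit 441852139177177952668163358831104772057793267),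
    (nat_lit 139, nat_lit 264983527547230301571683161851591864167155),
    (nat_lit 137, nat_lit 144045494737659012533968429665233398647703),
    (nat_lit 131, nat_lit 736595995152387833549853625256200223419),
    (nat_lit 127, nat_lit 30790515292689894969866990722818747159),
    (nat_lit 113, nat_lit 8586949319576899938239170417650583),
    (nat_lit 109, nat_lit 473022961816146413042658758988475),
    (nat_lit 107, nat_lit 50079290986288516948354744811035),
    (nat_lit 103, nat_lit 1760368345969468176824550810519),
    (nat_lit 101, nat_lit 1550432784880709368503235994227),
    (nat_lit 97, nat_lit 152076272278209298711361952607),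
    (nat_lit 89, nat_lit 526807005835216593886842679),
    (nat_lit 83, nat_lit 2911111237809585785085595),
    (nat_lit 79, nat_lit 89932533647391829339959), (nat_lit 73, nat_lit 9059857384996697084767),
    (nat_lit 71, nat_lit 20052041432995567487), (nat_lit 67, nat_lit 61808106872519771731),
    (nat_lit 61, nat_lit 1662926210933060155), (nat_lit 59, nat_lit 156326468341437115),
    (nat_lit 53, nat_lit 5310023542746835), (nat_lit 47, nat_lit 4626135339999),
    (nat_lit 43, nat_lit 3678700564051), (nat_lit 41, nat_lit 1870503675703),
    (nat_lit 37, nat_lit 96068509339), (nat_lit 31, nat_lit 303908791),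
    (nat_lit 29, nat_lit 332473075), (nat_lit 23, nat_lit 340831), (nat_lit 19, nat_lit 199411),
    (nat_lit 17, nat_lit 107287), (nat_lit 13, nat_lit 5659), (nat_lit 11, nat_lit 571),
    (nat_lit 7, nat_lit 23), (nat_lit 5, nat_lit 19), (nat_lit 3, nat_lit 3)]

def sieveModulus : ℕ := 112659767495915588664445118114496000675342581681178272045955

def maskBit (m i : ℕ) : Bool :=
  Nat.beq (Nat.mod (Nat.shiftRight m i) (nat_lit 2)) (nat_lit 1)

lemma squareMasks_spec : squareMasks.all (fun t => Nat.beq (sieveModulus % t.1) 0 &&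
    (List.range t.1).all (fun x => maskBit t.2 (x * x % t.1))) = true := by
  decide +kernel

/-- `z` is not a square modulo one of the moduli. -/
def sieved (z : ℕ) : Bool :=
  List.rec (motive := fun _ => Bool) false
    (fun t _ ih => Bool.rec (motive := fun _ => Bool) true ih (maskBit t.2 (Nat.mod z t.1)))
    squareMasks

/-- The least `m₀` in the list for which the hypothesis of the upper bound holds. -/
def findExponent (N E Q : ℕ) (l : List ℕ) : ℕ :=
  List.rec (motive := fun _ => ℕ) 0
    (fun m _ ih => cond (Nat.blt (122 * N * Q * Q ^ m) (E ^ m)) m ih) l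

/-- Triples `(k, a, c)` that are treated by quadratic reciprocity. -/
def smallTriples : List (ℕ × ℕ × ℕ) :=
  [(7, 6, 16), (7, 6, 80), (7, 6, 4160), (7, 96, 1), (7, 96, 5), (7, 96, 260), (8, 2, 6),
    (8, 2, 30), (8, 2, 240), (8, 2, 1056), (8, 2, 8190), (8, 2, 35910), (8, 12, 1), (8, 12, 5),
    (8, 12, 40), (8, 12, 176), (8, 12, 1365), (8, 12, 5985), (8, 70, 234), (8, 70, 1026),
    (10, 12, 56), (10, 12, 208), (11, 6, 32), (11, 6, 112), (11, 6, 12880), (11, 6, 44720),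
    (11, 120, 644), (11, 120, 2236), (12, 1, 5), (12, 1, 21), (12, 1, 96), (12, 1, 320),
    (12, 1, 1365), (12, 1, 4485), (12, 1, 19040), (12, 1, 62496), (12, 1, 265221), (12, 4, 24),
    (12, 4, 80), (12, 4, 4760), (12, 4, 15624), (12, 15, 91), (12, 15, 299), (12, 56, 340),
    (12, 56, 1116), (12, 209, 1269), (13, 3, 20), (13, 3, 64), (13, 3, 2464), (13, 3, 7700),
    (13, 33, 224), (13, 33, 700)]

def isSmall (k a c : ℕ) : Bool :=
  List.rec (motive := fun _ => Bool) false
    (fun t _ ih => cond (Nat.beq t.1 k && Nat.beq t.2.1 a && Nat.beq t.2.2 c) true ih) smallTriples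

/-- Run `K` on the first two terms of the tail of the recurrence that exceeds `S`. -/
def tailAbove (r S : ℕ) (K : ℕ → ℕ → Bool) (fuel : ℕ) : ℕ → ℕ → Bool :=
  Nat.rec (motive := fun _ => ℕ → ℕ → Bool) (fun _ _ => false)
    (fun _ ih x y => cond (Nat.blt S x) (K x y) (force (fun z => ih y z) (r * y - x))) fuel

/-- No term `U` of the recurrence starting with `x, y` below the bound is the root of an
extension of `{a, ka, c}`. -/
def sieveTail (r a S bound len : ℕ) (x y : ℕ) : Bool :=
  Nat.blt bound ((r - 1) ^ (len - 1) * (r - 1) ^ (len - 1)) &&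
  force (fun M => force (fun D => force (fun α => force (fun β => force (fun M' =>
    Nat.blt (iter (recStep M D r (fun u => sieved
      (Nat.add (Nat.mul α (Nat.add (Nat.mul u u) M')) β))) len (x % M + M * (y % M))) D)
    (M - 4)) (4 * (a * a))) (S * S - 4)) (M * M)) sieveModulus

def regNat (a b c d : ℕ) : Bool :=
  Nat.ble (a + b) (c + d) &&
    Nat.beq ((c + d - (a + b)) * (c + d - (a + b))) ((a * b + 4) * (c * d + 4))

/-- Extensions of `{a, ka, c}` with root in the recurrence starting with `x, y` are regular. -/
def sieveChain (k r a S c bound len : ℕ) (x y : ℕ) : Bool :=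
  tailAbove r S (fun u v => cond (regNat a (k * a) c ((u * u - 4) / a))
    (force (fun w => sieveTail r a S bound len v w) (r * v - u))
    (sieveTail r a S bound len u v)) 100 x y

def chainStarts (k r a : ℕ) : List (ℕ × ℕ) :=
  (2, r - a) :: (2, r + a) :: (cond (Nat.beq k 8 && Nat.beq a 12) [(4, 8), (4, 128)]
    (cond (Nat.beq k 7 && Nat.beq a 96) [(10, 22), (10, 2518)] []))

/-- All extensions of `{a, ka, c}`, where `S ^ 2 = ac + 4`, beyond `c` are regular. -/
def sieveTriple (k r a S : ℕ) : Bool :=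
  force (fun c => cond (Nat.beq c 0 || isSmall k a c) true
    (force (fun N => force (fun E => force (fun Q => force (fun m =>
      Nat.ble 1 m && Nat.ble 1 E && Nat.ble 200 (a * c) && Nat.ble (k * a) (3 * c) &&
      Nat.ble (4 * k) N &&
      force (fun bound => force (fun len =>
        (chainStarts k r a).all (fun p => sieveChain k r a S c bound len p.1 p.2))
        ((8 * Nat.log2 (3600 * a * c) + 2 * m * (Nat.log2 (Q ^ 8) + 1)) /
          (2 * Nat.log2 ((r - 1) ^ 8)) + 4))
        (a * (3600 * c * Q ^ (2 * m)) + 4))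
      (findExponent N E Q [3, 4, 5, 6, 7, 8, 10, 12, 15, 20, 30, 50, 110, 600]))
      (8 * k * (k - 1) ^ 2 * (N + 2) / (2 * k - 1) + 1))
      (27 * (N - 4 * k) ^ 2 / (256 * k * (k - 1) ^ 2)))
      (k * a * c)))
    ((S * S - 4) / a)

/-- `sieveTriple` for all third elements in one chain, up to the bound `10 ^ 26`. -/
def sieveThird (k r a fuel : ℕ) : ℕ → ℕ → Bool :=
  Nat.rec (motive := fun _ => ℕ → ℕ → Bool) (fun _ _ => false)
    (fun _ ih x y => cond (Nat.ble (10 ^ 26) (k * (x * x - 4))) true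
      (sieveTriple k r a x && force (fun z => ih y z) (r * y - x))) fuel

/-- `sieveThird` for all pairs `{a, ka}` with `a < 10 ^ 13`, where `x, y` are consecutive solutions
`a` of the Pell equation and `u, v` the corresponding roots `r`. -/
def sievePairs (k r₁ fuel : ℕ) : ℕ → ℕ → ℕ → ℕ → Bool :=
  Nat.rec (motive := fun _ => ℕ → ℕ → ℕ → ℕ → Bool) (fun _ _ _ _ => false)
    (fun _ ih u x v y => cond (Nat.ble (10 ^ 13) x) true
      ((chainStarts k u x).all (fun p => sieveThird k u x 100 p.1 p.2) &&
        force (fun v' => force (fun y' => ih v y v' y') (r₁ * y - x)) (r₁ * v - u))) fuel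


lemma sieved_sound {z : ℕ} (h : sieved z = true) (y : ℤ) : ¬ (sieveModulus : ℤ) ∣ z - y ^ 2 := by
  intro hd
  have key : ∀ l : List (ℕ × ℕ), l.all (fun t => Nat.beq (sieveModulus % t.1) 0 &&
      (List.range t.1).all (fun x => maskBit t.2 (x * x % t.1))) = true →
      (List.rec (motive := fun _ => Bool) false (fun t _ ih => Bool.rec (motive := fun _ => Bool)
        true ih (maskBit t.2 (Nat.mod z t.1))) l) = false := by
    intro l hl
    induction l with
    | nil => rfl
    | cons t l ih =>
      rw [List.all_cons, Bool.and_eq_true, Bool.and_eq_true, Nat.beq_eq, List.all_eq_true] at hl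
      obtain ⟨⟨h1, h2⟩, h3⟩ := hl
      have hq : t.1 ∣ sieveModulus := Nat.dvd_of_mod_eq_zero h1
      have hq0 : 0 < t.1 := Nat.pos_of_dvd_of_pos hq (by decide)
      have hq0' : (0 : ℤ) < t.1 := by exact_mod_cast hq0
      set x := (y % t.1).toNat with hx
      have hx' : (x : ℤ) = y % t.1 := Int.toNat_of_nonneg (Int.emod_nonneg _ hq0'.ne')
      have hxq : x < t.1 := by have := Int.emod_lt_of_pos y hq0'; omega
      have hz : z % t.1 = x * x % t.1 := by
        have e1 : (z : ℤ) ≡ y ^ 2 [ZMOD t.1] :=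
          (Int.modEq_iff_dvd.mpr ((Int.natCast_dvd_natCast.mpr hq).trans hd)).symm
        have e2 : (x : ℤ) ≡ y [ZMOD t.1] := by rw [hx']; exact Int.mod_modEq _ _
        have e3 := e1.trans (e2.pow 2).symm
        have : (z : ℤ) ≡ ((x * x : ℕ) : ℤ) [ZMOD t.1] := by push_cast; rwa [← sq]
        exact Int.natCast_modEq_iff.mp this
      have h4 := h2 x (List.mem_range.mpr hxq)
      have h5 : maskBit t.2 (Nat.mod z t.1) = true := by
        rw [show Nat.mod z t.1 = z % t.1 from rfl, hz]; exact h4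
      simp only [h5]
      exact ih h3
  have := key squareMasks squareMasks_spec
  rw [sieved, this] at h
  exact absurd h (by decide)

lemma lin_bounds {r x y : ℤ} (hr : 2 ≤ r) (hx : 0 ≤ x) (hxy : x ≤ y) : ∀ n,
    x ≤ lin r x y n ∧ lin r x y n ≤ lin r x y (n + 1) := by
  intro n
  induction n with
  | zero => exact ⟨le_rfl, hxy⟩
  | succ n ih =>
    refine ⟨ih.1.trans ih.2, ?_⟩
    have e : lin r x y (n + 1 + 1) = r * lin r x y (n + 1) - lin r x y n := rfl
    rw [e]
    nlinarith [ih.1, ih.2]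

lemma cast_rec {r x y : ℕ} (hr : 2 ≤ r) (hxy : x ≤ y) :
    ((r * y - x : ℕ) : ℤ) = r * y - x ∧ y ≤ r * y - x := by
  have h : x + y ≤ r * y := by nlinarith
  refine ⟨by rw [Nat.cast_sub (by omega)]; push_cast; ring, by omega⟩

lemma tailAbove_sound {r S : ℕ} {K : ℕ → ℕ → Bool} (hr : 2 ≤ r) : ∀ (fuel x y n : ℕ),
    tailAbove r S K fuel x y = true → x ≤ y → (S : ℤ) < lin r x y n →
    ∃ u v m : ℕ, K u v = true ∧ u ≤ v ∧ S < u ∧ lin r x y n = lin r u v m := by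
  intro fuel
  induction fuel with
  | zero => intro x y n h; exact absurd h (by simp [tailAbove])
  | succ f ih =>
    intro x y n h hxy hS
    have e : tailAbove r S K (f + 1) x y = cond (Nat.blt S x) (K x y)
      (force (fun z => tailAbove r S K f y z) (r * y - x)) := rfl
    rw [e, force_eq] at h
    rcases hb : Nat.blt S x with _ | _
    · rw [hb, cond_false] at h
      have hle : ¬ S < x := by
        intro hlt
        rw [← Nat.blt_eq, hb] at hlt
        exact absurd hlt (by decide)
      obtain ⟨hc, hle'⟩ := cast_rec hr hxy
      rcases n with _ | n
      · simp only [lin] at hS; exact absurd (by exact_mod_cast hS) hle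
      · rw [lin_shift, ← hc] at hS ⊢
        exact ih _ _ n h hle' hS
    · rw [hb, cond_true] at h
      exact ⟨x, y, n, h, hxy, by rwa [Nat.blt_eq] at hb, rfl⟩

lemma enc_natCast (M x y : ℕ) : enc M x y = x % M + M * (y % M) := by
  rw [enc, ← Int.natCast_mod, ← Int.natCast_mod, Int.toNat_natCast, Int.toNat_natCast]

lemma sieveTail_sound {r a S bound len x y n : ℕ} {c d U Z : ℤ} (hr : 3 ≤ r) (hxy : x ≤ y)
    (hy : 1 ≤ y) (h : sieveTail r a S bound len x y = true) (hS : (S : ℤ) ^ 2 = a * c + 4)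
    (hU : U = lin r x y n) (hUd : U ^ 2 = a * d + 4) (hb : U ^ 2 ≤ bound)
    (hZ : Z ^ 2 = c * d + 4) (hS2 : 2 ≤ S) (hl : 1 ≤ len) : False := by
  simp only [sieveTail, force_eq, Bool.and_eq_true, Nat.blt_eq, iter_eq] at h
  obtain ⟨h1, h2⟩ := h
  have hM : 0 < sieveModulus := by decide
  set M := sieveModulus with hMdef
  set t : ℕ → Bool := fun u => sieved (Nat.add (Nat.mul (S * S - 4) (Nat.add (Nat.mul u u)
    (M - 4))) (4 * (a * a))) with ht
  have hrec : ∀ i, (M : ℤ) ∣ lin r x y (i + 2) - ((r : ℤ) * lin r x y (i + 1) - lin r x y i) := by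
    intro i
    have e : lin r x y (i + 2) = r * lin r x y (i + 1) - lin r x y i := rfl
    rw [e, sub_self]; exact dvd_zero _
  have hlen : n < len := by
    by_contra! hle
    obtain ⟨n, rfl⟩ : ∃ m, n = m + 1 := ⟨n - 1, by omega⟩
    have hg := (lin_growth (R := r) (x₀ := x) (x₁ := y) (by exact_mod_cast hr)
      (by rw [abs_of_nonneg (by positivity)]; exact_mod_cast hxy) (by exact_mod_cast hy) n).2.2.1
    have hr1 : (1 : ℤ) ≤ (r : ℤ) - 1 := by have : (3 : ℤ) ≤ r := by exact_mod_cast hr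
                                           linarith
    have h3 : ((r : ℤ) - 1) ^ (len - 1) ≤ ((r : ℤ) - 1) ^ n * y := by
      calc ((r : ℤ) - 1) ^ (len - 1) ≤ ((r : ℤ) - 1) ^ n := pow_le_pow_right₀ hr1 (by omega)
        _ ≤ _ := le_mul_of_one_le_right (by positivity) (by exact_mod_cast hy)
    rw [← hU] at hg
    have h4 : ((r : ℤ) - 1) ^ (len - 1) ≤ U := h3.trans hg
    have h5 : (bound : ℤ) < ((r : ℤ) - 1) ^ (len - 1) * ((r : ℤ) - 1) ^ (len - 1) := by
      have := Int.ofNat_lt.mpr h1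
      push_cast [Nat.cast_sub (by omega : 1 ≤ r)] at this
      exact this
    have h6 : (0 : ℤ) ≤ ((r : ℤ) - 1) ^ (len - 1) := by positivity
    nlinarith
  rw [← enc_natCast] at h2
  rcases recStep_iterate hM t hrec len with h | ⟨-, h⟩
  · simp only [lin] at h
    rw [h] at h2
    exact lt_irrefl _ h2
  · have h3 := h n hlen
    rw [← hU] at h3
    refine sieved_sound h3 (a * Z) ?_
    have hM4 : 4 ≤ M := by decide
    have hMz : (0 : ℤ) < M := by exact_mod_cast hM
    have hu : (((U % M).toNat : ℕ) : ℤ) = U % M := Int.toNat_of_nonneg (Int.emod_nonneg _ hMz.ne')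
    have e : ((Nat.add (Nat.mul (S * S - 4) (Nat.add (Nat.mul (U % M).toNat (U % M).toNat)
        (M - 4))) (4 * (a * a)) : ℕ) : ℤ) =
        (S ^ 2 - 4) * ((U % M) * (U % M) + (M - 4)) + 4 * a ^ 2 := by
      rw [← hu]
      show (((S * S - 4) * ((U % M).toNat * (U % M).toNat + (M - 4)) + 4 * (a * a) : ℕ) : ℤ) = _
      rw [Nat.cast_add, Nat.cast_mul, Nat.cast_add, Nat.cast_sub hM4, Nat.cast_sub (by nlinarith)]
      push_cast; ring
    rw [e]
    have e2 : (a * Z) ^ 2 = (S ^ 2 - 4) * (U ^ 2 - 4) + 4 * a ^ 2 := by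
      linear_combination a ^ 2 * hZ - (a * c) * hUd - (U ^ 2 - 4) * hS
    rw [e2]
    have e3 : (M : ℤ) ∣ (U % M) * (U % M) - U ^ 2 := by
      rw [sq]; exact (Int.emod_emod_of_dvd _ (dvd_refl _) ▸
        (Int.ModEq.mul (Int.mod_modEq U M) (Int.mod_modEq U M)).symm.dvd)
    obtain ⟨w, hw⟩ := e3
    exact ⟨(S ^ 2 - 4) * (w + 1), by linear_combination (S ^ 2 - 4 : ℤ) * hw⟩

lemma regNat_sound {a b c d : ℕ} (h : regNat a b c d = true) : Reg a b c d := by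
  simp only [regNat, Bool.and_eq_true, Nat.ble_eq, Nat.beq_eq] at h
  obtain ⟨h1, h2⟩ := h
  have := congrArg (Nat.cast : ℕ → ℤ) h2
  push_cast [Nat.cast_sub h1] at this
  unfold Reg
  linear_combination this

lemma sieveChain_sound {k r a S c bound len x y n : ℕ} {d U Z : ℤ} (hr : 3 ≤ r) (ha : 0 < a)
    (hxy : x ≤ y) (h : sieveChain k r a S c bound len x y = true)
    (hS : (S : ℤ) ^ 2 = a * c + 4) (hSU : S < U)
    (hU : U = lin r x y n) (hUd : U ^ 2 = a * d + 4) (hb : U ^ 2 ≤ bound)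
    (hZ : Z ^ 2 = c * d + 4) (hS2 : 2 ≤ S) (hl : 1 ≤ len) : Reg a (k * a) c d := by
  rw [hU] at hSU
  obtain ⟨u, v, m, hK, huv, hSu, hm⟩ := tailAbove_sound (by omega) 100 x y n h hxy hSU
  rw [← hU] at hm
  obtain ⟨hc, hle⟩ := cast_rec (by omega : 2 ≤ r) huv
  rcases hreg : regNat a (k * a) c ((u * u - 4) / a) with _ | _
  · simp only [hreg, cond_false] at hK
    exact (sieveTail_sound hr huv (by omega) hK hS hm hUd hb hZ hS2 hl).elim
  · rcases m with _ | m
    · have hd : (((u * u - 4) / a : ℕ) : ℤ) = d := by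
        simp only [lin] at hm
        rw [hm] at hUd
        rw [Int.natCast_div, Nat.cast_sub (by nlinarith)]
        push_cast
        rw [show (u : ℤ) * u - 4 = a * d by linarith]
        exact Int.mul_ediv_cancel_left _ (by exact_mod_cast ha.ne')
      have := regNat_sound hreg
      rw [hd] at this
      exact_mod_cast this
    · simp only [hreg, cond_true, force_eq] at hK
      rw [lin_shift, ← hc] at hm
      exact (sieveTail_sound hr hle (by omega) hK hS hm hUd hb hZ hS2 hl).elim

lemma findExponent_spec (N E Q : ℕ) : ∀ l : List ℕ, findExponent N E Q l = 0 ∨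
    122 * N * Q * Q ^ findExponent N E Q l < E ^ findExponent N E Q l := by
  intro l
  induction l with
  | nil => left; rfl
  | cons m l ih =>
    have e : findExponent N E Q (m :: l) = cond (Nat.blt (122 * N * Q * Q ^ m) (E ^ m)) m
      (findExponent N E Q l) := rfl
    rcases hb : Nat.blt (122 * N * Q * Q ^ m) (E ^ m) with _ | _
    · rw [e, hb]; exact ih
    · rw [e, hb]; right; exact Nat.blt_eq.mp hb

lemma root_gt {k a r : ℤ} (hk : 7 ≤ k) (ha : 0 < a) (hr0 : 0 < r)
    (hr : r ^ 2 = a * (k * a) + 4) : 2 * a < r := by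
  have h : 7 * (a * a) ≤ a * (k * a) := by nlinarith [mul_pos ha ha]
  by_contra! hle
  nlinarith

lemma chainStarts_spec {k a r U V d : ℤ} (hk : k = 7 ∨ k = 8 ∨ k = 10 ∨ k = 11 ∨ k = 12 ∨ k = 13)
    (ha : 0 < a) (hr0 : 0 < r) (hr : r ^ 2 = a * (k * a) + 4) (hU : 0 < U) (hV : 0 < V)
    (h : IsExt a (k * a) d U V) :
    ∃ p ∈ chainStarts k.toNat r.toNat a.toNat, p.1 ≤ p.2 ∧ 1 ≤ p.1 ∧ ∃ n, U = lin r p.1 p.2 n := by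
  have hra := root_gt (by omega : 7 ≤ k) ha hr0 hr
  have hra' : ((r.toNat - a.toNat : ℕ) : ℤ) = r - a := by omega
  have hra'' : ((r.toNat + a.toNat : ℕ) : ℤ) = r + a := by omega
  rcases ext_classification hk ha hr0 hr hU hV h with ⟨n, hn⟩ | ⟨n, hn⟩ | ⟨rfl, rfl, hU'⟩ |
    ⟨rfl, rfl, hU'⟩
  · exact ⟨(2, r.toNat - a.toNat), by simp [chainStarts], by omega, by norm_num, n, by
      rw [hn, hra']; rfl⟩
  · exact ⟨(2, r.toNat + a.toNat), by simp [chainStarts], by omega, by norm_num, n, by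
      rw [hn, hra'']; rfl⟩
  · have hr34 : r = 34 := by nlinarith
    subst hr34
    have h8 : lin 34 8 4 = fun n => if n = 0 then 8 else lin 34 4 128 (n - 1) := by
      funext n
      rcases n with _ | n
      · rfl
      · rw [lin_shift]; simp
    rcases hU' with ⟨n, hn⟩ | ⟨n, hn⟩
    · exact ⟨(4, 8), by decide, by norm_num, by norm_num, n, hn⟩
    · rw [h8] at hn
      rcases n with _ | n
      · exact ⟨(4, 8), by decide, by norm_num, by norm_num, 1, hn⟩
      · exact ⟨(4, 128), by decide, by norm_num, by norm_num, n, hn⟩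
  · have hr254 : r = 254 := by nlinarith
    subst hr254
    have h8 : lin 254 22 10 = fun n => if n = 0 then 22 else lin 254 10 2518 (n - 1) := by
      funext n
      rcases n with _ | n
      · rfl
      · rw [lin_shift]; simp
    rcases hU' with ⟨n, hn⟩ | ⟨n, hn⟩
    · exact ⟨(10, 22), by decide, by norm_num, by norm_num, n, hn⟩
    · rw [h8] at hn
      rcases n with _ | n
      · exact ⟨(10, 22), by decide, by norm_num, by norm_num, 1, hn⟩
      · exact ⟨(10, 2518), by decide, by norm_num, by norm_num, n, hn⟩

lemma sieveTriple_sound {k a c d r s t X Y Z : ℤ}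
    (hk : k = 7 ∨ k = 8 ∨ k = 10 ∨ k = 11 ∨ k = 12 ∨ k = 13) (ha : 0 < a) (hc : 0 < c) (hcd : c < d)
    (hr0 : 0 < r) (hs0 : 0 < s) (ht0 : 0 < t) (hX0 : 0 < X) (hY0 : 0 < Y) (hZ0 : 0 < Z)
    (hr : r ^ 2 = a * (k * a) + 4) (hs : s ^ 2 = a * c + 4) (ht : t ^ 2 = k * a * c + 4)
    (hX : X ^ 2 = a * d + 4) (hY : Y ^ 2 = k * a * d + 4) (hZ : Z ^ 2 = c * d + 4)
    (hsm : isSmall k.toNat a.toNat c.toNat = false)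
    (h : sieveTriple k.toNat r.toNat a.toNat s.toNat = true) : Reg a (k * a) c d := by
  have hk7 : 7 ≤ k := by omega
  have hk13 : k ≤ 13 := by omega
  obtain ⟨p, hp, hp12, hp1, n, hn⟩ := chainStarts_spec hk ha hr0 hr hX0 hY0 ⟨hX, hY⟩
  have hr3 : 3 ≤ r := by linarith [root_gt hk7 ha hr0 hr]
  have hsX : s < X := by
    have : s ^ 2 < X ^ 2 := by rw [hs, hX]; nlinarith
    exact lt_of_pow_lt_pow_left₀ 2 hX0.le this
  have hs2 : 2 ≤ s := by nlinarith
  obtain ⟨d, rfl⟩ := Int.eq_ofNat_of_zero_le (by linarith : 0 ≤ d)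
  lift k to ℕ using by linarith
  lift a to ℕ using by linarith
  lift c to ℕ using by linarith
  lift r to ℕ using by linarith
  lift s to ℕ using by linarith
  lift t to ℕ using by linarith
  lift X to ℕ using by linarith
  lift Y to ℕ using by linarith
  lift Z to ℕ using by linarith
  simp only [Int.toNat_natCast] at *
  have hc' : (s * s - 4) / a = c := by
    have h1 : s * s = a * c + 4 := by rw [← sq]; exact_mod_cast hs
    rw [h1, Nat.add_sub_cancel, Nat.mul_div_cancel_left _ (by exact_mod_cast ha)]
  have hc0 : Nat.beq c 0 = false := by
    rw [Bool.eq_false_iff, ne_eq, Nat.beq_eq]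
    have : 0 < c := by exact_mod_cast hc
    omega
  simp only [sieveTriple, force_eq, hc', hc0, hsm, Bool.or_false, cond_false, Bool.and_eq_true,
    Nat.ble_eq, List.all_eq_true] at h
  set N := k * a * c with hN
  set E := 27 * (N - 4 * k) ^ 2 / (256 * k * (k - 1) ^ 2) with hE
  set Q := 8 * k * (k - 1) ^ 2 * (N + 2) / (2 * k - 1) + 1 with hQ
  set m := findExponent N E Q [3, 4, 5, 6, 7, 8, 10, 12, 15, 20, 30, 50, 110, 600] with hm
  obtain ⟨⟨⟨⟨⟨h1, h2⟩, h3⟩, h4⟩, h5⟩, h6⟩ := h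
  have hEQ : 122 * N * Q * Q ^ m < E ^ m := by
    rcases findExponent_spec N E Q [3, 4, 5, 6, 7, 8, 10, 12, 15, 20, 30, 50, 110, 600] with h | h
    · omega
    · exact h
  have hk1 : ((k - 1 : ℕ) : ℝ) = k - 1 := by
    rw [Nat.cast_sub (by exact_mod_cast (by linarith : (1 : ℤ) ≤ k))]; simp
  have hk2 : ((2 * k - 1 : ℕ) : ℝ) = 2 * k - 1 := by
    have : (7 : ℕ) ≤ k := by exact_mod_cast hk7
    rw [Nat.cast_sub (by omega)]; simp
  have hcd' : c < d := by exact_mod_cast hcd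
  have hbound := D4_upper_bound (k := k) (a := a) (c := c) (d := d) (s := s) (t := t) (X := X)
    (Y := Y) (Z := Z) (m₀ := m) (N := (N : ℕ)) (E := E) (Q := Q) (by exact_mod_cast hk7)
    (by exact_mod_cast hk13) h3 h4 (h3.trans (Nat.mul_le_mul_left _ hcd'.le)) h1
    (by exact_mod_cast hs) (by exact_mod_cast ht) (by exact_mod_cast hX) (by exact_mod_cast hY)
    (by exact_mod_cast hZ) rfl (by exact_mod_cast h2)
    (by
      have : E * (256 * k * (k - 1) ^ 2) ≤ 27 * (N - 4 * k) ^ 2 := Nat.div_mul_le_self _ _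
      have h7 := (Nat.cast_le (α := ℝ)).mpr this
      push_cast [Nat.cast_sub h5, hk1] at h7
      linarith)
    (by
      have : 8 * k * (k - 1) ^ 2 * (N + 2) ≤ (2 * k - 1) * Q := by
        have : (7 : ℕ) ≤ k := by exact_mod_cast hk7
        have h7 : 0 < 2 * k - 1 := by omega
        rw [hQ, mul_add (2 * k - 1), mul_one (2 * k - 1)]
        have h8 := Nat.div_add_mod (8 * k * (k - 1) ^ 2 * (N + 2)) (2 * k - 1)
        have h9 := Nat.mod_lt (8 * k * (k - 1) ^ 2 * (N + 2)) h7
        omega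
      have h7 := (Nat.cast_le (α := ℝ)).mpr this
      simp only [Nat.cast_mul, Nat.cast_pow, hk1, hk2, Nat.cast_add] at h7
      push_cast at h7 ⊢
      exact h7)
    (by exact_mod_cast hEQ)
  have hb : d < 3600 * c * Q ^ (2 * m) := by exact_mod_cast hbound
  have hb' : X ^ 2 ≤ a * (3600 * c * Q ^ (2 * m)) + 4 := by
    have : X ^ 2 = a * d + 4 := by exact_mod_cast hX
    rw [this]
    exact Nat.add_le_add_right (Nat.mul_le_mul_left _ hb.le) _
  exact sieveChain_sound (U := X) (Z := Z) (by exact_mod_cast hr3) (by exact_mod_cast ha) hp12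
    (h6 p hp) hs hsX hn hX (by exact_mod_cast hb') hZ (by exact_mod_cast hs2)
    (Nat.le_add_left 1 _)

lemma sieveThird_sound {k r a : ℕ} (hr : 2 ≤ r) : ∀ (fuel x y n : ℕ),
    sieveThird k r a fuel x y = true → x ≤ y → ∀ {S : ℕ}, (S : ℤ) = lin r x y n →
    k * (S * S - 4) < 10 ^ 26 → sieveTriple k r a S = true := by
  intro fuel
  induction fuel with
  | zero => intro x y n h; exact absurd h (by simp [sieveThird])
  | succ f ih =>
    intro x y n h hxy S hS hlt
    have e : sieveThird k r a (f + 1) x y = cond (Nat.ble (10 ^ 26) (k * (x * x - 4))) true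
      (sieveTriple k r a x && force (fun z => sieveThird k r a f y z) (r * y - x)) := rfl
    rw [e, force_eq] at h
    rcases hb : Nat.ble (10 ^ 26) (k * (x * x - 4)) with _ | _
    · rw [hb, cond_false, Bool.and_eq_true] at h
      obtain ⟨hc, hle⟩ := cast_rec hr hxy
      rcases n with _ | n
      · have : S = x := by simpa [lin] using hS
        rw [this]; exact h.1
      · rw [lin_shift, ← hc] at hS
        exact ih _ _ n h.2 hle hS hlt
    · exfalso
      rw [Nat.ble_eq] at hb
      have h1 := (lin_bounds (r := r) (x := x) (y := y) (by exact_mod_cast hr) (by positivity)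
        (by exact_mod_cast hxy) n).1
      rw [← hS] at h1
      have h2 : x ≤ S := by exact_mod_cast h1
      have h3 : x * x - 4 ≤ S * S - 4 := Nat.sub_le_sub_right (Nat.mul_le_mul h2 h2) _
      exact absurd (hb.trans (Nat.mul_le_mul_left k h3)) (by omega)

lemma sievePairs_sound {k r₁ : ℕ} (hr : 2 ≤ r₁) : ∀ (fuel u x v y j : ℕ),
    sievePairs k r₁ fuel u x v y = true → x ≤ y → u ≤ v → ∀ {r a : ℕ}, (a : ℤ) = lin r₁ x y j →
    (r : ℤ) = lin r₁ u v j → a < 10 ^ 13 →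
    ∀ p ∈ chainStarts k r a, sieveThird k r a 100 p.1 p.2 = true := by
  intro fuel
  induction fuel with
  | zero => intro u x v y j h; exact absurd h (by simp [sievePairs])
  | succ f ih =>
    intro u x v y j h hxy huv r a ha hra hlt
    have e : sievePairs k r₁ (f + 1) u x v y = cond (Nat.ble (10 ^ 13) x) true
      ((chainStarts k u x).all (fun p => sieveThird k u x 100 p.1 p.2) &&
        force (fun v' => force (fun y' => sievePairs k r₁ f v y v' y') (r₁ * y - x))
          (r₁ * v - u)) := rfl
    rw [e, force_eq, force_eq] at h
    rcases hb : Nat.ble (10 ^ 13) x with _ | _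
    · rw [hb, cond_false, Bool.and_eq_true, List.all_eq_true] at h
      obtain ⟨hc, hle⟩ := cast_rec hr hxy
      obtain ⟨hc', hle'⟩ := cast_rec hr huv
      rcases j with _ | j
      · have h1 : a = x := by simpa [lin] using ha
        have h2 : r = u := by simpa [lin] using hra
        rw [h1, h2]; exact h.1
      · rw [lin_shift, ← hc] at ha
        rw [lin_shift, ← hc'] at hra
        exact ih _ _ _ _ j h.2 hle hle' ha hra hlt
    · exfalso
      rw [Nat.ble_eq] at hb
      have h1 := (lin_bounds (r := r₁) (x := x) (y := y) (by exact_mod_cast hr) (by positivity)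
        (by exact_mod_cast hxy) j).1
      rw [← ha] at h1
      have h2 : x ≤ a := by exact_mod_cast h1
      omega

/-- The solutions of `r² = k a² + 4` are generated by the least one. -/
lemma pell_chain {k r₁ a₁ : ℤ} (hk : 0 < k) (hr₁ : 2 < r₁) (ha₁ : 0 < a₁)
    (h₁ : r₁ ^ 2 = k * a₁ ^ 2 + 4)
    (hmin : ∀ a r : ℤ, 0 < a → a < a₁ → r ^ 2 ≠ k * a ^ 2 + 4)
    (hpar : ∀ a r : ℤ, r ^ 2 = k * a ^ 2 + 4 →
      Even (r₁ * r - k * a₁ * a) ∧ Even (r₁ * a - a₁ * r)) :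
    ∀ (N : ℕ) (a r : ℤ), a.toNat ≤ N → 0 < a → 0 < r → r ^ 2 = k * a ^ 2 + 4 →
    ∃ j, a = lin r₁ a₁ (r₁ * a₁) j ∧ r = lin r₁ r₁ (r₁ ^ 2 - 2) j := by
  have hup := lin_cross (A := a₁) (B := k * a₁) (r := r₁) (U₀ := a₁) (V₀ := r₁) (U₁ := r₁ * a₁)
    (V₁ := r₁ ^ 2 - 2) (by linear_combination h₁) (by ring) (by linear_combination h₁)
  intro N
  induction N with
  | zero => intro a r h1 h2; omega
  | succ N ih =>
    intro a r haN ha hr h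
    have hge : a₁ ≤ a := by
      by_contra! hlt
      exact hmin a r ha hlt h
    rcases hge.eq_or_lt with rfl | hgt
    · exact ⟨0, rfl, by simp only [lin]; exact eq_of_sq hr.le (by linarith) (by rw [h, h₁])⟩
    obtain ⟨⟨r', hr'⟩, ⟨a', ha'⟩⟩ := hpar a r h
    have h' : r' ^ 2 = k * a' ^ 2 + 4 := by
      have : 4 * r' ^ 2 = 4 * (k * a' ^ 2 + 4) := by
        have e1 : 4 * r' ^ 2 = (r₁ * r - k * a₁ * a) ^ 2 := by rw [hr']; ring
        have e2 : 4 * a' ^ 2 = (r₁ * a - a₁ * r) ^ 2 := by rw [ha']; ring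
        linear_combination e1 - k * e2 + 4 * h + (r ^ 2 - k * a ^ 2) * h₁
      linarith
    have hr'0 : 0 < r' := by
      have : (k * a₁ * a) ^ 2 < (r₁ * r) ^ 2 := by
        have e : (r₁ * r) ^ 2 - (k * a₁ * a) ^ 2 = 4 * k * a ^ 2 + 4 * k * a₁ ^ 2 + 16 := by
          linear_combination (r ^ 2) * h₁ + (k * a₁ ^ 2 + 4) * h
        nlinarith [mul_nonneg hk.le (sq_nonneg a), mul_nonneg hk.le (sq_nonneg a₁)]
      have := lt_of_pow_lt_pow_left₀ 2 (by positivity) this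
      linarith
    have ha'0 : 0 < a' := by
      have : (a₁ * r) ^ 2 < (r₁ * a) ^ 2 := by
        have e : (r₁ * a) ^ 2 - (a₁ * r) ^ 2 = 4 * (a ^ 2 - a₁ ^ 2) := by
          linear_combination a ^ 2 * h₁ - a₁ ^ 2 * h
        nlinarith
      have := lt_of_pow_lt_pow_left₀ 2 (by positivity) this
      linarith
    have ha'lt : a' < a := by
      have : ((r₁ - 2) * a) ^ 2 < (a₁ * r) ^ 2 := by
        have e : (a₁ * r) ^ 2 - ((r₁ - 2) * a) ^ 2 = 4 * a₁ ^ 2 + (4 * r₁ - 8) * a ^ 2 := by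
          linear_combination a₁ ^ 2 * h - a ^ 2 * h₁
        nlinarith [mul_pos ha₁ ha₁, mul_nonneg (by linarith : 0 ≤ 4 * r₁ - 8) (sq_nonneg a)]
      have := lt_of_pow_lt_pow_left₀ 2 (by positivity) this
      linarith
    obtain ⟨j, hj, hj'⟩ := ih a' r' (by omega) ha'0 hr'0 h'
    refine ⟨j + 1, ?_, ?_⟩
    · have := (hup j).1
      rw [← hj, ← hj'] at this
      have e : 2 * (r₁ * a' + a₁ * r') = 2 * (2 * a) := by
        linear_combination (-r₁) * ha' - a₁ * hr' + a * h₁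
      linarith
    · have := (hup j).2
      rw [← hj, ← hj'] at this
      have e : 2 * (r₁ * r' + k * a₁ * a') = 2 * (2 * r) := by
        linear_combination (-r₁) * hr' - k * a₁ * ha' + r * h₁
      linarith

set_option maxRecDepth 100000 in
lemma sievePairs_seven : sievePairs 7 16 100 16 6 254 96 = true := by
  decide +kernel

set_option maxRecDepth 100000 in
lemma sievePairs_eight : sievePairs 8 6 100 6 2 34 12 = true := by
  decide +kernel

set_option maxRecDepth 100000 in
lemma sievePairs_ten : sievePairs 10 38 100 38 12 1442 456 = true := by
  decide +kernel

set_option maxRecDepth 100000 in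
lemma sievePairs_eleven : sievePairs 11 20 100 20 6 398 120 = true := by
  decide +kernel

set_option maxRecDepth 100000 in
lemma sievePairs_twelve : sievePairs 12 4 100 4 1 14 4 = true := by
  decide +kernel

set_option maxRecDepth 100000 in
lemma sievePairs_thirteen : sievePairs 13 11 100 11 3 119 33 = true := by
  decide +kernel

lemma pell_not_sq {k a₁ : ℤ} (h : ∀ a ∈ Finset.Ioo 0 a₁, ¬ IsSquare (k * a ^ 2 + 4)) (a r : ℤ)
    (ha : 0 < a) (ha' : a < a₁) : r ^ 2 ≠ k * a ^ 2 + 4 := fun e =>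
  h a (Finset.mem_Ioo.mpr ⟨ha, ha'⟩) ⟨r, by rw [← e, sq]⟩

/-- The solutions of the Pell equation pass through the sieve. -/
lemma sieveThird_of_pell {k a r : ℤ} (hk : k = 7 ∨ k = 8 ∨ k = 10 ∨ k = 11 ∨ k = 12 ∨ k = 13)
    (ha : 0 < a) (hr0 : 0 < r) (hr : r ^ 2 = k * a ^ 2 + 4) (hlt : a < 10 ^ 13) :
    ∀ p ∈ chainStarts k.toNat r.toNat a.toNat,
      sieveThird k.toNat r.toNat a.toNat 100 p.1 p.2 = true := by
  have ha' : (a.toNat : ℤ) = a := Int.toNat_of_nonneg ha.le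
  have hr' : (r.toNat : ℤ) = r := Int.toNat_of_nonneg hr0.le
  have hlt' : a.toNat < 10 ^ 13 := by omega
  have par : ∀ k a r : ℤ, r ^ 2 = k * a ^ 2 + 4 → (Even r ↔ (Even k ∨ Even a)) := by
    intro k a r h
    rw [← Int.even_pow' (n := 2) two_ne_zero, h, Int.even_add, Int.even_mul,
      Int.even_pow' two_ne_zero]
    simp [show Even (4 : ℤ) by decide]
  rcases hk with rfl | rfl | rfl | rfl | rfl | rfl
  · obtain ⟨j, h1, h2⟩ := pell_chain (k := 7) (r₁ := 16) (a₁ := 6) (by norm_num) (by norm_num)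
      (by norm_num) (by norm_num) (pell_not_sq (by decide +kernel)) (fun a r _ =>
        ⟨⟨8 * r - 21 * a, by ring⟩, ⟨8 * a - 3 * r, by ring⟩⟩) _ a r le_rfl ha hr0 hr
    exact sievePairs_sound (by norm_num) 100 16 6 254 96 j sievePairs_seven (by norm_num) (by norm_num)
      (by rw [ha']; exact h1) (by rw [hr']; exact h2) hlt'
  · obtain ⟨j, h1, h2⟩ := pell_chain (k := 8) (r₁ := 6) (a₁ := 2) (by norm_num) (by norm_num)
      (by norm_num) (by norm_num) (pell_not_sq (by decide +kernel)) (fun a r _ =>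
        ⟨⟨3 * r - 8 * a, by ring⟩, ⟨3 * a - r, by ring⟩⟩) _ a r le_rfl ha hr0 hr
    exact sievePairs_sound (by norm_num) 100 6 2 34 12 j sievePairs_eight (by norm_num) (by norm_num)
      (by rw [ha']; exact h1) (by rw [hr']; exact h2) hlt'
  · obtain ⟨j, h1, h2⟩ := pell_chain (k := 10) (r₁ := 38) (a₁ := 12) (by norm_num) (by norm_num)
      (by norm_num) (by norm_num) (pell_not_sq (by decide +kernel)) (fun a r _ =>
        ⟨⟨19 * r - 60 * a, by ring⟩, ⟨19 * a - 6 * r, by ring⟩⟩) _ a r le_rfl ha hr0 hr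
    exact sievePairs_sound (by norm_num) 100 38 12 1442 456 j sievePairs_ten (by norm_num) (by norm_num)
      (by rw [ha']; exact h1) (by rw [hr']; exact h2) hlt'
  · obtain ⟨j, h1, h2⟩ := pell_chain (k := 11) (r₁ := 20) (a₁ := 6) (by norm_num) (by norm_num)
      (by norm_num) (by norm_num) (pell_not_sq (by decide +kernel)) (fun a r _ =>
        ⟨⟨10 * r - 33 * a, by ring⟩, ⟨10 * a - 3 * r, by ring⟩⟩) _ a r le_rfl ha hr0 hr
    exact sievePairs_sound (by norm_num) 100 20 6 398 120 j sievePairs_eleven (by norm_num) (by norm_num)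
      (by rw [ha']; exact h1) (by rw [hr']; exact h2) hlt'
  · obtain ⟨j, h1, h2⟩ := pell_chain (k := 12) (r₁ := 4) (a₁ := 1) (by norm_num) (by norm_num)
      (by norm_num) (by norm_num) (pell_not_sq (by decide +kernel)) (fun a r h => by
        have := par 12 a r h
        simp only [Int.even_sub, Int.even_mul]
        simp [this, show Even (12 : ℤ) by decide, show Even (4 : ℤ) by decide])
      _ a r le_rfl ha hr0 hr
    exact sievePairs_sound (by norm_num) 100 4 1 14 4 j sievePairs_twelve (by norm_num) (by norm_num)
      (by rw [ha']; exact h1) (by rw [hr']; exact h2) hlt'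
  · obtain ⟨j, h1, h2⟩ := pell_chain (k := 13) (r₁ := 11) (a₁ := 3) (by norm_num) (by norm_num)
      (by norm_num) (by norm_num) (pell_not_sq (by decide +kernel)) (fun a r h => by
        have := par 13 a r h
        simp only [Int.even_sub, Int.even_mul]
        simp [this, show ¬ Even (13 : ℤ) by decide, show ¬ Even (11 : ℤ) by decide,
          show ¬ Even (3 : ℤ) by decide])
      _ a r le_rfl ha hr0 hr
    exact sievePairs_sound (by norm_num) 100 11 3 119 33 j sievePairs_thirteen (by norm_num) (by norm_num)
      (by rw [ha']; exact h1) (by rw [hr']; exact h2) hlt'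

/-- A third element is larger than `a`, apart from two exceptional pairs. -/
lemma third_ge {k a c r s t : ℤ} (hk : k = 7 ∨ k = 8 ∨ k = 10 ∨ k = 11 ∨ k = 12 ∨ k = 13)
    (ha : 0 < a) (hc : 0 < c) (hr0 : 0 < r) (hs0 : 0 < s) (ht0 : 0 < t)
    (hr : r ^ 2 = a * (k * a) + 4) (hs : s ^ 2 = a * c + 4) (ht : t ^ 2 = k * a * c + 4) :
    a ≤ c ∨ a ≤ 96 := by
  have hra := root_gt (by omega : 7 ≤ k) ha hr0 hr
  have hs2 : 2 < s := by nlinarith [mul_pos ha hc]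
  have key : r - a ≤ s → a ≤ c := by
    intro h
    have h1 : (r - a) ^ 2 ≤ s ^ 2 := pow_le_pow_left₀ (by linarith) h 2
    have h2 : 2 * r ≤ k * a := by
      apply le_of_sq_le (by nlinarith)
      have : 21 ≤ k * (k - 4) := by nlinarith [(by omega : 7 ≤ k)]
      nlinarith [mul_le_mul_of_nonneg_right this (sq_nonneg a)]
    have h3 : a * a ≤ a * c := by nlinarith
    exact le_of_mul_le_mul_left h3 ha
  rcases ext_classification hk ha hr0 hr hs0 ht0 ⟨hs, ht⟩ with ⟨n, hn⟩ | ⟨n, hn⟩ | ⟨-, rfl, -⟩ |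
    ⟨-, rfl, -⟩
  · left
    apply key
    rcases n with _ | n
    · simp [lin] at hn; omega
    · have := (lin_growth (R := r) (x₀ := 2) (x₁ := r - a) (by linarith)
        (by rw [abs_of_pos two_pos]; linarith) (by linarith) n).2.2.1
      rw [← hn] at this
      have h1 : (1 : ℤ) ≤ (r - 1) ^ n := one_le_pow₀ (by linarith)
      nlinarith
  · left
    apply key
    rcases n with _ | n
    · simp [lin] at hn; omega
    · have := (lin_growth (R := r) (x₀ := 2) (x₁ := r + a) (by linarith)
        (by rw [abs_of_pos two_pos]; linarith) (by linarith) n).2.2.1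
      rw [← hn] at this
      have h1 : (1 : ℤ) ≤ (r - 1) ^ n := one_le_pow₀ (by linarith)
      nlinarith
  · right; norm_num
  · right; norm_num

/-- Regularity of the extensions of a bounded triple that is not in the list `smallTriples`. -/
theorem reg_of_bounded {k a c d r s t X Y Z : ℤ}
    (hk : k = 7 ∨ k = 8 ∨ k = 10 ∨ k = 11 ∨ k = 12 ∨ k = 13) (ha : 0 < a) (hc : 0 < c) (hcd : c < d)
    (hr0 : 0 < r) (hs0 : 0 < s) (ht0 : 0 < t) (hX0 : 0 < X) (hY0 : 0 < Y) (hZ0 : 0 < Z)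
    (hr : r ^ 2 = a * (k * a) + 4) (hs : s ^ 2 = a * c + 4) (ht : t ^ 2 = k * a * c + 4)
    (hX : X ^ 2 = a * d + 4) (hY : Y ^ 2 = k * a * d + 4) (hZ : Z ^ 2 = c * d + 4)
    (hN : k * a * c < 10 ^ 26) (hsm : isSmall k.toNat a.toNat c.toNat = false) :
    Reg a (k * a) c d := by
  apply sieveTriple_sound hk ha hc hcd hr0 hs0 ht0 hX0 hY0 hZ0 hr hs ht hX hY hZ hsm
  have hlt : a < 10 ^ 13 := by
    rcases third_ge hk ha hc hr0 hs0 ht0 hr hs ht with h | h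
    · by_contra! hge
      have h1 : (7 : ℤ) * (10 ^ 13 * 10 ^ 13) ≤ k * (a * c) := by
        have : (7 : ℤ) ≤ k := by omega
        gcongr
        exact hge.trans h
      linarith
    · linarith
  obtain ⟨p, hp, hp12, hp1, n, hn⟩ := chainStarts_spec hk ha hr0 hr hs0 ht0 ⟨hs, ht⟩
  have h3 := sieveThird_of_pell hk ha hr0 (by linear_combination hr) hlt p hp
  have hr3 : 3 ≤ r := by linarith [root_gt (by omega : 7 ≤ k) ha hr0 hr]
  have hr' : (r.toNat : ℤ) = r := Int.toNat_of_nonneg hr0.le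
  have hs' : (s.toNat : ℤ) = s := Int.toNat_of_nonneg hs0.le
  refine sieveThird_sound (by omega) 100 p.1 p.2 n h3 hp12 (by rw [hr', hs', hn]) ?_
  have h4 : ((s.toNat * s.toNat : ℕ) : ℤ) = a * c + 4 := by push_cast; rw [hs', ← hs, sq]
  have h5 : ((s.toNat * s.toNat - 4 : ℕ) : ℤ) = a * c := by
    have : 0 < a * c := mul_pos ha hc
    omega
  zify
  rw [h5, Int.toNat_of_nonneg (by omega)]
  linarith

/-! ### Detection of non-squares by Euler's criterion -/

/-- A power modulo `p`, for exponents below `128 ^ fuel`. -/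
def powMod (p x fuel : ℕ) : ℕ → ℕ :=
  Nat.rec (motive := fun _ => ℕ → ℕ) (fun _ => nat_lit 1)
    (fun _ ih e => Bool.rec (motive := fun _ => ℕ)
      (Nat.mod (Nat.mul (Nat.pow (ih (Nat.div e (nat_lit 128))) (nat_lit 128))
        (Nat.pow x (Nat.mod e (nat_lit 128)))) p)
      (nat_lit 1) (Nat.beq e (nat_lit 0))) fuel

lemma powMod_modEq (p x : ℕ) : ∀ fuel e, e < 128 ^ fuel → powMod p x fuel e ≡ x ^ e [MOD p] := by
  intro fuel
  induction fuel with
  | zero =>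
    intro e he
    have : e = 0 := by simpa using he
    subst this
    exact Nat.ModEq.refl 1
  | succ f ih =>
    intro e he
    have h : powMod p x (f + 1) e = Bool.rec (motive := fun _ => ℕ)
      ((powMod p x f (e / 128)) ^ 128 * x ^ (e % 128) % p) 1 (Nat.beq e 0) := rfl
    rcases hb : Nat.beq e 0 with _ | _
    · rw [h, hb]
      refine (Nat.mod_modEq _ _).trans ?_
      have h1 := ih (e / 128) (by rw [pow_succ] at he; omega)
      have h2 := (h1.pow 128).mul_right (x ^ (e % 128))
      rwa [← pow_mul, ← pow_add, mul_comm (e / 128), Nat.div_add_mod] at h2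
    · rw [Nat.beq_eq] at hb
      subst hb
      exact Nat.ModEq.refl 1

/-- `z` is not a square modulo the prime `q`. -/
def nonres (q z : ℕ) : Bool :=
  Nat.beq (powMod q (Nat.mod z q) (nat_lit 5) (Nat.div q (nat_lit 2))) (Nat.sub q (nat_lit 1))

lemma nonres_sound {q z : ℕ} (hq : q.Prime) (hq2 : q ≠ 2) (hlt : q < 2 ^ 35)
    (h : nonres q z = true) (y : ℤ) : ¬ (q : ℤ) ∣ z - y ^ 2 := by
  intro hd
  have := Fact.mk hq
  have hq3 : 2 < q := lt_of_le_of_ne hq.two_le (Ne.symm hq2)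
  have h1 : powMod q (z % q) 5 (q / 2) = q - 1 := Nat.beq_eq.mp h
  have h2 := powMod_modEq q (z % q) 5 (q / 2) (by norm_num at hlt ⊢; omega)
  rw [h1] at h2
  have h3 : (z : ZMod q) ^ (q / 2) = -1 := by
    have h4 := (h2.trans ((Nat.mod_modEq z q).pow (q / 2)))
    have h5 := (ZMod.natCast_eq_natCast_iff _ _ _).mpr h4
    rw [Nat.cast_sub hq.one_le] at h5
    push_cast at h5
    rw [← h5]; simp
  have hz : (z : ZMod q) = (y : ZMod q) ^ 2 := by
    have := (ZMod.intCast_zmod_eq_zero_iff_dvd (z - y ^ 2) q).mpr hd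
    push_cast at this
    exact sub_eq_zero.mp this
  have hne : (y : ZMod q) ≠ 0 := by
    intro h0
    rw [hz, h0, zero_pow two_ne_zero, zero_pow (by omega : q / 2 ≠ 0)] at h3
    have : (1 : ZMod q) = 0 := by linear_combination h3
    exact one_ne_zero this
  have hodd : 2 * (q / 2) = q - 1 := by
    have := hq.eq_two_or_odd
    omega
  rw [hz, ← pow_mul, hodd, ZMod.pow_card_sub_one_eq_one hne] at h3
  have h6 : ((2 : ℕ) : ZMod q) = 0 := by push_cast; linear_combination h3
  rw [ZMod.natCast_eq_zero_iff] at h6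
  exact absurd (Nat.le_of_dvd two_pos h6) (by omega)

/-! ### Primality of small numbers -/

/-- The product of the primes below `1734`. -/
def primorial1733 : ℕ :=
  307360544345590823899550745757780775238264271016205344757454583285713968735224640942989161341631848684740846420515753081759625011954068413442735806414699533869889937667932466838952065016519275921558571931379094250830515928937660551534829197958743172633016983725383081552874932086211624818950618113416381489277159695294865270034655484486496881779654256586462495602115684896887588507794561771765729238464946952653178264783379483564141589506911670390708171193546270464785439847267972447216532703500466906453534405088836746570377955966820564621215524360412613752496322343992778370728897926696502657841890655559589549627778441590983266837993953612635131293246683806438570251123413722924508713812094168411702427507696671383093901916592364490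

def primorial41 : ℕ := 304250263527210

lemma primorial1733_spec :
    (List.range 1734).all (fun i => Nat.ble i 1 || Nat.blt 1 (Nat.gcd i primorial1733)) = true := by
  decide +kernel

lemma primorial41_spec :
    (List.range 42).all (fun i => Nat.ble i 1 || Nat.blt 1 (Nat.gcd i primorial41)) = true := by
  decide +kernel

lemma prime_of_gcd {q n P : ℕ} (hP : (List.range (n + 1)).all (fun i => Nat.ble i 1 ||
    Nat.blt 1 (Nat.gcd i P)) = true) (hq : 1 < q) (hlt : q < (n + 1) ^ 2) (h : Nat.gcd q P = 1) :
    q.Prime := by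
  by_contra hn
  have h1 : q.minFac.Prime := Nat.minFac_prime hq.ne'
  have h2 := Nat.minFac_sq_le_self (by omega) hn
  have h3 : q.minFac < n + 1 := lt_of_pow_lt_pow_left₀ 2 (by omega) (h2.trans_lt hlt)
  rw [List.all_eq_true] at hP
  have h4 := hP _ (List.mem_range.mpr h3)
  rw [Bool.or_eq_true, Nat.ble_eq, Nat.blt_eq] at h4
  have h5 : 1 < Nat.gcd q.minFac P := h4.resolve_left (by have := h1.two_le; omega)
  have h6 : Nat.gcd q.minFac P ∣ Nat.gcd q P := Nat.gcd_dvd_gcd_of_dvd_left _ q.minFac_dvd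
  rw [h, Nat.dvd_one] at h6
  omega

def tinyPrimes : List ℕ := [3, 5, 7, 11, 13, 17, 19, 23, 29, 31, 37, 41]

/-- A test for odd primes below `1734 ^ 2`. -/
def primeTest (q : ℕ) : Bool :=
  Bool.rec (motive := fun _ => Bool)
    (Bool.rec (motive := fun _ => Bool)
      (Nat.blt q 3006756 && Nat.beq (Nat.gcd q primorial1733) 1)
      (Nat.beq (Nat.gcd q primorial41) 1) (Nat.blt q 1764))
    (tinyPrimes.any (Nat.beq q)) (Nat.ble q 41)

lemma primeTest_sound {q : ℕ} (h : primeTest q = true) : q.Prime ∧ q ≠ 2 ∧ q < 2 ^ 35 := by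
  unfold primeTest at h
  rcases h1 : Nat.ble q 41 with _ | _
  · have h1' : ¬ q ≤ 41 := fun hle => by rw [Nat.ble_eq_true_of_le hle] at h1; cases h1
    rw [h1] at h
    rcases h2 : Nat.blt q 1764 with _ | _
    · rw [h2] at h
      simp only [Bool.and_eq_true, Nat.blt_eq, Nat.beq_eq] at h
      refine ⟨prime_of_gcd (n := 1733) primorial1733_spec (by omega) ?_ h.2, by omega, ?_⟩
      · have := h.1; norm_num; omega
      · have := h.1; norm_num; omega
    · rw [h2] at h
      simp only [Nat.beq_eq] at h
      rw [Nat.blt_eq] at h2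
      refine ⟨prime_of_gcd (n := 41) primorial41_spec (by omega) (by norm_num; omega) h,
        by omega, by norm_num; omega⟩
  · rw [h1] at h
    simp only [List.any_eq_true, Nat.beq_eq] at h
    obtain ⟨p, hp, rfl⟩ := h
    simp only [tinyPrimes, List.mem_cons, List.not_mem_nil, or_false] at hp
    rcases hp with rfl | rfl | rfl | rfl | rfl | rfl | rfl | rfl | rfl | rfl | rfl | rfl <;> norm_num

/-! ### Two-sided recurrences modulo `M` -/

/-- `z` is seen not to be a square modulo one of the primes `qs`. -/
def killed (qs : List ℕ) (z : ℕ) : Bool :=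
  List.rec (motive := fun _ => Bool) false
    (fun q _ ih => Bool.rec (motive := fun _ => Bool) ih true (nonres q z)) qs

lemma killed_sound {M : ℕ} {qs : List ℕ} (hp : qs.all primeTest = true)
    (hM : ∀ q ∈ qs, q ∣ M) {z : ℕ} (h : killed qs z = true) (y : ℤ) : ¬ (M : ℤ) ∣ z - y ^ 2 := by
  induction qs with
  | nil => exact absurd h (by simp [killed])
  | cons q qs ih =>
    rw [List.all_cons, Bool.and_eq_true] at hp
    have e : killed (q :: qs) z = Bool.rec (motive := fun _ => Bool) (killed qs z) true
      (nonres q z) := rfl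
    rcases hn : nonres q z with _ | _
    · rw [e, hn] at h
      exact ih hp.2 (fun q hq => hM q (List.mem_cons_of_mem _ hq)) h
    · obtain ⟨h1, h2, h3⟩ := primeTest_sound hp.1
      intro hd
      exact nonres_sound h1 h2 h3 hn y
        ((Int.natCast_dvd_natCast.mpr (hM q List.mem_cons_self)).trans hd)

def listProd (qs : List ℕ) : ℕ :=
  List.rec (motive := fun _ => ℕ) (nat_lit 1) (fun q _ ih => Nat.mul q ih) qs

lemma listProd_eq (qs : List ℕ) : listProd qs = qs.prod := by
  induction qs with
  | nil => rfl
  | cons q qs ih => rw [List.prod_cons, ← ih]; rfl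

/-- The test that `α (u - γ) + δ` is not a square, for `u` modulo `M`. -/
def testAt (M α γ δ : ℕ) (qs : List ℕ) (u : ℕ) : Bool :=
  force (killed qs) (Nat.add (Nat.mul α (Nat.add u (Nat.mul γ (Nat.sub M (nat_lit 1))))) δ)

lemma testAt_sound {M α γ δ : ℕ} (hM0 : 0 < M) {qs : List ℕ} (hp : qs.all primeTest = true)
    (hM : ∀ q ∈ qs, q ∣ M) {w : ℤ} (h : testAt M α γ δ qs (w % M).toNat = true) {w' : ℤ}
    (hw : (M : ℤ) ∣ w' - w) : ¬ IsSquare ((α : ℤ) * (w' - γ) + δ) := by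
  rintro ⟨y, hy⟩
  rw [testAt, force_eq] at h
  refine killed_sound hp hM h y ?_
  have hMz : (0 : ℤ) < M := by exact_mod_cast hM0
  have hu : (((w % M).toNat : ℕ) : ℤ) = w % M := Int.toNat_of_nonneg (Int.emod_nonneg _ hMz.ne')
  have e : ((Nat.add (Nat.mul α (Nat.add (w % M).toNat (Nat.mul γ (Nat.sub M 1)))) δ : ℕ) : ℤ) =
      α * (w % M + γ * (M - 1)) + δ := by
    show ((α * ((w % M).toNat + γ * (M - 1)) + δ : ℕ) : ℤ) = _
    rw [Nat.cast_add, Nat.cast_mul, Nat.cast_add, hu, Nat.cast_mul, Nat.cast_sub hM0, Nat.cast_one]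
  rw [e, sq, ← hy]
  obtain ⟨c, hc⟩ := hw
  have h2 := Int.emod_add_mul_ediv w M
  exact ⟨α * (γ - c - w / M), by linear_combination (-α : ℤ) * hc + α * h2⟩

/-- Scan the terms with indices from `pos` to `L`, except those in the increasing list `E`. -/
def scan (M D V L : ℕ) (t : ℕ → Bool) (E : List ℕ) : ℕ → ℕ → ℕ :=
  List.rec (motive := fun _ => ℕ → ℕ → ℕ)
    (fun pos s => iter (recStep M D V t) (Nat.sub L pos) s)
    (fun e _ ih pos s => force (ih (Nat.succ e))
      (recStep M D V (fun _ => true) (iter (recStep M D V t) (Nat.sub e pos) s))) E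

/-- The list `E` is increasing, with entries at least `pos` and below `L`. -/
def increasing (L : ℕ) (E : List ℕ) : ℕ → Bool :=
  List.rec (motive := fun _ => ℕ → Bool) (fun pos => Nat.ble pos L)
    (fun e _ ih pos => Nat.ble pos e && ih (Nat.succ e)) E

lemma scan_sound {M V L : ℕ} (hM : 0 < M) (t : ℕ → Bool) {x : ℕ → ℤ}
    (hx : ∀ i, (M : ℤ) ∣ x (i + 2) - (V * x (i + 1) - x i)) : ∀ (E : List ℕ) (pos : ℕ),
    increasing L E pos = true → scan M (M * M) V L t E pos (enc M (x pos) (x (pos + 1))) = M * M ∨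
      (scan M (M * M) V L t E pos (enc M (x pos) (x (pos + 1))) = enc M (x L) (x (L + 1)) ∧
        ∀ i, pos ≤ i → i < L → i ∉ E → t (x i % M).toNat = true) := by
  have shift : ∀ (t : ℕ → Bool) (pos n : ℕ),
      (recStep M (M * M) V t)^[n] (enc M (x pos) (x (pos + 1))) = M * M ∨
      ((recStep M (M * M) V t)^[n] (enc M (x pos) (x (pos + 1))) =
        enc M (x (pos + n)) (x (pos + n + 1)) ∧
        ∀ i < n, t (x (pos + i) % M).toNat = true) := by
    intro t pos n
    exact recStep_iterate hM t (x := fun i => x (pos + i)) (fun i => hx (pos + i)) n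
  have dead : ∀ (t : ℕ → Bool) (n : ℕ), (recStep M (M * M) V t)^[n] (M * M) = M * M := by
    intro t n
    exact Function.iterate_fixed (recStep_dead M V t) n
  have sdead : ∀ (E : List ℕ) (pos : ℕ), scan M (M * M) V L t E pos (M * M) = M * M := by
    intro E
    induction E with
    | nil => intro pos; exact (congrFun (iter_eq _ _) _).trans (dead t _)
    | cons e E ih =>
      intro pos
      have e1 : scan M (M * M) V L t (e :: E) pos (M * M) = force (scan M (M * M) V L t E (e + 1))
        (recStep M (M * M) V (fun _ => true) (iter (recStep M (M * M) V t) (e - pos) (M * M))) :=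
        rfl
      rw [e1, force_eq, iter_eq, dead, recStep_dead, ih]
  intro E
  induction E with
  | nil =>
    intro pos hpos
    have hpos' : pos ≤ L := Nat.ble_eq.mp hpos
    have e1 : scan M (M * M) V L t [] pos (enc M (x pos) (x (pos + 1))) =
      iter (recStep M (M * M) V t) (L - pos) (enc M (x pos) (x (pos + 1))) := rfl
    rw [e1, iter_eq]
    rcases shift t pos (L - pos) with h | ⟨h, h'⟩
    · left; exact h
    · right
      rw [h, Nat.add_sub_cancel' hpos']
      refine ⟨rfl, fun i hi hiL _ => ?_⟩
      have := h' (i - pos) (by omega)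
      rwa [Nat.add_sub_cancel' hi] at this
  | cons e E ih =>
    intro pos hpos
    have e0 : increasing L (e :: E) pos = (Nat.ble pos e && increasing L E (e + 1)) := rfl
    rw [e0, Bool.and_eq_true, Nat.ble_eq] at hpos
    have e1 : scan M (M * M) V L t (e :: E) pos (enc M (x pos) (x (pos + 1))) =
      force (scan M (M * M) V L t E (e + 1)) (recStep M (M * M) V (fun _ => true)
        (iter (recStep M (M * M) V t) (e - pos) (enc M (x pos) (x (pos + 1))))) := rfl
    rw [e1, force_eq, iter_eq]
    rcases shift t pos (e - pos) with h | ⟨h, h'⟩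
    · left; rw [h, recStep_dead, sdead]
    · rw [h, Nat.add_sub_cancel' hpos.1]
      have h2 : recStep M (M * M) V (fun _ => true) (enc M (x e) (x (e + 1))) =
          enc M (x (e + 1)) (x (e + 1 + 1)) := by
        rcases shift (fun _ => true) e 1 with h3 | ⟨h3, -⟩
        · exfalso
          rw [Function.iterate_one, recStep_enc hM] at h3
          simp only [if_true] at h3
          exact (enc_lt hM _ _).ne h3
        · exact h3
      rw [h2]
      rcases ih (e + 1) hpos.2 with h3 | ⟨h3, h4⟩
      · left; exact h3
      · right
        refine ⟨h3, fun i hi hiL hiE => ?_⟩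
        rw [List.mem_cons, not_or] at hiE
        rcases lt_or_gt_of_ne hiE.1 with hlt | hgt
        · have := h' (i - pos) (by omega)
          rwa [Nat.add_sub_cancel' hi] at this
        · exact h4 i (by omega) hiL hiE.2

/-- The sieve for one modulus: `s` is the state of the terms with indices `0` and `1`. -/
def scanCheck (V α γ δ L : ℕ) (qs E : List ℕ) (s : ℕ) : Bool :=
  qs.all primeTest && increasing L E 0 && Nat.blt 0 L &&
  force (fun M => force (fun D => Nat.beq
    (scan M D V L (testAt M α γ δ qs) E (nat_lit 0) s) s) (Nat.mul M M)) (listProd qs)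

lemma enc_inj {M : ℕ} (hM : 0 < M) {x y x' y' : ℤ} (h : enc M x y = enc M x' y') :
    (M : ℤ) ∣ x - x' ∧ (M : ℤ) ∣ y - y' := by
  have hM' : (0 : ℤ) < M := by exact_mod_cast hM
  have key : ∀ x y : ℤ, enc M x y % M = (x % M).toNat ∧ enc M x y / M = (y % M).toNat := by
    intro x y
    have h1 := Int.emod_lt_of_pos x hM'
    have h3 : (x % M).toNat < M := by omega
    exact ⟨by rw [enc, Nat.add_mul_mod_self_left, Nat.mod_eq_of_lt h3],
      by rw [enc, Nat.add_mul_div_left _ _ hM, Nat.div_eq_of_lt h3, zero_add]⟩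
  have h1 := key x y
  have h2 := key x' y'
  rw [h] at h1
  have e1 := h1.1.symm.trans h2.1
  have e2 := h1.2.symm.trans h2.2
  have := Int.emod_nonneg x hM'.ne'
  have := Int.emod_nonneg x' hM'.ne'
  have := Int.emod_nonneg y hM'.ne'
  have := Int.emod_nonneg y' hM'.ne'
  exact ⟨Int.ModEq.dvd (show x' ≡ x [ZMOD M] by unfold Int.ModEq; omega),
    Int.ModEq.dvd (show y' ≡ y [ZMOD M] by unfold Int.ModEq; omega)⟩

/-- A two-sided recurrence is periodic modulo `M` if one state recurs. -/
lemma periodic_of_state {M : ℤ} {y : ℤ → ℤ} {K : ℤ} (hy : ∀ n, y (n + 1) + y (n - 1) = K * y n)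
    {L : ℤ} (h0 : M ∣ y L - y 0) (h1 : M ∣ y (L + 1) - y 1) : ∀ n, M ∣ y (n + L) - y n := by
  have key : ∀ n : ℤ, M ∣ y (n + L) - y n ∧ M ∣ y (n + 1 + L) - y (n + 1) := by
    intro n
    induction n using Int.induction_on with
    | zero => exact ⟨by simpa using h0, by simpa [add_comm] using h1⟩
    | succ n ih =>
      refine ⟨ih.2, ?_⟩
      have e1 := hy ((n : ℤ) + 1 + L)
      have e2 := hy ((n : ℤ) + 1)
      rw [show (n : ℤ) + 1 + L + 1 = n + 1 + 1 + L by ring,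
        show (n : ℤ) + 1 + L - 1 = n + L by ring] at e1
      rw [show (n : ℤ) + 1 - 1 = n by ring] at e2
      have : y (n + 1 + 1 + L) - y (n + 1 + 1) =
          K * (y (n + 1 + L) - y (n + 1)) - (y (n + L) - y n) := by linear_combination e1 - e2
      rw [this]
      exact dvd_sub (ih.2.mul_left _) ih.1
    | pred n ih =>
      have e1 := hy (-(n : ℤ) + L)
      have e2 := hy (-(n : ℤ))
      rw [show -(n : ℤ) + L + 1 = -n + 1 + L by ring,
        show -(n : ℤ) + L - 1 = -n - 1 + L by ring] at e1
      have : y (-n - 1 + L) - y (-n - 1) =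
          K * (y (-n + L) - y (-n)) - (y (-n + 1 + L) - y (-n + 1)) := by
        linear_combination e1 - e2
      refine ⟨?_, by rw [show -(n : ℤ) - 1 + 1 = -n by ring]; exact ih.1⟩
      rw [this]
      exact dvd_sub (ih.1.mul_left _) ih.2
  exact fun n => (key n).1

lemma periodic_mul {M : ℤ} {y : ℤ → ℤ} {L : ℤ} (h : ∀ n, M ∣ y (n + L) - y n) (j : ℤ) :
    ∀ n, M ∣ y (n + L * j) - y n := by
  induction j using Int.induction_on with
  | zero => intro n; simp
  | succ j ih =>
    intro n
    have := dvd_add (h (n + L * j)) (ih n)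
    rw [show n + L * (j + 1) = n + L * j + L by ring]
    simpa using this
  | pred j ih =>
    intro n
    have := dvd_sub (ih n) (h (n + L * (-j - 1)))
    rw [show n + L * (-j - 1) + L = n + L * -j by ring] at this
    simpa using this

theorem scanCheck_sound {V α γ δ L : ℕ} {qs E : List ℕ} {s : ℕ}
    (h : scanCheck V α γ δ L qs E s = true) {y : ℤ → ℤ} {K : ℤ}
    (hy : ∀ n, y (n + 1) + y (n - 1) = K * y n) (hK : (qs.prod : ℤ) ∣ K - V)
    (hs : s = enc qs.prod (y 0) (y 1)) {n : ℤ} (hn : IsSquare ((α : ℤ) * (y n - γ) + δ)) :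
    ∃ e ∈ E, (L : ℤ) ∣ n - e := by
  simp only [scanCheck, force_eq, Bool.and_eq_true, Nat.beq_eq, Nat.blt_eq, listProd_eq] at h
  obtain ⟨⟨⟨hp, hinc⟩, hL⟩, hsc⟩ := h
  set M := qs.prod with hM
  have hM0 : 0 < M := by
    apply List.prod_pos
    intro q hq
    exact (primeTest_sound (List.all_eq_true.mp hp q hq)).1.pos
  have hdvd : ∀ q ∈ qs, q ∣ M := fun q hq => List.dvd_prod hq
  have hx : ∀ i : ℕ, (M : ℤ) ∣ y ((i + 2 : ℕ) : ℤ) - (V * y ((i + 1 : ℕ) : ℤ) - y (i : ℤ)) := by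
    intro i
    have e := hy ((i : ℤ) + 1)
    rw [show (i : ℤ) + 1 + 1 = ((i + 2 : ℕ) : ℤ) by push_cast; ring,
      show (i : ℤ) + 1 - 1 = i by ring] at e
    have : y ((i + 2 : ℕ) : ℤ) - (V * y ((i + 1 : ℕ) : ℤ) - y (i : ℤ)) =
        (K - V) * y ((i + 1 : ℕ) : ℤ) := by push_cast at e ⊢; linear_combination e
    rw [this]
    exact hK.mul_right _
  have hLz : (0 : ℤ) < L := by exact_mod_cast hL
  rcases scan_sound (L := L) hM0 (testAt M α γ δ qs) (x := fun i : ℕ => y (i : ℤ)) hx E 0 hinc with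
    h1 | ⟨h1, h2⟩
  · exfalso
    simp only [Nat.cast_zero, zero_add, Nat.cast_one] at h1
    rw [← hs] at h1
    exact (enc_lt hM0 (y 0) (y 1)).ne (hs.symm.trans (hsc.symm.trans h1))
  · simp only [Nat.cast_zero, zero_add, Nat.cast_one] at h1
    rw [← hs] at h1
    have h3 := enc_inj hM0 (h1.symm.trans (hsc.trans hs))
    have hper := periodic_of_state hy (L := L) h3.1 (by push_cast at h3; exact h3.2)
    set i := (n % L).toNat with hi
    have hi' : (i : ℤ) = n % L := Int.toNat_of_nonneg (Int.emod_nonneg _ hLz.ne')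
    have hiL : i < L := by have := Int.emod_lt_of_pos n hLz; omega
    have hdiv := Int.emod_add_mul_ediv n L
    by_cases hiE : i ∈ E
    · exact ⟨i, hiE, n / L, by rw [hi']; linarith⟩
    · exfalso
      have h4 := h2 i (Nat.zero_le _) hiL hiE
      refine testAt_sound hM0 hp hdvd h4 (w' := y n) ?_ hn
      have := periodic_mul hper (n / L) (i : ℤ)
      rw [hi', hdiv] at this
      rwa [hi']


/-! ### Lucas sequences -/

lemma lin_add (R x₀ x₁ : ℤ) (m : ℕ) : ∀ n, lin R x₀ x₁ (m + n + 1) =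
    lin R x₀ x₁ (m + 1) * lin R 0 1 (n + 1) - lin R x₀ x₁ m * lin R 0 1 n
  | 0 => by simp [lin]
  | 1 => by
    have e : lin R x₀ x₁ (m + 2) = R * lin R x₀ x₁ (m + 1) - lin R x₀ x₁ m := rfl
    show lin R x₀ x₁ (m + 2) = _
    rw [e]; simp [lin]; ring
  | (n + 2) => by
    have h1 := lin_add R x₀ x₁ m n
    have h2 := lin_add R x₀ x₁ m (n + 1)
    have e : lin R x₀ x₁ (m + (n + 2) + 1) =
      R * lin R x₀ x₁ (m + (n + 1) + 1) - lin R x₀ x₁ (m + n + 1) := rfl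
    have e1 : lin R 0 1 (n + 2 + 1) = R * lin R 0 1 (n + 1 + 1) - lin R 0 1 (n + 1) := rfl
    have e2 : lin R 0 1 (n + 2) = R * lin R 0 1 (n + 1) - lin R 0 1 n := rfl
    rw [e, h1, h2, e1, e2]
    ring

lemma lin_two_eq (R : ℤ) : ∀ n, lin R 2 R n = 2 * lin R 0 1 (n + 1) - R * lin R 0 1 n
  | 0 => by simp [lin]
  | 1 => by simp [lin]; ring
  | (n + 2) => by
    have h1 := lin_two_eq R n
    have h2 := lin_two_eq R (n + 1)
    have e : lin R 2 R (n + 2) = R * lin R 2 R (n + 1) - lin R 2 R n := rfl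
    have e1 : lin R 0 1 (n + 2 + 1) = R * lin R 0 1 (n + 1 + 1) - lin R 0 1 (n + 1) := rfl
    have e2 : lin R 0 1 (n + 2) = R * lin R 0 1 (n + 1) - lin R 0 1 n := rfl
    rw [e, h1, h2, e1, e2]; ring

/-- The step `n ↦ 2n + bit` for consecutive terms of the sequence `lin R 0 1` modulo `M`. -/
def lucStep (M R bit s : ℕ) : ℕ :=
  Bool.rec (motive := fun _ => ℕ)
    (Nat.add (Nat.mod (Nat.add (Nat.mul (Nat.div s M) (Nat.div s M))
        (Nat.mul (Nat.sub M (Nat.mod s M)) (Nat.mod s M))) M)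
      (Nat.mul M (Nat.mod (Nat.mul (Nat.div s M) (Nat.add (Nat.mul R (Nat.div s M))
        (Nat.mul (nat_lit 2) (Nat.sub M (Nat.mod s M))))) M)))
    (Nat.add (Nat.mod (Nat.mul (Nat.mod s M) (Nat.add (Nat.mul (nat_lit 2) (Nat.div s M))
        (Nat.mul R (Nat.sub M (Nat.mod s M))))) M)
      (Nat.mul M (Nat.mod (Nat.add (Nat.mul (Nat.div s M) (Nat.div s M))
        (Nat.mul (Nat.sub M (Nat.mod s M)) (Nat.mod s M))) M)))
    (Nat.beq bit (nat_lit 0))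

/-- The terms with indices `n` and `n + 1` of the sequence `lin R 0 1` modulo `M`. -/
def luc (M R fuel : ℕ) : ℕ → ℕ :=
  Nat.rec (motive := fun _ => ℕ → ℕ) (fun _ => M)
    (fun _ ih n => force (lucStep M R (Nat.mod n (nat_lit 2))) (ih (Nat.div n (nat_lit 2)))) fuel

lemma enc_mod_div {M : ℕ} (hM : 0 < M) (x y : ℤ) :
    ((enc M x y % M : ℕ) : ℤ) = x % M ∧ ((enc M x y / M : ℕ) : ℤ) = y % M ∧ enc M x y % M < M := by
  have hM' : (0 : ℤ) < M := by exact_mod_cast hM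
  have h1 := Int.emod_lt_of_pos x hM'
  have h2 := Int.emod_nonneg x hM'.ne'
  have h3 : (x % M).toNat < M := by omega
  refine ⟨?_, ?_, Nat.mod_lt _ hM⟩
  · rw [enc, Nat.add_mul_mod_self_left, Nat.mod_eq_of_lt h3, Int.toNat_of_nonneg h2]
  · rw [enc, Nat.add_mul_div_left _ _ hM, Nat.div_eq_of_lt h3, zero_add,
      Int.toNat_of_nonneg (Int.emod_nonneg _ hM'.ne')]

/-- A natural number of the form `u % M + M * (v % M)` encodes the pair `(x, y)`. -/
lemma enc_of_modEq {M u v : ℕ} {x y : ℤ} (hu : (u : ℤ) ≡ x [ZMOD M]) (hv : (v : ℤ) ≡ y [ZMOD M]) :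
    u % M + M * (v % M) = enc M x y := by
  rw [enc]
  have h1 : ((u % M : ℕ) : ℤ) = x % M := by rw [Int.natCast_mod]; exact hu
  have h2 : ((v % M : ℕ) : ℤ) = y % M := by rw [Int.natCast_mod]; exact hv
  rw [← h1, ← h2, Int.toNat_natCast, Int.toNat_natCast]

lemma luc_eq {M : ℕ} (hM : 1 < M) (R : ℕ) : ∀ fuel n, n < 2 ^ fuel →
    luc M R fuel n = enc M (lin R 0 1 n) (lin R 0 1 (n + 1)) := by
  intro fuel
  induction fuel with
  | zero =>
    intro n hn
    have : n = 0 := by simpa using hn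
    subst this
    show M = enc M 0 1
    have h1 : (1 : ℤ) % M = 1 := Int.emod_eq_of_lt (by norm_num) (by exact_mod_cast hM)
    simp [enc, h1]
  | succ f ih =>
    intro n hn
    have e : luc M R (f + 1) n = force (lucStep M R (n % 2)) (luc M R f (n / 2)) := rfl
    rw [e, force_eq, ih (n / 2) (by rw [pow_succ] at hn; omega)]
    obtain ⟨m, hm⟩ : ∃ m, m = n / 2 := ⟨_, rfl⟩
    rw [← hm]
    obtain ⟨h1, h2, h3⟩ := enc_mod_div (by omega : 0 < M) (lin R 0 1 m) (lin R 0 1 (m + 1))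
    obtain ⟨s, hs⟩ : ∃ s, s = enc M (lin R 0 1 m) (lin R 0 1 (m + 1)) := ⟨_, rfl⟩
    rw [← hs] at h1 h2 h3 ⊢
    have ha : ((s % M : ℕ) : ℤ) ≡ lin R 0 1 m [ZMOD M] := by rw [h1]; exact Int.mod_modEq _ _
    have hb : ((s / M : ℕ) : ℤ) ≡ lin R 0 1 (m + 1) [ZMOD M] := by
      rw [h2]; exact Int.mod_modEq _ _
    have hneg : ((M - s % M : ℕ) : ℤ) ≡ -lin R 0 1 m [ZMOD M] := by
      rw [Nat.cast_sub h3.le]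
      have e3 : (M : ℤ) ≡ 0 [ZMOD M] := by simp [Int.ModEq]
      simpa using e3.sub ha
    have d1 : lin R 0 1 (2 * m + 1) = lin R 0 1 (m + 1) * lin R 0 1 (m + 1) +
        -lin R 0 1 m * lin R 0 1 m := by
      have := lin_add R 0 1 m m
      rw [← two_mul] at this
      rw [this]; ring
    have d2 : lin R 0 1 (2 * m + 2) = lin R 0 1 (m + 1) * (R * lin R 0 1 (m + 1) +
        2 * -lin R 0 1 m) := by
      have := lin_add R 0 1 m (m + 1)
      rw [show m + (m + 1) + 1 = 2 * m + 2 by ring] at this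
      have e2 : lin R 0 1 (m + 1 + 1) = R * lin R 0 1 (m + 1) - lin R 0 1 m := rfl
      rw [this, e2]; ring
    have d0 : lin R 0 1 (2 * m) = lin R 0 1 m * (2 * lin R 0 1 (m + 1) + R * -lin R 0 1 m) := by
      have e2 : lin R 0 1 (2 * m + 2) = R * lin R 0 1 (2 * m + 1) - lin R 0 1 (2 * m) := rfl
      rw [d1, d2] at e2
      linear_combination e2
    have c1 : ((s / M * (s / M) + (M - s % M) * (s % M) : ℕ) : ℤ) ≡ lin R 0 1 (2 * m + 1)
        [ZMOD M] := by
      rw [d1, Nat.cast_add, Nat.cast_mul, Nat.cast_mul]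
      exact (hb.mul hb).add (hneg.mul ha)
    have c2 : ((s / M * (R * (s / M) + 2 * (M - s % M)) : ℕ) : ℤ) ≡ lin R 0 1 (2 * m + 2)
        [ZMOD M] := by
      rw [d2, Nat.cast_mul, Nat.cast_add, Nat.cast_mul, Nat.cast_mul]
      exact hb.mul ((hb.mul_left _).add (hneg.mul_left _))
    have c0 : ((s % M * (2 * (s / M) + R * (M - s % M)) : ℕ) : ℤ) ≡ lin R 0 1 (2 * m)
        [ZMOD M] := by
      rw [d0, Nat.cast_mul, Nat.cast_add, Nat.cast_mul, Nat.cast_mul]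
      exact ha.mul ((hb.mul_left _).add (hneg.mul_left _))
    have hst : lucStep M R (n % 2) s = Bool.rec (motive := fun _ => ℕ)
      ((s / M * (s / M) + (M - s % M) * (s % M)) % M +
        M * (s / M * (R * (s / M) + 2 * (M - s % M)) % M))
      (s % M * (2 * (s / M) + R * (M - s % M)) % M +
        M * ((s / M * (s / M) + (M - s % M) * (s % M)) % M)) (Nat.beq (n % 2) 0) := rfl
    rw [hst]
    rcases Nat.mod_two_eq_zero_or_one n with h0 | h0
    · rw [h0, show Nat.beq 0 0 = true from rfl]
      have hn2 : n = 2 * m := by omega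
      rw [hn2]
      exact enc_of_modEq c0 c1
    · rw [h0, show Nat.beq 1 0 = false from rfl]
      have hn2 : n = 2 * m + 1 := by omega
      rw [hn2]
      exact enc_of_modEq c1 c2

/-- The term of `lin R 2 R` modulo `M`, read off from the state `s` of `lin R 0 1`. -/
def lucV (M R s : ℕ) : ℕ :=
  Nat.mod (Nat.add (Nat.mul (nat_lit 2) (Nat.div s M)) (Nat.mul R (Nat.sub M (Nat.mod s M)))) M

lemma lucV_modEq {M : ℕ} (hM : 1 < M) {R s n : ℕ}
    (hs : s = enc M (lin R 0 1 n) (lin R 0 1 (n + 1))) :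
    (lucV M R s : ℤ) ≡ lin R 2 R n [ZMOD M] ∧ lucV M R s < M := by
  obtain ⟨h1, h2, h3⟩ := enc_mod_div (by omega : 0 < M) (lin R 0 1 n) (lin R 0 1 (n + 1))
  rw [← hs] at h1 h2 h3
  refine ⟨?_, Nat.mod_lt _ (by omega)⟩
  have e : lucV M R s = (2 * (s / M) + R * (M - s % M)) % M := rfl
  rw [e, lin_two_eq, Int.natCast_mod]
  refine (Int.mod_modEq _ _).trans ?_
  have ha : ((s % M : ℕ) : ℤ) ≡ lin R 0 1 n [ZMOD M] := by rw [h1]; exact Int.mod_modEq _ _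
  have hb : ((s / M : ℕ) : ℤ) ≡ lin R 0 1 (n + 1) [ZMOD M] := by rw [h2]; exact Int.mod_modEq _ _
  rw [Nat.cast_add, Nat.cast_mul, Nat.cast_mul, Nat.cast_sub h3.le]
  have e3 : (M : ℤ) ≡ 0 [ZMOD M] := by simp [Int.ModEq]
  have := (hb.mul_left 2).add ((e3.sub ha).mul_left (R : ℤ))
  refine this.trans ?_
  rw [zero_sub, mul_neg, ← sub_eq_add_neg]

/-! ### Identities for two-sided recurrences -/

lemma two_sided_add {w : ℤ → ℤ} {R : ℤ} (hw : ∀ n, w (n + 1) + w (n - 1) = R * w n) (m : ℕ) :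
    ∀ n, w (n + m) + w (n - m) = lin R 2 R m * w n := by
  induction m using Nat.twoStepInduction with
  | zero => intro n; simp [lin]; ring
  | one => intro n; simpa [lin] using hw n
  | more m h1 h2 =>
    intro n
    have e : lin R 2 R (m + 2) = R * lin R 2 R (m + 1) - lin R 2 R m := rfl
    have e1 := hw (n + (m + 1 : ℕ))
    have e2 := hw (n - (m + 1 : ℕ))
    push_cast at *
    rw [show n + ((m : ℤ) + 1) + 1 = n + (m + 2) by ring,
      show n + ((m : ℤ) + 1) - 1 = n + m by ring] at e1
    rw [show n - ((m : ℤ) + 1) + 1 = n - m by ring,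
      show n - ((m : ℤ) + 1) - 1 = n - (m + 2) by ring] at e2
    rw [e]
    linear_combination e1 + e2 + R * h2 n - h1 n

lemma two_sided_shift {w : ℤ → ℤ} {R : ℤ} (hw : ∀ n, w (n + 1) + w (n - 1) = R * w n) (e : ℤ) :
    ∀ n : ℕ, w (e + n) = lin R (w e) (w (e + 1)) n := by
  intro n
  induction n using Nat.twoStepInduction with
  | zero => simp [lin]
  | one => simp [lin]
  | more n h1 h2 =>
    have e1 : lin R (w e) (w (e + 1)) (n + 2) =
      R * lin R (w e) (w (e + 1)) (n + 1) - lin R (w e) (w (e + 1)) n := rfl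
    have e2 := hw (e + n + 1)
    rw [e1, ← h1, ← h2]
    push_cast
    rw [show e + (n : ℤ) + 1 - 1 = e + n by ring] at e2
    rw [show e + ((n : ℤ) + 2) = e + n + 1 + 1 by ring, show e + ((n : ℤ) + 1) = e + n + 1 by ring]
    linarith

lemma two_sided_step {w : ℤ → ℤ} {R : ℤ} (hw : ∀ n, w (n + 1) + w (n - 1) = R * w n) (e : ℤ)
    (L : ℕ) : ∀ j : ℤ, w (e + L * (j + 1)) + w (e + L * (j - 1)) = lin R 2 R L * w (e + L * j) := by
  intro j
  rw [← two_sided_add hw L (e + L * j)]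
  congr 2 <;> ring

/-- The sequence `lin R 2 R` extended to all integers. -/
lemma two_sided_lucas (R : ℤ) : ∀ n : ℤ, lin R 2 R (n + 1).natAbs + lin R 2 R (n - 1).natAbs =
    R * lin R 2 R n.natAbs := by
  intro n
  have key : ∀ m : ℕ, lin R 2 R (m + 2) + lin R 2 R m = R * lin R 2 R (m + 1) := by
    intro m
    have e : lin R 2 R (m + 2) = R * lin R 2 R (m + 1) - lin R 2 R m := rfl
    rw [e]; ring
  rcases lt_trichotomy n 0 with h | rfl | h
  · obtain ⟨m, rfl⟩ : ∃ m : ℕ, n = -(m + 1) := ⟨(-n - 1).toNat, by omega⟩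
    have := key m
    rw [show (-((m : ℤ) + 1) + 1).natAbs = m by omega, show (-((m : ℤ) + 1) - 1).natAbs = m + 2 by
      omega, show (-((m : ℤ) + 1)).natAbs = m + 1 by omega]
    linarith
  · simp [lin]; ring
  · obtain ⟨m, rfl⟩ : ∃ m : ℕ, n = m + 1 := ⟨(n - 1).toNat, by omega⟩
    have := key m
    rw [show ((m : ℤ) + 1 + 1).natAbs = m + 2 by omega, show ((m : ℤ) + 1 - 1).natAbs = m by
      omega, show ((m : ℤ) + 1).natAbs = m + 1 by omega]
    linarith

lemma lucas_mul (R : ℤ) (m : ℕ) : ∀ n, lin R 2 R (m * n) = lin (lin R 2 R m) 2 (lin R 2 R m) n := by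
  intro n
  induction n using Nat.twoStepInduction with
  | zero => simp [lin]
  | one => simp [lin]
  | more n h1 h2 =>
    have e : lin (lin R 2 R m) 2 (lin R 2 R m) (n + 2) = lin R 2 R m *
      lin (lin R 2 R m) 2 (lin R 2 R m) (n + 1) - lin (lin R 2 R m) 2 (lin R 2 R m) n := rfl
    rw [e, ← h1, ← h2]
    have := two_sided_step (w := fun n : ℤ => lin R 2 R n.natAbs)
      (two_sided_lucas R) 0 m ((n : ℤ) + 1)
    rw [show (0 + (m : ℤ) * ((n : ℤ) + 1 + 1)).natAbs = m * (n + 2) by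
        rw [show (0 + (m : ℤ) * ((n : ℤ) + 1 + 1)) = ((m * (n + 2) : ℕ) : ℤ) by push_cast; ring]
        exact Int.natAbs_natCast _,
      show (0 + (m : ℤ) * ((n : ℤ) + 1 - 1)).natAbs = m * n by
        rw [show (0 + (m : ℤ) * ((n : ℤ) + 1 - 1)) = ((m * n : ℕ) : ℤ) by push_cast; ring]
        exact Int.natAbs_natCast _,
      show (0 + (m : ℤ) * ((n : ℤ) + 1)).natAbs = m * (n + 1) by
        rw [show (0 + (m : ℤ) * ((n : ℤ) + 1)) = ((m * (n + 1) : ℕ) : ℤ) by push_cast; ring]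
        exact Int.natAbs_natCast _] at this
    linarith

lemma lucas_two_mul (R : ℤ) (m : ℕ) : lin R 2 R (m * 2) = lin R 2 R m ^ 2 - 2 := by
  rw [lucas_mul]; simp [lin]; ring

lemma even_lucas {R : ℤ} {m : ℕ} (h : Even R ∨ 3 ∣ m) : Even (lin R 2 R m) := by
  rcases h with h | ⟨k, rfl⟩
  · induction m using Nat.twoStepInduction with
    | zero => simp [lin]
    | one => simpa [lin] using h
    | more m h1 h2 =>
      have e : lin R 2 R (m + 2) = R * lin R 2 R (m + 1) - lin R 2 R m := rfl
      rw [e]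
      exact (h.mul_right _).sub h1
  · rw [mul_comm, lucas_mul]
    have e : lin (lin R 2 R k) 2 (lin R 2 R k) 3 = lin R 2 R k * (lin R 2 R k ^ 2 - 3) := by
      simp [lin]; ring
    rw [e, Int.even_mul, Int.even_sub, Int.even_pow' two_ne_zero]
    simp only [show ¬ Even (3 : ℤ) by decide, iff_false]
    exact em _

lemma lucas_mod_sixteen {R : ℤ} {m : ℕ} (h : Even R ∨ 3 ∣ m) :
    ∃ q, lin R 2 R (m * 2 * 2) = 2 * (8 * q + 1) := by
  obtain ⟨u, hu⟩ := even_lucas h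
  rw [lucas_two_mul, lucas_two_mul, hu]
  refine ⟨u ^ 4 - u ^ 2, ?_⟩
  ring

lemma lucas_pos {R : ℤ} (hR : 2 ≤ R) (m : ℕ) : 0 < lin R 2 R m := by
  have := (lin_bounds hR zero_le_two hR m).1
  linarith

/-- `w (e + 2 m j) ≡ - w e` modulo the `m`-th Lucas number, for odd `j`. -/
lemma lucas_dvd_add {w : ℤ → ℤ} {R : ℤ} (hw : ∀ n, w (n + 1) + w (n - 1) = R * w n) (e : ℤ) (m : ℕ)
    {j : ℤ} (hj : Odd j) : lin R 2 R m ∣ w (e + 2 * m * j) + w e := by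
  have h1 : ∀ n, lin R 2 R m ∣ w (n + 2 * m) + w n := by
    intro n
    have := two_sided_add hw m (n + m)
    rw [show n + (m : ℤ) + m = n + 2 * m by ring, show n + (m : ℤ) - m = n by ring] at this
    exact ⟨_, this⟩
  have h2 : ∀ n, lin R 2 R m ∣ w (n + 4 * m) - w n := by
    intro n
    have := dvd_sub (h1 (n + 2 * m)) (h1 n)
    rw [show n + 2 * (m : ℤ) + 2 * m = n + 4 * m by ring] at this
    have e : w (n + 4 * m) - w n = w (n + 4 * m) + w (n + 2 * m) - (w (n + 2 * m) + w n) := by ring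
    rwa [e]
  obtain ⟨i, rfl⟩ := hj
  have h3 := periodic_mul h2 i (e + 2 * m)
  have h4 := dvd_add h3 (h1 e)
  rw [show e + 2 * (m : ℤ) + 4 * m * i = e + 2 * m * (2 * i + 1) by ring] at h4
  have e : w (e + 2 * m * (2 * i + 1)) + w e = w (e + 2 * m * (2 * i + 1)) - w (e + 2 * m) +
    (w (e + 2 * m) + w e) := by ring
  rwa [e]

section

open NumberTheorySymbols

/-! ### Jacobi symbols -/

/-- Whether the product of the Legendre symbols of `2 x` modulo the primes `ps` is `-1`. -/
def legendreSign (ps : List ℕ) (x : ℕ) : Bool :=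
  List.rec (motive := fun _ => Bool) false
    (fun p _ ih => Bool.rec (motive := fun _ => Bool) (Bool.not ih) ih
      (Nat.beq (powMod p (Nat.mod (Nat.mul (nat_lit 2) x) p) (nat_lit 5) (Nat.div p (nat_lit 2)))
        (nat_lit 1))) ps

lemma legendreSign_sound {ps : List ℕ} (hp : ∀ p ∈ ps, p.Prime ∧ p ≠ 2 ∧ p < 2 ^ 35) {x : ℕ} {v : ℤ}
    (hx : ∀ p ∈ ps, (p : ℤ) ∣ x - 2 * v) (hc : ∀ p ∈ ps, ¬ p ∣ x) :
    J(v | ps.prod) = if legendreSign ps x then -1 else 1 := by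
  induction ps with
  | nil => simp [legendreSign]
  | cons p ps ih =>
    obtain ⟨hp1, hp2, hp3⟩ := hp p List.mem_cons_self
    have := Fact.mk hp1
    have hih := ih (fun q hq => hp q (List.mem_cons_of_mem _ hq))
      (fun q hq => hx q (List.mem_cons_of_mem _ hq)) (fun q hq => hc q (List.mem_cons_of_mem _ hq))
    have hx0 : (x : ZMod p) = 2 * v := by
      have := (ZMod.intCast_zmod_eq_zero_iff_dvd _ p).mpr (hx p List.mem_cons_self)
      push_cast at this
      exact sub_eq_zero.mp this
    have hxne : (x : ZMod p) ≠ 0 := by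
      rw [ne_eq, ZMod.natCast_eq_zero_iff]; exact hc p List.mem_cons_self
    have hvne : (v : ZMod p) ≠ 0 := fun h => hxne (by rw [hx0, h, mul_zero])
    have h2ne : (2 : ZMod p) ≠ 0 := fun h => hxne (by rw [hx0, h, zero_mul])
    have hp3' : 2 < p := lt_of_le_of_ne hp1.two_le (Ne.symm hp2)
    have hodd : 2 * (p / 2) = p - 1 := by have := hp1.eq_two_or_odd; omega
    have hpw := powMod_modEq p (2 * x % p) 5 (p / 2) (by norm_num at hp3 ⊢; omega)
    have hpw' : (powMod p (2 * x % p) 5 (p / 2) : ZMod p) = (v : ZMod p) ^ (p / 2) := by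
      have h1 := (ZMod.natCast_eq_natCast_iff _ _ _).mpr
        (hpw.trans ((Nat.mod_modEq (2 * x) p).pow (p / 2)))
      rw [h1]
      push_cast
      rw [hx0, ← mul_assoc, ← sq, mul_pow, ← pow_mul, hodd, ZMod.pow_card_sub_one_eq_one h2ne,
        one_mul]
    have hne : ps.prod ≠ 0 := by
      rw [ne_eq, List.prod_eq_zero_iff]
      intro h0
      exact (hp 0 (List.mem_cons_of_mem _ h0)).1.ne_zero rfl
    have := NeZero.mk hne
    rw [List.prod_cons, jacobiSym.mul_right, ← jacobiSym.legendreSym.to_jacobiSym, hih]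
    have e : legendreSign (p :: ps) x = Bool.rec (motive := fun _ => Bool)
      (Bool.not (legendreSign ps x)) (legendreSign ps x)
      (Nat.beq (powMod p (2 * x % p) 5 (p / 2)) 1) := rfl
    rcases hb : Nat.beq (powMod p (2 * x % p) 5 (p / 2)) 1 with _ | _
    · have hl : legendreSym p v = -1 := by
        rcases legendreSym.eq_one_or_neg_one p hvne with h1 | h1
        · exfalso
          have h2 := legendreSym.eq_pow p v
          rw [h1, ← hpw'] at h2
          have h3 : ((powMod p (2 * x % p) 5 (p / 2) : ℕ) : ZMod p) = ((1 : ℕ) : ZMod p) := by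
            push_cast at h2 ⊢; exact h2.symm
          rw [ZMod.natCast_eq_natCast_iff] at h3
          have hlt : powMod p (2 * x % p) 5 (p / 2) < p := by
            have : powMod p (2 * x % p) 5 (p / 2) = Bool.rec (motive := fun _ => ℕ)
              (powMod p (2 * x % p) 4 (p / 2 / 128) ^ 128 * (2 * x % p) ^ (p / 2 % 128) % p) 1
              (Nat.beq (p / 2) 0) := rfl
            rw [this]
            rcases Nat.beq (p / 2) 0 with _ | _
            · exact Nat.mod_lt _ hp1.pos
            · exact hp1.one_lt
          have h4 : powMod p (2 * x % p) 5 (p / 2) = 1 := by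
            have := Nat.ModEq.eq_of_lt_of_lt h3 hlt hp1.one_lt
            exact this
          rw [h4] at hb
          exact absurd hb (by decide)
        · exact h1
      rw [e, hb, hl]
      rcases legendreSign ps x with _ | _ <;> simp
    · have hl : legendreSym p v = 1 := by
        rw [Nat.beq_eq] at hb
        rw [legendreSym.eq_one_iff p hvne, ZMod.euler_criterion p hvne, ← hpw', hb]
        simp
      rw [e, hb, hl]
      rcases legendreSign ps x with _ | _ <;> simp

/-- The Jacobi symbol of `± 2 ^ i * inert * act` modulo `v ≡ 1 (mod 8)`. -/
lemma jacobi_eq {v i : ℕ} {inert act : List ℕ} {G : ℤ} (hv : v % 8 = 1)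
    (hI : ∀ n ∈ inert, n % 2 = 1 ∧ (n : ℤ) ∣ v - 1) (hA : ∀ p ∈ act, p % 2 = 1)
    (hG : G = ((2 ^ i * (inert.prod * act.prod) : ℕ) : ℤ) ∨
      G = -((2 ^ i * (inert.prod * act.prod) : ℕ) : ℤ)) : J(G | v) = J((v : ℤ) | act.prod) := by
  have hvodd : Odd v := Nat.odd_iff.mpr (by omega)
  have prod_odd : ∀ l : List ℕ, (∀ n ∈ l, n % 2 = 1) → Odd l.prod := by
    intro l hl
    induction l with
    | nil => simp
    | cons n l ih =>
      rw [List.prod_cons]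
      exact (Nat.odd_iff.mpr (hl n List.mem_cons_self)).mul
        (ih fun m hm => hl m (List.mem_cons_of_mem _ hm))
  have h2 : J(2 | v) = 1 := by
    rw [jacobiSym.at_two hvodd, ZMod.χ₈_nat_eq_if_mod_eight]
    simp [hv, show v % 2 = 1 by omega]
  have hneg : J(G | v) = J(((2 ^ i * (inert.prod * act.prod) : ℕ) : ℤ) | v) := by
    rcases hG with rfl | rfl
    · rfl
    · rw [jacobiSym.neg _ hvodd, ZMod.χ₄_nat_one_mod_four (by omega), one_mul]
  have hin : J((v : ℤ) | inert.prod) = 1 := by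
    have key : ∀ l : List ℕ, (∀ n ∈ l, n % 2 = 1 ∧ (n : ℤ) ∣ v - 1) → J((v : ℤ) | l.prod) = 1 := by
      intro l hl
      induction l with
      | nil => simp
      | cons n l ih =>
        have hn := hl n List.mem_cons_self
        have := NeZero.mk (show n ≠ 0 by omega)
        have := NeZero.mk (show l.prod ≠ 0 from (prod_odd l fun m hm =>
          (hl m (List.mem_cons_of_mem _ hm)).1).pos.ne')
        rw [List.prod_cons, jacobiSym.mul_right, ih fun m hm => hl m (List.mem_cons_of_mem _ hm),
          jacobiSym.mod_left, show (v : ℤ) % n = 1 % n from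
            (Int.emod_emod_of_dvd _ (dvd_refl _)).symm.trans (by
              rw [Int.emod_emod_of_dvd _ (dvd_refl _)]
              exact (Int.emod_eq_emod_iff_emod_sub_eq_zero.mpr (Int.emod_eq_zero_of_dvd hn.2))),
          ← jacobiSym.mod_left, jacobiSym.one_left, one_mul]
    exact key inert hI
  rw [hneg]
  push_cast
  rw [jacobiSym.mul_left, jacobiSym.pow_left, h2, one_pow, one_mul, jacobiSym.mul_left]
  have r1 := jacobiSym.quadratic_reciprocity_one_mod_four (a := v) (b := inert.prod) (by omega)
    (prod_odd _ fun n hn => (hI n hn).1)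
  have r2 := jacobiSym.quadratic_reciprocity_one_mod_four (a := v) (b := act.prod) (by omega)
    (prod_odd _ hA)
  have c1 : ((inert.map (Nat.cast : ℕ → ℤ)).prod) = ((inert.prod : ℕ) : ℤ) := by simp
  have c2 : ((act.map (Nat.cast : ℕ → ℤ)).prod) = ((act.prod : ℕ) : ℤ) := by simp
  rw [c1, c2, ← r2, ← r1, hin, one_mul]

/-! ### Covering all powers of two -/

/-- `x ↦ x ^ 2 - 2` modulo `M`, iterated `n` times; `N = M - 2`. -/
def sqIter (M N n : ℕ) : ℕ → ℕ :=
  Nat.rec (motive := fun _ => ℕ → ℕ) (fun x => x)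
    (fun _ ih x => force ih (Nat.mod (Nat.add (Nat.mul x x) N) M)) n

/-- `x ↦ x ^ 2 - 2` modulo `M`, iterated `3 n` times; `N = M - 2`. -/
def sqIterThree (M N n : ℕ) : ℕ → ℕ :=
  Nat.rec (motive := fun _ => ℕ → ℕ) (fun x => x)
    (fun _ ih x => force ih (Nat.mod (Nat.add (Nat.mul
      (Nat.add (Nat.mul (Nat.add (Nat.mul x x) N) (Nat.add (Nat.mul x x) N)) N)
      (Nat.add (Nat.mul (Nat.add (Nat.mul x x) N) (Nat.add (Nat.mul x x) N)) N)) N) M)) n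

lemma sq_step {M : ℕ} (hM : 2 ≤ M) {x : ℕ} {R : ℤ} {m : ℕ} (hx : (x : ℤ) ≡ lin R 2 R m [ZMOD M]) :
    ((x * x + (M - 2) : ℕ) : ℤ) ≡ lin R 2 R (m * 2) [ZMOD M] := by
  rw [lucas_two_mul, Nat.cast_add, Nat.cast_mul, Nat.cast_sub hM]
  have e3 : (M : ℤ) ≡ 0 [ZMOD M] := by simp [Int.ModEq]
  have := (hx.mul hx).add (e3.sub (Int.ModEq.refl 2))
  refine this.trans ?_
  rw [zero_sub, ← sub_eq_add_neg, sq]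

lemma sqIter_modEq {M : ℕ} (hM : 2 ≤ M) (R : ℤ) : ∀ (n x m : ℕ),
    (x : ℤ) ≡ lin R 2 R m [ZMOD M] → (x < M) →
    (sqIter M (M - 2) n x : ℤ) ≡ lin R 2 R (m * 2 ^ n) [ZMOD M] ∧ sqIter M (M - 2) n x < M := by
  intro n
  induction n with
  | zero => intro x m hx hlt; simpa [sqIter] using ⟨hx, hlt⟩
  | succ n ih =>
    intro x m hx hlt
    have e : sqIter M (M - 2) (n + 1) x = force (sqIter M (M - 2) n)
      ((x * x + (M - 2)) % M) := rfl
    rw [e, force_eq, pow_succ', ← mul_assoc]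
    refine ih _ _ ?_ (Nat.mod_lt _ (by omega))
    rw [Int.natCast_mod]
    exact (Int.mod_modEq _ _).trans (sq_step hM hx)

lemma sqIterThree_modEq {M : ℕ} (hM : 2 ≤ M) (R : ℤ) : ∀ (n x m : ℕ),
    (x : ℤ) ≡ lin R 2 R m [ZMOD M] → (x < M) →
    (sqIterThree M (M - 2) n x : ℤ) ≡ lin R 2 R (m * 2 ^ (3 * n)) [ZMOD M] ∧
      sqIterThree M (M - 2) n x < M := by
  intro n
  induction n with
  | zero => intro x m hx hlt; simpa [sqIterThree] using ⟨hx, hlt⟩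
  | succ n ih =>
    intro x m hx hlt
    obtain ⟨y, hy⟩ : ∃ y, y = x * x + (M - 2) := ⟨_, rfl⟩
    obtain ⟨z, hz⟩ : ∃ z, z = y * y + (M - 2) := ⟨_, rfl⟩
    have e : sqIterThree M (M - 2) (n + 1) x = force (sqIterThree M (M - 2) n)
      ((z * z + (M - 2)) % M) := by rw [hz, hy]; rfl
    rw [e, force_eq, show m * 2 ^ (3 * (n + 1)) = m * 2 * 2 * 2 * 2 ^ (3 * n) by ring]
    refine ih _ _ ?_ (Nat.mod_lt _ (by omega))
    rw [Int.natCast_mod]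
    have h1 := sq_step hM hx
    rw [← hy] at h1
    have h2 := sq_step hM h1
    rw [← hz] at h2
    exact (Int.mod_modEq _ _).trans (sq_step hM h2)

/-- One step in the computation of the mask of the signs: the state is `x + M * mask`. -/
def coverStep (M N D : ℕ) (act : List ℕ) (s : ℕ) : ℕ :=
  force (fun x => Nat.add (sqIter M N (Nat.mod D (nat_lit 3)) (sqIterThree M N
      (Nat.div D (nat_lit 3)) x))
    (Nat.mul M (Nat.add (Nat.mul (nat_lit 2) (Nat.div s M))
      (Bool.rec (motive := fun _ => ℕ) (nat_lit 0) (Bool.rec (motive := fun _ => ℕ) (nat_lit 0)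
        (nat_lit 1) (legendreSign act x)) (Nat.beq (Nat.gcd x M) (nat_lit 1)))))) (Nat.mod s M)

/-- The sign at `x` is `-1`. -/
def signAt (M : ℕ) (act : List ℕ) (x : ℕ) : Bool := Nat.beq (Nat.gcd x M) 1 && legendreSign act x

lemma coverStep_iterate {M : ℕ} (hM : 2 ≤ M) (R : ℤ) (D : ℕ) (act : List ℕ) {x m : ℕ}
    (hx : (x : ℤ) ≡ lin R 2 R m [ZMOD M]) (hlt : x < M) : ∀ n : ℕ, ∃ y b : ℕ,
    (coverStep M (M - 2) D act)^[n] x = y + M * b ∧ y < M ∧ b < 2 ^ n ∧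
    (y : ℤ) ≡ lin R 2 R (m * 2 ^ (D * n)) [ZMOD M] ∧
    ∀ j < n, b.testBit (n - 1 - j) = true → ∃ z : ℕ, z < M ∧
      (z : ℤ) ≡ lin R 2 R (m * 2 ^ (D * j)) [ZMOD M] ∧ signAt M act z = true := by
  intro n
  induction n with
  | zero => exact ⟨x, 0, by simp, hlt, by simp, by simpa using hx, by omega⟩
  | succ n ih =>
    obtain ⟨y, b, h1, h2, h3, h4, h5⟩ := ih
    rw [Function.iterate_succ_apply', h1]
    have hmod : (y + M * b) % M = y := by rw [Nat.add_mul_mod_self_left, Nat.mod_eq_of_lt h2]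
    have hdiv : (y + M * b) / M = b := by
      rw [Nat.add_mul_div_left _ _ (by omega), Nat.div_eq_of_lt h2, zero_add]
    obtain ⟨t, ht⟩ : ∃ t : ℕ, t = Bool.rec (motive := fun _ => ℕ) 0 (Bool.rec (motive := fun _ => ℕ)
      0 1 (legendreSign act y)) (Nat.beq (Nat.gcd y M) 1) := ⟨_, rfl⟩
    have ht' : t = if signAt M act y then 1 else 0 := by
      rw [ht, signAt]
      rcases Nat.beq (Nat.gcd y M) 1 with _ | _
      · rfl
      · rcases legendreSign act y with _ | _ <;> rfl
    have e : coverStep M (M - 2) D act (y + M * b) = force (fun x => sqIter M (M - 2) (D % 3)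
      (sqIterThree M (M - 2) (D / 3) x) + M * (2 * ((y + M * b) / M) + Bool.rec
        (motive := fun _ => ℕ) 0 (Bool.rec (motive := fun _ => ℕ) 0 1 (legendreSign act x))
          (Nat.beq (Nat.gcd x M) 1))) ((y + M * b) % M) := rfl
    rw [e, force_eq, hmod, hdiv, ← ht]
    obtain ⟨g1, g2⟩ := sqIterThree_modEq hM R (D / 3) y _ h4 h2
    obtain ⟨g3, g4⟩ := sqIter_modEq hM R (D % 3) _ _ g1 g2
    have htle : t ≤ 1 := by rw [ht']; split <;> omega
    refine ⟨_, 2 * b + t, rfl, g4, by rw [pow_succ]; omega, ?_, ?_⟩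
    · rw [mul_assoc, mul_assoc, ← pow_add, ← pow_add] at g3
      rwa [show D * n + (3 * (D / 3) + D % 3) = D * (n + 1) by rw [Nat.div_add_mod]; ring] at g3
    · intro j hj hbit
      rcases Nat.lt_succ_iff_lt_or_eq.mp hj with hlt' | rfl
      · apply h5 j hlt'
        rw [show n + 1 - 1 - j = (n - 1 - j) + 1 by omega, Nat.testBit_succ] at hbit
        rwa [show (2 * b + t) / 2 = b by omega] at hbit
      · refine ⟨y, h2, h4, ?_⟩
        rw [show j + 1 - 1 - j = 0 by omega, Nat.testBit_zero, decide_eq_true_eq] at hbit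
        by_contra hs
        rw [if_neg hs] at ht'
        omega

/-- The union of the masks `B >>> (P - m)` over the entries `(τ, m)`. -/
def rowMask (B P : ℕ) (row : List (ℕ × ℕ)) : ℕ :=
  List.rec (motive := fun _ => ℕ) (nat_lit 0)
    (fun t _ ih => Nat.lor ih (Nat.shiftRight B (Nat.sub P t.2))) row

lemma rowMask_testBit {B P i : ℕ} : ∀ row : List (ℕ × ℕ), (rowMask B P row).testBit i = true →
    ∃ t ∈ row, B.testBit (P - t.2 + i) = true := by
  intro row
  induction row with
  | nil => intro h; simp [rowMask] at h
  | cons t row ih =>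
    intro h
    have e : rowMask B P (t :: row) = rowMask B P row ||| (B >>> (P - t.2)) := rfl
    rw [e, Nat.testBit_or, Bool.or_eq_true, Nat.testBit_shiftRight] at h
    rcases h with h | h
    · obtain ⟨t', ht', h'⟩ := ih h
      exact ⟨t', List.mem_cons_of_mem _ ht', h'⟩
    · exact ⟨t, List.mem_cons_self, h⟩

/-- The certificate that the residue `e` contains only the index `e` of a square. -/
structure CoverCert where
  e : ℕ
  s : ℕ
  T : ℕ
  i : ℕ
  D : ℕ
  P : ℕ
  O : ℕ
  M : ℕ
  inert : List ℕ
  act : List ℕ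
  rows : List (List (ℕ × ℕ))

/-- The entry `(τ, m)` in row `ρ` satisfies `τ ≡ ± 2 ^ (D * m + ρ)` modulo `O`. -/
def entryCheck (L s T D P O ρ : ℕ) (t : ℕ × ℕ) : Bool :=
  Nat.beq (Nat.mod t.1 2) 1 && Nat.beq (Nat.mod L (2 ^ (s + 1) * (T * t.1))) 0 && Nat.blt t.2 P &&
  force (fun z => Nat.beq (Nat.mod z O) (Nat.mod t.1 O) || Nat.beq (Nat.mod (Nat.add z t.1) O) 0)
    (powMod O (nat_lit 2) (nat_lit 5) (Nat.add (Nat.mul D t.2) ρ))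

def rowsCheck (L s T D P O B : ℕ) (rows : List (List (ℕ × ℕ))) : ℕ → Bool :=
  List.rec (motive := fun _ => ℕ → Bool) (fun ρ => Nat.beq ρ D)
    (fun row _ ih ρ => row.all (entryCheck L s T D P O ρ) &&
      Nat.beq (Nat.mod (rowMask B P row) (2 ^ P)) (2 ^ P - 1) && force ih (Nat.succ ρ)) rows

lemma rowsCheck_sound {L s T D P O B : ℕ} : ∀ (rows : List (List (ℕ × ℕ))) (ρ₀ : ℕ),
    rowsCheck L s T D P O B rows ρ₀ = true → ∀ ρ, ρ₀ ≤ ρ → ρ < D → ∃ row : List (ℕ × ℕ),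
      (∀ t ∈ row, entryCheck L s T D P O ρ t = true) ∧
      rowMask B P row % 2 ^ P = 2 ^ P - 1 := by
  intro rows
  induction rows with
  | nil => intro ρ₀ h ρ h1 h2; have : ρ₀ = D := Nat.beq_eq.mp h; omega
  | cons row rows ih =>
    intro ρ₀ h ρ h1 h2
    have e : rowsCheck L s T D P O B (row :: rows) ρ₀ = (row.all (entryCheck L s T D P O ρ₀) &&
      Nat.beq (rowMask B P row % 2 ^ P) (2 ^ P - 1) &&
        force (rowsCheck L s T D P O B rows) (ρ₀ + 1)) := rfl
    rw [e, force_eq, Bool.and_eq_true, Bool.and_eq_true, List.all_eq_true, Nat.beq_eq] at h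
    rcases h1.eq_or_lt with rfl | hlt
    · exact ⟨row, h.1.1, h.1.2⟩
    · exact ih (ρ₀ + 1) h.2 ρ hlt h2

/-- Every `σ` is covered: some entry `(τ, m)` in row `ρ` has sign `-1` at `D * m + ρ + σ`. -/
lemma cover_exists {M : ℕ} (hM : 2 ≤ M) {R : ℤ} {L s T D P O : ℕ} {act : List ℕ}
    {rows : List (List (ℕ × ℕ))} {x m b : ℕ} (hx : (x : ℤ) ≡ lin R 2 R m [ZMOD M]) (hlt : x < M)
    (hD : 0 < D) (hP : 0 < P) (hit : (coverStep M (M - 2) D act)^[P] x = x + M * b)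
    (hrows : rowsCheck L s T D P O (b + b * 2 ^ P) rows 0 = true) (σ : ℕ) :
    ∃ (ρ : ℕ) (t : ℕ × ℕ) (z : ℕ), ρ < D ∧ entryCheck L s T D P O ρ t = true ∧ z < M ∧
      (z : ℤ) ≡ lin R 2 R (m * 2 ^ (D * t.2 + ρ + σ)) [ZMOD M] ∧ signAt M act z = true := by
  obtain ⟨y, b', h1, h2, h3, h4, h5⟩ := coverStep_iterate hM R D act hx hlt P
  rw [hit] at h1
  have hy : y = x := by
    have e1 : (x + M * b) % M = x := by rw [Nat.add_mul_mod_self_left, Nat.mod_eq_of_lt hlt]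
    have e2 : (y + M * b') % M = y := by rw [Nat.add_mul_mod_self_left, Nat.mod_eq_of_lt h2]
    rw [← e1, h1, e2]
  have hb : b' = b := by
    rw [hy] at h1
    exact (Nat.eq_of_mul_eq_mul_left (by omega : 0 < M) (Nat.add_left_cancel h1)).symm
  subst hb hy
  -- the sequence is periodic with period `D * P`
  have sq_congr : ∀ (n u v : ℕ), lin R 2 R u ≡ lin R 2 R v [ZMOD M] →
      lin R 2 R (u * 2 ^ n) ≡ lin R 2 R (v * 2 ^ n) [ZMOD M] := by
    intro n u v h
    induction n with
    | zero => simpa using h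
    | succ n ih =>
      rw [pow_succ, ← mul_assoc, ← mul_assoc, lucas_two_mul, lucas_two_mul]
      exact (ih.pow 2).sub_right 2
  have hper : ∀ k, lin R 2 R (m * 2 ^ (D * P * k)) ≡ lin R 2 R m [ZMOD M] := by
    intro k
    induction k with
    | zero => simp
    | succ k ih =>
      have := sq_congr (D * P) _ _ ih
      rw [mul_assoc, ← pow_add] at this
      rw [show D * P * (k + 1) = D * P * k + D * P by ring]
      exact this.trans (h4.symm.trans hx)
  obtain ⟨ρ, hρ⟩ : ∃ ρ, ρ = (D - σ % D) % D := ⟨_, rfl⟩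
  have hρD : ρ < D := by rw [hρ]; exact Nat.mod_lt _ hD
  obtain ⟨J, hJ⟩ : D ∣ ρ + σ := by
    have hσ := Nat.div_add_mod σ D
    have hσD := Nat.mod_lt σ hD
    rcases Nat.eq_zero_or_pos (σ % D) with h0 | h0
    · have : ρ = 0 := by rw [hρ, h0]; simp
      exact ⟨σ / D, by omega⟩
    · have : ρ = D - σ % D := by rw [hρ, Nat.mod_eq_of_lt (by omega)]
      exact ⟨σ / D + 1, by rw [mul_add]; omega⟩
  obtain ⟨row, hrow, hmask⟩ := rowsCheck_sound rows 0 hrows ρ (Nat.zero_le _) hρD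
  obtain ⟨j, hj⟩ : ∃ j, j = J % P := ⟨_, rfl⟩
  have hjP : j < P := by rw [hj]; exact Nat.mod_lt _ hP
  have hbit : (rowMask (b' + b' * 2 ^ P) P row).testBit (P - 1 - j) = true := by
    have := congrArg (fun n => Nat.testBit n (P - 1 - j)) hmask
    simp only [Nat.testBit_mod_two_pow, Nat.testBit_two_pow_sub_one] at this
    simpa [show P - 1 - j < P by omega] using this
  obtain ⟨t, htrow, htbit⟩ := rowMask_testBit row hbit
  have hent := hrow t htrow
  have htP : t.2 < P := by
    have := hent
    simp only [entryCheck, Bool.and_eq_true, Nat.blt_eq] at this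
    exact this.1.2
  have hB : b' + b' * 2 ^ P = b' * 2 ^ P + b' := add_comm _ _
  rw [hB] at htbit
  obtain ⟨q, hq⟩ : ∃ q, q = (J + t.2) % P := ⟨_, rfl⟩
  have hqP : q < P := by rw [hq]; exact Nat.mod_lt _ hP
  have hq' : q = if j + t.2 < P then j + t.2 else j + t.2 - P := by
    rw [hq, Nat.add_mod, ← hj, Nat.mod_eq_of_lt htP]
    split
    · exact Nat.mod_eq_of_lt ‹_›
    · rw [Nat.mod_eq_sub_mod (by omega), Nat.mod_eq_of_lt (by omega)]
  have hbq : b'.testBit (P - 1 - q) = true := by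
    rw [mul_comm b', Nat.testBit_two_pow_mul_add b' h3] at htbit
    split at htbit
    · rw [show P - t.2 + (P - 1 - j) = P - 1 - q by rw [hq']; split <;> omega] at htbit
      exact htbit
    · rw [show P - t.2 + (P - 1 - j) - P = P - 1 - q by rw [hq']; split <;> omega] at htbit
      exact htbit
  obtain ⟨z, hz1, hz2, hz3⟩ := h5 q hqP hbq
  refine ⟨ρ, t, z, hρD, hent, hz1, hz2.trans ?_, hz3⟩
  have hdm := Nat.div_add_mod (J + t.2) P
  rw [← hq] at hdm
  have e : D * t.2 + ρ + σ = D * P * ((J + t.2) / P) + D * q := by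
    calc D * t.2 + ρ + σ = D * (J + t.2) := by rw [mul_add]; omega
      _ = D * (P * ((J + t.2) / P) + q) := by rw [hdm]
      _ = _ := by ring
  have := sq_congr (D * q) _ _ (hper ((J + t.2) / P))
  rw [mul_assoc, ← pow_add, ← e] at this
  exact this.symm

end

section

open NumberTheorySymbols

/-! ### Primality of larger numbers -/

/-- The product of the odd numbers `2 i + 1` with `l ≤ i < l + 2 ^ n`. -/
def oddProd (n : ℕ) : ℕ → ℕ :=
  Nat.rec (motive := fun _ => ℕ → ℕ) (fun l => Nat.succ (Nat.mul (nat_lit 2) l))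
    (fun n ih l => Nat.mul (force ih l) (force ih (Nat.add l (Nat.pow (nat_lit 2) n)))) n

lemma dvd_oddProd : ∀ {n l i : ℕ}, l ≤ i → i < l + 2 ^ n → 2 * i + 1 ∣ oddProd n l := by
  intro n
  induction n with
  | zero =>
    intro l i h1 h2
    have : i = l := by simp at h2; omega
    rw [this]; exact dvd_refl _
  | succ n ih =>
    intro l i h1 h2
    have e : oddProd (n + 1) l = force (oddProd n) l * force (oddProd n) (l + 2 ^ n) := rfl
    rw [e, force_eq, force_eq]
    rw [pow_succ] at h2
    rcases lt_or_ge i (l + 2 ^ n) with h | h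
    · exact (ih h1 h).mul_right _
    · exact (ih h (by omega)).mul_left _

def largePrimes : List ℕ := [5693327, 10387723, 16254971, 16811527, 25479829, 26017309, 76003507,
  153693347, 285334769, 1008484843, 2442718511, 3274281247, 9967811677, 17203644217, 21468395677]

lemma largePrimes_coprime : force (fun P => largePrimes.all (fun q => Nat.beq (Nat.mod q 2) 1 &&
    Nat.blt q 21743000000 && Nat.blt 4000000 q && Nat.beq (Nat.gcd q P) 1))
    (Nat.mul (oddProd 16 0) (oddProd 13 65536)) = true := by
  decide +kernel

lemma prime_of_mem_largePrimes {q : ℕ} (h : q ∈ largePrimes) : q.Prime ∧ q ≠ 2 ∧ q < 2 ^ 35 := by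
  have hc := largePrimes_coprime
  rw [force_eq, List.all_eq_true] at hc
  have hq := hc q h
  simp only [Bool.and_eq_true, Nat.beq_eq, Nat.blt_eq] at hq
  obtain ⟨⟨⟨h1, h2⟩, h3⟩, h4⟩ := hq
  replace h1 : q % 2 = 1 := h1
  refine ⟨?_, by omega, by omega⟩
  by_contra hn
  have g1 : q.minFac.Prime := Nat.minFac_prime (by omega)
  have g2 := Nat.minFac_sq_le_self (by omega) hn
  have g3 : q.minFac < 147456 := lt_of_pow_lt_pow_left₀ 2 (by omega) (g2.trans_lt (h2.trans (by norm_num)))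
  obtain ⟨i, hi⟩ : ∃ i, q.minFac = 2 * i + 1 := by
    have : q.minFac % 2 = 1 := by
      rcases g1.eq_two_or_odd with h0 | h0
      · have := q.minFac_dvd; rw [h0] at this; omega
      · exact h0
    exact ⟨q.minFac / 2, by omega⟩
  have g4 : q.minFac ∣ Nat.mul (oddProd 16 0) (oddProd 13 65536) := by
    rw [hi]
    rcases lt_or_ge i 65536 with h0 | h0
    · exact (dvd_oddProd (Nat.zero_le _) (by omega)).mul_right _
    · exact (dvd_oddProd h0 (by omega)).mul_left _
  have g5 := Nat.dvd_gcd q.minFac_dvd g4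
  rw [h4, Nat.dvd_one] at g5
  exact g1.one_lt.ne' g5

/-- A test for odd primes. -/
def oddPrimeTest (q : ℕ) : Bool := primeTest q || largePrimes.any (Nat.beq q)

lemma oddPrimeTest_sound {q : ℕ} (h : oddPrimeTest q = true) : q.Prime ∧ q ≠ 2 ∧ q < 2 ^ 35 := by
  rw [oddPrimeTest, Bool.or_eq_true, List.any_eq_true] at h
  rcases h with h | ⟨p, hp, he⟩
  · exact primeTest_sound h
  · rw [Nat.beq_eq] at he; subst he; exact prime_of_mem_largePrimes hp

/-! ### Residues containing a single square -/

/-- The `n`-th term of `lin R 2 R` modulo `M`, for `n < 2 ^ 64`. -/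
def lucasMod (M R n : ℕ) : ℕ := force (lucV M R) (luc M R (nat_lit 64) n)

lemma lucasMod_modEq {M : ℕ} (hM : 1 < M) {R n : ℕ} (hn : n < 2 ^ 64) :
    (lucasMod M R n : ℤ) ≡ lin R 2 R n [ZMOD M] ∧ lucasMod M R n < M := by
  rw [lucasMod, force_eq]
  exact lucV_modEq hM (luc_eq hM R 64 n hn)

lemma lin_congr {M R R' x₀ x₀' x₁ x₁' : ℤ} (hR : R ≡ R' [ZMOD M]) (h0 : x₀ ≡ x₀' [ZMOD M])
    (h1 : x₁ ≡ x₁' [ZMOD M]) : ∀ n, lin R x₀ x₁ n ≡ lin R' x₀' x₁' n [ZMOD M] := by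
  intro n
  induction n using Nat.twoStepInduction with
  | zero => exact h0
  | one => exact h1
  | more n ih1 ih2 => exact (hR.mul ih2).sub ih1

/-- `forceList l f` is `f l`; the kernel evaluates the entries of `l` to literals. -/
def forceList {α : Type} (l : List ℕ) : (List ℕ → α) → α :=
  List.rec (motive := fun _ => (List ℕ → α) → α) (fun f => f [])
    (fun a _ ih f => force (fun n => ih (fun t => f (n :: t))) a) l

@[simp] lemma forceList_eq {α : Type} (l : List ℕ) (f : List ℕ → α) : forceList l f = f l := by
  induction l generalizing f with
  | nil => rfl
  | cons a l ih =>
    have e : forceList (a :: l) f = force (fun n => forceList l (fun t => f (n :: t))) a := rfl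
    rw [e, force_eq, ih]

/-- The check that the signs along the orbit of `x` cover all powers of two. -/
def orbitCheck (L s T D P O M : ℕ) (act : List ℕ) (rows : List (List (ℕ × ℕ))) (x : ℕ) : Bool :=
  Nat.beq (luc M x (nat_lit 64) O) M &&
  force (fun y => Nat.beq (Nat.mod y M) x && force (fun b =>
    rowsCheck L s T D P O (Nat.add b (Nat.mul b (Nat.pow (nat_lit 2) P))) rows (nat_lit 0))
      (Nat.div y M)) (iter (coverStep M (Nat.sub M (nat_lit 2)) D act) P x)

/-- The check that `e` is the only `n ≡ e (mod L)` for which `α (w n - γ) + δ` is a square. -/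
def coverCheck (R α γ δ L w : ℕ) (c : CoverCert) : Bool :=
  Nat.ble 2 c.s && (Nat.beq (Nat.mod R 2) 0 || Nat.beq (Nat.mod c.T 3) 0) &&
  Nat.beq (Nat.mod c.T 2) 1 && Nat.beq (Nat.mod L (2 ^ (c.s + 1))) 0 &&
  Nat.blt (2 ^ c.s * c.T) (2 ^ 64) && Nat.blt c.O (2 ^ 64) && Nat.blt 0 c.D && Nat.blt 0 c.P &&
  Nat.blt 2 c.M && Nat.blt (c.D * c.P) (2 ^ 35) &&
  force (fun g => Nat.beq (g + α * (w + γ)) δ || Nat.beq (α * (w + γ)) (δ + g))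
    (2 ^ c.i * (listProd c.inert * listProd c.act)) &&
  c.inert.all (fun n => Nat.beq (Nat.mod n 2) 1 && Nat.blt 2 n &&
    Nat.beq (lucasMod n R (2 ^ c.s * c.T)) 2) &&
  c.act.all (fun p => oddPrimeTest p && Nat.beq (Nat.mod c.M p) 0) &&
  forceList c.act (fun act => force (fun D => force (fun P => force (fun O => force (fun M => force
    (orbitCheck L c.s c.T D P O M act c.rows) (lucasMod M R (2 ^ c.s * c.T))) c.M) c.O) c.P) c.D)

/-- The sequence `lin x 2 x` depends only on the index up to sign modulo a period `O`. -/
lemma lucas_congr_of_period {M x O : ℕ} (hM : 1 < M) (hO : O < 2 ^ 64) (h : luc M x 64 O = M)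
    {u v : ℕ} (huv : (O : ℤ) ∣ u - v ∨ (O : ℤ) ∣ u + v) :
    lin x 2 x u ≡ lin x 2 x v [ZMOD M] := by
  have h1 := luc_eq hM x 64 O hO
  have hone : enc M 0 1 = M := by
    have : (1 : ℤ) % M = 1 := Int.emod_eq_of_lt (by norm_num) (by exact_mod_cast hM)
    simp [enc, this]
  obtain ⟨h2, h3⟩ := enc_inj (by omega) (hone.trans (h.symm.trans h1))
  have e0 := lin_two_eq (x : ℤ) O
  have e1 := lin_add (x : ℤ) 2 x 0 O
  have p0 : (M : ℤ) ∣ lin x 2 x O - 2 := by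
    rw [e0, show 2 * lin (x : ℤ) 0 1 (O + 1) - x * lin x 0 1 O - 2 =
      x * (0 - lin x 0 1 O) - 2 * (1 - lin x 0 1 (O + 1)) by ring]
    exact dvd_sub (h2.mul_left _) (h3.mul_left _)
  have p1 : (M : ℤ) ∣ lin x 2 x (O + 1) - x := by
    rw [show O + 1 = 0 + O + 1 by ring, e1, show lin (x : ℤ) 2 x (0 + 1) = x from rfl,
      show lin (x : ℤ) 2 x 0 = 2 from rfl, show (x : ℤ) * lin x 0 1 (O + 1) - 2 * lin x 0 1 O - x =
      2 * (0 - lin x 0 1 O) - x * (1 - lin x 0 1 (O + 1)) by ring]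
    exact dvd_sub (h2.mul_left _) (h3.mul_left _)
  have hper := periodic_of_state (y := fun n : ℤ => lin x 2 x n.natAbs) (two_sided_lucas (x : ℤ))
    (L := O) (M := M) (by simpa [lin] using p0) (by
      rw [show ((O : ℤ) + 1).natAbs = O + 1 by omega]; simpa [lin] using p1)
  have conv : ∀ a b : ℤ, (O : ℤ) ∣ a - b → lin (x : ℤ) 2 x a.natAbs ≡ lin x 2 x b.natAbs [ZMOD M] := by
    rintro a b ⟨j, hj⟩
    have := periodic_mul (y := fun n : ℤ => lin (x : ℤ) 2 x n.natAbs) hper j b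
    rw [← hj, show b + (a - b) = a by ring] at this
    exact (Int.modEq_iff_dvd.mpr this).symm
  rcases huv with huv | huv
  · simpa using conv u v huv
  · simpa using conv u (-v) (by simpa using huv)

theorem coverCheck_sound {R α γ δ L we : ℕ} {c : CoverCert} (hR : 2 ≤ R)
    (h : coverCheck R α γ δ L we c = true) {w : ℤ → ℤ}
    (hw : ∀ n, w (n + 1) + w (n - 1) = R * w n) (he : w c.e = we) {n : ℤ}
    (hn : (L : ℤ) ∣ n - c.e) (hsq : IsSquare ((α : ℤ) * (w n - γ) + δ)) : n = c.e := by
  obtain ⟨e, s, T, i, D, P, O, M, inert, act, rows⟩ := c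
  simp only [coverCheck, force_eq, forceList_eq, Bool.and_eq_true, Bool.or_eq_true, Nat.beq_eq, Nat.blt_eq,
    Nat.ble_eq, List.all_eq_true, listProd_eq, orbitCheck] at h
  obtain ⟨⟨⟨⟨⟨⟨⟨⟨⟨⟨⟨⟨⟨hs, hpar⟩, hT⟩, hL⟩, hsT⟩, hO⟩, hD⟩, hP⟩, hM⟩, hDP⟩, hG⟩, hinert⟩, hact⟩,
    hper, hx, hrows⟩ := h
  simp only at he hn ⊢
  by_contra hne
  have hRz : (2 : ℤ) ≤ R := by exact_mod_cast hR
  obtain ⟨hx1, hx2⟩ := lucasMod_modEq (M := M) (by omega) (R := R) hsT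
  set x := lucasMod M R (2 ^ s * T) with hxdef
  set y := iter (coverStep M (M.sub 2) D act) P x with hy
  have hit : (coverStep M (M - 2) D act)^[P] x = x + M * (y / M) := by
    rw [← iter_eq]
    show y = x + M * (y / M)
    conv_lhs => rw [← Nat.mod_add_div y M]
    rw [show y % M = x from hx]
  obtain ⟨k, u, hu, hku⟩ : ∃ (k : ℕ) (u : ℤ), Odd u ∧ n - e = 2 ^ k * u := by
    obtain ⟨k, u, hu, h1⟩ := Nat.exists_eq_two_pow_mul_odd (n := (n - e).natAbs) (by omega)
    rcases Int.natAbs_eq (n - e) with h2 | h2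
    · exact ⟨k, u, by exact_mod_cast hu, by rw [h2, h1]; push_cast; ring⟩
    · exact ⟨k, -u, by simpa using (by exact_mod_cast hu : Odd (u : ℤ)), by
        rw [h2, h1]; push_cast; ring⟩
  have hsk : s + 1 ≤ k := by
    by_contra hlt
    have h1 : ((2 ^ (s + 1) : ℕ) : ℤ) ∣ n - e :=
      (Int.natCast_dvd_natCast.mpr (Nat.dvd_of_mod_eq_zero hL)).trans hn
    rw [hku, show s + 1 = k + (s - k + 1) by omega, pow_add] at h1
    push_cast at h1
    have h2 := Int.dvd_of_mul_dvd_mul_left (by positivity) h1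
    rw [pow_succ] at h2
    have h3 : (2 : ℤ) ∣ u := (Dvd.intro_left _ rfl).trans h2
    rcases hu with ⟨j, hj⟩
    omega
  obtain ⟨σ, rfl⟩ := Nat.exists_eq_add_of_le hsk
  obtain ⟨ρ, t, z, hρ, hent, hz1, hz2, hz3⟩ := cover_exists (by omega) hx1 hx2 hD hP hit hrows σ
  obtain ⟨τ, m⟩ := t
  simp only [entryCheck, force_eq, Bool.and_eq_true, Bool.or_eq_true, Nat.beq_eq, Nat.blt_eq] at hent
  obtain ⟨⟨⟨hτ, hLτ⟩, hmP⟩, hdlog⟩ := hent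
  simp only at hz2
  have hdlog' : (O : ℤ) ∣ ((τ * 2 ^ σ : ℕ) : ℤ) - ((2 ^ (D * m + ρ + σ) : ℕ) : ℤ) ∨
      (O : ℤ) ∣ ((τ * 2 ^ σ : ℕ) : ℤ) + ((2 ^ (D * m + ρ + σ) : ℕ) : ℤ) := by
    have hlt : D * m + ρ < 128 ^ 5 := by
      have : D * (m + 1) ≤ D * P := Nat.mul_le_mul_left D hmP
      rw [mul_add] at this
      norm_num at hDP ⊢
      omega
    have hp := powMod_modEq O 2 5 _ hlt
    have e1 : (2 : ℤ) ^ (D * m + ρ + σ) = 2 ^ (D * m + ρ) * 2 ^ σ := pow_add _ _ _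
    rcases hdlog with hd | hd
    · left
      have h1 : (2 : ℕ) ^ (D * m + ρ) ≡ τ [MOD O] := hp.symm.trans hd
      have h2 := (Nat.modEq_iff_dvd.mp h1).mul_right ((2 : ℤ) ^ σ)
      push_cast at h2 ⊢
      rwa [e1, ← sub_mul]
    · right
      have h1 : O ∣ powMod O 2 5 (D * m + ρ) + τ := Nat.dvd_of_mod_eq_zero hd
      have h2 : O ∣ 2 ^ (D * m + ρ) + τ :=
        (Nat.modEq_zero_iff_dvd.mp ((hp.symm.add_right τ).trans (Nat.modEq_zero_iff_dvd.mpr h1)))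
      have h3 := (Int.natCast_dvd_natCast.mpr h2).mul_right ((2 : ℤ) ^ σ)
      push_cast at h3 ⊢
      rw [e1, ← add_mul, add_comm (τ : ℤ)]
      exact h3
  obtain ⟨j, hj⟩ : ((T * τ : ℕ) : ℤ) ∣ u := by
    obtain ⟨j, hj⟩ := (Int.natCast_dvd_natCast.mpr (Nat.dvd_of_mod_eq_zero hLτ)).trans hn
    have hcop : IsCoprime ((T * τ : ℕ) : ℤ) ((2 ^ σ : ℕ) : ℤ) := by
      rw [Nat.isCoprime_iff_coprime]
      exact (Nat.coprime_two_right.mpr ((Nat.odd_iff.mpr hT).mul (Nat.odd_iff.mpr hτ))).pow_right σ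
    refine hcop.dvd_of_dvd_mul_left ⟨j, ?_⟩
    have h2 : (2 : ℤ) ^ (s + 1) ≠ 0 := by positivity
    apply mul_left_cancel₀ h2
    push_cast at hj ⊢
    rw [← mul_assoc, ← pow_add, ← hku, hj]
    ring
  have hjodd : Odd j := by
    rw [hj, Int.odd_mul] at hu
    exact hu.2
  obtain ⟨N, hN⟩ : ∃ N, N = 2 ^ s * T * (τ * 2 ^ σ) := ⟨_, rfl⟩
  have hnN : n = e + 2 * N * j := by
    have : n - e = 2 * N * j := by rw [hku, hj, hN]; push_cast; ring
    linarith
  obtain ⟨q, hq⟩ : ∃ q, lin (R : ℤ) 2 R N = 2 * (8 * q + 1) := by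
    have e1 : N = 2 ^ (s - 2) * T * (τ * 2 ^ σ) * 2 * 2 := by
      rw [hN]
      obtain ⟨s', rfl⟩ := Nat.exists_eq_add_of_le hs
      rw [show 2 + s' - 2 = s' by omega]
      ring
    rw [e1]
    apply lucas_mod_sixteen
    rcases hpar with hp | hp
    · left
      have : Even R := Nat.even_iff.mpr hp
      exact_mod_cast this
    · right
      exact ((Nat.dvd_of_mod_eq_zero hp).mul_left _).mul_right _
  have hpos := lucas_pos hRz N
  obtain ⟨v, hv⟩ : ∃ v : ℕ, (v : ℤ) = 8 * q + 1 := ⟨(8 * q + 1).toNat, by omega⟩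
  rw [← hv] at hq
  have hdv : (v : ℤ) ∣ w n + we := by
    have := lucas_dvd_add hw e N hjodd
    rw [← hnN, he, hq] at this
    exact (Dvd.intro_left _ rfl).trans this
  have hNM : lin (R : ℤ) 2 R N ≡ z [ZMOD M] := by
    have e1 := lin_congr hx1 (Int.ModEq.refl 2) hx1 (τ * 2 ^ σ)
    have e2 := lin_congr hx1 (Int.ModEq.refl 2) hx1 (2 ^ (D * m + ρ + σ))
    rw [← lucas_mul] at e1 e2
    rw [hN]
    exact e1.symm.trans ((lucas_congr_of_period (by omega) hO hper hdlog').trans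
      (e2.trans hz2.symm))
  have hI : ∀ n ∈ inert, n % 2 = 1 ∧ (n : ℤ) ∣ v - 1 := by
    intro n hn
    obtain ⟨⟨g1, g2⟩, g3⟩ := hinert n hn
    refine ⟨g1, ?_⟩
    obtain ⟨f1, -⟩ := lucasMod_modEq (M := n) (by omega) (R := R) hsT
    rw [g3] at f1
    have f2 := lin_congr f1 (Int.ModEq.refl 2) f1 (τ * 2 ^ σ)
    rw [← lucas_mul, ← hN, hq] at f2
    have f3 : ∀ k, lin (2 : ℤ) 2 2 k = 2 := by
      intro k
      induction k using Nat.twoStepInduction with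
      | zero => rfl
      | one => rfl
      | more k h1 h2 =>
        have : lin (2 : ℤ) 2 2 (k + 2) = 2 * lin 2 2 2 (k + 1) - lin 2 2 2 k := rfl
        rw [this, h1, h2]; norm_num
    have f4 : (n : ℤ) ∣ 2 * (v - 1) := by
      have := Int.modEq_iff_dvd.mp f2
      rw [show ((2 : ℕ) : ℤ) = 2 from rfl, f3] at this
      rwa [mul_sub, mul_one]
    have hc : IsCoprime (n : ℤ) ((2 : ℕ) : ℤ) := by
      rw [Nat.isCoprime_iff_coprime]
      exact Nat.coprime_two_right.mpr (Nat.odd_iff.mpr g1)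
    exact hc.dvd_of_dvd_mul_left f4
  have hprime : ∀ p ∈ act, p.Prime ∧ p ≠ 2 ∧ p < 2 ^ 35 := fun p hp =>
    oddPrimeTest_sound (hact p hp).1
  have hpM : ∀ p ∈ act, p ∣ M := fun p hp => Nat.dvd_of_mod_eq_zero (hact p hp).2
  rw [signAt, Bool.and_eq_true, Nat.beq_eq] at hz3
  have hleg := legendreSign_sound hprime (x := z) (v := v) (by
      intro p hp
      rw [← hq]
      exact (Int.natCast_dvd_natCast.mpr (hpM p hp)).trans (Int.modEq_iff_dvd.mp hNM))
    (fun p hp hpz => (hprime p hp).1.one_lt.ne' (Nat.dvd_one.mp (hz3.1 ▸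
      Nat.dvd_gcd hpz (hpM p hp))))
  rw [if_pos hz3.2] at hleg
  have hjac := jacobi_eq (v := v) (i := i) (inert := inert) (act := act)
    (G := δ - α * (we + γ)) (by omega) hI (fun p hp => by
      rcases (hprime p hp).1.eq_two_or_odd with h0 | h0
      · exact absurd h0 (hprime p hp).2.1
      · exact h0) (by
      rcases hG with h0 | h0
      · left; have := congrArg (Nat.cast : ℕ → ℤ) h0; push_cast at this ⊢; linarith
      · right; have := congrArg (Nat.cast : ℕ → ℤ) h0; push_cast at this ⊢; linarith)
  rw [hleg] at hjac
  refine ZMod.nonsquare_of_jacobiSym_eq_neg_one hjac ?_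
  obtain ⟨r, hr⟩ := hsq
  refine ⟨(r : ZMod v), ?_⟩
  have h0 := (ZMod.intCast_zmod_eq_zero_iff_dvd _ v).mpr hdv
  have h1 := congrArg (Int.cast : ℤ → ZMod v) hr
  push_cast at h0 h1 ⊢
  linear_combination h1 - α * h0

end

/-! ### Certificates for a pair and a third element -/

/-- A two-sided sequence with given terms at `0` and `1`. -/
lemma exists_two_sided (R x y : ℤ) : ∃ w : ℤ → ℤ,
    (∀ n, w (n + 1) + w (n - 1) = R * w n) ∧ w 0 = x ∧ w 1 = y := by
  have key : ∀ (x y : ℤ) (m : ℕ), lin R x y (m + 2) + lin R x y m = R * lin R x y (m + 1) := by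
    intro x y m
    have e : lin R x y (m + 2) = R * lin R x y (m + 1) - lin R x y m := rfl
    rw [e]; ring
  refine ⟨fun n => if 0 ≤ n then lin R x y n.toNat else lin R x (R * x - y) (-n).toNat,
    fun n => ?_, by simp [lin], by simp [lin]⟩
  rcases lt_trichotomy n 0 with h | rfl | h
  · obtain ⟨m, rfl⟩ : ∃ m : ℕ, n = -((m + 1 : ℕ) : ℤ) := ⟨(-n - 1).toNat, by omega⟩
    have h1 : ¬ (0 : ℤ) ≤ -((m + 1 : ℕ) : ℤ) := by omega
    have h2 : ¬ (0 : ℤ) ≤ -((m + 1 : ℕ) : ℤ) - 1 := by omega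
    have e1 : (- -((m + 1 : ℕ) : ℤ)).toNat = m + 1 := by omega
    have e2 : (-(-((m + 1 : ℕ) : ℤ) - 1)).toNat = m + 2 := by omega
    simp only [h1, h2, if_false, e1, e2]
    rcases Nat.eq_zero_or_pos m with rfl | hm
    · simp [lin]
    · have h3 : ¬ (0 : ℤ) ≤ -((m + 1 : ℕ) : ℤ) + 1 := by omega
      have e3 : (-(-((m + 1 : ℕ) : ℤ) + 1)).toNat = m := by omega
      simp only [h3, if_false, e3]
      linarith [key x (R * x - y) m]
  · simp [lin]
  · obtain ⟨m, rfl⟩ : ∃ m : ℕ, n = ((m + 1 : ℕ) : ℤ) := ⟨(n - 1).toNat, by omega⟩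
    have h1 : (0 : ℤ) ≤ ((m + 1 : ℕ) : ℤ) := by omega
    have h2 : (0 : ℤ) ≤ ((m + 1 : ℕ) : ℤ) - 1 := by omega
    have h3 : (0 : ℤ) ≤ ((m + 1 : ℕ) : ℤ) + 1 := by omega
    have e1 : (((m + 1 : ℕ) : ℤ)).toNat = m + 1 := by omega
    have e2 : (((m + 1 : ℕ) : ℤ) - 1).toNat = m := by omega
    have e3 : (((m + 1 : ℕ) : ℤ) + 1).toNat = m + 2 := by omega
    simp only [h1, h2, h3, if_true, e1, e2, e3]
    linarith [key x y m]

/-- Run `f` on the terms of index `e` and `e + 1` of the recurrence starting with `x, y`. -/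
def withTerm (f : ℕ → ℕ → Bool) (R e : ℕ) : ℕ → ℕ → Bool :=
  Nat.rec (motive := fun _ => ℕ → ℕ → Bool) f
    (fun _ ih x y => Nat.ble x (R * y) && force (fun z => ih y z) (R * y - x)) e

lemma withTerm_sound {f : ℕ → ℕ → Bool} {R : ℕ} : ∀ (e : ℕ) {x y : ℕ},
    withTerm f R e x y = true → ∃ u v : ℕ, f u v = true ∧ (u : ℤ) = lin R x y e ∧
      (v : ℤ) = lin R x y (e + 1) := by
  intro e
  induction e with
  | zero => intro x y h; exact ⟨x, y, h, rfl, rfl⟩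
  | succ e ih =>
    intro x y h
    have e1 : withTerm f R (e + 1) x y = (Nat.ble x (R * y) &&
      force (fun z => withTerm f R e y z) (R * y - x)) := rfl
    rw [e1, force_eq, Bool.and_eq_true, Nat.ble_eq] at h
    obtain ⟨u, v, h1, h2, h3⟩ := ih h.2
    refine ⟨u, v, h1, ?_, ?_⟩
    · rw [lin_shift, h2]; push_cast [Nat.cast_sub h.1]; rfl
    · rw [lin_shift, h3]; push_cast [Nat.cast_sub h.1]; rfl

/-- The check that among the indices `≡ e (mod L)` only those `≡ e (mod L l)` lead to squares;
`u` and `v` are the terms of index `e` and `e + 1`. -/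
def liftCheck (R α γ δ L l : ℕ) (qs : List ℕ) (u v : ℕ) : Bool :=
  Nat.blt L (2 ^ 64) && forceList qs (fun qs => force (fun l => force (fun M => Nat.blt 1 M && force (fun f => force (fun V => force
    (fun s => scanCheck V α γ δ l qs [0] s)
      (Nat.add (Nat.mod u M) (Nat.mul M (Nat.mod (Nat.add (Nat.mul u (Nat.div f M))
        (Nat.mul (Nat.mod f M) (Nat.add v (Nat.mul (Nat.sub M 1) (Nat.mul R u))))) M))))
    (lucV M R f)) (luc M R (nat_lit 64) L)) (listProd qs)) l)

lemma liftCheck_sound {R α γ δ L l : ℕ} {qs : List ℕ} {u v : ℕ}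
    (h : liftCheck R α γ δ L l qs u v = true) {w : ℤ → ℤ}
    (hw : ∀ n, w (n + 1) + w (n - 1) = R * w n) {e : ℤ} (hu : w e = u) (hv : w (e + 1) = v) {n : ℤ}
    (hn : (L : ℤ) ∣ n - e) (hsq : IsSquare ((α : ℤ) * (w n - γ) + δ)) :
    ((L * l : ℕ) : ℤ) ∣ n - e := by
  simp only [liftCheck, force_eq, forceList_eq, Bool.and_eq_true, Nat.blt_eq, listProd_eq] at h
  obtain ⟨hL, hM, hsc⟩ := h
  set M := qs.prod with hMdef
  have hf := luc_eq hM R 64 L hL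
  set f := luc M R 64 L with hfdef
  obtain ⟨hV, -⟩ := lucV_modEq hM hf
  obtain ⟨f1, f2, f3⟩ := enc_mod_div (by omega : 0 < M) (lin R 0 1 L) (lin R 0 1 (L + 1))
  rw [← hf] at f1 f2 f3
  obtain ⟨j, hj⟩ := hn
  have hnj : n = e + L * j := by linarith
  have key := scanCheck_sound hsc (y := fun i : ℤ => w (e + L * i)) (K := lin R 2 R L)
    (two_sided_step hw e L) (Int.modEq_iff_dvd.mp hV) (n := j) ?_ (by rwa [← hnj])
  · obtain ⟨e', he', hd⟩ := key
    rw [List.mem_singleton] at he'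
    subst he'
    obtain ⟨i, hi⟩ := hd
    refine ⟨i, ?_⟩
    rw [hj]
    push_cast at hi ⊢
    rw [sub_zero] at hi
    rw [hi]; ring
  · refine enc_of_modEq ?_ ?_
    · simp only [mul_zero, add_zero]
      rw [hu]
    · simp only [mul_one]
      rw [two_sided_shift hw e L, hu, hv]
      have e1 : lin (R : ℤ) u v L = u * lin R 0 1 (L + 1) + lin R 0 1 L * (v - R * u) := by
        rcases L with _ | L
        · simp [lin]
        · have h1 := lin_add (R : ℤ) u v 0 L
          have h2 : lin (R : ℤ) 0 1 (L + 2) = R * lin R 0 1 (L + 1) - lin R 0 1 L := rfl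
          rw [show 0 + L + 1 = L + 1 by ring] at h1
          rw [h1, h2]
          simp [lin]; ring
      rw [e1]
      show ((u * (f / M) + f % M * (v + (M - 1) * (R * u)) : ℕ) : ℤ) ≡ _ [ZMOD M]
      rw [Nat.cast_add, Nat.cast_mul, Nat.cast_mul, f1, f2, Nat.cast_add, Nat.cast_mul,
        Nat.cast_sub hM.le]
      refine ((Int.ModEq.refl _).mul (Int.mod_modEq _ _)).add ((Int.mod_modEq _ _).mul ?_)
      rw [Int.modEq_iff_dvd]
      refine ⟨-(R * u), ?_⟩
      push_cast
      ring

/-- Lifts from `L`, followed by the final check. -/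
def liftsCheck (R α γ δ : ℕ) (c : CoverCert) (u v : ℕ) (lifts : List (ℕ × List ℕ)) : ℕ → Bool :=
  List.rec (motive := fun _ => ℕ → Bool) (fun L => coverCheck R α γ δ L u c)
    (fun t _ ih L => liftCheck R α γ δ L t.1 t.2 u v && force ih (L * t.1)) lifts

lemma liftsCheck_sound {R α γ δ : ℕ} {c : CoverCert} {u v : ℕ} (hR : 2 ≤ R) {w : ℤ → ℤ}
    (hw : ∀ n, w (n + 1) + w (n - 1) = R * w n) (hu : w c.e = u) (hv : w (c.e + 1) = v) {n : ℤ}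
    (hsq : IsSquare ((α : ℤ) * (w n - γ) + δ)) : ∀ (lifts : List (ℕ × List ℕ)) (L : ℕ),
    liftsCheck R α γ δ c u v lifts L = true → (L : ℤ) ∣ n - c.e → n = c.e := by
  intro lifts
  induction lifts with
  | nil => intro L h hn; exact coverCheck_sound hR h hw hu hn hsq
  | cons t lifts ih =>
    intro L h hn
    have e : liftsCheck R α γ δ c u v (t :: lifts) L = (liftCheck R α γ δ L t.1 t.2 u v &&
      force (liftsCheck R α γ δ c u v lifts) (L * t.1)) := rfl
    rw [e, force_eq, Bool.and_eq_true] at h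
    exact ih _ h.2 (liftCheck_sound h.1 hw hu hv hn hsq)

/-- The certificate for a sequence: `x, y` are consecutive extensions of the pair, at the index `h`
or `h + 1` of the sequence starting with `w₀, w₁`, in this order or reversed. -/
structure ClassCert where
  x : ℕ
  y : ℕ
  h : ℕ
  w₀ : ℕ
  w₁ : ℕ
  L : ℕ
  primes : List ℕ
  covers : List (List (ℕ × List ℕ) × CoverCert)

def classCheck (R α γ δ : ℕ) (good : ℕ → Bool) (c : ClassCert) : Bool :=
  forceList c.primes (fun qs => forceList (c.covers.map (fun t => t.2.e)) (fun E =>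
    force (fun L => force (fun s => scanCheck R α γ δ L qs E s)
      (c.w₀ % listProd qs + listProd qs * (c.w₁ % listProd qs))) c.L)) &&
  c.covers.all (fun t => withTerm (fun u v => good u && liftsCheck R α γ δ t.2 u v t.1 c.L)
    R t.2.e c.w₀ c.w₁)

lemma classCheck_sound {R α γ δ : ℕ} {good : ℕ → Bool} {c : ClassCert} (hR : 2 ≤ R)
    (h : classCheck R α γ δ good c = true) {w : ℤ → ℤ}
    (hw : ∀ n, w (n + 1) + w (n - 1) = R * w n) (h0 : w 0 = c.w₀) (h1 : w 1 = c.w₁) {n : ℤ}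
    (hsq : IsSquare ((α : ℤ) * (w n - γ) + δ)) : ∃ u : ℕ, w n = u ∧ good u = true := by
  simp only [classCheck, force_eq, forceList_eq, Bool.and_eq_true, listProd_eq, List.all_eq_true] at h
  obtain ⟨h2, h3⟩ := h
  obtain ⟨e, he, hd⟩ := scanCheck_sound h2 hw (by simp) (by
    rw [h0, h1]; exact enc_of_modEq (Int.ModEq.refl _) (Int.ModEq.refl _)) hsq
  rw [List.mem_map] at he
  obtain ⟨t, ht, rfl⟩ := he
  obtain ⟨u, v, h4, h5, h6⟩ := withTerm_sound _ (h3 t ht)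
  rw [Bool.and_eq_true] at h4
  have hs := two_sided_shift hw 0
  simp only [zero_add, h0, h1] at hs
  have hu : w t.2.e = u := by rw [hs, h5]
  have hv : w (t.2.e + 1) = v := by
    have := hs (t.2.e + 1)
    push_cast at this
    rw [this, h6]
  have := liftsCheck_sound hR hw hu hv hsq t.1 c.L h4.2 hd
  exact ⟨u, by rw [this, hu], h4.1⟩

/-- The certificate for the extensions of `{A, B, C}` through the sequences of `{A, B}`. -/
structure TripleCert where
  A : ℕ
  B : ℕ
  C : ℕ
  r : ℕ
  classes : List ClassCert

/-- The possible bases of the sequences with given `W` are covered by the classes. -/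
def baseCheck (A B r : ℕ) (classes : List ClassCert) (W : ℕ) : Bool :=
  Nat.blt (A + B) (r * W) || force (fun S =>
    Nat.blt (S * S) (4 * (W * W - 4)) || sieved (S * S - 4 * (W * W - 4)) ||
    classes.any (fun c => Nat.beq (c.x + c.y) S && Nat.beq (c.x * c.y) (W * W - 4)))
    (A + B - r * W)

def tripleCheck (m : ℕ) (t : TripleCert) : Bool :=
  force (fun A => force (fun B => force (fun C => force (fun r => force (fun R => force (fun α =>
    force (fun γ => force (fun δ =>
  Nat.beq (r * r) (A * B + 4) && Nat.blt 0 A && Nat.blt A B && Nat.blt 4 B &&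
  (List.range ((A + B) / r + 1)).all (fun W => Nat.blt W 2 || baseCheck A B r t.classes W) &&
  t.classes.all (fun c => withTerm (fun u v =>
      (Nat.beq u (A * B * c.x + γ) && Nat.beq v (A * B * c.y + γ)) ||
      (Nat.beq v (A * B * c.x + γ) && Nat.beq u (A * B * c.y + γ))) R c.h c.w₀ c.w₁ &&
    classCheck R α γ δ (fun u => force (fun d => Nat.ble d m || regNat A B C d || regNat C d A B)
        ((u - γ) / (A * B))) c))
    (4 * (A * B) ^ 2)) (2 * (A + B))) (A * B * C)) (A * B + 2)) t.r) t.C) t.B) t.A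

lemma ext_value_rec {A B r U₀ V₀ U₁ V₁ : ℤ} (hr : r ^ 2 = A * B + 4)
    (h0 : B * U₀ ^ 2 - A * V₀ ^ 2 = 4 * (B - A))
    (hU : 2 * U₁ = r * U₀ + A * V₀) (hV : 2 * V₁ = r * V₀ + B * U₀) (n : ℕ) :
    B * lin r U₀ U₁ n ^ 2 + 2 * A - 2 * B =
      lin (A * B + 2) (B * U₀ ^ 2 + 2 * A - 2 * B) (B * U₁ ^ 2 + 2 * A - 2 * B) n := by
  have hpell : ∀ n, B * lin r U₀ U₁ n ^ 2 - A * lin r V₀ V₁ n ^ 2 = 4 * (B - A) := by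
    intro n
    induction n with
    | zero => exact h0
    | succ n ih =>
      obtain ⟨h1, h2⟩ := lin_cross hr hU hV n
      have : 4 * (B * lin r U₀ U₁ (n + 1) ^ 2 - A * lin r V₀ V₁ (n + 1) ^ 2) = 4 * (4 * (B - A)) := by
        have e : 4 * (B * lin r U₀ U₁ (n + 1) ^ 2 - A * lin r V₀ V₁ (n + 1) ^ 2) =
          B * (2 * lin r U₀ U₁ (n + 1)) ^ 2 - A * (2 * lin r V₀ V₁ (n + 1)) ^ 2 := by ring
        rw [e, h1, h2]
        linear_combination 4 * ih + (B * lin r U₀ U₁ n ^ 2 - A * lin r V₀ V₁ n ^ 2) * hr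
      linarith
  induction n using Nat.twoStepInduction with
  | zero => rfl
  | one => rfl
  | more n ih1 ih2 =>
    have e1 : lin r U₀ U₁ (n + 2) = r * lin r U₀ U₁ (n + 1) - lin r U₀ U₁ n := rfl
    have e2 : ∀ R x y : ℤ, lin R x y (n + 2) = R * lin R x y (n + 1) - lin R x y n := fun _ _ _ => rfl
    rw [e2 (A * B + 2), ← ih1, ← ih2]
    have h1 := (lin_cross hr hU hV (n + 1)).1
    have h2 := hpell (n + 1)
    rw [show n + 1 + 1 = n + 2 from rfl, e1] at h1
    rw [e1]
    set x := lin r U₀ U₁ (n + 1)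
    set y := lin r U₀ U₁ n
    set v := lin r V₀ V₁ (n + 1)
    have h3 : A * v = r * x - 2 * y := by linarith
    have h4 : A * (B * x ^ 2) - (r * x - 2 * y) ^ 2 = 4 * A * (B - A) := by
      rw [← h3]; linear_combination A * h2
    have : 2 * (B * (r * x - y) ^ 2 + 2 * A - 2 * B) = 2 * ((A * B + 2) * (B * x ^ 2 + 2 * A - 2 * B) -
        (B * y ^ 2 + 2 * A - 2 * B)) := by
      linear_combination (B * x ^ 2) * hr - B * h4
    linarith

set_option maxHeartbeats 400000 in
theorem tripleCheck_sound {m : ℕ} {t : TripleCert} (h : tripleCheck m t = true) {d U V Z : ℤ}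
    (hd : m < d) (hU0 : 0 < U) (hV0 : 0 < V) (hU : U ^ 2 = t.A * d + 4) (hV : V ^ 2 = t.B * d + 4)
    (hZ : Z ^ 2 = t.C * d + 4) : Reg t.A t.B t.C d := by
  obtain ⟨A, B, C, r, classes⟩ := t
  simp only [tripleCheck, force_eq, Bool.and_eq_true, Nat.beq_eq, Nat.blt_eq, List.all_eq_true,
    Bool.or_eq_true] at h
  obtain ⟨⟨⟨⟨⟨hr, hA⟩, hAB⟩, hB⟩, hbase⟩, hcl⟩ := h
  simp only at hU hV hZ ⊢
  have hrz : (r : ℤ) ^ 2 = A * B + 4 := by rw [sq]; exact_mod_cast hr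
  have hr0 : (0 : ℤ) < r := by
    rcases Nat.eq_zero_or_pos r with rfl | h0
    · simp at hr
    · exact_mod_cast h0
  have hAz : (0 : ℤ) < A := by exact_mod_cast hA
  have hABz : (A : ℤ) < B := by exact_mod_cast hAB
  have hBz : (4 : ℤ) < B := by exact_mod_cast hB
  obtain ⟨n, d₀, U₀, V₀, U₁, V₁, h0, hU₀, hV₀, hb, hU₁, hV₁, hUn, -⟩ :=
    IsExt.exists_base hAz hABz hr0 hrz V.toNat le_rfl hU0 hV0 ⟨hU, hV⟩
  have hrec := ext_value_rec hrz (by linear_combination (B : ℤ) * h0.left - A * h0.right)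
    hU₁ hV₁ (n + 1)
  rw [← hUn] at hrec
  have hval : (B : ℤ) * U ^ 2 + 2 * A - 2 * B = A * B * d + 2 * (A + B) := by rw [hU]; ring
  rw [hval] at hrec
  obtain ⟨x₀, x₁, W, hx₀, hx₁, hW, hsum, hprod, hf0, hf1⟩ : ∃ x₀ x₁ W : ℤ, 0 ≤ x₀ ∧ 0 ≤ x₁ ∧ 2 ≤ W ∧
      x₀ + x₁ = A + B - r * W ∧ x₀ * x₁ = W ^ 2 - 4 ∧
      (B : ℤ) * U₀ ^ 2 + 2 * A - 2 * B = A * B * x₀ + 2 * (A + B) ∧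
      (B : ℤ) * U₁ ^ 2 + 2 * A - 2 * B = A * B * x₁ + 2 * (A + B) := by
    have hnn : (0 : ℤ) ≤ A + B - r * 2 := by
      have : ((B : ℤ) - r) ^ 2 = B * (A + B - r * 2) + 4 := by linear_combination hrz
      by_contra! hneg
      nlinarith [sq_nonneg ((B : ℤ) - r)]
    rcases h0.base_cases hAz hABz hBz hr0 hrz hU₀ hV₀ hb with
      ⟨rfl, rfl⟩ | ⟨rfl, rfl⟩ | ⟨e, W, hd0, he0, hW, hprod, hsum, he⟩
    · have e1 : U₁ = r - A := by linarith
      refine ⟨0, A + B - r * 2, 2, le_rfl, hnn, le_rfl, by ring, by ring, by ring, ?_⟩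
      rw [e1]
      linear_combination (B : ℤ) * hrz
    · have e1 : U₁ = 2 := by
        have : 2 * U₁ = 2 * 2 := by linear_combination hU₁ + hrz
        linarith
      refine ⟨A + B - r * 2, 0, 2, hnn, le_rfl, le_rfl, by ring, by ring, ?_, ?_⟩
      · linear_combination (B : ℤ) * hrz
      · rw [e1]; ring
    · refine ⟨d₀, e, W, hd0.le, he0.le, by linarith, hsum, hprod, ?_, ?_⟩
      · rw [h0.left]; ring
      · rw [(he U₁ V₁ hU₁ hV₁).left]; ring
  rw [hf0, hf1] at hrec
  obtain ⟨W, rfl⟩ := Int.eq_ofNat_of_zero_le (by linarith : 0 ≤ W)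
  obtain ⟨c, hc, hcx⟩ : ∃ c ∈ classes, (x₀ = c.x ∧ x₁ = c.y) ∨ (x₀ = c.y ∧ x₁ = c.x) := by
    have hle : r * W ≤ A + B := by
      have : (r : ℤ) * W ≤ A + B := by linarith
      exact_mod_cast this
    have hr0' : 0 < r := by exact_mod_cast hr0
    have hWr : W < (A + B) / r + 1 := by
      rw [Nat.lt_succ_iff, Nat.le_div_iff_mul_le hr0', mul_comm]; exact hle
    have hW2 : 2 ≤ W := by exact_mod_cast hW
    have hWW : 4 ≤ W * W := by nlinarith
    rcases hbase W (List.mem_range.mpr hWr) with hlt | hbc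
    · omega
    simp only [baseCheck, force_eq, Bool.or_eq_true, Nat.blt_eq, List.any_eq_true,
      Bool.and_eq_true, Nat.beq_eq] at hbc
    have hS : ((A + B - r * W : ℕ) : ℤ) = x₀ + x₁ := by rw [hsum]; push_cast [Nat.cast_sub hle]; ring
    have hP : ((W * W - 4 : ℕ) : ℤ) = x₀ * x₁ := by
      rw [hprod]; push_cast [Nat.cast_sub hWW]; ring
    set S := A + B - r * W
    set P := W * W - 4
    have hdisc : ((S : ℤ) * S - 4 * P) = (x₀ - x₁) ^ 2 := by rw [hS, hP]; ring
    have hge : 4 * P ≤ S * S := by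
      have : (4 * P : ℤ) ≤ S * S := by linarith [sq_nonneg (x₀ - x₁)]
      exact_mod_cast this
    rcases hbc with hbc | (hbc | hbc) | ⟨c, hc, h1, h2⟩
    · omega
    · omega
    · exfalso
      refine sieved_sound hbc (x₀ - x₁) ?_
      rw [← hdisc]
      push_cast [Nat.cast_sub hge]
      simp
    · refine ⟨c, hc, ?_⟩
      have g1 : (c.x : ℤ) + c.y = x₀ + x₁ := by rw [← hS, ← h1]; push_cast; ring
      have g2 : (c.x : ℤ) * c.y = x₀ * x₁ := by rw [← hP, ← h2]; push_cast; ring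
      have : (x₀ - c.x) * (x₀ - c.y) = 0 := by linear_combination g2 - x₀ * g1
      rcases mul_eq_zero.mp this with g | g
      · left; constructor <;> linarith
      · right; constructor <;> linarith
  obtain ⟨hterm, hclass⟩ := hcl c hc
  obtain ⟨u, v, huv, hu, hv⟩ := withTerm_sound _ hterm
  simp only [Bool.or_eq_true, Bool.and_eq_true, Nat.beq_eq] at huv
  obtain ⟨w, hw, hw0, hw1⟩ := exists_two_sided ((A * B + 2 : ℕ) : ℤ) c.w₀ c.w₁
  have hs := two_sided_shift hw 0
  simp only [zero_add, hw0, hw1] at hs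
  have hwu : w c.h = u := by rw [hs, hu]
  have hwv : w (c.h + 1) = v := by
    have := hs (c.h + 1)
    push_cast at this
    rw [this, hv]
    push_cast; rfl
  obtain ⟨N, hN⟩ : ∃ N, w N = A * B * d + 2 * (A + B) := by
    have hfwd := two_sided_shift hw c.h (n + 1)
    have hbwd := two_sided_shift (w := fun i => w (c.h + 1 - i)) (R := ((A * B + 2 : ℕ) : ℤ)) (by
      intro i
      rw [← hw (c.h + 1 - i), add_comm]
      congr 2 <;> ring) 0 (n + 1)
    simp only [zero_add, sub_zero, hwv] at hbwd
    rw [show (c.h : ℤ) + 1 - 1 = c.h by ring, hwu] at hbwd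
    rw [hwu, hwv] at hfwd
    rw [hrec]
    push_cast at hfwd hbwd
    rcases hcx with ⟨rfl, rfl⟩ | ⟨rfl, rfl⟩ <;> rcases huv with ⟨rfl, rfl⟩ | ⟨rfl, rfl⟩
    · exact ⟨_, by rw [hfwd]; push_cast; rfl⟩
    · exact ⟨_, by rw [hbwd]; push_cast; rfl⟩
    · exact ⟨_, by rw [hbwd]; push_cast; rfl⟩
    · exact ⟨_, by rw [hfwd]; push_cast; rfl⟩
  obtain ⟨u', hu', hgood⟩ := classCheck_sound (by omega) hclass hw hw0 hw1 (n := N)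
    ⟨A * B * Z, by rw [hN]; push_cast; linear_combination (-(A * B : ℤ) ^ 2) * hZ⟩
  have hABpos : 0 < A * B := Nat.mul_pos hA (by omega)
  obtain ⟨d', rfl⟩ := Int.eq_ofNat_of_zero_le (by omega : 0 ≤ d)
  have hu'' : u' = A * B * d' + 2 * (A + B) := by
    have : (u' : ℤ) = A * B * d' + 2 * (A + B) := by rw [← hu', hN]
    exact_mod_cast this
  rw [hu'', Nat.add_sub_cancel, Nat.mul_div_cancel_left _ hABpos] at hgood
  rw [Bool.or_eq_true, Bool.or_eq_true, Nat.ble_eq] at hgood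
  rcases hgood with (hle | hreg) | hreg
  · omega
  · exact regNat_sound hreg
  · have := regNat_sound hreg
    unfold Reg at this ⊢
    linear_combination this


/-! ### The small triples -/

/-- The check that the triple of the certificate is `{a, k a, c}`, and the certificate holds. -/
def certCheck (t : ℕ × ℕ × ℕ × TripleCert) : Bool :=
  force (fun k => force (fun a => force (fun c => force (fun b =>
    force (fun A => force (fun B => force (fun C =>
  ((Nat.beq A a && Nat.beq B b && Nat.beq C c) || (Nat.beq A a && Nat.beq B c && Nat.beq C b) ||
    (Nat.beq A c && Nat.beq B a && Nat.beq C b) || (Nat.beq A b && Nat.beq B c && Nat.beq C a) ||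
    (Nat.beq A c && Nat.beq B b && Nat.beq C a)) && tripleCheck c t.2.2.2)
    t.2.2.2.C) t.2.2.2.B) t.2.2.2.A) (k * a)) t.2.2.1) t.2.1) t.1

lemma certCheck_sound {t : ℕ × ℕ × ℕ × TripleCert} (h : certCheck t = true) {d X Y Z : ℤ}
    (hd : t.2.2.1 < d) (hX0 : 0 < X) (hY0 : 0 < Y) (hZ0 : 0 < Z) (hX : X ^ 2 = t.2.1 * d + 4)
    (hY : Y ^ 2 = t.1 * t.2.1 * d + 4) (hZ : Z ^ 2 = t.2.2.1 * d + 4) :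
    Reg t.2.1 (t.1 * t.2.1) t.2.2.1 d := by
  obtain ⟨k, a, c, t⟩ := t
  simp only [certCheck, force_eq, Bool.and_eq_true, Bool.or_eq_true, Nat.beq_eq] at h
  simp only at hd hX hY hZ ⊢
  obtain ⟨hp, ht⟩ := h
  have hb : ((k * a : ℕ) : ℤ) = k * a := by push_cast; ring
  rw [← hb] at hY ⊢
  rcases hp with (((⟨⟨h1, h2⟩, h3⟩ | ⟨⟨h1, h2⟩, h3⟩) | ⟨⟨h1, h2⟩, h3⟩) | ⟨⟨h1, h2⟩, h3⟩) |
    ⟨⟨h1, h2⟩, h3⟩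
  · have := tripleCheck_sound ht hd hX0 hY0 (h1 ▸ hX) (h2 ▸ hY) (h3 ▸ hZ)
    rw [h1, h2, h3] at this
    unfold Reg at this ⊢; linear_combination this
  · have := tripleCheck_sound ht hd hX0 hZ0 (h1 ▸ hX) (h2 ▸ hZ) (h3 ▸ hY)
    rw [h1, h2, h3] at this
    unfold Reg at this ⊢; linear_combination this
  · have := tripleCheck_sound ht hd hZ0 hX0 (h1 ▸ hZ) (h2 ▸ hX) (h3 ▸ hY)
    rw [h1, h2, h3] at this
    unfold Reg at this ⊢; linear_combination this
  · have := tripleCheck_sound ht hd hY0 hZ0 (h1 ▸ hY) (h2 ▸ hZ) (h3 ▸ hX)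
    rw [h1, h2, h3] at this
    unfold Reg at this ⊢; linear_combination this
  · have := tripleCheck_sound ht hd hZ0 hY0 (h1 ▸ hZ) (h2 ▸ hY) (h3 ▸ hX)
    rw [h1, h2, h3] at this
    unfold Reg at this ⊢; linear_combination this

def certificatesSeven : List (ℕ × ℕ × ℕ × TripleCert) := [
  (7, 6, 16, ⟨6, 16, 42, 10, [⟨0, 2, 2, 399404, 4076, 112, [83, 4801, 31, 2017, 223], [([(3, [11,
    43]), (5, [59, 71]), (5, [101]), (19, [37, 113, 151, 571])], ⟨0, 2, 95, 9, 1, 51, 103, 1031,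
    [3, 3, 3, 113], [1031], [[(1, 0), (35, 43), (21, 23), (7, 14), (3, 9), (15, 38)]]⟩), ([(5,
    [71, 211])], ⟨2, 2, 1, 9, 1, 5, 11, 23, [3, 3, 3], [23], [[(1, 0), (5, 4)]]⟩)]⟩]⟩),
  (7, 6, 80, ⟨42, 80, 6, 58, [⟨0, 6, 0, 244, 20404, 96, [19, 1231, 4591, 47, 577], [([(5, [11,
    1601])], ⟨0, 2, 1, 9, 1, 3, 9, 73, [3, 3, 3, 5, 7], [73], [[(1, 0), (5, 2)]]⟩), ([(3, [17,
    73]), (5, [11, 61]), (7, [13, 113, 167])], ⟨2, 2, 21, 9, 1, 35, 71, 5113, [3, 3, 3, 5, 7,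
    13, 43], [5113], [[(1, 0), (3, 16), (15, 9), (5, 28)]]⟩)]⟩]⟩),
  (7, 6, 4160, ⟨6, 4160, 42, 158, [⟨0, 3850, 0, 8332, 96104332, 480, [157, 1783, 41, 11789, 193,
    1759, 2113], [([], ⟨0, 3, 1, 11, 1, 14, 29, 463, [3, 3, 3, 3, 3, 5, 13], [463], [[(1, 0),
    (3, 5), (5, 8)]]⟩)]⟩, ⟨16, 42, 0, 407692, 1056652, 336, [53, 197, 239, 281, 953, 251, 97,
    113, 223], [([(5, [11, 19, 31]), (13, [181, 337, 911, 1039, 1091]), (17, [103, 443, 509,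
    883, 2039]), (179, [1433, 4297, 5011, 6803, 7159, 7517])], ⟨0, 2, 179, 11, 1, 21, 337,
    120647, [3, 3, 3, 5, 13], [120647], [[(1, 0), (13, 10), (21, 17), (273, 6), (595, 15)]]⟩),
    ([(2, [2113]), (2, [2687]), (3, [127]), (5, [11, 19, 31])], ⟨2, 5, 3, 11, 1, 14, 29, 173,
    [3, 3, 3, 3, 5, 13, 193, 76801], [173], [[(1, 0), (15, 13), (5, 8)]]⟩)]⟩]⟩),
  (7, 96, 1, ⟨1, 672, 96, 26, [⟨0, 621, 0, 1346, 418658, 16, [337, 431, 1279], [([(3, [23, 193]),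
    (5, [11, 59, 239])], ⟨0, 2, 1, 13, 1, 9, 19, 37, [3, 3, 3, 3, 7], [37], [[(1, 0), (3, 4),
    (5, 7), (15, 2)]]⟩)]⟩, ⟨5, 96, 0, 4706, 65858, 48, [673, 431, 23, 193], [([(5, [11, 61]),
    (7, [29, 83, 223])], ⟨0, 2, 7, 13, 1, 3, 9, 251, [3, 3, 3, 7], [251], [[(1, 0), (5, 2)]]⟩),
    ([(5, [11, 41, 61]), (5, [151, 199, 599]), (7, [29, 83, 2099]), (7, [97, 293]), (7, [1373,
    6173, 8233]), (11, [43, 89, 109])], ⟨2, 2, 245, 13, 1, 72, 323, 616457, [3, 3, 3, 3, 7],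
    [37, 16661], [[(1, 0), (15, 29), (77, 27), (1155, 56)]]⟩)]⟩]⟩),
  (7, 96, 5, ⟨5, 672, 96, 58, [⟨0, 561, 0, 1354, 1886314, 48, [19, 1231, 47, 97], [([(5, [11, 61,
    239]), (7, [43, 113, 167, 1009])], ⟨0, 2, 1, 13, 1, 9, 27, 107, [3, 3, 3, 5, 7], [107],
    [[(1, 0), (7, 7), (5, 5)]]⟩)]⟩, ⟨1, 96, 0, 4714, 323914, 240, [41, 11, 3361, 4591, 61, 761,
    191], [([(3, [17, 73])], ⟨0, 2, 3, 13, 1, 3, 7, 13, [3, 3, 3, 5, 7, 19], [13], [[(1, 0), (3,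
    2), (5, 1)]]⟩), ([(3, [17, 37]), (3, [107, 269]), (3, [163]), (7, [43, 113, 251]), (11, [23,
    67, 89, 131]), (11, [241, 727, 967, 1453, 2903]), (17, [101, 103, 137, 919])], ⟨2, 2, 5049,
    13, 1, 561, 1123, 4493, [3, 3, 3, 5, 7, 10099], [4493], [[(1, 0), (21, 146), (7, 510), (15,
    440), (231, 323), (3, 197), (11, 177), (165, 56)]]⟩)]⟩]⟩),
  (7, 96, 260, ⟨260, 672, 96, 418, [⟨0, 96, 0, 1864, 16774984, 64, [353, 8863, 127, 1409], [([(3,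
    [191, 419]), (5, [31, 71, 3001])], ⟨0, 2, 1, 17, 1, 9, 19, 37, [3, 3, 3, 5, 7, 13], [37],
    [[(1, 0), (3, 4), (5, 7), (15, 2)]]⟩), ([(3, [191]), (3, [17, 109]), (3, [53]), (3, [487,
    647]), (5, [31, 61, 71]), (5, [149, 2699]), (7, [43, 83, 113]), (7, [197, 293, 1567, 4409]),
    (11, [23, 131]), (13, [79, 313, 521, 547]), (17, [67, 101, 103, 307, 409, 919]), (19, [37,
    151, 227, 569]), (23, [47, 137, 229, 461]), (29, [59, 233, 347, 811, 1741, 2087])], ⟨2, 2,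
    27405, 17, 13, 1802, 46853, 285334769, [3, 3, 3, 5, 7, 13, 107], [285334769], [[(1, 0),
    (4301, 630), (45885, 971), (23023, 188), (95095, 1190), (177905, 1749), (28405, 714), (429,
    929), (133, 1463)], [(69, 640), (385, 1716), (49335, 367), (1225785, 470), (1105, 618),
    (146965, 279), (5681, 44), (143, 859), (231, 1116)], [(23, 570), (10140585, 919), (2187185,
    1760), (3059, 231), (245157, 1602), (95, 1572), (595, 805), (357, 205), (9867, 1499)], [(19,
    902), (81719, 1532), (165, 1225), (41055, 1445), (8151, 29), (3289, 1429), (85085, 1664),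
    (5313, 1686)], [(33, 555), (8211, 775), (4389, 216), (2185, 340), (255, 314), (13685, 1375),
    (55, 1155), (7315, 816)], [(11, 485), (4849845, 834), (273, 1004), (1174173, 1634), (6783,
    1107), (51, 1446), (2737, 705), (85, 244), (437, 1472)], [(17, 1376), (62491, 529), (168245,
    1386), (391391, 1564), (7293, 503), (780045, 545), (31395, 442), (91, 934), (759, 1125)],
    [(195, 1113), (3927, 690), (25935, 774), (627, 1457), (260015, 475), (10465, 372), (156009,
    1677), (323323, 94), (253, 1055)], [(39, 443), (167739, 1073), (105, 1300), (451605, 128),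
    (52003, 1607), (8645, 704), (969, 546), (65, 1043), (209, 1387)], [(13, 373), (55913, 1003),
    (14421, 225), (150535, 58), (35, 1230), (90321, 1260), (596505, 1344), (15015, 357), (323,
    476)], [(7, 560), (30107, 1190), (897, 1013), (3705, 213), (124355, 390), (22287, 1116),
    (4807, 155), (1495, 1613), (561, 129)], [(15, 739), (64515, 1369), (805, 1800), (8580495,
    1030), (5311735, 773), (7429, 1046), (7735, 1178), (3187041, 173)], [(3, 69), (12903, 699),
    (161, 1130), (1716099, 360), (1062347, 103), (5, 669), (2145, 1598), (533715, 16)]]⟩)]⟩]⟩)]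

lemma certificatesSeven_check : certificatesSeven.all certCheck = true := by
  decide +kernel

def certificatesEightLow : List (ℕ × ℕ × ℕ × TripleCert) := [
  (8, 2, 6, ⟨2, 16, 6, 6, [⟨0, 6, 0, 36, 228, 1680, [7, 239, 577, 31, 241, 4663, 97, 71, 83,
    13441], [([], ⟨0, 2, 1, 9, 1, 2, 5, 19, [], [19], [[(1, 0), (3, 1)]]⟩), ([(7, [293, 587,
    1471])], ⟨2, 2, 7, 9, 1, 18, 37, 223, [13], [223], [[(1, 0), (105, 9), (3, 8), (35,
    1)]]⟩)]⟩]⟩),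
  (8, 2, 30, ⟨16, 30, 2, 22, [⟨0, 2, 0, 92, 1052, 48, [241, 37, 17, 4943, 31], [([(5, [59, 79,
    101]), (11, [43, 109, 131])], ⟨0, 2, 1, 9, 1, 21, 49, 97, [3, 5], [97], [[(1, 0), (11, 8),
    (5, 10), (15, 6), (33, 4)]]⟩), ([(3, [19, 557]), (7, [29, 41, 113, 127]), (7, [97, 3529]),
    (13, [157, 181, 1093, 2549])], ⟨2, 2, 21, 9, 1, 8, 257, 1543, [3, 5, 41], [1543], [[(1, 0),
    (273, 4)]]⟩)]⟩]⟩),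
  (8, 2, 240, ⟨2, 16, 240, 6, [⟨0, 6, 0, 36, 228, 480, [29, 11, 1153, 5521, 2281, 1409, 3457,
    641], [([], ⟨0, 2, 1, 13, 1, 4, 17, 67, [], [67], [[(1, 0), (15, 1)]]⟩), ([(7, [13, 71,
    113])], ⟨1, 2, 7, 13, 1, 2, 5, 19, [13], [19], [[(1, 0), (3, 1)]]⟩), ([(3, [179, 24121]),
    (3, [53]), (11, [23, 43, 89, 131, 659]), (13, [79, 313, 389, 467])], ⟨3, 2, 9, 13, 1, 38,
    229, 1373, [179], [1373], [[(1, 0), (143, 35), (195, 31), (11, 24)]]⟩)]⟩]⟩),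
  (8, 2, 1056, ⟨2, 16, 1056, 6, [⟨0, 6, 3, 1149156, 33828, 96, [1153, 13729, 257, 1409, 193,
    3457], [([(3, [73, 179]), (5, [19, 241]), (7, [71, 83, 113, 139]), (7, [293, 587, 1471]),
    (11, [23, 43, 89, 109, 131]), (31, [61, 311, 557, 619, 1489])], ⟨0, 2, 7161, 12, 1, 41, 83,
    331, [28643], [331], [[(1, 0), (7, 8), (5, 27), (3, 31)]]⟩), ([(7, [83, 113, 2689])], ⟨2, 4,
    7, 12, 1, 9, 19, 8513, [], [8513], [[(1, 0), (3, 4)]]⟩), ([(5, [19, 29])], ⟨3, 2, 1, 12, 1,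
    18, 37, 593, [], [593], [[(1, 0), (5, 5), (15, 13)]]⟩)]⟩]⟩),
  (8, 2, 8190, ⟨16, 8190, 2, 362, [⟨0, 7482, 0, 16412, 980457692, 240, [11, 41, 17, 421, 29, 479],
    [([(7, [71, 83, 139, 839]), (11, [43, 67, 131, 307]), (31, [311, 373, 683, 743, 991])], ⟨0,
    2, 7, 9, 1, 11, 2047, 28657, [3, 3, 5, 7, 13], [28657], [[(1, 0), (1023, 10)]]⟩)]⟩, ⟨2, 240,
    1, 36462682652, 278492, 672, [11, 22343, 17, 83, 16421, 193, 11423, 191], [([(3, [251,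
    503]), (5, [29, 41, 61, 211]), (5, [101, 151, 349]), (5, [499, 1999]), (17, [137, 239, 271,
    409]), (5, [1249, 26251, 42499]), (17, [577, 2311, 3467, 3469, 8669])], ⟨0, 2, 758625, 9, 1,
    23, 47, 2633, [3, 3, 5, 7, 13, 499, 3469], [2633], [[(1, 0), (3, 19), (15, 5), (5, 9)]]⟩),
    ([(3, [251, 2017]), (3, [107, 2269]), (5, [29, 41, 61]), (11, [43, 67, 131, 197]), (13, [53,
    233, 701, 727]), (17, [137, 239, 271, 1019]), (19, [37, 113, 227, 379])], ⟨2, 2, 9, 9, 1,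
    815, 11411, 205397, [3, 3, 5, 7, 13, 19], [205397], [[(1, 0), (399, 490), (429, 415),
    (146965, 40), (3, 89), (19019, 727), (165, 515), (133, 401)]]⟩)]⟩]⟩),
  (8, 2, 35910, ⟨2, 16, 35910, 6, [⟨0, 6, 4, 39037476, 1149156, 480, [577, 31, 269, 5521, 97, 257,
    1409, 193, 3457], [([(7, [13, 83, 139]), (7, [293, 587, 1471]), (11, [23, 43, 89, 109, 353,
    461]), (13, [79, 313, 389]), (17, [67, 101, 373]), (23, [229, 643, 967, 1151, 1931]), (613,
    [3677, 8581, 13487, 14713, 36779, 39233, 67429, 73561, 98081, 140989])], ⟨0, 2, 98693, 9, 3,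
    905, 5431, 217241, [47, 8581], [217241], [[(1, 0), (55, 311), (3927, 541), (15, 668), (715,
    96), (7735, 180), (35, 799), (3003, 730)], [(5, 579), (65, 364), (85, 175), (1155, 619),
    (21, 308), (19635, 215), (273, 93), (33, 725)], [(3, 88), (165, 399), (187, 232), (2805,
    900), (36465, 685), (39, 778), (7, 219), (51, 589), (143, 421)]]⟩), ([(7, [13, 71, 251]),
    (7, [293, 2939]), (7, [6173, 8233, 13721]), (11, [23, 43, 89, 109, 461, 463]), (13, [79,
    181, 313]), (17, [67, 101, 103, 373]), (89, [2137, 2671, 4273, 6229, 6763, 11393])], ⟨2, 2,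
    4361, 9, 3, 726, 4357, 76003507, [], [76003507], [[(1, 0), (77, 87), (1309, 102), (119,
    260), (17, 15), (143, 369), (13, 527)], [(15, 538), (1155, 625), (19635, 640), (1785, 72),
    (255, 553), (2145, 181), (195, 339)], [(3, 520), (231, 607), (455, 63), (55, 585), (12155,
    401), (7735, 78)]]⟩), ([(5, [149, 151, 401, 1201]), (5, [499, 1499]), (7, [13, 71]), (7,
    [293, 1471, 2939, 14699])], ⟨4, 2, 175, 9, 1, 5, 33, 463, [349], [463], [[(1, 0), (35,
    1)]]⟩)]⟩]⟩)]

lemma certificatesEightLow_check : certificatesEightLow.all certCheck = true := by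
  decide +kernel

def certificatesEightHigh : List (ℕ × ℕ × ℕ × TripleCert) := [
  (8, 12, 1, ⟨1, 12, 96, 4, [⟨0, 5, 0, 26, 86, 144, [13, 97, 193, 607, 73, 577], [([], ⟨0, 2, 1,
    6, 1, 6, 13, 103, [3, 3], [103], [[(1, 0), (3, 4)]]⟩), ([(3, [109, 433]), (5, [11, 29, 79]),
    (5, [149, 199]), (3, [809, 28349]), (3, [2917, 4861]), (5, [251, 3001, 24001]), (5, [4999,
    22501]), (5, [18749, 49999]), (7, [41, 71, 139, 337]), (2, [13441])], ⟨1, 4, 1, 6, 1, 3, 7,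
    223, [3, 3], [223], [[(1, 0), (3, 2)]]⟩), ([(3, [433, 10369]), (5, [11, 79]), (7, [41, 71,
    139, 337]), (11, [23, 43, 197, 397])], ⟨3, 2, 9, 6, 1, 140, 899, 32863, [3, 3], [59, 557],
    [[(1, 0), (35, 62), (1155, 8), (33, 86)]]⟩)]⟩]⟩),
  (8, 12, 5, ⟨5, 96, 12, 22, [⟨0, 57, 0, 202, 27562, 16, [241, 6833, 5569], [([(3, [13]), (5, [59,
    101])], ⟨0, 2, 1, 9, 1, 5, 31, 61, [3, 3, 5], [61], [[(1, 0), (15, 4)]]⟩)]⟩, ⟨1, 12, 0, 682,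
    5962, 480, [23, 101, 461, 47, 2339, 769, 79, 17599], [([(13, [157, 1039, 1171, 3121])], ⟨0,
    2, 13, 9, 1, 3, 7, 181, [3, 3, 5], [181], [[(1, 0)]]⟩), ([(3, [19, 179]), (7, [29, 41, 71]),
    (11, [43, 109, 131]), (13, [157, 911]), (23, [139, 229, 277, 599, 691])], ⟨2, 2, 69, 9, 1,
    324, 1297, 2593, [3, 3, 5, 277], [2593], [[(1, 0), (2145, 182), (55, 285), (3, 80), (39,
    221), (7, 113), (13, 141), (91, 254)]]⟩)]⟩]⟩),
  (8, 12, 40, ⟨12, 40, 96, 22, [⟨0, 8, 2, 22260584, 46184, 16, [241, 17, 31], [([(3, [13, 383]),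
    (5, [59, 79]), (5, [199, 601, 1499]), (7, [29, 41, 71, 113]), (11, [43, 109, 131, 307]),
    (13, [157, 181, 859, 911]), (17, [67, 103, 137]), (19, [151, 191, 569, 1481])], ⟨0, 2, 1615,
    12, 1, 214, 857, 29137, [3, 3, 5, 191], [29137], [[(1, 0), (77, 206), (455, 140), (21, 81),
    (195, 204), (33, 56)]]⟩), ([], ⟨2, 2, 1, 12, 1, 1, 3, 47, [3, 3, 5], [47], [[(1, 0)]]⟩)]⟩]⟩),
  (8, 12, 176, ⟨12, 176, 96, 46, [⟨0, 96, 0, 376, 203128, 672, [13, 17, 29, 97, 191, 6719, 383,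
    2689], [([(5, [19, 59]), (11, [67, 307, 373, 661, 769])], ⟨0, 2, 1, 14, 1, 10, 41, 83, [3,
    3, 11], [83], [[(1, 0), (21, 9), (385, 4)]]⟩), ([(5, [19, 31]), (5, [101, 349]), (11, [67,
    109]), (13, [131, 157, 311, 389]), (137, [547, 823, 1097, 2467, 2741, 4933, 7673, 19727])],
    ⟨2, 2, 685, 14, 1, 545, 3271, 98129, [3, 3, 11, 547], [98129], [[(1, 0), (273, 234), (385,
    436), (11, 462), (21, 283), (35, 519), (231, 200), (13, 496), (455, 470)]]⟩)]⟩]⟩),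
  (8, 12, 1365, ⟨12, 1365, 96, 128, [⟨0, 1121, 0, 2754, 18364734, 48, [43, 16381, 2081, 31],
    [([(3, [8999, 19009]), (5, [11, 19]), (7, [29, 71, 503])], ⟨0, 2, 3, 6, 1, 33, 67, 3217, [3,
    3, 3, 3, 5, 7, 13], [3217], [[(1, 0), (7, 23), (15, 21), (3, 6), (21, 29), (5, 15)]]⟩)]⟩,
    ⟨1, 96, 0, 19134, 1575234, 48, [43, 8191, 17, 191, 11423], [([(7, [29, 71, 2017, 2129]),
    (11, [23, 89, 109, 617]), (13, [103, 157, 181, 313, 547, 571]), (19, [113, 229, 457, 1063,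
    3191]), (23, [139, 367, 1103, 1747])], ⟨0, 2, 1, 6, 1, 104, 901, 14137, [3, 3, 3, 3, 5, 7,
    13], [67, 211], [[(1, 0), (3059, 64), (62491, 80), (19, 89), (247, 35)]]⟩), ([(3, [37,
    233]), (3, [53, 379]), (3, [647]), (5, [11, 19, 149]), (7, [29, 71, 503]), (11, [23, 89,
    109]), (11, [967, 2179, 2903, 3389]), (13, [103, 131, 157]), (17, [67, 101, 137, 239, 271,
    307]), (19, [113, 229, 419, 457, 607]), (23, [139, 367, 919]), (29, [349, 463, 521, 811]),
    (103, [2267, 3089, 7417, 10711, 11743, 12979, 13597, 14419])], ⟨2, 2, 30591, 6, 3, 2929,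
    70297, 17203644217, [3, 3, 3, 3, 5, 7, 13], [17203644217], [[(1, 0), (1105, 939), (38019,
    90), (88179, 2321), (23, 2585), (30107, 240), (1595, 1724), (62491, 2299), (665, 845)],
    [(29, 2657), (32045, 667), (35581, 1271), (737035, 323), (72105, 2357), (1885, 2755),
    (78793, 2371), (493, 569), (667, 2313)], [(55, 1995), (85215, 459), (60697, 158), (62985,
    1644), (21505, 2492), (2639, 502), (57, 705), (2415, 488), (105, 832)]]⟩)]⟩]⟩),
  (8, 12, 5985, ⟨96, 5985, 12, 758, [⟨0, 4565, 0, 12162, 2622878562, 96, [23, 193, 31, 257, 6143],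
    [([(5, [29, 61, 89]), (7, [41, 83]), (11, [43, 67, 263, 307]), (13, [53, 79, 131, 311, 313,
    467]), (17, [101, 103, 137, 373, 409]), (19, [37, 113, 191, 419, 647]), (23, [47, 277, 367,
    827])], ⟨0, 2, 1, 9, 3, 387, 6967, 13933, [3, 3, 3, 3, 3, 5, 7, 19], [13933], [[(1, 0),
    (805, 229), (373065, 23), (15249, 347), (143, 42), (285, 264), (91, 249)], [(3, 253), (2415,
    95), (221, 60), (2093, 282), (3289, 75), (273, 115)], [(35, 195), (55, 375), (17043, 350),
    (90321, 45), (663, 313), (1448655, 357), (1463, 149), (69, 286)]]⟩)]⟩, ⟨5, 12, 0, 2884962,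
    6906882, 96, [193, 20143, 73, 257, 6143], [([(3, [17]), (3, [107]), (5, [29, 59, 241]), (7,
    [41, 83, 167]), (17, [101, 103, 137, 409])], ⟨0, 2, 153, 9, 1, 5, 11, 199, [3, 3, 3, 3, 3,
    5, 7, 11, 19, 103], [199], [[(1, 0), (3, 3), (5, 4), (7, 2), (35, 1)]]⟩), ([(3, [17]), (5,
    [29, 59, 61]), (7, [41, 83, 167, 239]), (11, [43, 67, 197]), (13, [53, 79, 131, 311]), (17,
    [101, 103, 137, 443]), (17, [1733, 6359, 8669, 17341]), (19, [37, 113, 191, 419]), (23, [47,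
    367, 827, 919, 1013, 5059]), (29, [173, 233, 349, 521, 929, 1277, 1973]), (31, [433, 557,
    619, 1301]), (37, [149, 223, 887, 1481, 1627, 2293]), (179, [359, 1433, 3221, 3581, 7159,
    7517, 8233])], ⟨2, 2, 9129, 9, 17, 29889, 3048679, 3274281247, [3, 3, 3, 3, 3, 5, 7, 19,
    101], [3274281247], [[(1, 0), (30478565, 24571), (74111037, 22950), (566901309, 6784),
    (3222219, 9998), (940355, 18590), (13498485, 13277), (2047395, 16017), (136838247, 278),
    (319865, 5113), (111435, 10), (165, 29035)], [(407, 24540), (623645, 21466), (11599797,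
    3679), (19019, 3206), (212135, 7989), (27115, 8514), (977699359, 26583), (121737, 14110),
    (2799951, 27062), (9361, 7603), (4879105, 20941), (11951, 12452), (2431, 3731)], [(185,
    8516), (5272635, 17544), (87087, 21956), (1272705, 11038), (20553, 29698), (1258629, 14265),
    (3698331, 12236), (666159, 5790), (55335, 27975), (9846921, 13740), (823745, 6640), (25415,
    659)], [(11, 6609), (335264215, 1291), (449735, 12247), (1040776737, 4519), (607759061,
    21604), (101751517, 12524), (323, 24410), (80925845, 24674), (3139339, 6543), (39585, 5932),
    (2145962445, 12195), (10343905, 25199)], [(5, 20474), (2245789, 14389), (123239415, 14306),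
    (2139, 15639), (3802305, 8325), (370555185, 13535), (3023603, 2124), (9408035, 17668),
    (11571, 12746), (357, 6765), (87453015, 21277), (1479, 13271)], [(2035, 15125), (351509,
    25007), (37851, 27227), (1768767, 5893), (15283, 12055), (28129101, 16477), (2187185, 6743),
    (4888496795, 17168), (119567, 11530), (12155, 24205), (393965, 297), (59755, 3037)], [(2639,
    13395), (3553, 1130), (435435, 12541), (795093, 22985), (2140635, 21262), (143064163,
    19658), (81719, 14082), (273615, 21787), (24531, 17004), (102765, 20283), (66045, 15281),
    (1501423, 200)], [(55, 27083), (24703679, 20998), (1355633565, 20915), (30039, 27097),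
    (5830201, 28740), (508757585, 3109), (3927, 13374), (127281, 19355), (90321, 26326),
    (4499495, 11325), (1023, 9296), (682465, 14065)], [(111, 19882), (170085, 16808), (1330665,
    16283), (40579, 12158), (15249, 12025), (1315237, 18139), (465, 23161), (57855, 3331),
    (1236789689135, 6840), (663, 28962), (41055, 10302), (9080799, 4124)], [(1147, 18666),
    (1757545, 15592), (101269, 5807), (852397, 7916), (4352865, 875), (157573, 10809), (189255,
    17812), (3234846615, 20014), (419543, 12313), (29029, 20004), (201158529, 12657), (6851,
    27746), (18445, 26023)], [(3, 1951), (243318845, 26655), (408595, 4667), (91435695, 26522),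
    (501740239, 4935), (2821065, 20541), (5644821, 29034), (7507115, 20674), (346925579, 2567),
    (3975465, 13570), (69, 14903), (330429, 3817)], [(31, 735), (824619, 27355), (11339, 24271),
    (5115, 29770), (944835515, 25306), (3857, 10794), (5370365, 28520), (228063745, 18800),
    (236379, 11663), (119, 4813), (57057, 5157), (713, 13687)], [(555, 10467), (75361, 4466),
    (290191, 8338), (76245, 2610), (200651, 5970), (48433, 29353), (1569799, 5445), (45403995,
    24598), (13560547, 16893), (1044291885, 7661), (19332995, 22201), (25935, 19022)], [(33,
    8560), (1005792645, 3242), (131905, 22203), (1823277183, 23555), (10555545, 13673),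
    (1696413, 2048), (787865, 1394), (25536095, 7375), (43730115, 20179), (759, 21512),
    (1349205, 14198), (22287, 9424)], [(15, 22425), (6737367, 16340), (42427, 17403), (30107,
    24374), (109073965, 12457), (10013, 25145), (1309, 11422), (1227135, 6667), (975821, 466),
    (7843, 20296), (1652145, 24291), (39896441585, 6104)], [(37, 17930), (56695, 14856),
    (1054527, 26958), (6105, 17076), (19285, 1379), (1729, 26485), (2465, 1904), (337306278855,
    2182), (36465, 26156), (11067, 7500), (595, 25287), (221, 27010), (851, 993)], [(7917,
    15346), (1852405, 3772), (67052843, 10705), (89947, 21661), (872002131, 17212), (10659,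
    3081), (5569795, 3001), (42605315, 16724), (703703, 21136), (2068781, 4724), (245157,
    16033), (242165, 19938), (2915341, 27642)]]⟩)]⟩]⟩),
  (8, 70, 234, ⟨70, 234, 560, 128, [⟨0, 48, 2, 150278769248, 9173408, 16, [17, 2081, 193], [([(5,
    [19, 41]), (3, [43, 59]), (7, [29, 71, 839]), (11, [23, 89, 617]), (19, [113, 229, 419,
    607]), (103, [2267, 3089, 11743, 13597, 14419, 14831, 38933]), (1229, [2459, 46703, 58991,
    98321, 233509, 457189, 467021, 479309, 589921, 825889, 1135597])], ⟨0, 2, 2405153, 6, 1,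
    2231, 4463, 21468395677, [3, 3, 5, 5, 7, 7, 7, 13], [21468395677], [[(1, 0), (21, 1670),
    (33, 235), (165, 2108), (55, 2066), (5, 1873), (3, 42), (1155, 1505), (7, 1628), (11,
    193)]]⟩), ([(3, [43, 191]), (3, [8999])], ⟨2, 2, 3, 6, 1, 6, 13, 157, [3, 3, 5, 5, 7, 7, 7,
    13], [157], [[(1, 0), (3, 4)]]⟩)]⟩]⟩),
  (8, 70, 1026, ⟨70, 1026, 560, 268, [⟨0, 560, 0, 2192, 40221392, 480, [23, 31, 719, 17519, 127,
    257, 5839, 577], [([], ⟨0, 2, 1, 6, 1, 6, 13, 79, [3, 3, 3, 5, 5, 7, 7, 7, 7, 19], [79],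
    [[(1, 0), (5, 3)]]⟩), ([(3, [17, 37]), (7, [13, 29, 251, 419]), (11, [109, 131, 199, 331]),
    (13, [79, 311, 389, 701]), (47, [563, 1033, 1223, 2819, 3761, 4229, 4889]), (1709, [20507,
    20509, 30763, 41017, 246097, 328127, 338383, 375979, 481939, 526373, 563971, 902351])], ⟨2,
    2, 240969, 6, 3, 1427, 8563, 428149, [3, 3, 3, 5, 5, 7, 7, 7, 19, 963877], [428149], [[(1,
    0), (2145, 39), (105, 1046), (91, 735), (385, 699), (429, 793), (21, 373), (5, 673), (77,
    26)], [(3, 259), (55, 585), (15, 932), (13, 621), (1001, 647), (273, 994), (1155, 958),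
    (231, 285), (1365, 240)], [(7, 113), (143, 533), (15015, 152), (39, 880), (35, 786), (33,
    171), (3003, 906), (165, 844), (195, 126)]]⟩)]⟩]⟩)]

lemma certificatesEightHigh_check : certificatesEightHigh.all certCheck = true := by
  decide +kernel

def certificatesTen : List (ℕ × ℕ × ℕ × TripleCert) := [
  (10, 12, 56, ⟨12, 120, 56, 38, [⟨0, 56, 0, 264, 80904, 144, [13, 131, 17, 47, 503, 1823], [([],
    ⟨0, 2, 3, 13, 1, 2, 5, 31, [3, 3, 3, 5], [31], [[(1, 0), (3, 1)]]⟩), ([(2, [7103]), (17,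
    [101, 307, 409, 613, 1019]), (17, [577, 20809, 27743, 46817])], ⟨2, 4, 867, 13, 1, 2, 5,
    641, [3, 3, 3, 5, 23, 577], [641], [[(1, 0)]]⟩)]⟩]⟩),
  (10, 12, 208, ⟨120, 208, 12, 158, [⟨0, 12, 0, 656, 300176, 96, [17, 23, 431, 193, 2113], [([(5,
    [11, 19, 31])], ⟨0, 2, 1, 14, 1, 3, 9, 73, [3, 3, 3, 5, 13], [73], [[(1, 0), (5, 2)]]⟩),
    ([(3, [71, 577]), (3, [593, 12097]), (3, [163]), (5, [11, 19, 179]), (7, [83, 127, 197,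
    211]), (11, [43, 67, 89, 131]), (19, [37, 191, 227, 379]), (31, [61, 311, 373, 433])], ⟨2,
    2, 15903, 14, 1, 102, 409, 26017309, [3, 3, 3, 3, 5, 13], [26017309], [[(1, 0), (5, 60),
    (1155, 25), (231, 67), (3, 11)]]⟩)]⟩]⟩)]

lemma certificatesTen_check : certificatesTen.all certCheck = true := by
  decide +kernel

def certificatesEleven : List (ℕ × ℕ × ℕ × TripleCert) := [
  (11, 6, 32, ⟨6, 66, 32, 20, [⟨0, 32, 0, 144, 12816, 240, [7, 199, 23, 29, 5189, 719, 2399],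
    [([], ⟨0, 2, 1, 6, 1, 6, 13, 53, [3, 3, 3, 3, 11], [53], [[(1, 0), (5, 3)]]⟩), ([(3, [179,
    181]), (7, [41, 43]), (13, [53, 79, 103, 131, 157])], ⟨2, 2, 39, 6, 1, 86, 173, 377831, [3,
    3, 3, 3, 3, 11], [377831], [[(1, 0), (5, 39), (7, 9), (15, 66), (3, 27), (21, 36)]]⟩)]⟩]⟩),
  (11, 6, 112, ⟨66, 112, 6, 86, [⟨0, 6, 0, 356, 44708, 64, [3697, 2833, 6719, 257, 383], [([(3,
    [17, 47]), (3, [19, 2591])], ⟨0, 2, 3, 9, 1, 2, 5, 31, [3, 3, 7, 11, 17], [31], [[(1, 0),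
    (3, 1)]]⟩), ([(3, [17, 47]), (5, [31, 239, 6079]), (7, [13, 41, 71, 1609]), (13, [79, 157,
    311, 911]), (13, [337, 677, 4057, 5407, 14197]), (17, [103, 271, 409, 919, 953])], ⟨2, 4,
    13, 9, 1, 55, 2759, 5519, [3, 3, 7, 11, 7487], [5519], [[(1, 0), (85, 13), (357, 44), (39,
    18), (3315, 31)]]⟩)]⟩]⟩),
  (11, 6, 12880, ⟨6, 12880, 66, 278, [⟨0, 12330, 0, 25772, 952888172, 144, [31, 19, 73, 2161,
    14879, 1153], [([(5, [41, 241, 269]), (7, [13, 29, 71, 223]), (11, [67, 197, 331, 463,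
    1319]), (13, [53, 79, 181]), (17, [101, 103, 239, 307])], ⟨0, 2, 1, 9, 1, 671, 4027, 64433,
    [3, 3, 5, 7, 23], [64433], [[(1, 0), (15, 290), (1309, 480), (255255, 330), (2805, 588),
    (231, 450), (7, 182)]]⟩)]⟩, ⟨32, 66, 0, 2498732, 5126252, 576, [2273, 73, 3119, 191, 359,
    383, 1279], [([(5, [41, 89]), (7, [13, 29, 71]), (11, [67, 197, 331, 461, 1013, 1187]), (11,
    [727, 1451, 2663, 2903, 4357]), (13, [53, 79, 131])], ⟨0, 3, 33, 9, 1, 48, 193, 203809, [3,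
    3, 5, 7, 17, 23], [203809], [[(1, 0), (3, 42), (65, 7), (3003, 32)]]⟩), ([(5, [41, 269]),
    (3, [271]), (3, [1619]), (7, [13, 29, 71]), (7, [97, 293, 881]), (11, [67, 197, 331, 593]),
    (13, [53, 79, 131, 181]), (13, [3041, 3719, 11831, 14197, 16223]), (17, [101, 103, 373,
    443])], ⟨2, 4, 2457, 9, 2, 108739, 434957, 2442718511, [3, 3, 5, 7, 23, 223], [2442718511],
    [[(1, 0), (1547, 86412), (85, 67159), (429, 83715), (273, 55373), (6545, 48201), (77,
    89781), (35, 103995), (1155, 17162), (36465, 42135), (2431, 6015), (15015, 78971), (455,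
    57065), (55, 23598)], [(3, 71583), (4641, 49256), (255, 30003), (65, 26345), (2145, 48251),
    (5, 73275), (165, 95181), (595, 97878), (255255, 72854), (7735, 50948), (1309, 83664), (7,
    30719), (91, 92528), (17, 102622), (39, 24653)]]⟩)]⟩]⟩),
  (11, 6, 44720, ⟨66, 44720, 6, 1718, [⟨0, 41350, 0, 89572, 122045441572, 48, [101, 7, 769, 2719],
    [([(3, [73]), (5, [19, 31]), (5, [149, 151, 401]), (5, [751, 10501]), (7, [29, 41]), (11,
    [67, 109, 197])], ⟨0, 2, 75, 9, 1, 131, 263, 13151, [3, 3, 5, 11, 13, 17, 43], [13151],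
    [[(1, 0), (15, 103), (77, 53), (1155, 25), (55, 65), (5, 20)]]⟩)]⟩, ⟨6, 112, 1,
    52532900349412, 17798692, 16, [7, 127, 2719], [([(3, [17, 97]), (3, [37, 73]), (3, [53,
    107]), (5, [19, 89]), (5, [149, 151, 401, 4951]), (11, [67, 109, 131, 197, 331]), (19, [113,
    227, 229, 379, 419])], ⟨0, 2, 28215, 9, 1, 11, 23, 68311, [3, 3, 5, 11, 13, 17, 37, 43, 67,
    2281], [68311], [[(1, 0), (5, 6)]]⟩), ([(3, [17, 4079]), (3, [37, 1151]), (3, [107]), (5,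
    [19, 449]), (5, [149, 151]), (7, [29, 71, 167]), (11, [67, 197, 199])], ⟨2, 2, 3465, 9, 1,
    5, 31, 61, [3, 3, 5, 11, 13, 37, 43, 131, 139], [61], [[(1, 0), (15, 4)]]⟩)]⟩]⟩),
  (11, 120, 644, ⟨120, 644, 1320, 278, [⟨0, 208, 2, 7883623992568, 102011128, 192, [17, 109, 3119,
    191, 14879, 1279], [([(3, [19, 359]), (5, [41, 89, 241]), (5, [149]), (5, [751, 2999]), (5,
    [4999, 11251]), (7, [29, 43, 71]), (7, [97, 293, 587]), (13, [53, 79, 131, 311]), (29, [59,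
    233, 349, 521, 811])], ⟨0, 2, 989625, 14, 1, 81, 163, 285251, [3, 3, 5, 5, 5, 7, 23,
    950039], [285251], [[(1, 0), (35, 7), (3, 20), (5, 15), (7, 73), (15, 35), (105, 27)]]⟩),
    ([(5, [41, 641]), (11, [67, 461, 1013, 1321])], ⟨2, 2, 1, 14, 1, 21, 49, 97, [3, 3, 5, 5, 5,
    7, 23], [97], [[(1, 0), (11, 8), (5, 10), (15, 6), (33, 4)]]⟩)]⟩]⟩),
  (11, 120, 2236, ⟨120, 1320, 2236, 398, [⟨0, 644, 2, 56103656719680, 354185280, 240, [97, 31,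
    18439, 59, 719, 21121], [([(7, [41, 113, 127, 211]), (7, [293, 491]), (11, [89, 109, 353,
    461]), (11, [241, 1453, 1693, 5081]), (13, [53, 79, 131]), (17, [67, 101, 137, 239, 1021]),
    (1061, [25463, 44563, 82759, 89123, 103979, 118831, 140053, 152783, 163393])], ⟨0, 2, 81697,
    14, 3, 447, 2683, 5693327, [3, 3, 3, 3, 3, 3, 5, 5, 5, 11, 461, 461], [5693327], [[(1, 0),
    (55, 368), (221, 42), (385, 337), (119, 98), (17, 129)], [(3, 305), (165, 226), (663, 347),
    (1155, 195), (357, 403), (51, 434)], [(5, 276), (3927, 47), (429, 309), (7735, 287), (35,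
    245), (3003, 278), (455, 158)]]⟩), ([(3, [17, 37]), (3, [271]), (7, [41, 113])], ⟨2, 2, 9,
    14, 1, 29, 59, 1063, [3, 3, 3, 3, 5, 5, 5, 11], [1063], [[(1, 0), (7, 18), (15, 27), (35,
    24)]]⟩)]⟩]⟩)]

lemma certificatesEleven_check : certificatesEleven.all certCheck = true := by
  decide +kernel

def certificatesTwelveLow : List (ℕ × ℕ × ℕ × TripleCert) := [
  (12, 1, 5, ⟨5, 12, 1, 8, [⟨0, 1, 0, 34, 94, 336, [43, 17, 113, 23, 47, 2239, 4703], [([(5, [19,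
    29])], ⟨0, 2, 1, 4, 1, 3, 7, 43, [3, 5], [43], [[(1, 0), (3, 2), (5, 1)]]⟩), ([(3, [127,
    163]), (3, [109, 541]), (11, [67, 263, 353])], ⟨2, 2, 9, 4, 1, 12, 35, 1397, [3, 5], [11,
    127], [[(1, 0), (11, 8), (3, 5)]]⟩)]⟩]⟩),
  (12, 1, 21, ⟨12, 21, 1, 16, [⟨0, 1, 0, 66, 318, 1008, [127, 293, 19, 4049, 37, 41, 337, 2879],
    [([(5, [31, 179])], ⟨0, 2, 1, 4, 1, 18, 37, 73, [3, 3, 3, 7], [73], [[(1, 0), (5, 5), (15,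
    13), (3, 8)]]⟩), ([], ⟨2, 2, 1, 4, 1, 1, 3, 391, [3, 3, 3, 7], [17, 17, 23], [[(1,
    0)]]⟩)]⟩]⟩),
  (12, 1, 96, ⟨1, 12, 96, 4, [⟨0, 5, 0, 26, 86, 144, [13, 97, 193, 607, 73, 577], [([], ⟨0, 2, 1,
    6, 1, 6, 13, 103, [3, 3], [103], [[(1, 0), (3, 4)]]⟩), ([(3, [109, 433]), (5, [11, 29, 79]),
    (5, [149, 199]), (3, [809, 28349]), (3, [2917, 4861]), (5, [251, 3001, 24001]), (5, [4999,
    22501]), (5, [18749, 49999]), (7, [41, 71, 139, 337]), (2, [13441])], ⟨1, 4, 1, 6, 1, 3, 7,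
    223, [3, 3], [223], [[(1, 0), (3, 2)]]⟩), ([(3, [433, 10369]), (5, [11, 79]), (7, [41, 71,
    139, 337]), (11, [23, 43, 197, 397])], ⟨3, 2, 9, 6, 1, 140, 899, 32863, [3, 3], [59, 557],
    [[(1, 0), (35, 62), (1155, 8), (33, 86)]]⟩)]⟩]⟩),
  (12, 1, 320, ⟨1, 12, 320, 4, [⟨0, 5, 3, 53846, 3866, 144, [13, 97, 53, 193, 31, 73, 577], [([(3,
    [109]), (5, [19, 61, 89]), (3, [809, 1621])], ⟨0, 2, 135, 6, 1, 6, 13, 701, [3, 29, 53],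
    [701], [[(1, 0), (3, 4)]]⟩), ([(7, [41, 71, 223, 673]), (13, [103, 157])], ⟨2, 2, 13, 6, 1,
    14, 29, 59, [3, 103], [59], [[(1, 0), (21, 3), (3, 5)]]⟩), ([(7, [41, 71, 223, 673, 1567]),
    (11, [23, 43, 197, 307])], ⟨3, 2, 1, 6, 1, 12, 45, 1037, [3], [17, 61], [[(1, 0), (11, 10),
    (7, 7)]]⟩)]⟩]⟩),
  (12, 1, 1365, ⟨12, 1365, 1, 128, [⟨0, 1121, 0, 2754, 18364734, 16, [17, 2081, 193], [([(3,
    [43]), (11, [23, 89, 109, 659])], ⟨0, 2, 1, 4, 1, 21, 49, 1667, [3, 3, 3, 3, 5, 7, 13],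
    [1667], [[(1, 0), (3, 17), (11, 8), (33, 4)]]⟩)]⟩, ⟨1, 96, 1, 311877954, 19134, 16, [17,
    193], [([(3, [43, 191]), (3, [37, 233]), (5, [19, 41]), (7, [29, 71, 631, 839]), (11, [23,
    89, 109, 659]), (13, [103, 131, 157, 181, 313]), (17, [67, 101, 137])], ⟨0, 2, 39, 4, 1, 32,
    641, 1283, [3, 3, 3, 3, 5, 7, 13, 43, 157], [1283], [[(1, 0), (5, 25), (385, 8), (561, 29),
    (77, 15)]]⟩), ([(5, [19, 41, 241, 641]), (7, [29, 71, 2549, 3919]), (3, [43, 839]), (3, [37,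
    179]), (3, [53, 379]), (11, [23, 109, 199, 617])], ⟨2, 2, 27, 4, 1, 194, 389, 42013, [3, 3,
    3, 3, 5, 7, 13], [42013], [[(1, 0), (7, 134), (5, 84), (35, 24), (77, 112), (11,
    172)]]⟩)]⟩]⟩),
  (12, 1, 4485, ⟨12, 4485, 1, 232, [⟨0, 4033, 0, 8994, 217065054, 384, [7, 17, 107, 6287, 9473,
    8191, 769], [([(5, [31, 241])], ⟨0, 3, 5, 4, 1, 3, 7, 41, [3, 3, 3, 5, 13, 23, 401], [41],
    [[(1, 0), (3, 2)]]⟩)]⟩, ⟨1, 320, 1, 3363543714, 62814, 192, [7, 1583, 73, 6287, 9473, 29567,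
    193], [([(3, [433]), (3, [1187]), (5, [31, 401]), (37, [149, 593, 1109, 1481, 1999, 2663,
    6661]), (37, [13691, 38333, 65713, 197137])], ⟨0, 2, 12321, 4, 1, 23, 47, 25479829, [3, 3,
    3, 5, 11, 13, 23], [25479829], [[(1, 0), (5, 9), (3, 19)]]⟩), ([(3, [433, 577]), (3, [431]),
    (5, [179, 271, 281]), (7, [41, 71, 113, 127]), (7, [97, 197, 587, 2939]), (11, [43, 67, 89,
    131])], ⟨2, 2, 63, 4, 1, 281, 563, 1418759, [3, 3, 3, 5, 13, 23], [1418759], [[(1, 0),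
    (1155, 205), (7, 130), (15, 83), (105, 213), (11, 273)]]⟩)]⟩]⟩),
  (12, 1, 19040, ⟨1, 19040, 12, 138, [⟨0, 18765, 0, 38082, 357323682, 48, [577, 1663, 479], [([(5,
    [19, 41, 199]), (7, [13, 29, 97]), (13, [53, 79, 103, 389, 547]), (19, [37, 151, 227, 229,
    1597])], ⟨0, 2, 247, 9, 1, 26, 53, 52363, [5, 7, 17], [52363], [[(1, 0), (3, 17), (35, 9),
    (5, 21)]]⟩)]⟩, ⟨12, 1365, 1, 5049845922, 266562, 16, [31, 47, 223, 1663], [([(3, [479,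
    8929]), (3, [1459, 1801]), (5, [19, 41]), (7, [13, 29, 113]), (11, [43, 197, 881]), (13,
    [53, 79, 103, 131, 547]), (17, [307, 883, 1021, 1223, 1327]), (29, [233, 349, 523, 1217]),
    (59, [709, 827, 1181, 4129, 4721])], ⟨0, 2, 5133, 9, 3, 425, 2551, 16254971, [5, 7, 17,
    233], [16254971], [[(1, 0), (6545, 330), (39, 90), (4641, 328), (15, 320), (143, 287), (273,
    294)], [(3, 249), (19635, 154), (51, 283), (187, 55), (7735, 149), (7293, 145), (77, 225),
    (3003, 315)], [(5, 70), (1547, 78), (5005, 136), (23205, 398), (85, 104), (35, 274), (91,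
    44)]]⟩), ([(3, [479]), (3, [1367, 1459]), (5, [19, 41, 239]), (5, [101, 149, 599]), (7, [13,
    29, 113]), (11, [43, 197, 331, 353, 463]), (337, [5393, 6067, 8087, 9437, 10111, 21569,
    32353, 42461, 44483])], ⟨2, 2, 5055, 9, 1, 483, 967, 1933, [5, 7, 17, 10111], [1933], [[(1,
    0), (231, 122), (105, 139), (7, 314), (1155, 379), (11, 240)]]⟩)]⟩]⟩),
  (12, 1, 62496, ⟨1, 12, 62496, 4, [⟨0, 5, 5, 10445846, 749978, 144, [13, 97, 17, 193, 607, 577,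
    7489], [([(3, [109, 46817]), (3, [2593]), (3, [2917, 33049]), (5, [11, 19, 61]), (5, [149,
    449]), (7, [71, 139, 223]), (11, [23, 43, 197, 307, 397]), (13, [103, 131, 157, 233, 313,
    389]), (17, [67, 101, 239, 271, 443]), (23, [47, 137, 277, 367, 599, 829]), (23, [4231,
    9521, 16927, 17987, 31741])], ⟨0, 2, 9315, 6, 1, 4153, 91367, 16811527, [3, 3, 809],
    [16811527], [[(1, 0), (85, 2285), (16445, 2959), (8855, 1584), (3289, 231), (17, 3710),
    (279565, 2516), (21, 1738), (39, 3113), (3315, 1245), (30107, 2566)]]⟩), ([(3, [433, 1297]),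
    (5, [11, 19, 61]), (5, [149, 199, 449]), (11, [23, 43, 197, 397]), (3, [2593, 26729]), (13,
    [103, 131, 157, 313, 389]), (17, [67, 101, 271, 409]), (23, [47, 137, 277, 829, 1151])], ⟨2,
    2, 3105, 6, 1, 34, 953, 51461, [3, 3, 29, 47], [51461], [[(1, 0), (715, 32), (221, 16),
    (255, 25)]]⟩), ([(5, [11, 19, 79]), (11, [23, 43, 197, 397, 1321])], ⟨5, 3, 165, 6, 1, 6,
    13, 857, [3, 3, 79], [857], [[(1, 0), (3, 4)]]⟩)]⟩]⟩),
  (12, 1, 265221, ⟨12, 265221, 1, 1784, [⟨0, 261665, 0, 530466, 832789166046, 16, [21799, 31,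
    191], [([(3, [7, 17]), (3, [179]), (5, [29, 71, 181]), (7, [13, 113, 127]), (11, [23, 43,
    307]), (13, [131, 157, 389, 1039]), (17, [67, 101, 103, 443]), (19, [37, 419, 569]), (23,
    [137, 229, 461, 691]), (29, [59, 233, 349, 521, 811]), (31, [61, 311, 619, 683, 1117,
    1487])], ⟨0, 2, 3, 4, 21, 3859, 162079, 972473, [3, 3, 3, 3, 3, 11, 19, 47], [972473], [[(1,
    0), (6279, 2769), (155, 2231), (8671, 219), (973245, 1141), (17043, 3127), (14007, 1447),
    (1209, 1461)], [(165, 1482), (8666515, 2794), (37999335, 521), (1430715, 1701), (357, 857),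
    (324415, 421), (221, 3488), (55913, 563), (403, 741)], [(55, 762), (345345, 3531), (3698331,
    517), (98798271, 2890), (4524261, 1942), (3045, 1275), (5797, 3622), (12666445, 3660), (217,
    1249)], [(143, 3131), (32932757, 2170), (12155, 391), (1227135, 2016), (32782035, 530),
    (22165, 1503), (53295, 1977), (231, 500), (319, 1809)], [(77, 3639), (224315, 184), (667667,
    3858), (56751695, 1118), (103488385, 2230), (409045, 1296), (207669, 3778), (7163, 3282),
    (209, 138)], [(115, 3071), (1729, 1253), (2557191, 280), (151252255, 3096), (12121, 2072),
    (975821, 865), (46189, 3626), (82944785, 1984), (897, 2301)], [(51, 389), (46345, 3812),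
    (23529, 2435), (393255863, 1606), (93, 1501), (45353, 1387), (483, 2809), (852397, 3419),
    (299, 1581)], [(17, 3528), (106743, 2438), (7843, 1715), (147407, 3747), (2635, 1900),
    (289731, 2796), (666655, 2834), (31, 781)], [(33, 32), (96135, 436), (286143, 251),
    (24322155, 1370), (44352165, 2482), (175305, 1548), (15283, 2947), (5115, 2263), (65,
    1409)], [(11, 3171), (69069, 2081), (1705, 1543), (377, 2456), (32045, 3575), (140505,
    1302), (7293, 3520), (823745, 2494), (35, 1917)], [(91, 427), (20957209, 3325), (7735,
    1546), (33915, 3132), (14105, 2658), (20861295, 1685), (20995, 1904), (10659, 527), (203,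
    2964)], [(69, 2341), (6953765, 965), (2387, 561), (30489585, 2551), (1309, 3308), (20697677,
    780), (222053, 204), (10695, 713), (11305, 2412)], [(23, 1621), (236379, 3314), (30250451,
    1646), (10163195, 1831), (20092215, 574), (13498485, 1328), (34017, 648), (11165, 3726),
    (1955, 2740)], [(15, 2169), (787865, 3481), (3454485, 1208), (130065, 2388), (20677, 1040),
    (5083, 1250), (250705, 1340), (7315, 2055), (3795, 3103)], [(5, 1449), (31395, 359),
    (7381689, 1897), (3309033, 3219), (4991, 2870), (6045, 2910), (13485, 1588), (1151495,
    488)], [(13, 3818), (2993887, 2857), (1105, 1078), (5313, 2121), (45885, 1225), (451605,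
    3240), (35061, 98), (4845, 2664)], [(7, 467), (493991355, 480), (719355, 3047), (60697,
    686), (187, 2840), (1621477, 3059), (1612093, 3365), (28985, 1212), (19, 825)], [(715, 721),
    (6783, 1682), (7657, 1566), (650845, 2685), (39585, 1234), (17081, 244), (13750205, 3783),
    (239785, 2327), (1547, 96)], [(385, 1229), (88665115, 268), (4123, 2074), (1043119, 3008),
    (350455, 3193), (181815, 382), (18183, 3354), (13195, 514), (1173, 2010)], [(391, 1290),
    (150423, 610), (4018443, 2983), (2717, 97), (8645, 2702), (189805, 3395), (60605, 3521),
    (680295, 3556), (713, 2402)], [(3, 719), (157573, 2031), (690897, 3617), (26013, 938), (255,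
    1838), (2163777, 3491), (150345195, 3185), (50141, 3749), (465, 2950)]]⟩)]⟩, ⟨1, 19040, 1,
    11756971630626, 3713118, 3360, [7, 71, 113, 139, 29, 191, 881, 449, 257, 641, 2239], [([(3,
    [53, 127]), (3, [269, 271]), (5, [599, 701, 1051]), (11, [23, 43, 109, 197]), (17, [67, 101,
    103]), (43, [173, 773, 1031, 1033, 1549, 2579])], ⟨0, 2, 1935, 4, 1, 495, 6169, 5219831, [3,
    3, 3, 3, 3, 11, 17, 19, 47, 181], [61, 61, 85571], [[(1, 0), (1155, 53), (15, 34), (187,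
    285), (33, 211), (35, 337)]]⟩), ([(7, [293, 491, 1567, 3527]), (11, [23, 43, 199, 439]),
    (13, [131, 157, 389, 859]), (17, [67, 101, 103, 443]), (19, [37, 419, 569, 1291, 1597]),
    (23, [137, 229, 461, 643, 691, 829, 967]), (29, [59, 233, 349, 811, 929, 1217]), (31, [61,
    311, 619, 683])], ⟨2, 3, 7, 4, 10, 2252, 180161, 1441289, [3, 3, 3, 3, 3, 11, 19, 31, 47,
    113], [1441289], [[(1, 0), (45885, 2175), (622858665, 1491), (608685, 453), (27807, 93),
    (2145, 2113), (9177, 1675), (5, 500), (139035, 593)], [(561, 2186), (175305, 1266),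
    (1952535, 1687), (11571, 96), (50265787, 19), (181815, 1166), (39767, 1224), (2805, 434),
    (7843, 972)], [(2431, 1735), (10015005, 1237), (550715, 314), (23345, 1876), (22309287,
    1158), (111546435, 1658), (4669, 1376), (50141, 1897), (45849, 1339)], [(31, 1841),
    (140645505, 79), (65569, 218), (9116385915, 811), (4389, 532), (418209, 1049), (13096545,
    1810), (66495, 1702), (155, 89)], [(1311, 1245), (56751695, 1359), (1812239, 598), (440895,
    275), (11350339, 859), (41055, 2006), (8211, 1506), (19019, 81), (358701, 1937)], [(1653,
    1918), (1612093, 1386), (723695, 1465), (691587897, 747), (3457939485, 1247), (51765, 427),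
    (376805, 1824), (144739, 965), (2233, 233)], [(7, 429), (973245, 1022), (44863, 1728),
    (15015, 290), (1430715, 807), (64822395, 1138), (667, 946), (7163, 1467), (35, 929)], [(627,
    102), (897, 503), (274505, 1901), (589589, 1922), (46835, 288), (1272705, 1595), (40641,
    834), (1870935, 1380), (3927, 363)], [(253, 1382), (880555, 883), (3855005, 743),
    (367326905, 1260), (320943, 1768), (1173, 1076), (5865, 1576), (1265, 1882), (1131, 1176)],
    [(217, 18), (93093, 1631), (8870433, 2148), (1085, 518), (7395, 2249), (222053, 1056), (319,
    2055), (44352165, 396), (5083, 625)]]⟩)]⟩]⟩)]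

lemma certificatesTwelveLow_check : certificatesTwelveLow.all certCheck = true := by
  decide +kernel

def certificatesTwelveHigh : List (ℕ × ℕ × ℕ × TripleCert) := [
  (12, 4, 24, ⟨4, 48, 24, 14, [⟨0, 24, 0, 104, 4712, 336, [13, 41, 31, 607, 2017, 769, 10753],
    [([], ⟨0, 2, 1, 13, 1, 2, 5, 11, [3, 3], [11], [[(1, 0), (3, 1)]]⟩), ([(5, [11, 19, 29]),
    (5, [149, 449]), (11, [23, 43, 307]), (13, [103, 131, 157, 313]), (17, [67, 101, 239, 613]),
    (19, [113, 151, 191, 229, 419]), (23, [47, 137, 277, 367, 643, 1151])], ⟨2, 2, 5, 13, 1, 98,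
    5713, 57131, [3, 3], [57131], [[(1, 0), (10465, 86), (5681, 5), (357, 94), (759, 36),
    (36465, 91)]]⟩)]⟩]⟩),
  (12, 4, 80, ⟨48, 80, 4, 62, [⟨0, 4, 0, 256, 15616, 336, [7, 113, 13, 47, 4703, 2689, 13441],
    [([(5, [29, 79])], ⟨0, 2, 1, 18, 1, 3, 7, 13, [3, 5], [13], [[(1, 0), (3, 2), (5, 1)]]⟩),
    ([(3, [503]), (5, [29, 79])], ⟨2, 2, 3, 18, 1, 18, 37, 443, [3, 5, 23, 23], [443], [[(1, 0),
    (5, 5), (3, 8)]]⟩)]⟩]⟩),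
  (12, 4, 4760, ⟨4, 48, 4760, 14, [⟨0, 24, 0, 104, 4712, 240, [11, 193, 607, 79, 1201, 769,
    20161], [([(7, [71, 139, 223, 337]), (13, [103, 131, 157, 389])], ⟨0, 2, 65, 13, 1, 14, 29,
    59, [3, 131], [59], [[(1, 0), (21, 3), (3, 5)]]⟩), ([(7, [71, 223, 421]), (13, [103, 131,
    157, 1093])], ⟨1, 2, 91, 13, 1, 10, 41, 179089, [3], [179089], [[(1, 0), (5, 7)]]⟩), ([(3,
    [37, 89]), (5, [149, 199]), (7, [71, 139, 223]), (7, [293, 491, 881, 4409]), (7, [6173,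
    8233, 10289, 28813, 30869]), (11, [23, 43, 397, 6469]), (23, [47, 137, 367, 643, 829])], ⟨3,
    3, 16905, 13, 1, 29, 233, 467, [3, 11, 31, 47, 881], [467], [[(1, 0), (231, 1), (105,
    7)]]⟩)]⟩]⟩),
  (12, 4, 15624, ⟨4, 48, 15624, 14, [⟨0, 24, 3, 581967464, 2999912, 336, [757, 2017, 769, 673,
    29569, 10753], [([(5, [19, 29, 79]), (11, [23, 43, 307, 439, 1321]), (13, [103, 131, 157,
    313]), (17, [67, 101, 239, 271, 409]), (43, [257, 431, 859, 947, 1033, 1289]), (83, [167,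
    331, 997, 1163, 1327, 1493])], ⟨0, 2, 60673, 13, 2, 3049, 12197, 2097883, [3, 3, 11287],
    [2097883], [[(1, 0), (3003, 2132), (455, 826), (21, 796), (5005, 602), (231, 572), (35,
    2315), (195, 2380), (13, 1560), (143, 1336), (385, 2091)], [(3, 2699), (1155, 1741), (39,
    1210), (55, 945), (7, 1145), (5, 1169), (15015, 252), (33, 2475), (715, 2505)]]⟩), ([(3,
    [37, 53]), (3, [109, 433]), (5, [19, 29, 139]), (11, [23, 43, 307, 397, 461]), (13, [103,
    131, 157, 233, 313])], ⟨2, 2, 9, 13, 1, 12, 241, 8677, [3, 3, 73], [8677], [[(1, 0), (15,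
    8), (715, 3)]]⟩), ([(5, [19, 29, 79]), (5, [149, 199, 601])], ⟨3, 2, 5, 13, 1, 23, 47, 8461,
    [3, 3], [8461], [[(1, 0), (21, 8), (15, 5)]]⟩)]⟩]⟩),
  (12, 15, 91, ⟨15, 180, 91, 52, [⟨0, 91, 0, 390, 246090, 48, [17, 37, 97, 31, 577, 1153], [([(5,
    [11, 1201]), (11, [23, 43, 197, 397])], ⟨0, 2, 1, 4, 1, 28, 87, 1003, [3, 3, 3, 3, 5, 5, 5],
    [17, 59], [[(1, 0), (11, 25), (5, 8)]]⟩), ([(5, [11, 1201]), (7, [41, 71, 223]), (11, [23,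
    43, 197]), (13, [103, 131, 157, 233, 727]), (17, [67, 101, 271]), (19, [113, 151, 191, 229,
    379]), (107, [641, 1499, 3209, 3853, 4493, 6421, 9629, 10273, 12197, 14551]), (1033, [6197,
    8263, 10331, 18593, 22727, 24793, 37189, 57847, 61981])], ⟨2, 2, 110531, 4, 1, 95, 2281,
    1008484843, [3, 3, 3, 3, 5, 5, 5], [1008484843], [[(1, 0), (455, 22), (95095, 79), (3927,
    52), (6545, 31), (285, 92), (20995, 12)]]⟩)]⟩]⟩),
  (12, 15, 299, ⟨15, 299, 180, 67, [⟨0, 180, 0, 628, 807928, 144, [641, 31, 53, 127, 193, 1439],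
    [([(5, [29, 41, 179]), (7, [43, 71, 167]), (11, [131, 197]), (13, [157, 181, 311, 313])],
    ⟨0, 2, 3, 2, 1, 68, 289, 3469, [3, 3, 5, 5, 13, 23], [3469], [[(1, 0), (13, 54), (33, 8),
    (15, 37), (21, 18)]]⟩), ([(3, [431, 7559]), (5, [29, 79, 241]), (3, [163, 809]), (5, [149]),
    (5, [1499, 2999]), (7, [43, 71, 1889])], ⟨2, 2, 675, 2, 1, 51, 103, 55621, [3, 3, 5, 5, 13,
    19, 23, 41, 251], [55621], [[(1, 0), (5, 29), (7, 14), (15, 38)]]⟩)]⟩]⟩),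
  (12, 56, 340, ⟨56, 340, 672, 138, [⟨0, 120, 2, 243655185432, 12795672, 16, [9521, 31, 257,
    25121], [([(3, [479]), (5, [19, 41, 59]), (5, [101, 599, 1499]), (7, [13, 29, 251]), (7,
    [293, 491, 3527]), (11, [43, 331, 353, 439]), (13, [53, 79, 131, 311]), (17, [67, 883, 1021,
    2551]), (19, [37, 151, 227, 797]), (23, [461, 643, 691, 829, 919]), (1487, [8923, 11897,
    29741, 83273, 101117, 104089, 124909, 151673, 178441, 416359])], ⟨0, 2, 52045, 12, 9, 2871,
    51679, 153693347, [5, 7, 7, 17, 29, 41], [153693347], [[(1, 0), (3, 1342), (4199, 53),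
    (1955, 1493), (5865, 2835), (115115, 1719), (37182145, 2803), (8855, 2750), (13, 1840),
    (969, 2426)], [(17, 2531), (51, 1002), (1956955, 1379), (312455, 1776), (937365, 247),
    (1995, 177), (969969, 2312), (24035, 2807), (663, 2842)], [(35, 282), (105, 1624), (2028117,
    2808), (146965, 335), (1365, 593), (455, 2122), (51051, 888), (440895, 1677), (209, 974)],
    [(11, 2421), (437, 1470), (429, 2732), (46189, 2474), (35581, 42), (21505, 1043), (17043,
    1781), (3705, 650), (33, 892)], [(5, 1786), (15, 257), (289731, 1441), (20995, 1839), (195,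
    2097), (65, 755), (7293, 2392), (62985, 310), (69, 1388)], [(85, 1446), (255, 2788), (391,
    2577), (1105, 415), (385, 2703), (4849845, 1227), (1155, 1174), (1716099, 518), (1173,
    1048)], [(133, 2790), (399, 1261), (31395, 639), (19635, 834), (30107, 623), (4807, 1020),
    (5187, 230), (805, 328), (1729, 1759)], [(7, 1366), (21, 2708), (29393, 1419), (13685,
    2859), (41055, 1330), (28405, 2225), (1062347, 2520), (9867, 2778)], [(19, 1423), (57,
    2765), (4485, 2143), (2805, 2338), (4301, 2127), (741, 1734), (168245, 1302), (247, 392),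
    (115, 1832)]]⟩), ([(3, [479, 577]), (5, [19, 41, 239]), (19, [37, 151, 227, 229, 379])], ⟨2,
    2, 19, 12, 1, 14, 29, 1103, [5, 7, 7, 17], [1103], [[(1, 0), (3, 5), (5, 8)]]⟩)]⟩]⟩),
  (12, 56, 1116, ⟨56, 1116, 672, 250, [⟨0, 672, 0, 2344, 41999656, 144, [17, 79, 19, 47, 4129, 73,
    863], [([(5, [131, 239, 241]), (11, [89, 109, 199, 331])], ⟨0, 2, 1, 12, 1, 6, 21, 1079, [3,
    3, 3, 7, 7, 31], [13, 83], [[(1, 0), (5, 4), (11, 5)]]⟩), ([(5, [131, 239, 1439]), (7, [13,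
    29, 139]), (5, [101, 149, 1399]), (11, [89, 109, 199, 263]), (13, [53, 157, 181, 311]), (17,
    [67, 307, 373, 409, 509]), (19, [151, 191, 379, 419, 911]), (23, [137, 229, 277, 599,
    1609]), (89, [179, 1601, 2671, 3203, 3559, 3917]), (359, [719, 5743, 10771, 11489, 15077,
    17231, 19387, 25849, 33029, 45233])], ⟨2, 2, 159755, 12, 1, 1621, 29179, 10387723, [3, 3, 3,
    7, 7, 11, 31, 5743], [10387723], [[(1, 0), (124355, 93), (6561555, 989), (21945, 221),
    (15249, 405), (111546435, 1554), (3, 693), (253, 189), (4301, 754)]]⟩)]⟩]⟩),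
  (12, 209, 1269, ⟨1269, 2508, 209, 1784, [⟨0, 209, 0, 7554, 665181822, 2880, [7, 21799, 631, 31,
    5923, 29, 433, 79, 1151, 27647], [([(7, [13, 41, 503])], ⟨0, 2, 1, 4, 1, 86, 173, 347, [3,
    3, 3, 3, 3, 11, 11, 11, 19, 19, 47], [347], [[(1, 0), (7, 9), (3, 27), (21, 36), (35,
    48)]]⟩), ([(7, [13, 41, 127]), (11, [23, 43, 109, 197]), (11, [727, 2179, 2903]), (13, [131,
    389, 547, 857, 1249]), (17, [101, 103, 239, 443, 1087]), (19, [37, 419, 569, 571]), (23,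
    [137, 229, 691, 827, 967]), (41, [83, 409, 739, 821, 983]), (67, [401, 1607, 1609, 1741,
    4289, 4691, 5227, 15277]), (269, [2153, 5381, 8609, 11299, 16139, 16141, 20443, 20981,
    23671])], ⟨2, 2, 8128373, 4, 5, 1027, 41081, 9967811677, [3, 3, 3, 3, 3, 11, 11, 11, 19, 19,
    47, 1609], [9967811677], [[(1, 0), (391391, 328), (3380195, 309), (23, 449), (111546435,
    619), (759, 759), (33, 310), (146965, 887)], [(105, 784), (221, 429), (2415, 206), (167739,
    161), (3553, 95), (2717, 301), (7293, 739), (5083, 878)], [(1001, 794), (8580495, 301),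
    (11305, 569), (8645, 775), (533715, 635), (23023, 216), (1309, 588), (6561555, 507)], [(13,
    317), (111435, 851), (12903, 870), (4807, 432), (85215, 30), (391, 560), (17, 111), (209,
    1010), (299, 766)], [(77, 476), (665, 457), (1062347, 861), (1365, 74), (46189, 412), (1785,
    895), (15295, 906), (1771, 925), (504735, 189)]]⟩)]⟩]⟩)]

lemma certificatesTwelveHigh_check : certificatesTwelveHigh.all certCheck = true := by
  decide +kernel

def certificatesThirteen : List (ℕ × ℕ × ℕ × TripleCert) := [
  (13, 3, 20, ⟨3, 39, 20, 11, [⟨0, 20, 0, 84, 2424, 96, [1567, 47, 257, 6529], [([(3, [71, 433]),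
    (5, [89, 109, 211]), (7, [29, 41, 83])], ⟨0, 2, 3, 2, 1, 55, 121, 241, [3, 3, 3, 13], [241],
    [[(1, 0), (15, 52), (21, 40), (5, 19)]]⟩), ([(3, [71, 433]), (5, [61, 89]), (7, [29, 41,
    43]), (11, [23, 197, 199, 769]), (17, [67, 103, 271, 509])], ⟨2, 2, 51, 2, 1, 90, 589,
    480721, [3, 3, 3, 13], [647, 743], [[(1, 0), (77, 9), (15, 74)]]⟩)]⟩]⟩),
  (13, 3, 64, ⟨3, 64, 39, 14, [⟨0, 39, 0, 134, 7622, 336, [97, 41, 71, 31, 10333, 223, 10753],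
    [([(5, [11, 61]), (5, [149, 199, 449, 601])], ⟨0, 2, 5, 8, 1, 9, 27, 269, [3, 3, 3], [269],
    [[(1, 0), (7, 7), (5, 5), (35, 3)]]⟩), ([(3, [17, 53]), (5, [11, 29]), (11, [23, 197, 307,
    461]), (131, [263, 523, 2357, 3929, 5501, 6551, 9433, 11527, 11789])], ⟨2, 2, 393, 8, 1,
    509, 1019, 1601869, [3, 3, 3], [1601869], [[(1, 0), (33, 187), (105, 313), (5, 10), (7,
    363), (55, 257)]]⟩)]⟩]⟩),
  (13, 3, 2464, ⟨39, 2464, 3, 310, [⟨0, 1883, 0, 5006, 180953774, 144, [311, 2383, 8689, 17, 71,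
    97], [([(5, [29, 41, 59]), (3, [269]), (3, [2591, 12959]), (3, [487]), (3, [1459, 2917]),
    (5, [101, 601]), (2, [4799]), (2, [10369])], ⟨0, 5, 1, 7, 1, 3, 9, 17, [3, 3, 3, 3, 7, 11,
    13, 193], [17], [[(1, 0), (5, 2)]]⟩)]⟩, ⟨3, 20, 1, 28183039886, 293294, 16, [223, 2383,
    479], [([(3, [97, 21503]), (3, [17, 37]), (5, [29, 41, 59]), (5, [101, 499]), (7, [127, 167,
    449]), (7, [197, 491]), (11, [109, 199, 461, 463]), (11, [241, 727, 967, 1451]), (13, [53,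
    79, 157, 571]), (17, [67, 137, 239, 953, 1123]), (19, [113, 151])], ⟨0, 2, 1155, 7, 3, 1082,
    19477, 2999459, [3, 3, 3, 3, 3, 3, 7, 11, 13, 29], [2999459], [[(1, 0), (40755, 1047), (935,
    927), (13, 496), (12155, 341), (35, 770), (11305, 268), (455, 184)], [(5, 938), (17017,
    316), (4641, 1079), (1309, 902), (20995, 932), (357, 583), (65, 352), (4389, 526), (1615,
    436)], [(7, 913), (663, 165), (285285, 878), (8151, 108), (187, 1070), (627, 694), (91,
    327), (1785, 439), (85085, 172)]]⟩), ([(7, [449, 49057]), (3, [127, 167]), (5, [29, 41]),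
    (5, [101, 601]), (11, [109, 263, 307]), (19, [113, 151, 191])], ⟨2, 2, 95, 7, 1, 98, 197,
    787, [3, 3, 3, 7, 11, 13, 191], [787], [[(1, 0), (55, 20), (5, 89), (11, 29), (33, 14), (7,
    48)]]⟩)]⟩]⟩),
  (13, 3, 7700, ⟨3, 7700, 39, 152, [⟨0, 7399, 0, 15406, 170932306, 384, [17, 1777, 239, 5119, 383,
    11519], [([(3, [37, 73]), (5, [31, 389]), (7, [29, 41, 43, 139])], ⟨0, 4, 3, 4, 1, 53, 107,
    10271, [3, 3, 3, 3, 5, 5, 7, 11], [10271], [[(1, 0), (21, 7), (105, 1), (15, 11)]]⟩)]⟩, ⟨39,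
    64, 1, 21167007406, 916306, 336, [17, 11551, 29, 41, 239, 8737, 11423], [([(5, [31, 61,
    71]), (11, [23, 89, 109, 263, 439]), (13, [79, 131, 181]), (17, [67, 101]), (19, [113, 191,
    379]), (71, [283, 569, 853, 1279, 2557, 2699]), (229, [457, 1373, 1831, 2749, 6869, 6871,
    9161, 11909])], ⟨0, 2, 308921, 4, 1, 129, 1033, 6197, [3, 3, 3, 3, 5, 5, 7, 11, 457, 2699],
    [6197], [[(1, 0), (429, 97), (385, 23), (2431, 67), (51051, 114)]]⟩), ([(7, [97, 197, 293,
    3823, 10193]), (7, [8231, 28813]), (11, [23, 89, 263, 307]), (13, [79, 181, 311]), (17, [67,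
    101, 443]), (19, [113, 379, 607, 1483])], ⟨2, 2, 49, 4, 1, 25, 601, 16829, [3, 3, 3, 5, 5,
    7, 11, 97], [16829], [[(1, 0), (2431, 16), (1547, 8), (4199, 3)]]⟩)]⟩]⟩),
  (13, 33, 224, ⟨33, 224, 429, 86, [⟨0, 85, 2, 23451416194, 3171682, 640, [3697, 7309, 9649,
    16319, 257, 769, 14591], [([(3, [17, 47]), (3, [19, 109]), (7, [71, 83, 127, 2239]), (7,
    [491, 883, 1471]), (7, [1373, 8231, 49391]), (11, [23, 67, 89, 199, 331]), (11, [727, 1693,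
    3631]), (37, [223, 443, 739, 1109, 1553])], ⟨0, 2, 59829, 7, 1, 371, 743, 2971, [3, 3, 3, 7,
    11, 11, 97, 199, 443], [2971], [[(1, 0), (55, 41), (35, 347), (5, 59), (11, 353), (21,
    27)]]⟩), ([(3, [17, 47]), (3, [179]), (7, [71, 83, 281, 1609]), (11, [23, 67, 89, 131,
    263])], ⟨2, 2, 3, 7, 1, 86, 173, 1039, [3, 3, 3, 7, 11, 11], [1039], [[(1, 0), (11, 23),
    (15, 66), (3, 27), (105, 75)]]⟩)]⟩]⟩),
  (13, 33, 700, ⟨429, 700, 33, 548, [⟨0, 33, 0, 2258, 9912158, 48, [547, 27337, 31, 257, 2207],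
    [([(3, [17]), (5, [41, 601]), (7, [43, 83, 167, 211])], ⟨0, 2, 3, 4, 1, 221, 443, 2657, [3,
    3, 3, 5, 5, 7, 11, 11, 13], [2657], [[(1, 0), (105, 131), (3, 97), (7, 14), (21, 111), (5,
    20), (35, 34)]]⟩), ([(3, [17]), (3, [109, 1511]), (5, [41, 89, 271, 601]), (2, [8641]), (5,
    [149, 1801]), (7, [43, 83]), (19, [37, 113, 191]), (71, [283, 569, 709, 2273, 2557, 4259])],
    ⟨2, 4, 60705, 4, 1, 134, 269, 204439, [3, 3, 3, 5, 5, 7, 11, 11, 13, 89, 13633], [204439],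
    [[(1, 0), (15, 49), (3, 109), (5, 74), (7, 19), (35, 93)]]⟩)]⟩]⟩)]

lemma certificatesThirteen_check : certificatesThirteen.all certCheck = true := by
  decide +kernel

/-- The certificates for all small triples. -/
def certificates : List (ℕ × ℕ × ℕ × TripleCert) :=
certificatesSeven ++ certificatesEightLow ++ certificatesEightHigh ++ certificatesTen ++
    certificatesEleven ++ certificatesTwelveLow ++ certificatesTwelveHigh ++ certificatesThirteen

lemma certificates_check : certificates.all certCheck = true := by
  simp only [certificates, List.all_append, certificatesSeven_check, certificatesEightLow_check, certificatesEightHigh_check,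
    certificatesTen_check, certificatesEleven_check, certificatesTwelveLow_check,
    certificatesTwelveHigh_check, certificatesThirteen_check,
    Bool.and_self]


lemma certificates_complete : smallTriples.all (fun s => certificates.any (fun t =>
    Nat.beq s.1 t.1 && Nat.beq s.2.1 t.2.1 && Nat.beq s.2.2 t.2.2.1)) = true := by
  decide +kernel

lemma mem_of_isSmall {k a c : ℕ} (h : isSmall k a c = true) : (k, a, c) ∈ smallTriples := by
  have key : ∀ l : List (ℕ × ℕ × ℕ), List.rec (motive := fun _ => Bool) false
      (fun t _ ih => cond (Nat.beq t.1 k && Nat.beq t.2.1 a && Nat.beq t.2.2 c) true ih) l = true →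
      (k, a, c) ∈ l := by
    intro l
    induction l with
    | nil => intro h; cases h
    | cons t l ih =>
      intro h
      rcases hb : (Nat.beq t.1 k && Nat.beq t.2.1 a && Nat.beq t.2.2 c) with _ | _
      · simp only [hb, cond_false] at h
        exact List.mem_cons_of_mem _ (ih h)
      · rw [Bool.and_eq_true, Bool.and_eq_true, Nat.beq_eq, Nat.beq_eq, Nat.beq_eq] at hb
        obtain ⟨⟨h1, h2⟩, h3⟩ := hb
        rw [← h1, ← h2, ← h3]
        exact List.mem_cons_self
  exact key _ h

/-- The small triples have only regular extensions. -/
theorem reg_of_isSmall {k a c d X Y Z : ℤ} (hk : 0 < k) (ha : 0 < a) (hc : 0 < c) (hcd : c < d)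
    (hX0 : 0 < X) (hY0 : 0 < Y) (hZ0 : 0 < Z) (hX : X ^ 2 = a * d + 4) (hY : Y ^ 2 = k * a * d + 4)
    (hZ : Z ^ 2 = c * d + 4) (hsm : isSmall k.toNat a.toNat c.toNat = true) :
    Reg a (k * a) c d := by
  have h1 := List.all_eq_true.mp certificates_complete _ (mem_of_isSmall hsm)
  obtain ⟨t, ht, he⟩ := List.any_eq_true.mp h1
  simp only [Bool.and_eq_true, Nat.beq_eq] at he
  obtain ⟨⟨e1, e2⟩, e3⟩ := he
  have g1 : (t.1 : ℤ) = k := by omega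
  have g2 : (t.2.1 : ℤ) = a := by omega
  have g3 : (t.2.2.1 : ℤ) = c := by omega
  have := certCheck_sound (List.all_eq_true.mp certificates_check t ht) (d := d) (X := X) (Y := Y)
    (Z := Z) (by rw [g3]; exact hcd) hX0 hY0 hZ0 (by rw [g2]; exact hX) (by rw [g1, g2]; exact hY)
    (by rw [g3]; exact hZ)
  rwa [g1, g2, g3] at this

/-! ### The main theorem -/

lemma lt_of_large {k a c d s t X Y Z : ℤ} (hk : 7 ≤ k) (hk' : k ≤ 13) (ha : 0 < a) (hc : 0 < c)
    (hcd : c < d) (hbc : k * a ≤ 3 * c) (hs0 : 0 < s) (ht0 : 0 < t) (hX0 : 0 < X) (hY0 : 0 < Y)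
    (hZ0 : 0 < Z) (hs : s ^ 2 = a * c + 4) (ht : t ^ 2 = k * a * c + 4) (hX : X ^ 2 = a * d + 4)
    (hY : Y ^ 2 = k * a * d + 4) (hZ : Z ^ 2 = c * d + 4) (hN : 10 ^ 26 ≤ k * a * c) :
    d < c * (k * a * c) ^ 7 := by
  have hac : 200 ≤ a * c := by nlinarith [mul_pos ha hc]
  have had : 200 ≤ a * d := by nlinarith
  have hd0 : 0 < d := hc.trans hcd
  lift k to ℕ using by omega
  lift a to ℕ using ha.le
  lift c to ℕ using hc.le
  lift d to ℕ using hd0.le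
  lift s to ℕ using hs0.le
  lift t to ℕ using ht0.le
  lift X to ℕ using hX0.le
  lift Y to ℕ using hY0.le
  lift Z to ℕ using hZ0.le
  norm_cast at *
  have hNr : (10 : ℝ) ^ 26 ≤ ((k * a * c : ℕ) : ℝ) := by exact_mod_cast hN
  obtain ⟨N, hNdef⟩ : ∃ N : ℝ, N = ((k * a * c : ℕ) : ℝ) := ⟨_, rfl⟩
  rw [← hNdef] at hNr
  have hN0 : 0 < N := lt_of_lt_of_le (by norm_num) hNr
  have hmain := D4_upper_bound (m₀ := 3) (E := N ^ 2 / 17800) (Q := 600 * N) hk hk' hac hbc had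
    (by norm_num) hs ht hX hY hZ hNdef (by positivity) (by
      have h1 : (256 * (k : ℝ) * (k - 1) ^ 2) ≤ 479232 := by interval_cases k <;> norm_num
      have h2 : (k : ℝ) ≤ 13 := by exact_mod_cast hk'
      have h3 : N - 52 ≤ N - 4 * k := by linarith
      have h4 : (N - 52) ^ 2 ≤ (N - 4 * k) ^ 2 :=
        pow_le_pow_left₀ (by norm_num at hNr; linarith) h3 2
      calc 256 * (k : ℝ) * (k - 1) ^ 2 * (N ^ 2 / 17800) ≤ 479232 * (N ^ 2 / 17800) :=
            mul_le_mul_of_nonneg_right h1 (by positivity)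
        _ ≤ 27 * (N - 52) ^ 2 := by norm_num at hNr; nlinarith
        _ ≤ _ := by linarith) (by
      norm_num at hNr
      interval_cases k <;> norm_num <;> linarith) (by
      have h5 : 0 < N ^ 5 := by positivity
      have : (10 : ℝ) ^ 26 * N ^ 5 ≤ N * N ^ 5 := mul_le_mul_of_nonneg_right hNr h5.le
      have e1 : 122 * N * (600 * N) * (600 * N) ^ 3 = 122 * 600 ^ 4 * N ^ 5 := by ring
      have e2 : (N ^ 2 / 17800) ^ 3 = (N * N ^ 5) / 17800 ^ 3 := by ring
      rw [e1, e2, lt_div_iff₀ (by norm_num)]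
      refine lt_of_lt_of_le ?_ this
      have : 122 * 600 ^ 4 * N ^ 5 * 17800 ^ 3 = (122 * 600 ^ 4 * 17800 ^ 3) * N ^ 5 := by ring
      rw [this]
      exact mul_lt_mul_of_pos_right (by norm_num) h5)
  have hfin : (3600 : ℝ) * c * (600 * N) ^ (2 * 3) ≤ c * N ^ 7 := by
    have e : (3600 : ℝ) * c * (600 * N) ^ (2 * 3) = c * ((3600 * 600 ^ 6) * N ^ 6) := by ring
    rw [e, show N ^ 7 = N * N ^ 6 by ring]
    exact mul_le_mul_of_nonneg_left (mul_le_mul_of_nonneg_right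
      (le_trans (by norm_num) hNr) (by positivity)) (by positivity)
  have := hmain.trans_le hfin
  rw [hNdef] at this
  exact_mod_cast this

/-- A third element of `{a, ka, c}` is adjacent to the pair, or much larger. -/
lemma adjacent_or_large {k a c r s t : ℤ}
    (hk : k = 7 ∨ k = 8 ∨ k = 10 ∨ k = 11 ∨ k = 12 ∨ k = 13) (ha : 100 ≤ a) (hc : 0 < c)
    (hr0 : 0 < r) (hs0 : 0 < s) (ht0 : 0 < t) (hr : r ^ 2 = a * (k * a) + 4)
    (hs : s ^ 2 = a * c + 4) (ht : t ^ 2 = k * a * c + 4) :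
    (∃ ε : ℤ, (ε = 1 ∨ ε = -1) ∧ c = a + k * a + 2 * ε * r ∧ s = r + ε * a) ∨ 16 * a ^ 3 ≤ c := by
  have ha0 : 0 < a := by linarith
  have hk7 : 7 ≤ k := by omega
  have hr5 : 13 * a ≤ 5 * r := by
    apply le_of_sq_le (by positivity)
    nlinarith [mul_pos ha0 ha0]
  have hr2 : 2 ≤ r := by linarith
  have key : ∀ ε : ℤ, ε = 1 ∨ ε = -1 → (∃ n, s = lin r 2 (r + ε * a) n) →
      (c = a + k * a + 2 * ε * r ∧ s = r + ε * a) ∨ 16 * a ^ 3 ≤ c := by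
    rintro ε hε ⟨n, hn⟩
    have hε2 : ε ^ 2 = 1 := by rcases hε with rfl | rfl <;> norm_num
    have hεa : -a ≤ ε * a := by rcases hε with rfl | rfl <;> linarith
    rcases n with _ | _ | n
    · simp only [lin] at hn
      rw [hn] at hs
      have := mul_pos ha0 hc
      linarith
    · left
      have hs' : s = r + ε * a := hn
      refine ⟨?_, hs'⟩
      have : a * (c - (a + k * a + 2 * ε * r)) = 0 := by
        rw [hs'] at hs
        linear_combination hr - hs + a ^ 2 * hε2
      rcases mul_eq_zero.mp this with h | h <;> linarith
    · right
      have hmono := lin_bounds hr2 zero_le_two (by linarith : 2 ≤ r + ε * a)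
      have hge : ∀ n, lin r 2 (r + ε * a) 2 ≤ lin r 2 (r + ε * a) (n + 2) := by
        intro n
        induction n with
        | zero => exact le_rfl
        | succ n ih => exact ih.trans (hmono (n + 2)).2
      have h2 : lin r 2 (r + ε * a) 2 = r * (r + ε * a) - 2 := rfl
      have h3 : r * (r + ε * a) - 2 ≤ s := by rw [hn, ← h2]; exact hge n
      have h4 : 41 * a ^ 2 ≤ 10 * s := by
        have : (13 * a) * (8 * a) ≤ (5 * r) * (5 * (r + ε * a)) :=
          mul_le_mul hr5 (by linarith) (by positivity) (by positivity)
        nlinarith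
      have h5 : (41 * a ^ 2) ^ 2 ≤ (10 * s) ^ 2 := pow_le_pow_left₀ (by positivity) h4 2
      have h6 : a * (16 * a ^ 3) ≤ a * c := by
        have : 1 ≤ a ^ 4 := one_le_pow₀ (by linarith)
        nlinarith
      exact le_of_mul_le_mul_left h6 ha0
  rcases ext_classification hk ha0 hr0 hr hs0 ht0 ⟨hs, ht⟩ with h | h | ⟨-, h, -⟩ | ⟨-, h, -⟩
  · rcases key (-1) (Or.inr rfl) (by simpa [← sub_eq_add_neg] using h) with h | h
    · exact Or.inl ⟨-1, Or.inr rfl, h⟩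
    · exact Or.inr h
  · rcases key 1 (Or.inl rfl) (by simpa using h) with h | h
    · exact Or.inl ⟨1, Or.inl rfl, h⟩
    · exact Or.inr h
  · omega
  · omega

lemma reg_of_adjacent {k a c d r s t X Y Z ε : ℤ}
    (hk : k = 7 ∨ k = 8 ∨ k = 10 ∨ k = 11 ∨ k = 12 ∨ k = 13) (ha : 100 ≤ a) (hc : 0 < c) (hcd : c < d)
    (hr0 : 0 < r) (hs0 : 0 < s) (ht0 : 0 < t) (hX0 : 0 < X) (hY0 : 0 < Y) (hZ0 : 0 < Z)
    (hr : r ^ 2 = a * (k * a) + 4) (hs : s ^ 2 = a * c + 4) (ht : t ^ 2 = k * a * c + 4)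
    (hX : X ^ 2 = a * d + 4) (hY : Y ^ 2 = k * a * d + 4) (hZ : Z ^ 2 = c * d + 4)
    (hN : 10 ^ 26 ≤ k * a * c) (hε : ε = 1 ∨ ε = -1) (hce : c = a + k * a + 2 * ε * r)
    (hse : s = r + ε * a) : Reg a (k * a) c d := by
  have hk7 : 7 ≤ k := by omega
  have hk13 : k ≤ 13 := by omega
  have ha100 := ha
  replace ha : 0 < a := by linarith
  have haa : 100 * a ≤ a * a := mul_le_mul_of_nonneg_right ha100 ha.le
  have hr4 : r < 4 * a := by
    by_contra! hge
    have : (4 * a) ^ 2 ≤ r ^ 2 := pow_le_pow_left₀ (by positivity) hge 2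
    nlinarith
  have hc22 : c ≤ 22 * a := by
    have : k * a ≤ 13 * a := mul_le_mul_of_nonneg_right hk13 ha.le
    rcases hε with rfl | rfl <;> linarith
  have hac : a * c ≤ 22 * a ^ 2 := by
    have : a * c ≤ a * (22 * a) := mul_le_mul_of_nonneg_left hc22 ha.le
    linarith
  have hkac : k * a * c ≤ 286 * a ^ 2 := by
    have : k * (a * c) ≤ 13 * (a * c) := mul_le_mul_of_nonneg_right hk13 (mul_pos ha hc).le
    linarith
  have ha8 : 10 ^ 8 ≤ a := by
    by_contra! hlt
    have : a ^ 2 ≤ (10 ^ 8) ^ 2 := pow_le_pow_left₀ ha.le hlt.le 2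
    linarith
  rcases reg_or_large_of_adjacent hk ha8 hε hr0 hs0 hr hce hse (hc.trans hcd) hX0 hY0 hZ0 hX hY
    hZ with h | h
  · exact h
  · exfalso
    have hbc : k * a ≤ 3 * c := by
      have h6 : 6 * r ≤ (2 * k + 3) * a := by
        apply le_of_sq_le (by positivity)
        nlinarith [mul_pos ha ha, mul_nonneg (mul_nonneg (by linarith : 0 ≤ k - 7)
          (by linarith : 0 ≤ k)) (mul_pos ha ha).le]
      rcases hε with rfl | rfl <;> nlinarith
    have hd := lt_of_large hk7 hk13 ha hc hcd hbc hs0 ht0 hX0 hY0 hZ0 hs ht hX hY hZ hN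
    clear hr hs ht hY hZ
    have h1 : k * a * c ≤ a ^ 3 := by
      have : 286 * a ^ 2 ≤ a * a ^ 2 := mul_le_mul_of_nonneg_right (by linarith) (sq_nonneg a)
      linarith
    have h2 : (k * a * c) ^ 7 ≤ (a ^ 3) ^ 7 := pow_le_pow_left₀ (by positivity) h1 7
    have h3 : c ≤ a ^ 2 := by linarith
    have h4 : c * (k * a * c) ^ 7 ≤ a ^ 2 * (a ^ 3) ^ 7 :=
      mul_le_mul h3 h2 (by positivity) (by positivity)
    have h5 : (a ^ 20) ^ 2 ≤ X ^ 2 := pow_le_pow_left₀ (by positivity) h 2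
    have h6 : a * d < a * (a ^ 2 * (a ^ 3) ^ 7) := mul_lt_mul_of_pos_left (hd.trans_le h4) ha
    have h7 : a * (a ^ 2 * (a ^ 3) ^ 7) = a ^ 24 := by ring
    have h8 : (a ^ 20) ^ 2 = a ^ 24 * a ^ 16 := by ring
    have h9 : 100 ≤ a ^ 16 := ha100.trans (le_self_pow₀ (by linarith) (by norm_num))
    have h10 : 1 ≤ a ^ 24 := one_le_pow₀ (by linarith)
    have h11 : a ^ 24 * 100 ≤ a ^ 24 * a ^ 16 := mul_le_mul_of_nonneg_left h9 (by linarith)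
    linarith

lemma reg_of_large {k a c d r s t X Y Z : ℤ}
    (hk : k = 7 ∨ k = 8 ∨ k = 10 ∨ k = 11 ∨ k = 12 ∨ k = 13) (ha : 0 < a) (hc : 0 < c) (hcd : c < d)
    (hr0 : 0 < r) (hs0 : 0 < s) (ht0 : 0 < t) (hX0 : 0 < X) (hY0 : 0 < Y) (hZ0 : 0 < Z)
    (hr : r ^ 2 = a * (k * a) + 4) (hs : s ^ 2 = a * c + 4) (ht : t ^ 2 = k * a * c + 4)
    (hX : X ^ 2 = a * d + 4) (hY : Y ^ 2 = k * a * d + 4) (hZ : Z ^ 2 = c * d + 4)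
    (hN : 10 ^ 26 ≤ k * a * c)
    (ih : ∀ e u y z : ℤ, 0 < e → e < c → u ^ 2 = a * e + 4 → y ^ 2 = k * a * e + 4 →
      z ^ 2 = c * e + 4 → Reg a (k * a) e c) : Reg a (k * a) c d := by
  have hk7 : 7 ≤ k := by omega
  have hk13 : k ≤ 13 := by omega
  have hac0 := mul_pos ha hc
  rcases le_or_gt (10 ^ 13 * a) c with hca | hca
  · rcases reg_or_large hk7 hk13 ha hca hr0 hs0 ht0 hr hs ht hX0 hY0 hZ0 hX hY hZ hcd ih with h | h
    · exact h
    · exfalso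
      have hd := lt_of_large hk7 hk13 ha hc hcd (by nlinarith) hs0 ht0 hX0 hY0 hZ0 hs ht hX hY hZ hN
      obtain ⟨N, hNd⟩ : ∃ N, N = k * a * c := ⟨_, rfl⟩
      rw [← hNd] at h hd hN
      have h1 : (c * (N + 1) ^ 4) ^ 2 ≤ (2 * Z) ^ 2 := pow_le_pow_left₀ (by positivity) h 2
      have h2 : c * d < c * (c * N ^ 7) := mul_lt_mul_of_pos_left hd hc
      have h3 : N ^ 8 ≤ (N + 1) ^ 8 := pow_le_pow_left₀ (by linarith) (by linarith) 8
      have h4 : c ^ 2 * N ^ 8 ≤ c ^ 2 * (N + 1) ^ 8 := mul_le_mul_of_nonneg_left h3 (by positivity)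
      have hN0 : 0 < N := by linarith
      have h5 : 0 < c ^ 2 * N ^ 7 := by positivity
      have h6 : 10 ^ 26 * (c ^ 2 * N ^ 7) ≤ N * (c ^ 2 * N ^ 7) := mul_le_mul_of_nonneg_right hN h5.le
      nlinarith
  · have hka : k * a * c ≤ 13 * a * c := by
      have : k * (a * c) ≤ 13 * (a * c) := mul_le_mul_of_nonneg_right hk13 hac0.le
      linarith
    have ha2 : 76 * 10 ^ 10 ≤ a ^ 2 := by
      have : a * c ≤ a * (10 ^ 13 * a) := mul_le_mul_of_nonneg_left hca.le ha.le
      nlinarith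
    have ha100 : 100 ≤ a := by nlinarith
    rcases adjacent_or_large hk ha100 hc hr0 hs0 ht0 hr hs ht with ⟨ε, hε, hce, hse⟩ | h
    · exact reg_of_adjacent hk ha100 hc hcd hr0 hs0 ht0 hX0 hY0 hZ0 hr hs ht hX hY hZ hN hε hce hse
    · exfalso
      have : a ^ 3 = a ^ 2 * a := by ring
      have h2 : 76 * 10 ^ 10 * a ≤ a ^ 2 * a := mul_le_mul_of_nonneg_right ha2 ha.le
      linarith

/-- Two extensions `c < d` of `{a, ka}` forming a quadruple are related by regularity. -/
theorem reg_of_quadruple {k a r : ℤ} (hk : k = 7 ∨ k = 8 ∨ k = 10 ∨ k = 11 ∨ k = 12 ∨ k = 13)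
    (ha : 0 < a) (hr : r ^ 2 = a * (k * a) + 4) : ∀ (n : ℕ) (c d s t X Y Z : ℤ), d.toNat ≤ n →
    0 < c → c < d → s ^ 2 = a * c + 4 → t ^ 2 = k * a * c + 4 → X ^ 2 = a * d + 4 →
    Y ^ 2 = k * a * d + 4 → Z ^ 2 = c * d + 4 → Reg a (k * a) c d := by
  have hk0 : 0 < k := by omega
  have pos : ∀ x y : ℤ, 0 < y → x ^ 2 = y → 0 < |x| := by
    intro x y hy h
    rw [abs_pos]
    rintro rfl
    rw [← h] at hy
    norm_num at hy
  intro n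
  induction n with
  | zero => intro c d s t X Y Z hd hc hcd; omega
  | succ n ih =>
    intro c d s t X Y Z hd hc hcd hs ht hX hY hZ
    have hd0 : 0 < d := hc.trans hcd
    have hr0 := pos r _ (by positivity) hr
    have hs0 := pos s _ (by positivity) hs
    have ht0 := pos t _ (by positivity) ht
    have hX0 := pos X _ (by positivity) hX
    have hY0 := pos Y _ (by positivity) hY
    have hZ0 := pos Z _ (by positivity) hZ
    have hs' := hs
    have ht' := ht
    rw [← sq_abs] at hr hs ht hX hY hZ
    rcases hsm : isSmall k.toNat a.toNat c.toNat with _ | _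
    · rcases lt_or_ge (k * a * c) (10 ^ 26) with hN | hN
      · exact reg_of_bounded hk ha hc hcd hr0 hs0 ht0 hX0 hY0 hZ0 hr hs ht hX hY hZ hN hsm
      · refine reg_of_large hk ha hc hcd hr0 hs0 ht0 hX0 hY0 hZ0 hr hs ht hX hY hZ hN ?_
        intro e u y z he hec hu hy hz
        exact ih e c u y s t z (by omega) he hec hu hy hs' ht' (by rw [hz]; ring)
    · exact reg_of_isSmall hk0 ha hc hcd hX0 hY0 hZ0 hX hY hZ hsm

/-- The largest element of a regular quadruple is the larger root of the quadratic equation. -/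
lemma exists_root_of_reg {x y z d : ℤ} (hx : 0 < x) (hxy : x < y) (hyz : y < z) (hzd : z < d)
    (h : Reg x y z d) : ∃ w : ℤ, 0 ≤ w ∧ w ^ 2 = (x * y + 4) * (x * z + 4) * (y * z + 4) ∧
      2 * d = 2 * (x + y + z) + x * y * z + w := by
  unfold Reg at h
  refine ⟨2 * d - 2 * (x + y + z) - x * y * z, ?_, ?_, by ring⟩
  · by_contra! hneg
    have h1 : 0 < (d - z) * (2 * (x + y + z) + x * y * z - z - d) :=
      mul_pos (by linarith) (by linarith)
    have h2 : (d - z) * (2 * (x + y + z) + x * y * z - z - d) =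
        (x - y) ^ 2 - 4 * z * (x + y) + z * (2 * x + 2 * y) - x * y * z ^ 2 - 16 -
          z * (2 * x + 2 * y) := by
      linear_combination -h
    have hy : 0 < y := hx.trans hxy
    have hz : 0 < z := hy.trans hyz
    have h3 : (x - y) ^ 2 < z * y := by nlinarith
    have h4 : 0 < x * y * z ^ 2 := by positivity
    nlinarith [mul_pos hy hz, mul_pos hx hz]
  · linear_combination 4 * h

/-- Every `D(4)`-quadruple containing `a` and `k*a` (for `k ∈ {7,8,10,11,12,13}`) is regular:
if its elements are `x < y < z < d`, then `d = d₊(x,y,z)`. -/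
theorem every_D4_quadruple_containing_a_and_ka_is_regular
    (k a x y z d : ℤ)
    (hk : k ∈ ({7, 8, 10, 11, 12, 13} : Set ℤ))
    (ha : 0 < a)
    (hx : 0 < x) (hxy : x < y) (hyz : y < z) (hzd : z < d)
    (hmem_a : a = x ∨ a = y ∨ a = z ∨ a = d)
    (hmem_ka : k * a = x ∨ k * a = y ∨ k * a = z ∨ k * a = d)
    (h1 : IsSquare (x * y + 4)) (h2 : IsSquare (x * z + 4)) (h3 : IsSquare (x * d + 4))
    (h4 : IsSquare (y * z + 4)) (h5 : IsSquare (y * d + 4)) (h6 : IsSquare (z * d + 4)) :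
    ∃ w : ℤ, 0 ≤ w ∧ w ^ 2 = (x * y + 4) * (x * z + 4) * (y * z + 4) ∧
      2 * d = 2 * (x + y + z) + x * y * z + w := by
  have hk' : k = 7 ∨ k = 8 ∨ k = 10 ∨ k = 11 ∨ k = 12 ∨ k = 13 := by simpa using hk
  obtain ⟨p1, e1⟩ := h1
  obtain ⟨p2, e2⟩ := h2
  obtain ⟨p3, e3⟩ := h3
  obtain ⟨p4, e4⟩ := h4
  obtain ⟨p5, e5⟩ := h5
  obtain ⟨p6, e6⟩ := h6
  have hka : a < k * a := by nlinarith [show 7 ≤ k by omega]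
  -- the pair `{u, v} = {a, ka}` and the two other elements `c < e`
  have key : ∀ u v c e p q q' s s' t : ℤ, a = u → k * a = v → 0 < c → c < e → p ^ 2 = u * v + 4 →
      q ^ 2 = u * c + 4 → q' ^ 2 = v * c + 4 → s ^ 2 = u * e + 4 → s' ^ 2 = v * e + 4 →
      t ^ 2 = c * e + 4 → Reg u v c e := by
    rintro u v c e p q q' s s' t rfl rfl hc hce hp hq hq' hs hs' ht
    exact reg_of_quadruple hk' ha hp e.toNat c e q q' s s' t le_rfl hc hce hq hq' hs hs' ht
  apply exists_root_of_reg hx hxy hyz hzd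
  rcases hmem_a with h | h | h | h <;> rcases hmem_ka with h' | h' | h' | h'
  · omega
  · exact key x y z d p1 p2 p4 p3 p5 p6 h h' (by omega) hzd (by linarith) (by linarith)
      (by linarith) (by linarith) (by linarith) (by linarith)
  · have := key x z y d p2 p1 p4 p3 p6 p5 h h' (by omega) (by omega) (by linarith) (by linarith)
      (by linarith) (by linarith) (by linarith) (by linarith)
    unfold Reg at this ⊢; linear_combination this
  · have := key x d y z p3 p1 p5 p2 p6 p4 h h' (by omega) hyz (by linarith) (by linarith)
      (by linarith) (by linarith) (by linarith) (by linarith)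
    unfold Reg at this ⊢; linear_combination this
  · omega
  · omega
  · have := key y z x d p4 p1 p2 p5 p6 p3 h h' hx (by omega) (by linarith) (by linarith)
      (by linarith) (by linarith) (by linarith) (by linarith)
    unfold Reg at this ⊢; linear_combination this
  · have := key y d x z p5 p1 p3 p4 p6 p2 h h' hx (by omega) (by linarith) (by linarith)
      (by linarith) (by linarith) (by linarith) (by linarith)
    unfold Reg at this ⊢; linear_combination this
  · omega
  · omega
  · omega
  · have := key z d x y p6 p2 p3 p4 p5 p1 h h' hx hxy (by linarith) (by linarith)
      (by linarith) (by linarith) (by linarith) (by linarith)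
    unfold Reg at this ⊢; linear_combination this
  · omega
  · omega
  · omega
  · omega
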